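/- Let D ⊂ ℂⁿ be a bounded pseudoconvex domain that is h-extendible at p⁰ = 0 ∈ ∂D with multitype (1, m₂, …, m_n), in local coordinates where D is defined near 0 by ρ(z) = Re z₁ + P(z', z̄') + o(|z₁| + |z₂|^{m₂} + ⋯ + |z_n|^{m_n}) < 0, with P a (1/m₂, …, 1/m_n)-weighted homogeneous plurisubharmonic polynomial in z' = (z₂,…,z_n) containing no pluriharmonic terms, and let D_∞ = { z : Re z₁ + P(z', z̄') < 0 } be the local model. Let p^j → 0 be a sequence in D converging within a nontangential cone with vertex at 0, and set π^j(z) = ( z₁/|ρ(p^j)|, z₂/|ρ(p^j)|^{1/m₂}, …, z_n/|ρ(p^j)|^{1/m_n} ) and D^j = π^j(D). Then for every z ∈ D_∞, K_{D^j}(z,z) → K_{D_∞}(z,z) as j → ∞. -/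

import Mathlib

open MeasureTheory Metric Filter Topology Set
open scoped ENNReal

noncomputable section

/-- Membership in the Bergman space `A²(Ω)`: holomorphic and square-integrable. -/
def MemA2 {n : ℕ} (Ω : Set (Fin n → ℂ)) (f : (Fin n → ℂ) → ℂ) : Prop :=
  DifferentiableOn ℂ f Ω ∧ MemLp f 2 (volume.restrict Ω)

/-- `K` is the Bergman kernel of `Ω`: the reproducing kernel of `A²(Ω)`. -/
def IsBergmanKernel {n : ℕ} (Ω : Set (Fin n → ℂ)) (K : (Fin n → ℂ) → (Fin n → ℂ) → ℂ) : Prop :=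
  (∀ w ∈ Ω, MemA2 Ω fun z => K z w) ∧
  ∀ f, MemA2 Ω f → ∀ w ∈ Ω, f w = ∫ z in Ω, f z * (starRingEnd ℂ) (K z w)

/-- Wirtinger derivative `∂f/∂z_μ`. -/
def wderiv {n : ℕ} (μ : Fin n) (f : (Fin n → ℂ) → ℂ) (z : Fin n → ℂ) : ℂ :=
  (fderiv ℝ f z (Pi.single μ 1) - Complex.I * fderiv ℝ f z (Pi.single μ Complex.I)) / 2

/-- Wirtinger derivative `∂f/∂z̄_μ`. -/
def wderivBar {n : ℕ} (μ : Fin n) (f : (Fin n → ℂ) → ℂ) (z : Fin n → ℂ) : ℂ :=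
  (fderiv ℝ f z (Pi.single μ 1) + Complex.I * fderiv ℝ f z (Pi.single μ Complex.I)) / 2

/-- One-variable Wirtinger derivative `∂f/∂z`. -/
def wderiv1 (f : ℂ → ℂ) (z : ℂ) : ℂ :=
  (fderiv ℝ f z 1 - Complex.I * fderiv ℝ f z Complex.I) / 2

/-- One-variable Wirtinger derivative `∂f/∂z̄`. -/
def wderiv1Bar (f : ℂ → ℂ) (z : ℂ) : ℂ :=
  (fderiv ℝ f z 1 + Complex.I * fderiv ℝ f z Complex.I) / 2

/-- Bergman metric tensor `g_{μν}(z) = ∂² log K(z,z) / ∂z_μ ∂z̄_ν`. -/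
def bergmanTensor {n : ℕ} (K : (Fin n → ℂ) → (Fin n → ℂ) → ℂ) (μ ν : Fin n)
    (z : Fin n → ℂ) : ℂ :=
  wderiv μ (fun w => wderivBar ν (fun u => Complex.log (K u u)) w) z

/-- The hermitian quadratic form of the Bergman metric. -/
def bergmanQuad {n : ℕ} (K : (Fin n → ℂ) → (Fin n → ℂ) → ℂ) (z ξ : Fin n → ℂ) : ℝ :=
  (∑ μ, ∑ ν, bergmanTensor K μ ν z * ξ μ * (starRingEnd ℂ) (ξ ν)).re

/-- The Bergman metric `b_Ω(z,ξ)`. -/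
def bergmanMetric {n : ℕ} (K : (Fin n → ℂ) → (Fin n → ℂ) → ℂ) (z ξ : Fin n → ℂ) : ℝ :=
  Real.sqrt (bergmanQuad K z ξ)

/-- Piecewise-`C¹` curves on `[0,1]`. -/
def PiecewiseC1 {n : ℕ} (γ : ℝ → (Fin n → ℂ)) : Prop :=
  ContinuousOn γ (Set.Icc 0 1) ∧
  ∃ (k : ℕ) (t : Fin (k + 1) → ℝ), StrictMono t ∧ t 0 = 0 ∧ t (Fin.last k) = 1 ∧
    ∀ i : Fin k, ContDiffOn ℝ 1 γ (Set.Icc (t i.castSucc) (t i.succ))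

/-- The Bergman length of a curve. -/
def bergmanLength {n : ℕ} (K : (Fin n → ℂ) → (Fin n → ℂ) → ℂ) (γ : ℝ → (Fin n → ℂ)) : ℝ :=
  ∫ t in (0:ℝ)..1, bergmanMetric K (γ t) (deriv γ t)

/-- The Bergman pseudodistance of `Ω`. -/
def bergmanDist {n : ℕ} (Ω : Set (Fin n → ℂ)) (K : (Fin n → ℂ) → (Fin n → ℂ) → ℂ)
    (z w : Fin n → ℂ) : ℝ :=
  sInf { L : ℝ | ∃ γ : ℝ → (Fin n → ℂ), γ 0 = z ∧ γ 1 = w ∧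
    (∀ t ∈ Set.Icc (0:ℝ) 1, γ t ∈ Ω) ∧ PiecewiseC1 γ ∧ L = bergmanLength K γ }

/-- The Bergman ball `B_Ω(p,r)`. -/
def bergmanBall {n : ℕ} (Ω : Set (Fin n → ℂ)) (K : (Fin n → ℂ) → (Fin n → ℂ) → ℂ)
    (p : Fin n → ℂ) (r : ℝ) : Set (Fin n → ℂ) :=
  { z ∈ Ω | bergmanDist Ω K p z < r }

/-- The Bergman pseudodistance is an honest distance. -/
def BergmanDistIsDistance {n : ℕ} (Ω : Set (Fin n → ℂ))
    (K : (Fin n → ℂ) → (Fin n → ℂ) → ℂ) : Prop :=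
  ∀ z ∈ Ω, ∀ w ∈ Ω, z ≠ w → 0 < bergmanDist Ω K z w

/-- `Ω` is complete with respect to the Bergman distance. -/
def BergmanComplete {n : ℕ} (Ω : Set (Fin n → ℂ))
    (K : (Fin n → ℂ) → (Fin n → ℂ) → ℂ) : Prop :=
  ∀ x : ℕ → (Fin n → ℂ), (∀ k, x k ∈ Ω) →
    (∀ ε : ℝ, 0 < ε → ∃ N, ∀ k ≥ N, ∀ l ≥ N, bergmanDist Ω K (x k) (x l) < ε) →
    ∃ p ∈ Ω, Filter.Tendsto (fun k => bergmanDist Ω K (x k) p) Filter.atTop (nhds 0)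

/-- The Euclidean unit ball `𝔹ⁿ ⊂ ℂⁿ`. -/
def euclUnitBall (n : ℕ) : Set (Fin n → ℂ) :=
  { z | ∑ μ, ‖z μ‖ ^ 2 < 1 }

/-- The Bergman–Fridman invariant `h_X(p)`. -/
def fridmanInv {n : ℕ} (Ω : Set (Fin n → ℂ)) (K : (Fin n → ℂ) → (Fin n → ℂ) → ℂ)
    (p : Fin n → ℂ) : ℝ :=
  sInf { c : ℝ | ∃ r : ℝ, 0 < r ∧ c = 1 / r ∧ ∃ f : (Fin n → ℂ) → (Fin n → ℂ),
    DifferentiableOn ℂ f (euclUnitBall n) ∧ Set.InjOn f (euclUnitBall n) ∧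
    f '' euclUnitBall n ⊆ Ω ∧ bergmanBall Ω K p r ⊆ f '' euclUnitBall n }

/-- Biholomorphic equivalence of domains in `ℂⁿ` (an injective holomorphic map of `ℂⁿ`
restricted to a domain is automatically a biholomorphism onto its image). -/
def Biholomorphic {n : ℕ} (U V : Set (Fin n → ℂ)) : Prop :=
  ∃ f : (Fin n → ℂ) → (Fin n → ℂ),
    DifferentiableOn ℂ f U ∧ Set.InjOn f U ∧ f '' U = V

/-- The Levi form of a real-valued function `ρ` at `p` in direction `ξ`. -/
def leviForm {n : ℕ} (ρ : (Fin n → ℂ) → ℝ) (p ξ : Fin n → ℂ) : ℝ :=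
  (∑ μ, ∑ ν, wderiv μ (fun w => wderivBar ν (fun u => (ρ u : ℂ)) w) p
      * ξ μ * (starRingEnd ℂ) (ξ ν)).re

/-- The complex tangent space of `{ρ = 0}` at `p`. -/
def complexTangent {n : ℕ} (ρ : (Fin n → ℂ) → ℝ) (p : Fin n → ℂ) : Set (Fin n → ℂ) :=
  { ξ | ∑ μ, wderiv μ (fun u => (ρ u : ℂ)) p * ξ μ = 0 }

/-- Strong pseudoconvexity at a boundary point, for defining function `ρ`. -/
def StronglyPseudoconvexAt {n : ℕ} (ρ : (Fin n → ℂ) → ℝ) (p : Fin n → ℂ) : Prop :=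
  ∀ ξ ∈ complexTangent ρ p, ξ ≠ 0 → 0 < leviForm ρ p ξ

/-- `ρ` is a (global) defining function for `D`. -/
def IsDefiningFunction {n : ℕ} (D : Set (Fin n → ℂ)) (ρ : (Fin n → ℂ) → ℝ) : Prop :=
  (∀ z, z ∈ D ↔ ρ z < 0) ∧ ∀ z ∈ frontier D, fderiv ℝ ρ z ≠ 0

/-- Plurisubharmonicity via the sub-mean-value property on complex lines. -/
def PlurisubharmonicOn {n : ℕ} (u : (Fin n → ℂ) → ℝ) (Ω : Set (Fin n → ℂ)) : Prop :=
  UpperSemicontinuousOn u Ω ∧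
  ∀ (a b : Fin n → ℂ) (r : ℝ), 0 < r →
    (∀ w : ℂ, ‖w‖ ≤ r → a + w • b ∈ Ω) →
    u a ≤ (1 / (2 * Real.pi)) *
      ∫ θ in (0:ℝ)..(2 * Real.pi), u (a + ((r : ℂ) * Complex.exp (θ * Complex.I)) • b)

/-- Pseudoconvexity: `-log dist(·, ∂D)` is plurisubharmonic on `D`. -/
def IsPseudoconvex {n : ℕ} (D : Set (Fin n → ℂ)) : Prop :=
  PlurisubharmonicOn (fun z => -Real.log (Metric.infDist z Dᶜ)) D

/-- Order of vanishing at `0` of a vector-valued map on `ℂ` (`⊤` if it vanishes to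
infinite order). -/
def vanishingOrderC {n : ℕ} (f : ℂ → (Fin n → ℂ)) : ℝ≥0∞ :=
  sInf ((fun m : ℕ => (m : ℝ≥0∞)) '' { m : ℕ | iteratedDeriv m f 0 ≠ 0 })

/-- Order of vanishing at `0` of a real-valued function on `ℂ`. -/
def vanishingOrderR (g : ℂ → ℝ) : ℝ≥0∞ :=
  sInf ((fun m : ℕ => (m : ℝ≥0∞)) '' { m : ℕ | iteratedFDeriv ℝ m g 0 ≠ 0 })

/-- The D'Angelo 1-type of `ρ` at `p`. -/
def dAngeloOneType {n : ℕ} (ρ : (Fin n → ℂ) → ℝ) (p : Fin n → ℂ) : ℝ≥0∞ :=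
  ⨆ (φ : ℂ → (Fin n → ℂ)) (_ : AnalyticAt ℂ φ 0) (_ : φ 0 = p)
    (_ : vanishingOrderC (fun w => φ w - p) ≠ ⊤),
    vanishingOrderR (fun w => ρ (φ w)) / vanishingOrderC (fun w => φ w - p)

/-- The Levi form at `p` has at most one degenerate eigenvalue. -/
def LeviCorankOneAt {n : ℕ} (ρ : (Fin n → ℂ) → ℝ) (p : Fin n → ℂ) : Prop :=
  ∃ V : Submodule ℂ (Fin n → ℂ), n - 2 ≤ Module.finrank ℂ V ∧
    (V : Set (Fin n → ℂ)) ⊆ complexTangent ρ p ∧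
    ∀ ξ ∈ V, ξ ≠ 0 → 0 < leviForm ρ p ξ

/-- A bounded smooth pseudoconvex finite-type Levi corank one domain, with defining
function `ρ`. -/
def IsLeviCorankOneDomain {n : ℕ} (D : Set (Fin n → ℂ)) (ρ : (Fin n → ℂ) → ℝ) : Prop :=
  IsOpen D ∧ IsConnected D ∧ Bornology.IsBounded D ∧ IsPseudoconvex D ∧
  ContDiff ℝ (⊤ : ℕ∞) ρ ∧ IsDefiningFunction D ρ ∧
  (∀ p ∈ frontier D, dAngeloOneType ρ p ≠ ⊤) ∧
  ∀ p ∈ frontier D, LeviCorankOneAt ρ p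

/-- The open unit disc in `ℂ`. -/
def openUnitDisc : Set ℂ := Metric.ball 0 1

/-- Tautness of a domain in `ℂⁿ`. -/
def IsTaut {n : ℕ} (D : Set (Fin n → ℂ)) : Prop :=
  ∀ f : ℕ → ℂ → (Fin n → ℂ),
    (∀ k, DifferentiableOn ℂ (f k) openUnitDisc ∧ f k '' openUnitDisc ⊆ D) →
    ∃ φ : ℕ → ℕ, StrictMono φ ∧
      ((∃ g : ℂ → (Fin n → ℂ), DifferentiableOn ℂ g openUnitDisc ∧ g '' openUnitDisc ⊆ D ∧
          TendstoLocallyUniformlyOn (fun k => f (φ k)) g Filter.atTop openUnitDisc) ∨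
        ∀ S : Set ℂ, IsCompact S → S ⊆ openUnitDisc →
          ∀ L : Set (Fin n → ℂ), IsCompact L → L ⊆ D →
            ∀ᶠ k in Filter.atTop, ∀ w ∈ S, f (φ k) w ∉ L)

/-- Convergence of a sequence of domains in the local Hausdorff sense. -/
def LocalHausdorffConv {n : ℕ} (Ω : ℕ → Set (Fin n → ℂ)) (Ωl : Set (Fin n → ℂ)) : Prop :=
  (∀ S : Set (Fin n → ℂ), IsCompact S → S ⊆ Ωl → ∀ᶠ j in Filter.atTop, S ⊆ Ω j) ∧
  ∀ S : Set (Fin n → ℂ), IsCompact S →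
    (∃ j₀ : ℕ, S ⊆ interior (⋂ j, ⋂ (_ : j₀ ≤ j), Ω j)) → S ⊆ Ωl

/-- A real-valued subharmonic polynomial of degree at most `d` in one complex variable,
containing no harmonic terms. -/
def SubharmonicPolyNoHarm (P : ℂ → ℝ) (d : ℕ) : Prop :=
  (∃ c : Fin (d + 1) → Fin (d + 1) → ℂ,
    (∀ j, c j 0 = 0) ∧ (∀ k, c 0 k = 0) ∧
    ∀ w : ℂ, (P w : ℂ) = ∑ j, ∑ k, c j k * w ^ (j : ℕ) * (starRingEnd ℂ) w ^ (k : ℕ)) ∧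
  ∀ w : ℂ, 0 ≤ (wderiv1 (fun u => wderiv1Bar (fun v => (P v : ℂ)) u) w).re

/-- A strictly subharmonic real polynomial of degree `2` in one complex variable. -/
def StrictlySubharmonicPolyDeg2 (Q : ℂ → ℝ) : Prop :=
  (∃ c : Fin 3 → Fin 3 → ℂ, ∀ w : ℂ,
      (Q w : ℂ) = ∑ j, ∑ k, c j k * w ^ (j : ℕ) * (starRingEnd ℂ) w ^ (k : ℕ)) ∧
  ∀ w : ℂ, 0 < (wderiv1 (fun u => wderiv1Bar (fun v => (Q v : ℂ)) u) w).re

/-- A nontangential cone in `D` with vertex `p0 ∈ ∂D`. -/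
def IsNontangentialCone {n : ℕ} (D Γ : Set (Fin n → ℂ)) (p0 : Fin n → ℂ) : Prop :=
  Γ ⊆ D ∧ p0 ∈ closure Γ ∧
  ∃ C : ℝ, 0 < C ∧ ∀ z ∈ Γ, ‖z - p0‖ ≤ C * Metric.infDist z Dᶜ

/-- The Bergman kernel is positive on the diagonal of `Ω`. -/
def DiagPos {n : ℕ} (Ω : Set (Fin n → ℂ)) (K : (Fin n → ℂ) → (Fin n → ℂ) → ℂ) : Prop :=
  ∀ z ∈ Ω, (K z z).im = 0 ∧ 0 < (K z z).re

/-- The Bergman metric of `Ω` is positive definite. -/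
def BergPosDef {n : ℕ} (Ω : Set (Fin n → ℂ)) (K : (Fin n → ℂ) → (Fin n → ℂ) → ℂ) : Prop :=
  ∀ z ∈ Ω, ∀ ξ : Fin n → ℂ, ξ ≠ 0 → 0 < bergmanMetric K z ξ

/-- The real coordinate directions of `ℂⁿ ≃ ℝ^{2n}`. -/
def realDir {n : ℕ} (μ : Fin (2 * n)) : Fin n → ℂ :=
  Pi.single ⟨(μ : ℕ) / 2, by have := μ.isLt; omega⟩
    (if (μ : ℕ) % 2 = 0 then 1 else Complex.I)

/-- The real coefficients `g̃_{μν}` of the Bergman metric, obtained by polarization. -/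
def realTensor {n : ℕ} (K : (Fin n → ℂ) → (Fin n → ℂ) → ℂ) (μ ν : Fin (2 * n))
    (z : Fin n → ℂ) : ℝ :=
  (bergmanQuad K z (realDir μ + realDir ν) - bergmanQuad K z (realDir μ)
    - bergmanQuad K z (realDir ν)) / 2

/-- The Christoffel symbols `Γ^η_{μν}` of the Bergman metric, in real coordinates. -/
def christoffel {n : ℕ} (K : (Fin n → ℂ) → (Fin n → ℂ) → ℂ) (η μ ν : Fin (2 * n))
    (z : Fin n → ℂ) : ℝ :=
  (1 / 2) * ∑ τ : Fin (2 * n),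
    (fderiv ℝ (realTensor K ν τ) z (realDir μ)
      + fderiv ℝ (realTensor K τ μ) z (realDir ν)
      - fderiv ℝ (realTensor K μ ν) z (realDir τ))
    * (Matrix.of fun a b => realTensor K a b z)⁻¹ τ η

/-- `z0 ∈ ∂D` is a local holomorphic peak point of `D`. -/
def IsLocalPeakPoint {n : ℕ} (D : Set (Fin n → ℂ)) (z0 : Fin n → ℂ) : Prop :=
  ∃ U ∈ nhds z0, ∃ g : (Fin n → ℂ) → ℂ,
    DifferentiableOn ℂ g (U ∩ D) ∧ ContinuousOn g (closure (U ∩ D)) ∧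
    g z0 = 1 ∧ ∀ z ∈ closure (U ∩ D), z ≠ z0 → ‖g z‖ < 1

/-- A real polynomial on `ℂⁿ` containing no pluriharmonic terms. -/
def IsPolyNoPluriharm {n : ℕ} (P : (Fin n → ℂ) → ℝ) : Prop :=
  ∃ (d : ℕ) (c : (Fin n → Fin (d + 1)) → (Fin n → Fin (d + 1)) → ℂ),
    (∀ α β, (∀ j, (β j : ℕ) = 0) → c α β = 0) ∧
    (∀ α β, (∀ j, (α j : ℕ) = 0) → c α β = 0) ∧
    ∀ z, (P z : ℂ) = ∑ α, ∑ β, c α β * (∏ j, z j ^ (α j : ℕ)) *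
      ∏ j, (starRingEnd ℂ) (z j) ^ (β j : ℕ)

section

open scoped ContDiff ComplexConjugate

/-! ### Complexified directional derivatives -/

/-- The complexified directional derivative `(∂_v - i ∂_w) / 2`. -/
def dop {n : ℕ} (v w : Fin n → ℂ) (u : (Fin n → ℂ) → ℂ) (z : Fin n → ℂ) : ℂ :=
  (fderiv ℝ u z v - Complex.I * fderiv ℝ u z w) / 2

section DopCalculus

variable {n : ℕ} {v w v' w' : Fin n → ℂ} {u g : (Fin n → ℂ) → ℂ} {z : Fin n → ℂ}

theorem wderiv_eq_dop (j : Fin n) (u : (Fin n → ℂ) → ℂ) :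
    wderiv j u = dop (Pi.single j 1) (Pi.single j Complex.I) u := rfl

theorem wderivBar_eq_dop (j : Fin n) (u : (Fin n → ℂ) → ℂ) :
    wderivBar j u = dop (Pi.single j 1) (-Pi.single j Complex.I) u := by
  funext z
  simp [wderivBar, dop]

theorem dop_add (hu : DifferentiableAt ℝ u z) (hg : DifferentiableAt ℝ g z) :
    dop v w (fun x => u x + g x) z = dop v w u z + dop v w g z := by
  simp only [dop, fderiv_fun_add hu hg, add_apply]
  ring

theorem dop_sub (hu : DifferentiableAt ℝ u z) (hg : DifferentiableAt ℝ g z) :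
    dop v w (fun x => u x - g x) z = dop v w u z - dop v w g z := by
  simp only [dop, fderiv_fun_sub hu hg, sub_apply]
  ring

theorem dop_neg : dop v w (fun x => -u x) z = -dop v w u z := by
  simp only [dop, fderiv_fun_neg, neg_apply]
  ring

theorem dop_mul (hu : DifferentiableAt ℝ u z) (hg : DifferentiableAt ℝ g z) :
    dop v w (fun x => u x * g x) z = dop v w u z * g z + u z * dop v w g z := by
  simp only [dop, fderiv_fun_mul hu hg, add_apply, smul_apply,
    smul_eq_mul]
  ring

theorem dop_const (c : ℂ) : dop v w (fun _ => c) z = 0 := by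
  simp [dop]

theorem dop_const_mul (hu : DifferentiableAt ℝ u z) (c : ℂ) :
    dop v w (fun x => c * u x) z = c * dop v w u z := by
  rw [dop_mul (differentiableAt_const c) hu, dop_const]
  ring

theorem dop_congr (h : u =ᶠ[𝓝 z] g) : dop v w u z = dop v w g z := by
  simp only [dop, h.fderiv_eq]

theorem dop_conj (hu : DifferentiableAt ℝ u z) :
    dop v (-w) (fun x => conj (u x)) z = conj (dop v w u z) := by
  have h : HasFDerivAt (fun x => conj (u x))
      ((Complex.conjCLE : ℂ →L[ℝ] ℂ).comp (fderiv ℝ u z)) z :=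
    (Complex.conjCLE : ℂ →L[ℝ] ℂ).hasFDerivAt.comp z hu.hasFDerivAt
  simp [dop, h.fderiv, map_ofNat]

theorem wderivBar_conj (j : Fin n) (hu : DifferentiableAt ℝ u z) :
    wderivBar j (fun x => conj (u x)) z = conj (wderiv j u z) := by
  rw [wderivBar_eq_dop, wderiv_eq_dop, dop_conj hu]

theorem wderiv_conj (j : Fin n) (hu : DifferentiableAt ℝ u z) :
    wderiv j (fun x => conj (u x)) z = conj (wderivBar j u z) := by
  rw [wderivBar_eq_dop, wderiv_eq_dop, ← dop_conj hu, neg_neg]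

theorem wderivBar_ofReal (j : Fin n) {r : (Fin n → ℂ) → ℝ}
    (hr : DifferentiableAt ℝ (fun x => (r x : ℂ)) z) :
    wderivBar j (fun x => (r x : ℂ)) z = conj (wderiv j (fun x => (r x : ℂ)) z) := by
  rw [← wderivBar_conj j hr]
  simp

theorem dop_contDiffAt {k : WithTop ℕ∞} (hu : ContDiffAt ℝ (k + 1) u z) :
    ContDiffAt ℝ k (dop v w u) z := by
  have h : ContDiffAt ℝ k (fderiv ℝ u) z := hu.fderiv_right le_rfl
  exact ((h.clm_apply contDiffAt_const).sub
    (contDiffAt_const.mul (h.clm_apply contDiffAt_const))).div_const 2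

theorem dop_contDiff (hu : ContDiff ℝ ∞ u) : ContDiff ℝ ∞ (dop v w u) :=
  contDiff_iff_contDiffAt.2 fun z => dop_contDiffAt (by simpa using hu.contDiffAt)

theorem dop_contDiffOn {Ω : Set (Fin n → ℂ)} (hΩ : IsOpen Ω) (hu : ContDiffOn ℝ ∞ u Ω) :
    ContDiffOn ℝ ∞ (dop v w u) Ω := fun z hz =>
  (dop_contDiffAt (by simpa using (hu.contDiffAt (hΩ.mem_nhds hz)))).contDiffWithinAt

theorem tsupport_dop_subset : tsupport (dop v w u) ⊆ tsupport u := by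
  apply closure_minimal _ (isClosed_tsupport u)
  intro z hz
  by_contra h
  apply hz
  have h0 : u =ᶠ[𝓝 z] fun _ => 0 := notMem_tsupport_iff_eventuallyEq.1 h
  rw [dop_congr h0, dop_const]

theorem dop_eq_zero_of_notMem_tsupport (h : z ∉ tsupport u) : dop v w u z = 0 := by
  have h0 : u =ᶠ[𝓝 z] fun _ => 0 := notMem_tsupport_iff_eventuallyEq.1 h
  rw [dop_congr h0, dop_const]

theorem dop_comm (hu : ContDiffAt ℝ 2 u z) :
    dop v w (dop v' w' u) z = dop v' w' (dop v w u) z := by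
  have hd : DifferentiableAt ℝ (fderiv ℝ u) z :=
    (hu.fderiv_right (m := 1) (by norm_num)).differentiableAt (by norm_num)
  have key : ∀ a b c d : Fin n → ℂ, dop a b (dop c d u) z =
      ((fderiv ℝ (fderiv ℝ u) z a c - Complex.I * fderiv ℝ (fderiv ℝ u) z a d) / 2 -
        Complex.I * ((fderiv ℝ (fderiv ℝ u) z b c -
          Complex.I * fderiv ℝ (fderiv ℝ u) z b d) / 2)) / 2 := by
    intro a b c d
    have h : HasFDerivAt (dop c d u)
        ((2 : ℂ)⁻¹ • ((ContinuousLinearMap.apply ℝ ℂ c).comp (fderiv ℝ (fderiv ℝ u) z) -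
          Complex.I • (ContinuousLinearMap.apply ℝ ℂ d).comp (fderiv ℝ (fderiv ℝ u) z))) z := by
      have h1 := (ContinuousLinearMap.apply ℝ ℂ c).hasFDerivAt.comp z hd.hasFDerivAt
      have h2 := (ContinuousLinearMap.apply ℝ ℂ d).hasFDerivAt.comp z hd.hasFDerivAt
      have := (h1.sub (h2.const_mul Complex.I)).const_mul (2 : ℂ)⁻¹
      refine this.congr_of_eventuallyEq (Eventually.of_forall fun x => ?_)
      simp [dop]
      ring
    simp only [dop, h.fderiv]
    simp
    ring
  have hs : IsSymmSndFDerivAt ℝ u z := hu.isSymmSndFDerivAt (by simp)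
  rw [key, key, hs.eq v v', hs.eq v w', hs.eq w v', hs.eq w w']
  ring

end DopCalculus

/-! ### Test functions -/

/-- Smooth functions with compact support in `Ω`. -/
structure IsTest {n : ℕ} (Ω : Set (Fin n → ℂ)) (θ : (Fin n → ℂ) → ℂ) : Prop where
  smooth : ContDiff ℝ ∞ θ
  compact : HasCompactSupport θ
  sub : tsupport θ ⊆ Ω

section Test

variable {n : ℕ} {Ω Ω' : Set (Fin n → ℂ)} {v w : Fin n → ℂ} {θ g η : (Fin n → ℂ) → ℂ}

theorem IsTest.mono (h : IsTest Ω θ) (hΩ : Ω ⊆ Ω') : IsTest Ω' θ :=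
  ⟨h.smooth, h.compact, h.sub.trans hΩ⟩

theorem IsTest.zero : IsTest Ω (fun _ => 0) :=
  ⟨contDiff_const, HasCompactSupport.zero, by simp [tsupport]⟩

theorem IsTest.continuous (h : IsTest Ω θ) : Continuous θ := h.smooth.continuous

theorem IsTest.differentiable (h : IsTest Ω θ) : Differentiable ℝ θ :=
  h.smooth.differentiable (by simp)

theorem IsTest.eq_zero (h : IsTest Ω θ) {z : Fin n → ℂ} (hz : z ∉ Ω) : θ z = 0 :=
  image_eq_zero_of_notMem_tsupport fun hz' => hz (h.sub hz')

theorem IsTest.dop (h : IsTest Ω θ) : IsTest Ω (dop v w θ) :=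
  ⟨dop_contDiff h.smooth, h.compact.mono' (subset_closure.trans tsupport_dop_subset),
    tsupport_dop_subset.trans h.sub⟩

theorem IsTest.wderiv (h : IsTest Ω θ) (j : Fin n) : IsTest Ω (wderiv j θ) := by
  rw [wderiv_eq_dop]; exact h.dop

theorem IsTest.wderivBar (h : IsTest Ω θ) (j : Fin n) : IsTest Ω (wderivBar j θ) := by
  rw [wderivBar_eq_dop]; exact h.dop

theorem IsTest.conj (h : IsTest Ω θ) : IsTest Ω (fun x => conj (θ x)) := by
  have hs : Function.support (fun x => conj (θ x)) = Function.support θ := by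
    ext x; simp
  refine ⟨(Complex.conjCLE : ℂ →L[ℝ] ℂ).contDiff.comp h.smooth, ?_, ?_⟩
  · have := h.compact
    rwa [HasCompactSupport, tsupport, ← hs] at this
  · have := h.sub
    rwa [tsupport, ← hs] at this

theorem IsTest.add (h : IsTest Ω θ) (h' : IsTest Ω η) : IsTest Ω (fun x => θ x + η x) := by
  have hs : tsupport (fun x => θ x + η x) ⊆ tsupport θ ∪ tsupport η := tsupport_add θ η
  exact ⟨h.smooth.add h'.smooth, h.compact.add h'.compact, hs.trans (union_subset h.sub h'.sub)⟩

theorem IsTest.mul_left (hΩ : IsOpen Ω) (hg : ContDiffOn ℝ ∞ g Ω) (h : IsTest Ω θ) :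
    IsTest Ω (fun x => g x * θ x) := by
  have hs : tsupport (fun x => g x * θ x) ⊆ tsupport θ :=
    closure_mono (Function.support_mul_subset_right g θ)
  refine ⟨contDiff_iff_contDiffAt.2 fun z => ?_, h.compact.mul_left, hs.trans h.sub⟩
  by_cases hz : z ∈ Ω
  · exact (hg.contDiffAt (hΩ.mem_nhds hz)).mul h.smooth.contDiffAt
  · have hz' : z ∉ tsupport (fun x => g x * θ x) := fun h' => hz (h.sub (hs h'))
    exact contDiffAt_const.congr_of_eventuallyEq (notMem_tsupport_iff_eventuallyEq.1 hz')

theorem IsTest.const_mul (h : IsTest Ω θ) (c : ℂ) : IsTest Ω (fun x => c * θ x) := by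
  have hs : tsupport (fun x => c * θ x) ⊆ tsupport θ :=
    closure_mono (Function.support_mul_subset_right (fun _ => c) θ)
  exact ⟨contDiff_const.mul h.smooth, h.compact.mul_left, hs.trans h.sub⟩

theorem IsTest.sub' (h : IsTest Ω θ) (h' : IsTest Ω η) : IsTest Ω (fun x => θ x - η x) := by
  simpa [sub_eq_add_neg] using h.add (h'.const_mul (-1))

theorem IsTest.sum {ι : Type*} (s : Finset ι) {U : ι → (Fin n → ℂ) → ℂ}
    (hU : ∀ i ∈ s, IsTest Ω (U i)) : IsTest Ω (fun x => ∑ i ∈ s, U i x) := by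
  classical
  induction s using Finset.induction_on with
  | empty => simpa using IsTest.zero
  | insert a s ha ih =>
    simp only [Finset.sum_insert ha]
    exact (hU a (Finset.mem_insert_self a s)).add
      (ih fun i hi => hU i (Finset.mem_insert_of_mem hi))

theorem IsTest.integrable (h : IsTest Ω θ) : Integrable θ :=
  h.continuous.integrable_of_hasCompactSupport h.compact

theorem IsTest.memLp (h : IsTest Ω θ) (p : ℝ≥0∞) : MemLp θ p :=
  h.continuous.memLp_of_hasCompactSupport h.compact

theorem IsTest.integrable_mul (hΩ : IsOpen Ω) (hg : ContDiffOn ℝ ∞ g Ω) (h : IsTest Ω θ) :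
    Integrable (fun x => g x * θ x) := (h.mul_left hΩ hg).integrable

theorem integral_mul_fderiv_test (hΩ : IsOpen Ω) (hg : ContDiffOn ℝ ∞ g Ω) (h : IsTest Ω θ)
    (v : Fin n → ℂ) :
    ∫ x, g x * fderiv ℝ θ x v = -∫ x, fderiv ℝ g x v * θ x := by
  have hθ' : IsTest Ω (fun x => fderiv ℝ θ x v) := by
    have h' : ContDiff ℝ ∞ (fderiv ℝ θ) := h.smooth.fderiv_right (by simp)
    exact ⟨h'.clm_apply contDiff_const, h.compact.fderiv_apply ℝ v,
      (tsupport_fderiv_apply_subset ℝ v).trans h.sub⟩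
  have hg' : ContDiffOn ℝ ∞ (fun x => fderiv ℝ g x v) Ω := by
    have h' : ContDiffOn ℝ ∞ (fderiv ℝ g) Ω := hg.fderiv_of_isOpen hΩ (by simp)
    exact h'.clm_apply contDiffOn_const
  exact integral_mul_fderiv_eq_neg_fderiv_mul_of_integrable
    (h.integrable_mul hΩ hg') (hθ'.integrable_mul hΩ hg) (h.integrable_mul hΩ hg)
    (fun x hx => (hg.contDiffAt (hΩ.mem_nhds (h.sub hx))).differentiableAt (by simp))
    (fun x _ => h.differentiable x)

/-- Integration by parts against a test function. -/
theorem integral_mul_dop (hΩ : IsOpen Ω) (hg : ContDiffOn ℝ ∞ g Ω) (h : IsTest Ω θ) :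
    ∫ x, g x * _root_.dop v w θ x = -∫ x, _root_.dop v w g x * θ x := by
  have hθ' : ∀ v, IsTest Ω (fun x => fderiv ℝ θ x v) := fun v => by
    have h' : ContDiff ℝ ∞ (fderiv ℝ θ) := h.smooth.fderiv_right (by simp)
    exact ⟨h'.clm_apply contDiff_const, h.compact.fderiv_apply ℝ v,
      (tsupport_fderiv_apply_subset ℝ v).trans h.sub⟩
  have hg' : ∀ v, ContDiffOn ℝ ∞ (fun x => fderiv ℝ g x v) Ω := fun v => by
    have h' : ContDiffOn ℝ ∞ (fderiv ℝ g) Ω := hg.fderiv_of_isOpen hΩ (by simp)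
    exact h'.clm_apply contDiffOn_const
  have e1 : ∀ x, g x * _root_.dop v w θ x =
      2⁻¹ * (g x * fderiv ℝ θ x v) - (2⁻¹ * Complex.I) * (g x * fderiv ℝ θ x w) := fun x => by
    simp only [_root_.dop]; ring
  have e2 : ∀ x, _root_.dop v w g x * θ x =
      2⁻¹ * (fderiv ℝ g x v * θ x) - (2⁻¹ * Complex.I) * (fderiv ℝ g x w * θ x) := fun x => by
    simp only [_root_.dop]; ring
  simp only [e1, e2]
  rw [integral_sub, integral_sub]
  · simp only [integral_const_mul, integral_mul_fderiv_test hΩ hg h]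
    ring
  · exact (h.integrable_mul hΩ (hg' v)).const_mul _
  · exact (h.integrable_mul hΩ (hg' w)).const_mul _
  · exact ((hθ' v).integrable_mul hΩ hg).const_mul _
  · exact ((hθ' w).integrable_mul hΩ hg).const_mul _

theorem integral_mul_wderivBar (hΩ : IsOpen Ω) (hg : ContDiffOn ℝ ∞ g Ω) (h : IsTest Ω θ)
    (j : Fin n) : ∫ x, g x * wderivBar j θ x = -∫ x, wderivBar j g x * θ x := by
  simp only [wderivBar_eq_dop]
  exact integral_mul_dop hΩ hg h

end Test

/-! ### The Bochner–Kodaira inequality -/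

section BochnerKodaira

variable {n : ℕ} {Ω : Set (Fin n → ℂ)} {r : (Fin n → ℂ) → ℝ}

/-- The twisted derivative `δ_j u = ∂_j u - u ∂_j r`. -/
def twist {n : ℕ} (r : (Fin n → ℂ) → ℝ) (j : Fin n) (u : (Fin n → ℂ) → ℂ) (z : Fin n → ℂ) : ℂ :=
  wderiv j u z - u z * wderiv j (fun x => (r x : ℂ)) z

/-- The weight `exp (-r)`. -/
def expW {n : ℕ} (r : (Fin n → ℂ) → ℝ) (z : Fin n → ℂ) : ℂ := (Real.exp (-r z) : ℂ)

theorem ContDiffOn.ofReal_comp {k : WithTop ℕ∞} (hr : ContDiffOn ℝ k r Ω) :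
    ContDiffOn ℝ k (fun x => (r x : ℂ)) Ω :=
  Complex.ofRealCLM.contDiff.comp_contDiffOn hr

theorem expW_contDiffOn (hr : ContDiffOn ℝ ∞ r Ω) : ContDiffOn ℝ ∞ (expW r) Ω :=
  (hr.neg.exp).ofReal_comp

theorem dop_expW {v w z : Fin n → ℂ} (hr : DifferentiableAt ℝ r z) :
    dop v w (expW r) z = -dop v w (fun x => (r x : ℂ)) z * expW r z := by
  have h1 : HasFDerivAt (fun x => (r x : ℂ)) (Complex.ofRealCLM.comp (fderiv ℝ r z)) z :=
    Complex.ofRealCLM.hasFDerivAt.comp z hr.hasFDerivAt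
  have h2 : HasFDerivAt (expW r)
      (Complex.ofRealCLM.comp (Real.exp (-r z) • -fderiv ℝ r z)) z :=
    Complex.ofRealCLM.hasFDerivAt.comp z (hr.hasFDerivAt.neg.exp)
  simp only [dop, h1.fderiv, h2.fderiv, expW]
  simp
  ring

theorem wderivBar_real {j : Fin n} {z : Fin n → ℂ} (hr : DifferentiableAt ℝ r z) :
    wderivBar j (fun x => (r x : ℂ)) z = conj (wderiv j (fun x => (r x : ℂ)) z) :=
  wderivBar_ofReal j (Complex.ofRealCLM.differentiableAt.comp z hr)

theorem twist_isTest (hΩ : IsOpen Ω) (hr : ContDiffOn ℝ ∞ r Ω) {g : (Fin n → ℂ) → ℂ}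
    (hg : IsTest Ω g) (j : Fin n) : IsTest Ω (twist r j g) := by
  have h := (hg.wderiv j).sub' (hg.mul_left hΩ (dop_contDiffOn (v := Pi.single j 1)
    (w := Pi.single j Complex.I) hΩ hr.ofReal_comp))
  convert h using 2
  rw [twist, mul_comm]
  rfl

theorem integral_mul_conj_twist (hΩ : IsOpen Ω) (hr : ContDiffOn ℝ ∞ r Ω)
    {u g : (Fin n → ℂ) → ℂ} (hu : ContDiffOn ℝ ∞ u Ω) (hg : IsTest Ω g) (k : Fin n) :
    ∫ x, u x * conj (twist r k g x) * expW r x =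
      -∫ x, wderivBar k u x * conj (g x) * expW r x := by
  have ht : IsTest Ω (fun x => expW r x * conj (g x)) :=
    hg.conj.mul_left hΩ (expW_contDiffOn hr)
  have h := integral_mul_wderivBar hΩ hu ht k
  rw [show (∫ x, wderivBar k u x * conj (g x) * expW r x) =
    ∫ x, wderivBar k u x * (expW r x * conj (g x)) from by congr 1; ext x; ring, ← h]
  congr 1
  ext x
  by_cases hx : x ∈ Ω
  · have hrd : DifferentiableAt ℝ r x :=
      (hr.contDiffAt (hΩ.mem_nhds hx)).differentiableAt (by simp)
    have hW : DifferentiableAt ℝ (expW r) x :=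
      ((expW_contDiffOn hr).contDiffAt (hΩ.mem_nhds hx)).differentiableAt (by simp)
    have e : wderivBar k (fun x => expW r x * conj (g x)) x =
        conj (twist r k g x) * expW r x := by
      rw [wderivBar_eq_dop, dop_mul hW (hg.conj.differentiable x), dop_expW hrd,
        ← wderivBar_eq_dop, ← wderivBar_eq_dop, wderivBar_conj k (hg.differentiable x),
        wderivBar_real hrd, twist, map_sub, map_mul]
      ring
    rw [e]
    ring
  · rw [(twist_isTest hΩ hr hg k).eq_zero hx, (ht.wderivBar k).eq_zero hx]
    simp

theorem integral_twist_mul_conj (hΩ : IsOpen Ω) (hr : ContDiffOn ℝ ∞ r Ω)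
    {u h : (Fin n → ℂ) → ℂ} (hu : IsTest Ω u) (hh : ContDiffOn ℝ ∞ h Ω) (j : Fin n) :
    ∫ x, twist r j u x * conj (h x) * expW r x =
      -∫ x, u x * conj (wderivBar j h x) * expW r x := by
  have := congrArg conj (integral_mul_conj_twist hΩ hr hh hu j)
  rw [map_neg, ← integral_conj, ← integral_conj] at this
  have e1 : ∀ x, conj (h x * conj (twist r j u x) * expW r x) =
      twist r j u x * conj (h x) * expW r x := fun x => by
    simp only [expW, map_mul, Complex.conj_conj, Complex.conj_ofReal]; ring
  have e2 : ∀ x, conj (wderivBar j h x * conj (u x) * expW r x) =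
      u x * conj (wderivBar j h x) * expW r x := fun x => by
    simp only [expW, map_mul, Complex.conj_conj, Complex.conj_ofReal]; ring
  simpa only [e1, e2] using this

theorem wderivBar_twist (hΩ : IsOpen Ω) (hr : ContDiffOn ℝ ∞ r Ω) {u : (Fin n → ℂ) → ℂ}
    (hu : IsTest Ω u) (j k : Fin n) {x : Fin n → ℂ} (hx : x ∈ Ω) :
    wderivBar k (twist r j u) x = twist r j (wderivBar k u) x -
      u x * wderiv j (wderivBar k (fun y => (r y : ℂ))) x := by
  have hc := (hr.ofReal_comp).contDiffAt (hΩ.mem_nhds hx)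
  have h1 : DifferentiableAt ℝ (wderiv j u) x := (hu.wderiv j).differentiable x
  have h2 : DifferentiableAt ℝ (wderiv j (fun y => (r y : ℂ))) x :=
    ((dop_contDiffOn hΩ hr.ofReal_comp).contDiffAt (hΩ.mem_nhds hx)).differentiableAt (by simp)
  have h3 : DifferentiableAt ℝ (fun z => u z * wderiv j (fun y => (r y : ℂ)) z) x :=
    (hu.differentiable x).mul h2
  have c1 : wderivBar k (wderiv j u) x = wderiv j (wderivBar k u) x := by
    rw [wderivBar_eq_dop, wderivBar_eq_dop, wderiv_eq_dop, wderiv_eq_dop]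
    exact dop_comm (hu.smooth.contDiffAt.of_le (WithTop.coe_le_coe.2 le_top))
  have c2 : wderivBar k (wderiv j (fun y => (r y : ℂ))) x =
      wderiv j (wderivBar k (fun y => (r y : ℂ))) x := by
    rw [wderivBar_eq_dop, wderivBar_eq_dop, wderiv_eq_dop, wderiv_eq_dop]
    exact dop_comm (hc.of_le (WithTop.coe_le_coe.2 le_top))
  have e : wderivBar k (twist r j u) x = wderivBar k (wderiv j u) x -
      (wderivBar k u x * wderiv j (fun y => (r y : ℂ)) x +
        u x * wderivBar k (wderiv j (fun y => (r y : ℂ))) x) := by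
    unfold twist
    simp only [wderivBar_eq_dop k]
    rw [dop_sub h1 h3, dop_mul (hu.differentiable x) h2]
  rw [e, c1, c2, twist]
  ring

theorem integral_twist_twist (hΩ : IsOpen Ω) (hr : ContDiffOn ℝ ∞ r Ω)
    {f g : (Fin n → ℂ) → ℂ} (hf : IsTest Ω f) (hg : IsTest Ω g) (j k : Fin n) :
    ∫ x, twist r j f x * conj (twist r k g x) * expW r x =
      (∫ x, wderiv j (wderivBar k (fun y => (r y : ℂ))) x * f x * conj (g x) * expW r x) +
      ∫ x, wderivBar k f x * conj (wderivBar j g x) * expW r x := by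
  have hW := expW_contDiffOn hr
  have hL : ContDiffOn ℝ ∞ (wderiv j (wderivBar k (fun y => (r y : ℂ)))) Ω := by
    rw [wderivBar_eq_dop, wderiv_eq_dop]
    exact dop_contDiffOn hΩ (dop_contDiffOn hΩ hr.ofReal_comp)
  have hgW : IsTest Ω (fun x => expW r x * conj (g x)) := hg.conj.mul_left hΩ hW
  rw [integral_mul_conj_twist hΩ hr (twist_isTest hΩ hr hf j).smooth.contDiffOn hg k,
    ← neg_inj, neg_neg, neg_add, ← integral_twist_mul_conj hΩ hr (hf.wderivBar k)
      hg.smooth.contDiffOn j, neg_add_eq_sub, ← integral_sub]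
  · congr 1
    ext x
    by_cases hx : x ∈ Ω
    · rw [wderivBar_twist hΩ hr hf j k hx]; ring
    · rw [hg.eq_zero hx]; simp
  · exact (hgW.integrable_mul hΩ (twist_isTest hΩ hr (hf.wderivBar k) j).smooth.contDiffOn).congr (Eventually.of_forall fun x => by
      ring)
  · exact (hgW.integrable_mul hΩ (hL.mul hf.smooth.contDiffOn)).congr (Eventually.of_forall fun x => by
      ring)

theorem sum_mul_conj_swap_re (a : Fin n → Fin n → ℂ) :
    -(2⁻¹ * ∑ j, ∑ k, ‖a j k - a k j‖ ^ 2) ≤ (∑ j, ∑ k, a k j * conj (a j k)).re := by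
  have h : ∀ j k, ‖a j k - a k j‖ ^ 2 =
      ‖a j k‖ ^ 2 + ‖a k j‖ ^ 2 - 2 * (a k j * conj (a j k)).re := fun j k => by
    simp only [← Complex.normSq_eq_norm_sq, Complex.normSq_apply, Complex.sub_re, Complex.sub_im,
      Complex.mul_re, Complex.conj_re, Complex.conj_im]
    ring
  have h2 : ∑ j, ∑ k, ‖a k j‖ ^ 2 = ∑ j, ∑ k, ‖a j k‖ ^ 2 := Finset.sum_comm
  simp only [h, Finset.sum_sub_distrib, Finset.sum_add_distrib, h2, ← Finset.mul_sum,
    Complex.re_sum]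
  have : 0 ≤ ∑ j, ∑ k, ‖a j k‖ ^ 2 := by positivity
  linarith

/-- The Bochner–Kodaira inequality for compactly supported `(0,1)`-forms. -/
theorem bochner_kodaira (hΩ : IsOpen Ω) (hr : ContDiffOn ℝ ∞ r Ω)
    (f : Fin n → (Fin n → ℂ) → ℂ) (hf : ∀ j, IsTest Ω (f j)) :
    ∫ x, leviForm r x (fun j => f j x) * Real.exp (-r x) ≤
      (∫ x, ‖∑ j, twist r j (f j) x‖ ^ 2 * Real.exp (-r x)) +
      ∫ x, 2⁻¹ * (∑ j, ∑ k, ‖wderivBar j (f k) x - wderivBar k (f j) x‖ ^ 2) *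
        Real.exp (-r x) := by
  have hW := expW_contDiffOn hr
  have hL : ∀ j k, ContDiffOn ℝ ∞ (wderiv j (wderivBar k (fun y => (r y : ℂ)))) Ω :=
    fun j k => by
    rw [wderivBar_eq_dop, wderiv_eq_dop]
    exact dop_contDiffOn hΩ (dop_contDiffOn hΩ hr.ofReal_comp)
  have i1 : ∀ j k, Integrable
      (fun x => twist r j (f j) x * conj (twist r k (f k) x) * expW r x) := fun j k => by
    exact (((twist_isTest hΩ hr (hf k) k).conj.mul_left hΩ hW).integrable_mul hΩ
      (twist_isTest hΩ hr (hf j) j).smooth.contDiffOn).congr (Eventually.of_forall fun x => by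
      ring)
  have i2 : ∀ j k, Integrable (fun x =>
      wderiv j (wderivBar k (fun y => (r y : ℂ))) x * f j x * conj (f k x) * expW r x) :=
    fun j k => by
    exact (((hf k).conj.mul_left hΩ hW).integrable_mul hΩ
      ((hL j k).mul (hf j).smooth.contDiffOn)).congr (Eventually.of_forall fun x => by
      ring)
  have i3 : ∀ j k, Integrable (fun x =>
      wderivBar k (f j) x * conj (wderivBar j (f k) x) * expW r x) := fun j k => by
    exact ((((hf k).wderivBar j).conj.mul_left hΩ hW).integrable_mul hΩ
      ((hf j).wderivBar k).smooth.contDiffOn).congr (Eventually.of_forall fun x => by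
      ring)
  have i4 : ∀ j k, Integrable (fun x =>
      ‖wderivBar j (f k) x - wderivBar k (f j) x‖ ^ 2 * Real.exp (-r x)) := fun j k => by
    have ht := ((hf k).wderivBar j).sub' ((hf j).wderivBar k)
    have := ((ht.conj.mul_left hΩ hW).integrable_mul hΩ ht.smooth.contDiffOn).re
    refine this.congr (Eventually.of_forall fun x => ?_)
    simp only [expW]
    rw [mul_left_comm, Complex.mul_conj, Complex.normSq_eq_norm_sq, ← Complex.ofReal_mul]
    exact mul_comm _ _
  have key : (∫ x, ∑ j, ∑ k, twist r j (f j) x * conj (twist r k (f k) x) * expW r x) =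
      (∫ x, ∑ j, ∑ k, wderiv j (wderivBar k (fun y => (r y : ℂ))) x * f j x * conj (f k x) *
        expW r x) +
      ∫ x, ∑ j, ∑ k, wderivBar k (f j) x * conj (wderivBar j (f k) x) * expW r x := by
    rw [integral_finsetSum _ fun j _ => integrable_finsetSum _ fun k _ => i1 j k,
      integral_finsetSum _ fun j _ => integrable_finsetSum _ fun k _ => i2 j k,
      integral_finsetSum _ fun j _ => integrable_finsetSum _ fun k _ => i3 j k,
      ← Finset.sum_add_distrib]
    refine Finset.sum_congr rfl fun j _ => ?_
    rw [integral_finsetSum _ fun k _ => i1 j k, integral_finsetSum _ fun k _ => i2 j k,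
      integral_finsetSum _ fun k _ => i3 j k, ← Finset.sum_add_distrib]
    exact Finset.sum_congr rfl fun k _ => integral_twist_twist hΩ hr (hf j) (hf k) j k
  have j1 := integrable_finsetSum Finset.univ fun j _ =>
    integrable_finsetSum Finset.univ fun k _ => i1 j k
  have j2 := integrable_finsetSum Finset.univ fun j _ =>
    integrable_finsetSum Finset.univ fun k _ => i2 j k
  have j3 := integrable_finsetSum Finset.univ fun j _ =>
    integrable_finsetSum Finset.univ fun k _ => i3 j k
  have key' := congrArg Complex.re key
  rw [Complex.add_re] at key'
  have re_int : ∀ {F : (Fin n → ℂ) → ℂ}, Integrable F →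
      (∫ x, F x).re = ∫ x, (RCLike.re (F x) : ℝ) := fun h => (integral_re h).symm
  rw [re_int j1, re_int j2, re_int j3] at key'
  have e1 : ∀ x, RCLike.re (∑ j, ∑ k, twist r j (f j) x * conj (twist r k (f k) x) * expW r x) =
      ‖∑ j, twist r j (f j) x‖ ^ 2 * Real.exp (-r x) := fun x => by
    have : ∑ j, ∑ k, twist r j (f j) x * conj (twist r k (f k) x) * expW r x =
        ((‖∑ j, twist r j (f j) x‖ ^ 2 * Real.exp (-r x) : ℝ) : ℂ) := by
      rw [← Complex.normSq_eq_norm_sq, Complex.ofReal_mul, ← Complex.mul_conj, map_sum,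
        Finset.sum_mul_sum, Finset.sum_mul]
      exact Finset.sum_congr rfl fun j _ => (Finset.sum_mul _ _ _).symm
    rw [this]; exact Complex.ofReal_re _
  have e2 : ∀ x, RCLike.re (∑ j, ∑ k, wderiv j (wderivBar k (fun y => (r y : ℂ))) x * f j x *
      conj (f k x) * expW r x) = leviForm r x (fun j => f j x) * Real.exp (-r x) := fun x => by
    simp only [← Finset.sum_mul, expW]
    exact Complex.re_mul_ofReal _ _
  have e3 : ∀ x, -(2⁻¹ * (∑ j, ∑ k, ‖wderivBar j (f k) x - wderivBar k (f j) x‖ ^ 2) *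
        Real.exp (-r x)) ≤
      RCLike.re (∑ j, ∑ k, wderivBar k (f j) x * conj (wderivBar j (f k) x) * expW r x) :=
    fun x => by
    simp only [← Finset.sum_mul, expW]
    refine le_trans ?_ (Complex.re_mul_ofReal _ _).ge
    rw [← neg_mul]
    exact mul_le_mul_of_nonneg_right
      (sum_mul_conj_swap_re fun j k => wderivBar j (f k) x) (Real.exp_pos _).le
  have i5 : Integrable fun x => 2⁻¹ * (∑ j, ∑ k,
      ‖wderivBar j (f k) x - wderivBar k (f j) x‖ ^ 2) * Real.exp (-r x) := by
    have := (integrable_finsetSum Finset.univ fun j _ =>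
      integrable_finsetSum Finset.univ fun k _ => i4 j k).const_mul (2⁻¹ : ℝ)
    refine this.congr (Eventually.of_forall fun x => ?_)
    simp only [← Finset.sum_mul]
    ring
  have h3 := integral_mono i5.neg j3.re e3
  simp only [Pi.neg_apply, integral_neg] at h3
  simp only [e1, e2] at key'
  linarith

end BochnerKodaira

/-! ### Mollifiers -/

section Mollifier

open scoped Convolution

variable {n : ℕ}

/-- A smooth, circle invariant probability density supported in the ball of radius `ε`. -/
structure IsMoll {n : ℕ} (ε : ℝ) (ρ : (Fin n → ℂ) → ℝ) : Prop where
  smooth : ContDiff ℝ ∞ ρ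
  nonneg : ∀ z, 0 ≤ ρ z
  integral_eq : ∫ z, ρ z = 1
  supp : ∀ z, ε ≤ ‖z‖ → ρ z = 0
  circ : ∀ c : ℂ, ‖c‖ = 1 → ∀ z, ρ (c • z) = ρ z

/-- The squared Euclidean norm. -/
def sqN {n : ℕ} (z : Fin n → ℂ) : ℝ := ∑ k, ‖z k‖ ^ 2

theorem sqN_contDiff : ContDiff ℝ ∞ (sqN (n := n)) := by
  unfold sqN
  refine ContDiff.sum fun k _ => ?_
  exact (contDiff_norm_sq ℝ).comp (contDiff_apply ℝ ℂ k)

theorem norm_sq_le_sqN (z : Fin n → ℂ) : ‖z‖ ^ 2 ≤ sqN z := by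
  have h : ‖z‖ ≤ Real.sqrt (sqN z) := by
    rw [pi_norm_le_iff_of_nonneg (Real.sqrt_nonneg _)]
    intro k
    refine Real.le_sqrt_of_sq_le ?_
    exact Finset.single_le_sum (f := fun k => ‖z k‖ ^ 2) (fun k _ => by positivity)
      (Finset.mem_univ k)
  calc ‖z‖ ^ 2 ≤ Real.sqrt (sqN z) ^ 2 := by gcongr
    _ = sqN z := Real.sq_sqrt (Finset.sum_nonneg fun k _ => by positivity)

theorem exists_isMoll {ε : ℝ} (hε : 0 < ε) : ∃ ρ : (Fin n → ℂ) → ℝ, IsMoll ε ρ := by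
  set b : (Fin n → ℂ) → ℝ := fun z => Real.smoothTransition (1 - ε⁻¹ ^ 2 * sqN z) with hb
  have hsm : ContDiff ℝ ∞ b :=
    Real.smoothTransition.contDiff.comp (contDiff_const.sub (contDiff_const.mul sqN_contDiff))
  have hsupp : ∀ z, ε ≤ ‖z‖ → b z = 0 := fun z hz => by
    refine Real.smoothTransition.zero_of_nonpos ?_
    have h1 := norm_sq_le_sqN z
    have h2 : ε ^ 2 ≤ sqN z := le_trans (by gcongr) h1
    have : ε⁻¹ ^ 2 * ε ^ 2 = 1 := by field_simp
    nlinarith [sq_nonneg ε⁻¹, mul_le_mul_of_nonneg_left h2 (sq_nonneg ε⁻¹)]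
  have hcs : HasCompactSupport b := by
    refine HasCompactSupport.intro (isCompact_closedBall (0 : Fin n → ℂ) ε) fun z hz => ?_
    refine hsupp z ?_
    simp only [mem_closedBall, dist_zero_right, not_le] at hz
    exact hz.le
  have hnn : ∀ z, 0 ≤ b z := fun z => Real.smoothTransition.nonneg _
  have hpos : 0 < ∫ z, b z := by
    refine hsm.continuous.integral_pos_of_hasCompactSupport_nonneg_nonzero hcs hnn (x := 0) ?_
    simp [hb, sqN, Real.smoothTransition.one]
  refine ⟨fun z => (∫ z, b z)⁻¹ * b z, contDiff_const.mul hsm,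
    fun z => mul_nonneg (inv_nonneg.2 hpos.le) (hnn z), ?_, fun z hz => by simp [hsupp z hz], ?_⟩
  · rw [integral_const_mul, inv_mul_cancel₀ hpos.ne']
  · intro c hc z
    simp [hb, sqN, hc]

/-- Convolution with `ρ`. -/
def mol {n : ℕ} (ρ : (Fin n → ℂ) → ℝ) (u : (Fin n → ℂ) → ℂ) (x : Fin n → ℂ) : ℂ :=
  ∫ t, (ρ t : ℂ) * u (x - t)

variable {ε : ℝ} {ρ : (Fin n → ℂ) → ℝ} {u g : (Fin n → ℂ) → ℂ} {x : Fin n → ℂ}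

theorem IsMoll.hasCompactSupport (h : IsMoll ε ρ) : HasCompactSupport ρ := by
  refine HasCompactSupport.intro (isCompact_closedBall (0 : Fin n → ℂ) ε) fun z hz => ?_
  refine h.supp z ?_
  simp only [mem_closedBall, dist_zero_right, not_le] at hz
  exact hz.le

theorem IsMoll.integrable (h : IsMoll ε ρ) : Integrable ρ :=
  h.smooth.continuous.integrable_of_hasCompactSupport h.hasCompactSupport

theorem IsMoll.isTest (h : IsMoll ε ρ) (x : Fin n → ℂ) {Ω : Set (Fin n → ℂ)}
    (hx : closedBall x ε ⊆ Ω) : IsTest Ω (fun y => (ρ (x - y) : ℂ)) := by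
  have hs : tsupport (fun y => (ρ (x - y) : ℂ)) ⊆ closedBall x ε := by
    refine closure_minimal (fun y hy => ?_) isClosed_closedBall
    by_contra hc
    simp only [mem_closedBall, not_le, dist_eq_norm] at hc
    refine hy ?_
    simp only [Complex.ofReal_eq_zero]
    refine h.supp _ ?_
    rw [norm_sub_rev]; exact hc.le
  refine ⟨?_, ?_, hs.trans hx⟩
  · exact Complex.ofRealCLM.contDiff.comp (h.smooth.comp (contDiff_const.sub contDiff_id))
  · exact (isCompact_closedBall x ε).of_isClosed_subset (isClosed_tsupport _) hs

theorem mol_eq_swap : mol ρ u x = ∫ y, u y * (ρ (x - y) : ℂ) := by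
  unfold mol
  rw [← integral_sub_left_eq_self _ volume x]
  simp only [sub_sub_cancel, mul_comm]

theorem mol_eq_convolution : mol ρ u = ρ ⋆[ContinuousLinearMap.lsmul ℝ ℝ] u := by
  ext x
  simp [mol, convolution]

theorem IsMoll.mol_contDiff (h : IsMoll ε ρ) (hu : LocallyIntegrable u) :
    ContDiff ℝ ∞ (mol ρ u) := by
  rw [mol_eq_convolution]
  exact h.hasCompactSupport.contDiff_convolution_left _ h.smooth hu

theorem IsMoll.fderiv_mol (h : IsMoll ε ρ) (hu : LocallyIntegrable u) (x v : Fin n → ℂ) :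
    fderiv ℝ (mol ρ u) x v = -∫ y, u y * fderiv ℝ (fun y => (ρ (x - y) : ℂ)) y v := by
  have h1 := h.hasCompactSupport.hasFDerivAt_convolution_left
    (ContinuousLinearMap.lsmul ℝ ℝ : ℝ →L[ℝ] ℂ →L[ℝ] ℂ) (h.smooth.of_le (by simp)) hu x
  rw [mol_eq_convolution, h1.fderiv, convolution_def, ContinuousLinearMap.integral_apply,
    ← integral_sub_left_eq_self _ volume x, ← integral_neg]
  · congr 1
    ext y
    have h2 : HasFDerivAt (fun y => (ρ (x - y) : ℂ))
        (Complex.ofRealCLM.comp ((fderiv ℝ ρ (x - y)).comp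
          (-ContinuousLinearMap.id ℝ (Fin n → ℂ)))) y :=
      Complex.ofRealCLM.hasFDerivAt.comp y
        (((h.smooth.differentiable (by simp)) (x - y)).hasFDerivAt.comp y
          ((hasFDerivAt_id y).const_sub x))
    rw [h2.fderiv]
    simp [ContinuousLinearMap.precompL]
    ring
  · have := (h.hasCompactSupport.fderiv ℝ).convolutionExists_left
      ((ContinuousLinearMap.lsmul ℝ ℝ : ℝ →L[ℝ] ℂ →L[ℝ] ℂ).precompL (Fin n → ℂ))
      (h.smooth.continuous_fderiv (by simp)) hu x
    exact this

theorem IsTest.integrable_mul_left {θ : (Fin n → ℂ) → ℂ} (hθ : IsTest univ θ)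
    (hu : LocallyIntegrable u) : Integrable (fun y => u y * θ y) := by
  have := hu.integrable_smul_right_of_hasCompactSupport hθ.continuous hθ.compact
  simpa using this

theorem IsMoll.dop_mol (h : IsMoll ε ρ) (hu : LocallyIntegrable u) (x v w : Fin n → ℂ) :
    dop v w (mol ρ u) x = -∫ y, u y * dop v w (fun y => (ρ (x - y) : ℂ)) y := by
  have ht : IsTest univ (fun y => (ρ (x - y) : ℂ)) := h.isTest x (subset_univ _)
  have hi : ∀ v, Integrable fun y => u y * fderiv ℝ (fun y => (ρ (x - y) : ℂ)) y v := by
    intro v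
    have h0 : IsTest univ (fun y => fderiv ℝ (fun y => (ρ (x - y) : ℂ)) y v) := by
      have := ht.dop (v := (2 : ℂ) • v) (w := 0)
      have e : (2 : ℂ) • v = (2 : ℝ) • v := by ext; simp
      have e2 : (fun y => fderiv ℝ (fun y => (ρ (x - y) : ℂ)) y v) =
          dop ((2 : ℂ) • v) 0 (fun y => (ρ (x - y) : ℂ)) := by
        ext y; simp [dop, e]
      rw [e2]; exact this
    exact h0.integrable_mul_left hu
  rw [dop, h.fderiv_mol hu, h.fderiv_mol hu]
  simp only [dop]
  rw [mul_neg, ← integral_const_mul, sub_neg_eq_add, neg_add_eq_sub,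
    ← integral_sub ((hi w).const_mul _) (hi v), ← integral_div, ← integral_neg]
  congr 1
  ext y
  ring

/-- Mollification commutes with differentiation in the weak sense. -/
theorem IsMoll.sum_dop_mol (h : IsMoll ε ρ) {ι : Type*} (s : Finset ι)
    {u : ι → (Fin n → ℂ) → ℂ} {B : (Fin n → ℂ) → ℂ} (v w : ι → (Fin n → ℂ))
    (hu : ∀ i ∈ s, LocallyIntegrable (u i))
    (hB : IsTest univ (fun y => (ρ (x - y) : ℂ)) →
      ∑ i ∈ s, ∫ y, u i y * dop (v i) (w i) (fun y => (ρ (x - y) : ℂ)) y =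
        -∫ y, B y * (ρ (x - y) : ℂ)) :
    ∑ i ∈ s, dop (v i) (w i) (mol ρ (u i)) x = mol ρ B x := by
  rw [mol_eq_swap, ← neg_inj, ← hB (h.isTest x (subset_univ _)), ← Finset.sum_neg_distrib]
  exact Finset.sum_congr rfl fun i hi => by rw [h.dop_mol (hu i hi), neg_neg]

theorem IsMoll.norm_mol_sub_le (h : IsMoll ε ρ) (hu : LocallyIntegrable u) {δ : ℝ}
    (hδ : ∀ y ∈ ball x ε, ‖u y - u x‖ ≤ δ) : ‖mol ρ u x - u x‖ ≤ δ := by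
  have hi : Integrable fun t => (ρ t : ℂ) * u (x - t) := by
    have := h.hasCompactSupport.convolutionExists_left
      (ContinuousLinearMap.lsmul ℝ ℝ : ℝ →L[ℝ] ℂ →L[ℝ] ℂ) h.smooth.continuous hu x
    simpa [ConvolutionExistsAt] using this
  have e : mol ρ u x - u x = ∫ t, (ρ t : ℂ) * (u (x - t) - u x) := by
    simp only [mul_sub]
    have hi2 : Integrable fun t => (ρ t : ℂ) * u x := h.integrable.ofReal.mul_const _
    have hone : ∫ t, (ρ t : ℂ) = 1 := by
      rw [← Complex.ofReal_one, ← h.integral_eq]; exact integral_ofReal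
    rw [integral_sub hi hi2, integral_mul_const, hone, one_mul, mol]
  rw [e]
  calc ‖∫ t, (ρ t : ℂ) * (u (x - t) - u x)‖ ≤ ∫ t, ρ t * δ := by
        refine norm_integral_le_of_norm_le (h.integrable.mul_const _)
          (Eventually.of_forall fun t => ?_)
        rw [norm_mul, Complex.norm_real, Real.norm_of_nonneg (h.nonneg t)]
        by_cases ht : ε ≤ ‖t‖
        · simp [h.supp t ht]
        · refine mul_le_mul_of_nonneg_left (hδ _ ?_) (h.nonneg t)
          simpa [mem_ball, dist_eq_norm] using ht
    _ = δ := by rw [integral_mul_const, h.integral_eq, one_mul]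

theorem IsMoll.mol_eq_zero (h : IsMoll ε ρ) (hu : ∀ y ∈ ball x ε, u y = 0) : mol ρ u x = 0 := by
  rw [mol_eq_swap]
  refine integral_eq_zero_of_ae (Eventually.of_forall fun y => ?_)
  by_cases hy : y ∈ ball x ε
  · simp [hu y hy]
  · simp only [mem_ball, not_lt, dist_eq_norm] at hy
    rw [norm_sub_rev] at hy
    simp [h.supp _ hy]

theorem IsMoll.mol_congr (h : IsMoll ε ρ) (hu : ∀ y ∈ ball x ε, u y = g y) :
    mol ρ u x = mol ρ g x := by
  rw [mol_eq_swap, mol_eq_swap]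
  congr 1
  ext y
  by_cases hy : y ∈ ball x ε
  · simp [hu y hy]
  · simp only [mem_ball, not_lt, dist_eq_norm] at hy
    rw [norm_sub_rev] at hy
    simp [h.supp _ hy]

/-! #### `L²` bounds -/

theorem IsMoll.lintegral_ofReal (h : IsMoll ε ρ) : ∫⁻ t, ENNReal.ofReal (ρ t) = 1 := by
  rw [← ofReal_integral_eq_lintegral_ofReal h.integrable (Eventually.of_forall h.nonneg),
    h.integral_eq, ENNReal.ofReal_one]

theorem IsMoll.enorm_mol_sq_le (h : IsMoll ε ρ) (hu : AEStronglyMeasurable u) (x : Fin n → ℂ) :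
    ‖mol ρ u x‖ₑ ^ 2 ≤ ∫⁻ t, ENNReal.ofReal (ρ t) * ‖u (x - t)‖ₑ ^ 2 := by
  have hm : AEMeasurable (fun t => ‖u (x - t)‖ₑ) :=
    (hu.comp_quasiMeasurePreserving
      (quasiMeasurePreserving_sub_left_of_right_invariant volume x)).enorm
  have hρ : AEMeasurable (fun t => ENNReal.ofReal (ρ t)) :=
    h.smooth.continuous.measurable.ennreal_ofReal.aemeasurable
  have h1 : ‖mol ρ u x‖ₑ ≤ ∫⁻ t, ENNReal.ofReal (ρ t) ^ (1/2 : ℝ) *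
      (ENNReal.ofReal (ρ t) ^ (1/2 : ℝ) * ‖u (x - t)‖ₑ) := by
    refine (enorm_integral_le_lintegral_enorm _).trans (lintegral_mono fun t => ?_)
    rw [← mul_assoc, ← ENNReal.rpow_add_of_nonneg _ _ (by norm_num) (by norm_num), enorm_mul]
    gcongr
    · norm_num
      rw [← ofReal_norm, Complex.norm_real, Real.norm_of_nonneg (h.nonneg t)]
  have h2 := ENNReal.lintegral_mul_le_Lp_mul_Lq volume Real.HolderConjugate.two_two
    (hρ.pow_const (1/2 : ℝ)) ((hρ.pow_const (1/2 : ℝ)).mul hm)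
  calc ‖mol ρ u x‖ₑ ^ 2 ≤ _ := pow_le_pow_left' (h1.trans h2) 2
    _ = ∫⁻ t, ENNReal.ofReal (ρ t) * ‖u (x - t)‖ₑ ^ 2 := by
      rw [mul_pow, ← ENNReal.rpow_natCast, ← ENNReal.rpow_natCast, ← ENNReal.rpow_mul,
        ← ENNReal.rpow_mul]
      have e : ∀ t, ENNReal.ofReal (ρ t) ^ (1/2 : ℝ) = ENNReal.ofReal (ρ t) ^ (2⁻¹ : ℝ) :=
        fun t => by norm_num
      simp only [Pi.mul_apply, ENNReal.mul_rpow_of_nonneg _ _ zero_le_two, ← ENNReal.rpow_mul]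
      norm_num [h.lintegral_ofReal]

theorem IsMoll.lintegral_mol_sq_le (h : IsMoll ε ρ) (hu : AEStronglyMeasurable u) :
    ∫⁻ x, ‖mol ρ u x‖ₑ ^ 2 ≤ ∫⁻ x, ‖u x‖ₑ ^ 2 := by
  have hm : AEMeasurable (fun p : (Fin n → ℂ) × (Fin n → ℂ) => ‖u (p.1 - p.2)‖ₑ ^ 2)
      (volume.prod volume) :=
    ((hu.comp_quasiMeasurePreserving
      (quasiMeasurePreserving_sub_of_right_invariant volume volume)).enorm).pow_const 2
  have hρ : Measurable (fun t => ENNReal.ofReal (ρ t)) :=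
    h.smooth.continuous.measurable.ennreal_ofReal
  calc ∫⁻ x, ‖mol ρ u x‖ₑ ^ 2 ≤ ∫⁻ x, ∫⁻ t, ENNReal.ofReal (ρ t) * ‖u (x - t)‖ₑ ^ 2 :=
        lintegral_mono fun x => h.enorm_mol_sq_le hu x
    _ = ∫⁻ t, ∫⁻ x, ENNReal.ofReal (ρ t) * ‖u (x - t)‖ₑ ^ 2 :=
        lintegral_lintegral_swap ((hρ.comp measurable_snd).aemeasurable.mul hm)
    _ = ∫⁻ t, ENNReal.ofReal (ρ t) * ∫⁻ x, ‖u x‖ₑ ^ 2 := by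
        congr 1; ext t
        rw [lintegral_const_mul' _ _ ENNReal.ofReal_ne_top,
          lintegral_sub_right_eq_self (fun x => ‖u x‖ₑ ^ 2) t]
    _ = ∫⁻ x, ‖u x‖ₑ ^ 2 := by
        rw [lintegral_mul_const _ hρ, h.lintegral_ofReal, one_mul]

theorem eLpNorm_two_sq {α : Type*} [MeasurableSpace α] {μ : Measure α} (f : α → ℂ) :
    eLpNorm f 2 μ ^ 2 = ∫⁻ x, ‖f x‖ₑ ^ 2 ∂μ := by
  have := eLpNorm_nnreal_pow_eq_lintegral (f := f) (μ := μ) (p := 2) (by norm_num)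
  simpa using this

theorem IsMoll.eLpNorm_mol_le (h : IsMoll ε ρ) (hu : AEStronglyMeasurable u) :
    eLpNorm (mol ρ u) 2 volume ≤ eLpNorm u 2 volume := by
  have := h.lintegral_mol_sq_le hu
  rw [← eLpNorm_two_sq, ← eLpNorm_two_sq] at this
  exact (ENNReal.pow_le_pow_left_iff two_ne_zero).1 this

theorem IsMoll.memLp_mol (h : IsMoll ε ρ) (hu : MemLp u 2 volume) : MemLp (mol ρ u) 2 volume :=
  ⟨(h.mol_contDiff (hu.locallyIntegrable one_le_two)).continuous.aestronglyMeasurable,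
    (h.eLpNorm_mol_le hu.1).trans_lt hu.2⟩

theorem IsMoll.mol_sub (h : IsMoll ε ρ) (hu : LocallyIntegrable u) (hg : LocallyIntegrable g) :
    mol ρ (fun x => u x - g x) = fun x => mol ρ u x - mol ρ g x := by
  have hi : ∀ {u : (Fin n → ℂ) → ℂ}, LocallyIntegrable u → ∀ x,
      Integrable fun t => (ρ t : ℂ) * u (x - t) := by
    intro u hu x
    have := h.hasCompactSupport.convolutionExists_left
      (ContinuousLinearMap.lsmul ℝ ℝ : ℝ →L[ℝ] ℂ →L[ℝ] ℂ) h.smooth.continuous hu x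
    simpa [ConvolutionExistsAt] using this
  ext x
  simp only [mol, mul_sub]
  exact integral_sub (hi hu x) (hi hg x)

/-- Mollifications converge in `L²`. -/
theorem tendsto_eLpNorm_mol_sub (hg : MemLp g 2 volume) {e : ℕ → ℝ} (he : Tendsto e atTop (𝓝 0))
    {r : ℕ → (Fin n → ℂ) → ℝ} (hr : ∀ k, IsMoll (e k) (r k)) :
    Tendsto (fun k => eLpNorm (fun x => mol (r k) g x - g x) 2 volume) atTop (𝓝 0) := by
  rw [ENNReal.tendsto_nhds_zero]
  intro δ hδ
  have hδ3 : δ / 3 ≠ 0 := (ENNReal.div_pos hδ.ne' (by norm_num)).ne'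
  obtain ⟨w, hw1, hw2, hw3, hw4⟩ := hg.exists_hasCompactSupport_eLpNorm_sub_le (by norm_num) hδ3
  have hcw := hw1.uniformContinuous_of_continuous hw3
  set K : Set (Fin n → ℂ) := cthickening 1 (tsupport w)
  have hK : IsCompact K := hw1.isCompact.cthickening
  obtain ⟨s, hs0, hs⟩ : ∃ s : ℝ, 0 < s ∧
      volume K ^ (2 : ℝ≥0∞).toReal⁻¹ * ENNReal.ofReal s ≤ δ / 3 := by
    have hV : volume K ^ (2 : ℝ≥0∞).toReal⁻¹ ≠ ⊤ :=
      ENNReal.rpow_ne_top_of_nonneg (inv_nonneg.2 ENNReal.toReal_nonneg) hK.measure_lt_top.ne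
    have hc : Tendsto (fun s : ℝ => volume K ^ (2 : ℝ≥0∞).toReal⁻¹ * ENNReal.ofReal s)
        (𝓝[>] 0) (𝓝 0) := by
      have h0 : Tendsto (fun s : ℝ => ENNReal.ofReal s) (𝓝[>] 0) (𝓝 0) := by
        have := (ENNReal.continuous_ofReal.tendsto (0 : ℝ)).mono_left
          (nhdsWithin_le_nhds (s := Ioi 0))
        simpa using this
      simpa using ENNReal.Tendsto.const_mul h0 (Or.inr hV)
    obtain ⟨s, hs, hs0⟩ := ((hc.eventually (ge_mem_nhds (pos_iff_ne_zero.2 hδ3))).and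
      self_mem_nhdsWithin).exists
    exact ⟨s, hs0, hs⟩
  obtain ⟨d, hd0, hd⟩ := Metric.uniformContinuous_iff.1 hcw s hs0
  filter_upwards [he.eventually (gt_mem_nhds hd0), he.eventually (gt_mem_nhds zero_lt_one)]
    with k hk hk1
  have hgL := hg.locallyIntegrable one_le_two
  have hwL := hw4.locallyIntegrable one_le_two
  have m1 : AEStronglyMeasurable (fun x => mol (r k) (fun x => g x - w x) x) volume :=
    ((hr k).memLp_mol (hg.sub hw4)).1
  have m2 : AEStronglyMeasurable (fun x => mol (r k) w x - w x) volume :=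
    ((hr k).memLp_mol hw4).1.sub hw4.1
  have m3 : AEStronglyMeasurable (fun x => g x - w x) volume := (hg.sub hw4).1
  have e1 : (fun x => mol (r k) g x - g x) = (fun x => mol (r k) (fun x => g x - w x) x) +
      (fun x => mol (r k) w x - w x) - (fun x => g x - w x) := by
    rw [(hr k).mol_sub hgL hwL]
    ext x; simp
  have b1 : eLpNorm (fun x => mol (r k) (fun x => g x - w x) x) 2 volume ≤ δ / 3 :=
    ((hr k).eLpNorm_mol_le m3).trans hw2
  have b2 : eLpNorm (fun x => mol (r k) w x - w x) 2 volume ≤ δ / 3 := by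
    have hz : ∀ x, x ∉ K → mol (r k) w x - w x = 0 := by
      intro x hx
      have hx' : ∀ y ∈ ball x (e k), w y = 0 := by
        intro y hy
        by_contra hne
        refine hx (mem_cthickening_of_dist_le x y 1 _ (subset_tsupport w hne) ?_)
        rw [dist_comm]; exact (hy.trans hk1).le
      have hx0 : w x = 0 := by
        by_contra hne
        exact hx (self_subset_cthickening _ (subset_tsupport w hne))
      rw [(hr k).mol_eq_zero hx', hx0, sub_zero]
    have : (fun x => mol (r k) w x - w x) = K.indicator (fun x => mol (r k) w x - w x) := by
      ext x
      by_cases hx : x ∈ K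
      · simp [hx]
      · simp [hx, hz x hx]
    rw [this, eLpNorm_indicator_eq_eLpNorm_restrict hK.measurableSet]
    refine (eLpNorm_le_of_ae_bound (C := s) (Eventually.of_forall fun x => ?_)).trans
      (by simpa using hs)
    refine (hr k).norm_mol_sub_le hwL fun y hy => ?_
    have := hd (hy.trans hk)
    rw [dist_eq_norm] at this
    exact this.le
  rw [e1]
  calc _ ≤ eLpNorm ((fun x => mol (r k) (fun x => g x - w x) x) +
      (fun x => mol (r k) w x - w x)) 2 volume + eLpNorm (fun x => g x - w x) 2 volume :=
        eLpNorm_sub_le (m1.add m2) m3 (by norm_num)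
    _ ≤ (δ / 3 + δ / 3) + δ / 3 :=
        add_le_add ((eLpNorm_add_le m1 m2 (by norm_num)).trans (add_le_add b1 b2)) hw2
    _ = δ := ENNReal.add_thirds δ

end Mollifier

/-! ### Holomorphic functions, the mean value property and Weyl's lemma -/

section Weyl

variable {n : ℕ} {Ω : Set (Fin n → ℂ)} {ε : ℝ} {ρ : (Fin n → ℂ) → ℝ} {u h : (Fin n → ℂ) → ℂ}
  {x : Fin n → ℂ}

theorem pi_eq_sum_single_re_im (v : Fin n → ℂ) :
    v = ∑ j, ((v j).re • (Pi.single j 1 : Fin n → ℂ) +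
      (v j).im • (Pi.single j Complex.I : Fin n → ℂ)) := by
  ext k
  simp [Finset.sum_apply, Pi.single_apply, Finset.sum_add_distrib]

theorem differentiableAt_complex_of_wderivBar (hd : DifferentiableAt ℝ u x)
    (h : ∀ j, wderivBar j u x = 0) : DifferentiableAt ℂ u x := by
  rw [differentiableAt_iff_restrictScalars ℝ hd]
  have hI : ∀ j, fderiv ℝ u x (Pi.single j Complex.I) =
      Complex.I * fderiv ℝ u x (Pi.single j 1) := fun j => by
    have := h j
    rw [wderivBar, div_eq_zero_iff] at this
    have h1 := this.resolve_right two_ne_zero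
    have h2 := congrArg (fun z => Complex.I * z) h1
    simp only [mul_add, ← mul_assoc, Complex.I_mul_I, mul_zero] at h2
    linear_combination -h2
  have hform : ∀ v, fderiv ℝ u x v = ∑ j, v j * fderiv ℝ u x (Pi.single j 1) := fun v => by
    conv_lhs => rw [pi_eq_sum_single_re_im v]
    simp only [map_sum, map_add, map_smul, hI, Complex.real_smul]
    refine Finset.sum_congr rfl fun j _ => ?_
    conv_rhs => rw [← Complex.re_add_im (v j)]
    ring
  refine ⟨LinearMap.toContinuousLinearMap
    (∑ j, (LinearMap.proj j).smulRight (fderiv ℝ u x (Pi.single j 1)) : (Fin n → ℂ) →ₗ[ℂ] ℂ), ?_⟩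
  ext v
  simp [hform v]

theorem wderivBar_eq_zero_of_differentiableAt (hd : DifferentiableAt ℂ u x) (j : Fin n) :
    wderivBar j u x = 0 := by
  have h1 : fderiv ℝ u x = (fderiv ℂ u x).restrictScalars ℝ := hd.fderiv_restrictScalars ℝ
  have h2 : (Pi.single j Complex.I : Fin n → ℂ) = Complex.I • Pi.single j 1 := by
    rw [← Pi.single_smul]; simp
  simp only [wderivBar, h1, ContinuousLinearMap.coe_restrictScalars', h2, map_smul, smul_eq_mul]
  rw [← mul_assoc, Complex.I_mul_I]
  ring

theorem measurePreserving_circle_smul {c : ℂ} (hc : ‖c‖ = 1) :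
    MeasurePreserving (fun z : Fin n → ℂ => c • z) := by
  have h1 : MeasurePreserving (fun z : ℂ => c * z) :=
    (rotation ⟨c, mem_sphere_zero_iff_norm.2 hc⟩).measurePreserving
  exact volume_preserving_pi fun _ : Fin n => h1

/-- The mean value property with respect to a circle invariant density. -/
theorem IsMoll.mol_eq_self (hρ : IsMoll ε ρ) (hε : 0 < ε) {U : Set (Fin n → ℂ)}
    (hh : DifferentiableOn ℂ h U) (hx : closedBall x ε ⊆ U) : mol ρ h x = h x := by
  set H : (Fin n → ℂ) → ℂ := (closedBall x ε).indicator h with hH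
  have hHx : H x = h x := by simp [hH, hε.le]
  have e0 : mol ρ h x = mol ρ H x :=
    hρ.mol_congr fun y hy => by simp [hH, ball_subset_closedBall hy]
  have hcont : ContinuousOn h (closedBall x ε) := hh.continuousOn.mono hx
  obtain ⟨C, hC⟩ := (isCompact_closedBall x ε).exists_bound_of_continuousOn hcont
  have hC0 : 0 ≤ C := (norm_nonneg _).trans (hC x (mem_closedBall_self hε.le))
  have hHb : ∀ y, ‖H y‖ ≤ C := fun y => by
    by_cases hy : y ∈ closedBall x ε
    · simpa [hH, hy] using hC y hy
    · simpa [hH, hy] using hC0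
  have hHm : Measurable H := by
    classical
    rw [hH, ← Set.piecewise_eq_indicator]
    exact hcont.measurable_piecewise continuousOn_const isClosed_closedBall.measurableSet
  have hrot : ∀ c : ℂ, ‖c‖ = 1 → ∫ t, (ρ t : ℂ) * H (x - c • t) = mol ρ H x := fun c hc => by
    have hc0 : c ≠ 0 := fun h0 => by simp [h0] at hc
    have := (measurePreserving_circle_smul (n := n) hc).integral_comp
      (MeasurableEquiv.smul₀ c hc0).measurableEmbedding (fun t => (ρ t : ℂ) * H (x - t))
    simp only [hρ.circ c hc] at this
    exact this
  have hint : Integrable (Function.uncurry fun (θ : ℝ) (t : Fin n → ℂ) =>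
      (ρ t : ℂ) * H (x - circleMap 0 1 θ • t))
      ((volume.restrict (Ioc 0 (2 * Real.pi))).prod volume) := by
    refine Integrable.mono' (g := fun p => C * ρ p.2)
      ((hρ.integrable.const_mul C).comp_snd _) ?_ (Eventually.of_forall fun p => ?_)
    · refine Measurable.aestronglyMeasurable ?_
      have m1 : Measurable fun p : ℝ × (Fin n → ℂ) => (ρ p.2 : ℂ) :=
        Complex.measurable_ofReal.comp (hρ.smooth.continuous.measurable.comp measurable_snd)
      have m2 : Measurable fun p : ℝ × (Fin n → ℂ) => x - circleMap 0 1 p.1 • p.2 :=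
        (continuous_const.sub (((continuous_circleMap 0 1).comp continuous_fst).smul
          continuous_snd)).measurable
      exact m1.mul (hHm.comp m2)
    · simp only [Function.uncurry, norm_mul, Complex.norm_real, Real.norm_of_nonneg (hρ.nonneg _)]
      rw [mul_comm]
      exact mul_le_mul_of_nonneg_right (hHb _) (hρ.nonneg _)
  have hswap := integral_integral_swap hint
  have hmean : ∀ t, (ρ t : ℂ) * ∫ θ in Ioc 0 (2 * Real.pi), H (x - circleMap 0 1 θ • t) =
      (ρ t : ℂ) * ((2 * Real.pi : ℝ) * h x) := fun t => by
    by_cases ht : ε ≤ ‖t‖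
    · simp [hρ.supp t ht]
    · congr 1
      have hmem : ∀ w : ℂ, w ∈ closedBall (0 : ℂ) 1 → x - w • t ∈ closedBall x ε := fun w hw => by
        simp only [mem_closedBall, dist_eq_norm, sub_zero, sub_sub_cancel_left, norm_neg] at hw ⊢
        rw [norm_smul]
        nlinarith [norm_nonneg t, norm_nonneg w]
      have hline : Differentiable ℂ fun w : ℂ => x - w • t := by fun_prop
      have hdc : DiffContOnCl ℂ (fun w : ℂ => h (x - w • t)) (ball 0 |1|) := by
        refine DifferentiableOn.diffContOnCl_ball (U := (fun w : ℂ => x - w • t) ⁻¹' U) ?_ ?_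
        · exact hh.comp hline.differentiableOn fun w hw => hw
        · rw [abs_one]; exact fun w hw => hx (hmem w hw)
      have := hdc.circleAverage
      rw [Real.circleAverage_def, intervalIntegral.integral_of_le (by positivity)] at this
      have e : ∀ θ, H (x - circleMap 0 1 θ • t) = h (x - circleMap 0 1 θ • t) := fun θ => by
        simp [hH, hmem (circleMap 0 1 θ) (by simp [circleMap])]
      simp only [e]
      simp only [zero_smul, sub_zero] at this
      rw [← this, Complex.real_smul, ← mul_assoc, ← Complex.ofReal_mul,
        mul_inv_cancel₀ (by positivity), Complex.ofReal_one, one_mul]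
  have e1 : ∀ θ : ℝ, ∫ t, (ρ t : ℂ) * H (x - circleMap 0 1 θ • t) = mol ρ H x :=
    fun θ => hrot _ (by simp [circleMap])
  simp only [e1, integral_const_mul, hmean, integral_mul_const] at hswap
  have hone : ∫ t, (ρ t : ℂ) = 1 := by
    rw [← Complex.ofReal_one, ← hρ.integral_eq]; exact integral_ofReal
  rw [hone, one_mul, setIntegral_const] at hswap
  rw [e0]
  have h2 : (volume.real (Ioc 0 (2 * Real.pi))) = 2 * Real.pi := by
    simp [Measure.real, Real.pi_pos.le]
  rw [h2, Complex.real_smul] at hswap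
  exact mul_left_cancel₀ (by exact_mod_cast Real.two_pi_pos.ne') hswap

theorem IsMoll.norm_mol_sq_le (hρ : IsMoll ε ρ) (hu : MemLp u 2 volume) {M : ℝ}
    (hM : ∀ t, ρ t ≤ M) (x : Fin n → ℂ) :
    ‖mol ρ u x‖ₑ ^ 2 ≤ ENNReal.ofReal M * eLpNorm u 2 volume ^ 2 := by
  calc ‖mol ρ u x‖ₑ ^ 2 ≤ ∫⁻ t, ENNReal.ofReal (ρ t) * ‖u (x - t)‖ₑ ^ 2 :=
        hρ.enorm_mol_sq_le hu.1 x
    _ ≤ ∫⁻ t, ENNReal.ofReal M * ‖u (x - t)‖ₑ ^ 2 := by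
        gcongr with t; exact hM t
    _ = ENNReal.ofReal M * eLpNorm u 2 volume ^ 2 := by
        rw [lintegral_const_mul' _ _ ENNReal.ofReal_ne_top, eLpNorm_two_sq,
          lintegral_sub_left_eq_self (fun x => ‖u x‖ₑ ^ 2) x]

theorem IsMoll.exists_bound (hρ : IsMoll ε ρ) : ∃ M, 0 < M ∧ ∀ t, ρ t ≤ M := by
  obtain ⟨M, hM⟩ := hρ.hasCompactSupport.exists_bound_of_continuous hρ.smooth.continuous
  exact ⟨max M 1, by positivity, fun t => ((le_abs_self _).trans (hM t)).trans (le_max_left _ _)⟩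

/-- Pointwise bound for holomorphic functions by the `L²` norm. -/
theorem exists_norm_sq_le_of_differentiableOn (n : ℕ) {ε : ℝ} (hε : 0 < ε) :
    ∃ M : ℝ, 0 < M ∧ ∀ (x : Fin n → ℂ) (U : Set (Fin n → ℂ)) (h : (Fin n → ℂ) → ℂ), IsOpen U →
      DifferentiableOn ℂ h U → closedBall x ε ⊆ U → MemLp h 2 (volume.restrict U) →
      ‖h x‖ₑ ^ 2 ≤ ENNReal.ofReal M * eLpNorm h 2 (volume.restrict U) ^ 2 := by
  obtain ⟨ρ, hρ⟩ := exists_isMoll (n := n) hε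
  obtain ⟨M, hM0, hM⟩ := hρ.exists_bound
  refine ⟨M, hM0, fun x U h hU hh hx hL => ?_⟩
  rw [← hρ.mol_eq_self hε hh hx, ← eLpNorm_indicator_eq_eLpNorm_restrict hU.measurableSet,
    hρ.mol_congr (g := U.indicator h) fun y hy => by simp [hx (ball_subset_closedBall hy)]]
  exact hρ.norm_mol_sq_le ((memLp_indicator_iff_restrict hU.measurableSet).2 hL) hM x

/-- `u` is weakly holomorphic on `Ω`. -/
def WeakHol {n : ℕ} (Ω : Set (Fin n → ℂ)) (u : (Fin n → ℂ) → ℂ) : Prop :=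
  ∀ (j : Fin n) (θ : (Fin n → ℂ) → ℂ), IsTest Ω θ → ∫ y, u y * wderivBar j θ y = 0

theorem WeakHol.differentiableAt_mol (hw : WeakHol Ω u) (hu : LocallyIntegrable u)
    (hρ : IsMoll ε ρ) (hx : closedBall x ε ⊆ Ω) : DifferentiableAt ℂ (mol ρ u) x := by
  refine differentiableAt_complex_of_wderivBar
    (((hρ.mol_contDiff hu).differentiable (by simp)) x) fun j => ?_
  rw [wderivBar_eq_dop, hρ.dop_mol hu, ← wderivBar_eq_dop, hw j _ (hρ.isTest x hx), neg_zero]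

theorem WeakHol.mol_ae_eq (hw : WeakHol Ω u) (hu : MemLp u 2 volume) {r : ℝ} (hr : 0 < r)
    (hρ : IsMoll r ρ) {x₀ : Fin n → ℂ} (hx : closedBall x₀ (3 * r) ⊆ Ω) :
    u =ᵐ[volume.restrict (ball x₀ r)] mol ρ u := by
  have huL := hu.locallyIntegrable one_le_two
  obtain ⟨M, hM0, hM⟩ := hρ.exists_bound
  have hpos : ∀ k : ℕ, 0 < r / (k + 2) := fun k => by positivity
  choose η hη using fun k => exists_isMoll (n := n) (hpos k)
  have hlim : Tendsto (fun k : ℕ => r / ((k : ℝ) + 2)) atTop (𝓝 0) :=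
    tendsto_const_nhds.div_atTop
      (tendsto_atTop_add_const_right _ _ tendsto_natCast_atTop_atTop)
  have hL2 := tendsto_eLpNorm_mol_sub hu hlim hη
  have hmeas := tendstoInMeasure_of_tendsto_eLpNorm (μ := volume) (p := 2) (f := fun k => mol (η k) u)
    (g := u) two_ne_zero (fun k => ((hη k).memLp_mol hu).1) hu.1 hL2
  obtain ⟨ns, hns, hae⟩ := hmeas.exists_seq_tendsto_ae
  have hpt : ∀ x ∈ ball x₀ r, Tendsto (fun k => mol (η k) u x) atTop (𝓝 (mol ρ u x)) := by
    intro x hxb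
    have hself : ∀ k, mol ρ (mol (η k) u) x = mol (η k) u x := fun k => by
      have hle : r / ((k : ℝ) + 2) ≤ r / 2 := by
        gcongr; linarith [(Nat.cast_nonneg k : (0 : ℝ) ≤ k)]
      refine hρ.mol_eq_self hr (U := ball x₀ (5 / 2 * r)) (fun y hy => ?_) ?_
      · refine (hw.differentiableAt_mol huL (hη k) ?_).differentiableWithinAt
        refine Subset.trans (closedBall_subset_closedBall' ?_) hx
        rw [mem_ball] at hy
        linarith
      · refine closedBall_subset_ball' ?_
        rw [mem_ball] at hxb
        linarith
    have hb : ∀ k, ‖mol (η k) u x - mol ρ u x‖ₑ ^ 2 ≤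
        ENNReal.ofReal M * eLpNorm (fun x => mol (η k) u x - u x) 2 volume ^ 2 := fun k => by
      have hm := (hη k).memLp_mol hu
      rw [← hself k]
      have := hρ.norm_mol_sq_le (hm.sub hu) hM x
      have e := hρ.mol_sub (hm.locallyIntegrable one_le_two) huL
      have e' := congrFun e x
      rw [← e']
      exact this
    have h0 : Tendsto (fun k => ‖mol (η k) u x - mol ρ u x‖ₑ ^ 2) atTop (𝓝 0) := by
      refine tendsto_of_tendsto_of_tendsto_of_le_of_le tendsto_const_nhds ?_
        (fun _ => bot_le) hb
      have := ENNReal.Tendsto.const_mul (a := ENNReal.ofReal M)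
        (((ENNReal.continuous_pow 2).tendsto _).comp hL2)
        (Or.inr ENNReal.ofReal_ne_top)
      simpa using this
    rw [tendsto_iff_norm_sub_tendsto_zero]
    have h1 : Tendsto (fun k => ‖mol (η k) u x - mol ρ u x‖ ^ 2) atTop (𝓝 0) := by
      have := (ENNReal.tendsto_toReal ENNReal.zero_ne_top).comp h0
      simpa [Function.comp_def] using this
    have h2 := h1.sqrt
    simpa using h2
  filter_upwards [ae_restrict_of_ae hae, ae_restrict_mem measurableSet_ball] with x hx1 hx2
  exact tendsto_nhds_unique hx1 ((hpt x hx2).comp hns.tendsto_atTop)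

/-- **Weyl's lemma** for the `∂̄`-operator. -/
theorem WeakHol.exists_differentiableOn (hΩ : IsOpen Ω) (hw : WeakHol Ω u)
    (hu : MemLp u 2 volume) :
    ∃ h, DifferentiableOn ℂ h Ω ∧ u =ᵐ[volume.restrict Ω] h := by
  have huL := hu.locallyIntegrable one_le_two
  have hex : ∀ x : Fin n → ℂ, ∃ r : ℝ, ∃ ρ : (Fin n → ℂ) → ℝ, 0 < r ∧ IsMoll r ρ ∧
      (x ∈ Ω → closedBall x (3 * r) ⊆ Ω) := fun x => by
    by_cases hx : x ∈ Ω
    · obtain ⟨r, hr, hrΩ⟩ := Metric.nhds_basis_closedBall.mem_iff.1 (hΩ.mem_nhds hx)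
      obtain ⟨ρ, hρ⟩ := exists_isMoll (n := n) (ε := r / 3) (by positivity)
      exact ⟨r / 3, ρ, by positivity, hρ, fun _ => by
        rwa [mul_div_cancel₀ r (three_ne_zero : (3 : ℝ) ≠ 0)]⟩
    · obtain ⟨ρ, hρ⟩ := exists_isMoll (n := n) one_pos
      exact ⟨1, ρ, one_pos, hρ, fun h => absurd h hx⟩
  choose r η hr hη hrΩ using hex
  have hloc : ∀ x₀ ∈ Ω, ∀ x ∈ Ω, x ∈ ball x₀ (r x₀) → mol (η x) u x = mol (η x₀) u x := by
    intro x₀ hx₀ x hx hxb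
    have h1 := hw.mol_ae_eq hu (hr x₀) (hη x₀) (hrΩ x₀ hx₀)
    have h2 := hw.mol_ae_eq hu (hr x) (hη x) (hrΩ x hx)
    have h3 := ae_restrict_of_ae_restrict_of_subset (s := ball x₀ (r x₀) ∩ ball x (r x))
      inter_subset_left h1
    have h4 := ae_restrict_of_ae_restrict_of_subset (s := ball x₀ (r x₀) ∩ ball x (r x))
      inter_subset_right h2
    have h5 : mol (η x) u =ᵐ[volume.restrict (ball x₀ (r x₀) ∩ ball x (r x))] mol (η x₀) u :=
      (EventuallyEq.symm h4).trans h3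
    exact Measure.eqOn_open_of_ae_eq h5 (isOpen_ball.inter isOpen_ball)
      ((hη x).mol_contDiff huL).continuous.continuousOn
      ((hη x₀).mol_contDiff huL).continuous.continuousOn ⟨hxb, mem_ball_self (hr x)⟩
  refine ⟨fun x => mol (η x) u x, fun x₀ hx₀ => ?_, ?_⟩
  · have hd : DifferentiableAt ℂ (mol (η x₀) u) x₀ :=
      hw.differentiableAt_mol huL (hη x₀)
        ((closedBall_subset_closedBall (by linarith [hr x₀])).trans (hrΩ x₀ hx₀))
    refine (hd.congr_of_eventuallyEq ?_).differentiableWithinAt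
    filter_upwards [hΩ.mem_nhds hx₀, ball_mem_nhds x₀ (hr x₀)] with x hx hxb
    exact hloc x₀ hx₀ x hx hxb
  · rw [EventuallyEq, ae_restrict_iff' hΩ.measurableSet, ae_iff]
    refine measure_null_of_locally_null _ fun x₀ hx₀ => ?_
    have hx₀ : x₀ ∈ Ω := by
      by_contra hc; exact hx₀ fun h => absurd h hc
    refine ⟨_, inter_mem_nhdsWithin _ (ball_mem_nhds x₀ (hr x₀)), ?_⟩
    have h1 := hw.mol_ae_eq hu (hr x₀) (hη x₀) (hrΩ x₀ hx₀)
    rw [EventuallyEq, ae_restrict_iff' measurableSet_ball, ae_iff] at h1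
    refine measure_mono_null (fun x hx => ?_) h1
    obtain ⟨hx1, hx2⟩ := hx
    simp only [mem_ofPred_eq, Classical.not_imp] at hx1 ⊢
    refine ⟨hx2, ?_⟩
    rw [← hloc x₀ hx₀ x hx1.1 hx2]
    exact hx1.2

end Weyl

section LTwo

variable {α : Type*} [MeasurableSpace α] {μ : Measure α} {ι : Type*} {l : Filter ι}

/-- Convergence in `L²` of square integrable functions. -/
structure L2T (μ : Measure α) (l : Filter ι) (u : ι → α → ℂ) (v : α → ℂ) : Prop where
  mem : ∀ k, MemLp (u k) 2 μ
  mem' : MemLp v 2 μ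
  tendsto : Tendsto (fun k => eLpNorm (fun x => u k x - v x) 2 μ) l (𝓝 0)

variable {u u' : ι → α → ℂ} {v v' g : α → ℂ}

theorem L2T.const (hv : MemLp v 2 μ) : L2T μ l (fun _ => v) v :=
  ⟨fun _ => hv, hv, by simpa using tendsto_const_nhds⟩

theorem L2T.add (h : L2T μ l u v) (h' : L2T μ l u' v') :
    L2T μ l (fun k x => u k x + u' k x) (fun x => v x + v' x) := by
  refine ⟨fun k => (h.mem k).add (h'.mem k), h.mem'.add h'.mem', ?_⟩
  have hs := h.tendsto.add h'.tendsto
  rw [add_zero] at hs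
  refine tendsto_of_tendsto_of_tendsto_of_le_of_le tendsto_const_nhds hs (fun _ => bot_le) fun k => ?_
  have := eLpNorm_add_le (μ := μ) (p := 2) ((h.mem k).sub h.mem').1 ((h'.mem k).sub h'.mem').1
    one_le_two
  refine le_trans (le_of_eq ?_) this
  congr 1
  ext x
  simp
  ring

theorem L2T.mul_left (h : L2T μ l u v) (hg : AEStronglyMeasurable g μ) {C : ℝ}
    (hC : ∀ x, ‖g x‖ ≤ C) : L2T μ l (fun k x => g x * u k x) (fun x => g x * v x) := by
  have hm : ∀ {w : α → ℂ}, MemLp w 2 μ → MemLp (fun x => g x * w x) 2 μ := fun hw =>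
    hw.of_le_mul (hg.mul hw.1) (Eventually.of_forall fun x => by
      rw [norm_mul]; exact mul_le_mul_of_nonneg_right (hC x) (norm_nonneg _))
  refine ⟨fun k => hm (h.mem k), hm h.mem', ?_⟩
  have hs := ENNReal.Tendsto.const_mul (a := ENNReal.ofReal C) h.tendsto
    (Or.inr ENNReal.ofReal_ne_top)
  rw [mul_zero] at hs
  refine tendsto_of_tendsto_of_tendsto_of_le_of_le tendsto_const_nhds hs (fun _ => bot_le) fun k => ?_
  refine eLpNorm_le_mul_eLpNorm_of_ae_le_mul (Eventually.of_forall fun x => ?_) 2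
  rw [← mul_sub, norm_mul]
  exact mul_le_mul_of_nonneg_right (hC x) (norm_nonneg _)

theorem L2T.zero : L2T μ l (fun _ _ => 0) (fun _ => 0) := L2T.const MemLp.zero

theorem L2T.sub (h : L2T μ l u v) (h' : L2T μ l u' v') :
    L2T μ l (fun k x => u k x - u' k x) (fun x => v x - v' x) := by
  have := h.add (h'.mul_left (g := fun _ => -1) aestronglyMeasurable_const (C := 1) (by simp))
  simpa [sub_eq_add_neg] using this

theorem L2T.sum {κ : Type*} (s : Finset κ) {u : κ → ι → α → ℂ} {v : κ → α → ℂ}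
    (h : ∀ j ∈ s, L2T μ l (u j) (v j)) :
    L2T μ l (fun k x => ∑ j ∈ s, u j k x) (fun x => ∑ j ∈ s, v j x) := by
  classical
  induction s using Finset.induction_on with
  | empty => simpa using L2T.zero
  | insert a s ha ih =>
    simp only [Finset.sum_insert ha]
    exact (h a (by simp)).add (ih fun j hj => h j (by simp [hj]))

theorem L2T.integral_mul_conj (h : L2T μ l u v) (h' : L2T μ l u' v') :
    Tendsto (fun k => ∫ x, u k x * conj (u' k x) ∂μ) l (𝓝 (∫ x, v x * conj (v' x) ∂μ)) := by
  have key : ∀ {a b : α → ℂ} (ha : MemLp a 2 μ) (hb : MemLp b 2 μ),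
      ∫ x, a x * conj (b x) ∂μ = inner ℂ (hb.toLp b) (ha.toLp a) := fun ha hb => by
    rw [L2.inner_def]
    refine integral_congr_ae ?_
    filter_upwards [ha.coeFn_toLp, hb.coeFn_toLp] with x h1 h2
    rw [h1, h2]
    simp
  have hc : ∀ {u : ι → α → ℂ} {v : α → ℂ} (h : L2T μ l u v),
      Tendsto (fun k => (h.mem k).toLp (u k)) l (𝓝 (h.mem'.toLp v)) := fun {u v} h => by
    rw [Lp.tendsto_Lp_iff_tendsto_eLpNorm'' _ h.mem]
    exact h.tendsto
  rw [key h.mem' h'.mem']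
  simp only [fun k => key (h.mem k) (h'.mem k)]
  exact (hc h').inner (hc h)

theorem L2T.integral_norm_sq_mul (h : L2T μ l u v) {g : α → ℝ} (hg : AEStronglyMeasurable g μ)
    {C : ℝ} (hC : ∀ x, ‖g x‖ ≤ C) :
    Tendsto (fun k => ∫ x, ‖u k x‖ ^ 2 * g x ∂μ) l (𝓝 (∫ x, ‖v x‖ ^ 2 * g x ∂μ)) := by
  have h1 := (h.mul_left (g := fun x => (g x : ℂ))
    (Complex.continuous_ofReal.comp_aestronglyMeasurable hg)
    (C := C) (by simpa using hC)).integral_mul_conj h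
  have e : ∀ w : α → ℂ, ∫ x, (g x : ℂ) * w x * conj (w x) ∂μ =
      ((∫ x, ‖w x‖ ^ 2 * g x ∂μ : ℝ) : ℂ) := fun w => by
    refine Eq.trans ?_ integral_ofReal
    congr 1
    ext x
    rw [mul_assoc, Complex.mul_conj, Complex.normSq_eq_norm_sq]
    push_cast
    exact mul_comm _ _
  simp only [e] at h1
  exact (Complex.continuous_re.tendsto _).comp h1

end LTwo

section BKWeak

variable {n : ℕ}

/-- The Bochner–Kodaira inequality for compactly supported square integrable forms with square
integrable distributional derivatives. -/
theorem bochner_kodaira_weak {r : (Fin n → ℂ) → ℝ} (hr : ContDiff ℝ ∞ r)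
    (hrc : HasCompactSupport r) {K : Set (Fin n → ℂ)} (hK : IsCompact K)
    {f : Fin n → (Fin n → ℂ) → ℂ} {B : (Fin n → ℂ) → ℂ} {W : Fin n → Fin n → (Fin n → ℂ) → ℂ}
    (hf : ∀ j, MemLp (f j) 2 volume) (hB : MemLp B 2 volume) (hW : ∀ j k, MemLp (W j k) 2 volume)
    (hfK : ∀ j, ∀ x ∉ K, f j x = 0)
    (hdiv : ∀ θ, IsTest univ θ → ∑ j, ∫ x, f j x * wderiv j θ x = -∫ x, B x * θ x)
    (hcl : ∀ j k θ, IsTest univ θ → (∫ x, f k x * wderivBar j θ x) - ∫ x, f j x * wderivBar k θ x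
      = -∫ x, W j k x * θ x) :
    ∫ x, leviForm r x (fun j => f j x) * Real.exp (-r x) ≤
      (∫ x, ‖B x - ∑ j, f j x * wderiv j (fun y => (r y : ℂ)) x‖ ^ 2 * Real.exp (-r x)) +
      ∑ j, ∑ k, ∫ x, ‖W j k x‖ ^ 2 * (2⁻¹ * Real.exp (-r x)) := by
  obtain ⟨M, hM⟩ := hrc.exists_bound_of_continuous hr.continuous
  have hE : Continuous fun x => Real.exp (-r x) := Real.continuous_exp.comp hr.continuous.neg
  have hEb : ∀ x, ‖Real.exp (-r x)‖ ≤ Real.exp M := fun x => by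
    rw [Real.norm_of_nonneg (Real.exp_pos _).le]
    exact Real.exp_le_exp.2 ((neg_le_abs _).trans (hM x))
  have hEb' : ∀ x, ‖2⁻¹ * Real.exp (-r x)‖ ≤ 2⁻¹ * Real.exp M := fun x => by
    rw [norm_mul, norm_inv, Real.norm_ofNat]
    exact mul_le_mul_of_nonneg_left (hEb x) (by norm_num)
  have hrT : IsTest univ (fun y => (r y : ℂ)) :=
    ⟨Complex.ofRealCLM.contDiff.comp hr, hrc.comp_left Complex.ofReal_zero, subset_univ _⟩
  have hbd : ∀ {g : (Fin n → ℂ) → ℂ}, IsTest univ g → ∃ C, ∀ x, ‖g x‖ ≤ C := fun hg =>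
    hg.compact.exists_bound_of_continuous hg.continuous
  choose ρ hρ using fun k : ℕ => exists_isMoll (n := n) (ε := 1 / (k + 1 : ℝ)) (by positivity)
  have hL : ∀ {u : (Fin n → ℂ) → ℂ}, MemLp u 2 volume →
      L2T volume atTop (fun k => mol (ρ k) u) u := fun hu =>
    ⟨fun k => (hρ k).memLp_mol hu, hu,
      tendsto_eLpNorm_mol_sub hu tendsto_one_div_add_atTop_nhds_zero_nat hρ⟩
  have hloc : ∀ j, LocallyIntegrable (f j) := fun j => (hf j).locallyIntegrable one_le_two
  have htest : ∀ k j, IsTest univ (mol (ρ k) (f j)) := fun k j => by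
    refine ⟨(hρ k).mol_contDiff (hloc j), ?_, subset_univ _⟩
    refine HasCompactSupport.intro (hK.cthickening (r := 1 / (k + 1 : ℝ))) fun x hx => ?_
    refine (hρ k).mol_eq_zero fun y hy => hfK j y fun hyK => hx ?_
    exact mem_cthickening_of_dist_le x y _ K hyK (by rw [dist_comm]; exact (mem_ball.1 hy).le)
  have hdivk : ∀ k x, ∑ j, wderiv j (mol (ρ k) (f j)) x = mol (ρ k) B x := fun k x => by
    simp only [wderiv_eq_dop]
    exact (hρ k).sum_dop_mol Finset.univ _ _ (fun j _ => hloc j) fun ht => hdiv _ ht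
  have hclk : ∀ k j l x, wderivBar j (mol (ρ k) (f l)) x - wderivBar l (mol (ρ k) (f j)) x =
      mol (ρ k) (W j l) x := fun k j l x => by
    have ht : IsTest univ (fun y => (ρ k (x - y) : ℂ)) := (hρ k).isTest x (subset_univ _)
    have := hcl j l _ ht
    rw [wderivBar_eq_dop, wderivBar_eq_dop, (hρ k).dop_mol (hloc l), (hρ k).dop_mol (hloc j),
      mol_eq_swap, ← wderivBar_eq_dop, ← wderivBar_eq_dop]
    linear_combination -this
  have hBK := fun k => bochner_kodaira (r := r) isOpen_univ hr.contDiffOn _ (htest k)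
  have l1 : Tendsto (fun k => ∫ x, leviForm r x (fun j => mol (ρ k) (f j) x) * Real.exp (-r x))
      atTop (𝓝 (∫ x, leviForm r x (fun j => f j x) * Real.exp (-r x))) := by
    have hbdE : ∀ j l, ∃ C, ∀ x, ‖wderiv j (wderivBar l fun y => (r y : ℂ)) x * expW r x‖ ≤ C :=
      fun j l => by
      obtain ⟨C, hC⟩ := hbd ((hrT.wderivBar l).wderiv j)
      refine ⟨C * Real.exp M, fun x => ?_⟩
      rw [norm_mul, expW, Complex.norm_real]
      exact mul_le_mul (hC x) (hEb x) (norm_nonneg _) ((norm_nonneg _).trans (hC x))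
    have hcE : ∀ j l, Continuous fun x =>
        wderiv j (wderivBar l fun y => (r y : ℂ)) x * expW r x := fun j l =>
      ((hrT.wderivBar l).wderiv j).continuous.mul (Complex.continuous_ofReal.comp hE)
    have key : ∀ g : Fin n → (Fin n → ℂ) → ℂ, (∀ j, MemLp (g j) 2 volume) →
        ∫ x, leviForm r x (fun j => g j x) * Real.exp (-r x) =
        (∑ j, ∑ l, ∫ x, (wderiv j (wderivBar l fun y => (r y : ℂ)) x * expW r x * g j x) *
          conj (g l x)).re := fun g hg => by
      have hi : ∀ j l, Integrable fun x => (wderiv j (wderivBar l fun y => (r y : ℂ)) x *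
          expW r x * g j x) * conj (g l x) := fun j l => by
        obtain ⟨C, hC⟩ := hbdE j l
        have h1 := ((L2T.const (l := (atTop : Filter ℕ)) (hg j)).mul_left
          (hcE j l).aestronglyMeasurable hC).mem'
        exact h1.integrable_mul (hg l).star
      rw [← Finset.sum_congr rfl fun j _ => integral_finsetSum _ fun l _ => hi j l,
        ← integral_finsetSum _ fun j _ => integrable_finsetSum _ fun l _ => hi j l,
        ← RCLike.re_eq_complex_re, ← integral_re (integrable_finsetSum _ fun j _ =>
          integrable_finsetSum _ fun l _ => hi j l)]
      congr 1
      ext x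
      rw [leviForm, ← Complex.re_mul_ofReal, Finset.sum_mul]
      simp only [Finset.sum_mul, expW, RCLike.re_eq_complex_re]
      congr 1
      refine Finset.sum_congr rfl fun j _ => Finset.sum_congr rfl fun l _ => ?_
      ring
    rw [key f hf]
    simp only [fun k => key _ fun j => (hρ k).memLp_mol (hf j)]
    refine (Complex.continuous_re.tendsto _).comp
      (tendsto_finsetSum _ fun j _ => tendsto_finsetSum _ fun l _ => ?_)
    obtain ⟨C, hC⟩ := hbdE j l
    exact ((hL (hf j)).mul_left (hcE j l).aestronglyMeasurable hC).integral_mul_conj (hL (hf l))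
  have l2 : Tendsto (fun k => ∫ x, ‖∑ j, twist r j (mol (ρ k) (f j)) x‖ ^ 2 * Real.exp (-r x))
      atTop (𝓝 (∫ x, ‖B x - ∑ j, f j x * wderiv j (fun y => (r y : ℂ)) x‖ ^ 2 *
        Real.exp (-r x))) := by
    have e : ∀ k x, ∑ j, twist r j (mol (ρ k) (f j)) x = mol (ρ k) B x -
        ∑ j, wderiv j (fun y => (r y : ℂ)) x * mol (ρ k) (f j) x := fun k x => by
      simp only [twist, Finset.sum_sub_distrib, hdivk]
      simp only [mul_comm]
    simp only [e]
    simp only [mul_comm (f _ _)]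
    refine L2T.integral_norm_sq_mul ((hL hB).sub (L2T.sum _ fun j _ => ?_))
      hE.aestronglyMeasurable hEb
    obtain ⟨C, hC⟩ := hbd (hrT.wderiv j)
    exact (hL (hf j)).mul_left (hrT.wderiv j).continuous.aestronglyMeasurable hC
  have l3 : Tendsto (fun k => ∫ x, 2⁻¹ * (∑ j, ∑ l, ‖wderivBar j (mol (ρ k) (f l)) x -
      wderivBar l (mol (ρ k) (f j)) x‖ ^ 2) * Real.exp (-r x)) atTop
      (𝓝 (∑ j, ∑ k, ∫ x, ‖W j k x‖ ^ 2 * (2⁻¹ * Real.exp (-r x)))) := by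
    have e : ∀ k, ∫ x, 2⁻¹ * (∑ j, ∑ l, ‖wderivBar j (mol (ρ k) (f l)) x -
        wderivBar l (mol (ρ k) (f j)) x‖ ^ 2) * Real.exp (-r x) =
        ∑ j, ∑ l, ∫ x, ‖mol (ρ k) (W j l) x‖ ^ 2 * (2⁻¹ * Real.exp (-r x)) := fun k => by
      have hi : ∀ j l, Integrable fun x =>
          ‖mol (ρ k) (W j l) x‖ ^ 2 * (2⁻¹ * Real.exp (-r x)) := fun j l =>
        (((hρ k).memLp_mol (hW j l)).integrable_norm_pow two_ne_zero).mul_bdd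
          (continuous_const.mul hE).aestronglyMeasurable (Eventually.of_forall hEb')
      rw [← Finset.sum_congr rfl fun j _ => integral_finsetSum _ fun l _ => hi j l,
        ← integral_finsetSum _ fun j _ => integrable_finsetSum _ fun l _ => hi j l]
      congr 1
      ext x
      simp only [hclk, Finset.mul_sum, Finset.sum_mul]
      refine Finset.sum_congr rfl fun j _ => Finset.sum_congr rfl fun l _ => ?_
      ring
    simp only [e]
    exact tendsto_finsetSum _ fun j _ => tendsto_finsetSum _ fun l _ =>
      (hL (hW j l)).integral_norm_sq_mul (continuous_const.mul hE).aestronglyMeasurable hEb'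
  exact le_of_tendsto_of_tendsto' l1 (l2.add l3) hBK

end BKWeak

section HilbertTools

/-- Solvability of a dual problem in a Hilbert space from an a priori estimate. -/
theorem exists_inner_eq_of_norm_le {X H : Type*} [AddCommGroup X] [Module ℂ X]
    [NormedAddCommGroup H] [InnerProductSpace ℂ H] [CompleteSpace H] (T : X →ₗ[ℂ] H)
    (L : X →ₗ[ℂ] ℂ) {C : ℝ} (hC : 0 ≤ C) (h : ∀ x, ‖L x‖ ≤ C * ‖T x‖) :
    ∃ v : H, ‖v‖ ≤ C ∧ ∀ x, L x = inner ℂ v (T x) := by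
  have hker : LinearMap.ker T ≤ LinearMap.ker L := fun x hx => by
    have := h x
    rw [LinearMap.mem_ker.1 hx, norm_zero, mul_zero] at this
    simpa using this
  obtain ⟨g, hg⟩ : ∃ g : LinearMap.range T →ₗ[ℂ] ℂ, ∀ x, g ⟨T x, x, rfl⟩ = L x := by
    refine ⟨(LinearMap.ker T).liftQ L hker ∘ₗ T.quotKerEquivRange.symm.toLinearMap, fun x => ?_⟩
    have : T.quotKerEquivRange.symm ⟨T x, x, rfl⟩ = (LinearMap.ker T).mkQ x := by
      rw [LinearEquiv.symm_apply_eq]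
      ext
      simp
    simp only [LinearMap.comp_apply, LinearEquiv.coe_coe, this]
    simp
  have hgb : ∀ y, ‖g y‖ ≤ C * ‖y‖ := by
    rintro ⟨_, x, rfl⟩
    rw [hg]
    exact h x
  obtain ⟨G, hG, hGn⟩ := exists_extension_norm_eq _ (g.mkContinuous C hgb)
  refine ⟨(InnerProductSpace.toDual ℂ H).symm G, ?_, fun x => ?_⟩
  · rw [LinearIsometryEquiv.norm_map, hGn]
    exact LinearMap.mkContinuous_norm_le _ hC _
  · rw [InnerProductSpace.toDual_symm_apply, ← hg]
    exact (hG ⟨T x, x, rfl⟩).symm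

variable {α : Type*} [MeasurableSpace α] {μ : Measure α}

theorem integral_mul_conj_eq_inner {a b : α → ℂ} (ha : MemLp a 2 μ) (hb : MemLp b 2 μ) :
    ∫ x, a x * conj (b x) ∂μ = inner ℂ (hb.toLp b) (ha.toLp a) := by
  rw [L2.inner_def]
  refine integral_congr_ae ?_
  filter_upwards [ha.coeFn_toLp, hb.coeFn_toLp] with x h1 h2
  rw [h1, h2]
  simp

/-- Weak compactness of bounded sets in `L²`, along ultrafilters. -/
theorem exists_weak_limit {ι : Type*} (𝒰 : Ultrafilter ι) {u : ι → α → ℂ} {M : ℝ} (hM : 0 ≤ M)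
    (hu : ∀ k, MemLp (u k) 2 μ) (hb : ∀ k, eLpNorm (u k) 2 μ ≤ ENNReal.ofReal M) :
    ∃ v, MemLp v 2 μ ∧ eLpNorm v 2 μ ≤ ENNReal.ofReal M ∧ ∀ θ, MemLp θ 2 μ →
      Tendsto (fun k => ∫ x, u k x * θ x ∂μ) 𝒰 (𝓝 (∫ x, v x * θ x ∂μ)) := by
  have hn : ∀ k, ‖(hu k).toLp (u k)‖ ≤ M := fun k => by
    rw [Lp.norm_toLp]
    exact ENNReal.toReal_le_of_le_ofReal hM (hb k)
  set Λ : ι → WeakDual ℂ (Lp ℂ 2 μ) := fun k =>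
    StrongDual.toWeakDual (InnerProductSpace.toDual ℂ _ ((hu k).toLp (u k))) with hΛ
  have hc := WeakDual.isCompact_closedBall (𝕜 := ℂ) (0 : StrongDual ℂ (Lp ℂ 2 μ)) M
  have hmem : ∀ k, Λ k ∈ (WeakDual.toStrongDual (𝕜 := ℂ) (E := Lp ℂ 2 μ)) ⁻¹' closedBall (0 : StrongDual ℂ (Lp ℂ 2 μ)) M :=
    fun k => by
    simp only [mem_preimage, mem_closedBall, dist_zero_right]
    refine le_trans (le_of_eq ?_) (hn k)
    exact LinearIsometryEquiv.norm_map (InnerProductSpace.toDual ℂ (Lp ℂ 2 μ)) _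
  obtain ⟨ℓ, hℓ, hlim⟩ := hc.ultrafilter_le_nhds (𝒰.map Λ)
    (by
      rw [le_principal_iff]
      exact Filter.mem_map.2 (Filter.univ_mem' hmem))
  set v : Lp ℂ 2 μ := (InnerProductSpace.toDual ℂ _).symm (WeakDual.toStrongDual ℓ) with hv
  have hvn : ‖v‖ ≤ M := by
    rw [hv, LinearIsometryEquiv.norm_map]
    simpa using hℓ
  have hT : ∀ y : Lp ℂ 2 μ, Tendsto (fun k => inner ℂ ((hu k).toLp (u k)) y) 𝒰
      (𝓝 (inner ℂ v y)) := fun y => by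
    have h1 : Tendsto Λ 𝒰 (𝓝 ℓ) := hlim
    have h2 := ((WeakDual.eval_continuous y).tendsto ℓ).comp h1
    rw [hv, InnerProductSpace.toDual_symm_apply]
    exact h2
  refine ⟨v, Lp.memLp v, ?_, fun θ hθ => ?_⟩
  · rw [← ENNReal.ofReal_toReal (Lp.memLp v).2.ne]
    exact ENNReal.ofReal_le_ofReal (by rwa [← Lp.norm_def])
  · have hθ' : MemLp (fun x => conj (θ x)) 2 μ := hθ.star
    have h3 := (Complex.continuous_conj.tendsto _).comp (hT (hθ'.toLp _))
    have e : ∀ {w : α → ℂ} (hw : MemLp w 2 μ), ∫ x, w x * θ x ∂μ =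
        conj (inner ℂ (hw.toLp w) (hθ'.toLp _)) := fun {w} hw => by
      rw [inner_conj_symm, ← integral_mul_conj_eq_inner hw hθ']
      simp
    rw [e (Lp.memLp v), Lp.toLp_coeFn]
    simp only [fun k => e (hu k)]
    exact h3

end HilbertTools

section Decomposition

theorem exists_orthogonal_part {ι H : Type*} [NormedAddCommGroup H] [InnerProductSpace ℂ H]
    [CompleteSpace H] (y : ι → H) (F : H) :
    ∃ G : H, (∀ i, inner ℂ (y i) G = 0) ∧
      ∀ b, (∀ i, inner ℂ (y i) b = 0) → inner ℂ G b = inner ℂ F b := by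
  set Y := Submodule.span ℂ (range y)
  have hmem : ∀ b, (∀ i, inner ℂ (y i) b = 0) → b ∈ Yᗮ := fun b hb => by
    rw [Submodule.mem_orthogonal']
    intro u hu
    induction hu using Submodule.span_induction with
    | mem x hx => obtain ⟨i, rfl⟩ := hx; rw [← inner_conj_symm, hb, map_zero]
    | zero => simp
    | add x z _ _ h1 h2 => rw [inner_add_right, h1, h2, add_zero]
    | smul c x _ h1 => rw [inner_smul_right, h1, mul_zero]
  refine ⟨Yᗮ.starProjection F, fun i => ?_, fun b hb => ?_⟩
  · exact (Submodule.mem_orthogonal _ _).1 (Yᗮ.starProjection_apply_mem F) _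
      (Submodule.subset_span ⟨i, rfl⟩)
  · have h := Submodule.inner_left_of_mem_orthogonal (hmem b hb)
      (Yᗮ.sub_starProjection_mem_orthogonal F)
    rw [inner_sub_left, sub_eq_zero] at h
    exact h.symm

variable {n : ℕ} {Ω : Set (Fin n → ℂ)}

theorem exists_closed_part (hΩ : IsOpen Ω) {g : (Fin n → ℂ) → ℝ} (hg : ContDiffOn ℝ ∞ g Ω)
    {p : Fin n → (Fin n → ℂ) → ℂ} (hp : ∀ j, IsTest Ω (p j)) :
    ∃ F : Fin n → (Fin n → ℂ) → ℂ, (∀ j, MemLp (F j) 2 volume) ∧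
      (∀ j k θ, IsTest Ω θ →
        ∫ x, F j x * (g x * wderivBar k θ x) = ∫ x, F k x * (g x * wderivBar j θ x)) ∧
      ∀ b : Fin n → (Fin n → ℂ) → ℂ, (∀ j, MemLp (b j) 2 volume) →
        (∀ j k θ, IsTest Ω θ →
          ∫ x, b j x * (g x * wderivBar k θ x) = ∫ x, b k x * (g x * wderivBar j θ x)) →
        ∑ j, ∫ x, b j x * conj (F j x) = ∑ j, ∫ x, b j x * conj (g x * p j x) := by
  have hgp : ∀ {θ}, IsTest Ω θ → MemLp (fun x => (g x : ℂ) * θ x) 2 volume := fun hθ =>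
    (hθ.mul_left hΩ hg.ofReal_comp).memLp 2
  have hgc : ∀ {θ} (k : Fin n), IsTest Ω θ →
      MemLp (fun x => (g x : ℂ) * conj (wderivBar k θ x)) 2 volume := fun k hθ =>
    hgp (hθ.wderivBar k).conj
  set I := {q : Fin n × Fin n × ((Fin n → ℂ) → ℂ) // IsTest Ω q.2.2}
  set y : I → PiLp 2 (fun _ : Fin n => Lp ℂ 2 (volume : Measure (Fin n → ℂ))) := fun q =>
    PiLp.single 2 q.1.1 ((hgc q.1.2.1 q.2).toLp _) - PiLp.single 2 q.1.2.1 ((hgc q.1.1 q.2).toLp _)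
  have hin : ∀ {b : Fin n → (Fin n → ℂ) → ℂ} (hb : ∀ j, MemLp (b j) 2 volume) (q : I),
      inner ℂ (y q) (WithLp.toLp 2 fun j => (hb j).toLp (b j)) =
      (∫ x, b q.1.1 x * (g x * wderivBar q.1.2.1 q.1.2.2 x)) -
        ∫ x, b q.1.2.1 x * (g x * wderivBar q.1.1 q.1.2.2 x) := fun {b} hb q => by
    have hs : ∀ (j : Fin n) (a : Lp ℂ 2 (volume : Measure (Fin n → ℂ)))
        (z : PiLp 2 (fun _ : Fin n => Lp ℂ 2 (volume : Measure (Fin n → ℂ)))),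
        inner ℂ (PiLp.single 2 j a) z = inner ℂ a (z j) := fun j a z => by
      rw [PiLp.inner_apply, Finset.sum_eq_single j]
      · rw [PiLp.single_eq_same]
      · intro i _ hi
        rw [PiLp.single_eq_of_ne _ hi, inner_zero_left]
      · simp
    rw [inner_sub_left, hs, hs, ← integral_mul_conj_eq_inner, ← integral_mul_conj_eq_inner]
    simp
  have hio : ∀ {a b : Fin n → (Fin n → ℂ) → ℂ} (ha : ∀ j, MemLp (a j) 2 volume)
      (hb : ∀ j, MemLp (b j) 2 volume),
      inner ℂ (WithLp.toLp 2 fun j => (ha j).toLp (a j) :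
        PiLp 2 (fun _ : Fin n => Lp ℂ 2 (volume : Measure (Fin n → ℂ))))
        (WithLp.toLp 2 fun j => (hb j).toLp (b j)) = ∑ j, ∫ x, b j x * conj (a j x) :=
    fun ha hb => by
    rw [PiLp.inner_apply]
    exact Finset.sum_congr rfl fun j _ => (integral_mul_conj_eq_inner (hb j) (ha j)).symm
  obtain ⟨G, hG1, hG2⟩ := exists_orthogonal_part y
    (WithLp.toLp 2 fun j => (hgp (hp j)).toLp _)
  have hGe : G = WithLp.toLp 2 fun j => (Lp.memLp (G j)).toLp (G j) := by
    ext j : 1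
    simp
  refine ⟨fun j => G j, fun j => Lp.memLp (G j), fun j k θ hθ => ?_, fun b hb h => ?_⟩
  · have := hG1 ⟨(j, k, θ), hθ⟩
    rw [hGe, hin] at this
    exact sub_eq_zero.1 this
  · have := hG2 (WithLp.toLp 2 fun j => (hb j).toLp (b j)) fun q => by
      rw [hin hb, sub_eq_zero]
      exact h _ _ _ q.2
    rw [hGe, hio, hio] at this
    exact this

end Decomposition

section LeviAlgebra

variable {n : ℕ} {Ω K : Set (Fin n → ℂ)} {x : Fin n → ℂ}

open scoped Manifold in
theorem exists_cutoff (hK : IsCompact K) (hΩ : IsOpen Ω) (hKΩ : K ⊆ Ω) :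
    ∃ χ : (Fin n → ℂ) → ℝ, ContDiff ℝ ∞ χ ∧ HasCompactSupport χ ∧ tsupport χ ⊆ Ω ∧
      (∀ x, χ x ∈ Icc (0 : ℝ) 1) ∧ ∀ x ∈ K, χ =ᶠ[𝓝 x] fun _ => 1 := by
  obtain ⟨L, hL, hKL, hLΩ⟩ := exists_compact_between hK hΩ hKΩ
  obtain ⟨f, hf1, hf0, hf⟩ := exists_contMDiffMap_one_nhds_of_subset_interior
    (n := (⊤ : ℕ∞)) 𝓘(ℝ, Fin n → ℂ) hK.isClosed hKL
  have hs : tsupport f ⊆ L := closure_minimal (fun x hx => by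
    by_contra h; exact hx (hf0 x h)) hL.isClosed
  exact ⟨f, f.contMDiff.contDiff, hL.of_isClosed_subset (isClosed_tsupport _) hs, hs.trans hLΩ, hf,
    fun x hx => eventually_nhdsSet_iff_forall.1 hf1 x hx⟩

theorem eventuallyEq_dop {v w : Fin n → ℂ} {u g : (Fin n → ℂ) → ℂ} (h : u =ᶠ[𝓝 x] g) :
    dop v w u =ᶠ[𝓝 x] dop v w g :=
  h.eventually_nhds.mono fun _ hy => dop_congr hy

theorem leviForm_congr {r s : (Fin n → ℂ) → ℝ} (h : r =ᶠ[𝓝 x] s) (ξ : Fin n → ℂ) :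
    leviForm r x ξ = leviForm s x ξ := by
  have h1 : (fun y => (r y : ℂ)) =ᶠ[𝓝 x] fun y => (s y : ℂ) := h.mono fun y hy => by simp [hy]
  have : ∀ μ ν, wderiv μ (wderivBar ν fun y => (r y : ℂ)) x =
      wderiv μ (wderivBar ν fun y => (s y : ℂ)) x := fun μ ν => by
    simp only [wderivBar_eq_dop, wderiv_eq_dop]
    exact dop_congr (eventuallyEq_dop h1)
  simp only [leviForm]
  congr 1
  exact Finset.sum_congr rfl fun μ _ => Finset.sum_congr rfl fun ν _ => by rw [this]

theorem leviForm_add_const_mul (hΩ : IsOpen Ω) {r s : (Fin n → ℂ) → ℝ} (hr : ContDiffOn ℝ ∞ r Ω)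
    (hs : ContDiffOn ℝ ∞ s Ω) (c : ℝ) (hx : x ∈ Ω) (ξ : Fin n → ℂ) :
    leviForm (fun y => r y + c * s y) x ξ = leviForm r x ξ + c * leviForm s x ξ := by
  have hd : ∀ {u : (Fin n → ℂ) → ℂ}, ContDiffOn ℝ ∞ u Ω → ∀ y ∈ Ω, DifferentiableAt ℝ u y :=
    fun hu y hy => (hu.contDiffAt (hΩ.mem_nhds hy)).differentiableAt (by simp)
  have h : ∀ μ ν, wderiv μ (wderivBar ν fun y => ((r y + c * s y : ℝ) : ℂ)) x =
      wderiv μ (wderivBar ν fun y => (r y : ℂ)) x +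
        c * wderiv μ (wderivBar ν fun y => (s y : ℂ)) x := fun μ ν => by
    simp only [wderivBar_eq_dop, wderiv_eq_dop]
    have hr' := dop_contDiffOn (v := Pi.single ν 1) (w := -Pi.single ν Complex.I) hΩ hr.ofReal_comp
    have hs' := dop_contDiffOn (v := Pi.single ν 1) (w := -Pi.single ν Complex.I) hΩ hs.ofReal_comp
    rw [dop_congr (g := fun y => dop (Pi.single ν 1) (-Pi.single ν Complex.I)
        (fun y => (r y : ℂ)) y +
        c * dop (Pi.single ν 1) (-Pi.single ν Complex.I) (fun y => (s y : ℂ)) y),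
      dop_add (hd hr' x hx) ((hd hs' x hx).const_mul _), dop_const_mul (hd hs' x hx)]
    filter_upwards [hΩ.mem_nhds hx] with y hy
    push_cast
    rw [dop_add (hd hr.ofReal_comp y hy) ((hd hs.ofReal_comp y hy).const_mul _),
      dop_const_mul (hd hs.ofReal_comp y hy)]
  have e : leviForm (fun y => r y + c * s y) x ξ =
      (∑ μ, ∑ ν, (wderiv μ (wderivBar ν fun y => (r y : ℂ)) x +
        c * wderiv μ (wderivBar ν fun y => (s y : ℂ)) x) * ξ μ * conj (ξ ν)).re := by
    simp only [leviForm]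
    congr 1
    exact Finset.sum_congr rfl fun μ _ => Finset.sum_congr rfl fun ν _ => by rw [← h]
  rw [e, leviForm, leviForm, ← Complex.re_ofReal_mul, ← Complex.add_re]
  congr 1
  simp only [Finset.mul_sum, ← Finset.sum_add_distrib]
  exact Finset.sum_congr rfl fun μ _ => Finset.sum_congr rfl fun ν _ => by ring

theorem leviForm_smul (r : (Fin n → ℂ) → ℝ) (t : ℝ) (ξ : Fin n → ℂ) :
    leviForm r x (fun j => t * ξ j) = t ^ 2 * leviForm r x ξ := by
  rw [leviForm, leviForm, ← Complex.re_ofReal_mul]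
  congr 1
  simp only [Finset.mul_sum, map_mul, Complex.conj_ofReal]
  refine Finset.sum_congr rfl fun μ _ => Finset.sum_congr rfl fun ν _ => ?_
  push_cast
  ring

theorem wderiv_add_const_mul (hΩ : IsOpen Ω) {r s : (Fin n → ℂ) → ℝ} (hr : ContDiffOn ℝ ∞ r Ω)
    (hs : ContDiffOn ℝ ∞ s Ω) (c : ℝ) (hx : x ∈ Ω) (j : Fin n) :
    wderiv j (fun y => ((r y + c * s y : ℝ) : ℂ)) x =
      wderiv j (fun y => (r y : ℂ)) x + c * wderiv j (fun y => (s y : ℂ)) x := by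
  have hd : ∀ {u : (Fin n → ℂ) → ℂ}, ContDiffOn ℝ ∞ u Ω → DifferentiableAt ℝ u x :=
    fun hu => (hu.contDiffAt (hΩ.mem_nhds hx)).differentiableAt (by simp)
  push_cast
  rw [wderiv_eq_dop, dop_add (hd hr.ofReal_comp) ((hd hs.ofReal_comp).const_mul _),
    dop_const_mul (hd hs.ofReal_comp)]
  rfl

end LeviAlgebra

section CoreEstimate

variable {n : ℕ} {Ω S : Set (Fin n → ℂ)} {κ φ : (Fin n → ℂ) → ℝ} {lam : Fin n → ℝ} {c : ℝ}

/-- Weights for the three weight estimate: `κ` satisfies the self bounded gradient condition and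
`φ` is plurisubharmonic, strictly so on `S`. -/
structure CoreWeights (Ω S : Set (Fin n → ℂ)) (κ φ : (Fin n → ℂ) → ℝ) (lam : Fin n → ℝ)
    (c : ℝ) : Prop where
  isOpen : IsOpen Ω
  measS : MeasurableSet S
  smooth : ContDiffOn ℝ ∞ κ Ω
  smooth' : ContDiffOn ℝ ∞ φ Ω
  nonneg : ∀ x ∈ Ω, 0 ≤ κ x
  nonneg' : ∀ x ∈ Ω, 0 ≤ φ x
  levi : ∀ x ∈ Ω, ∀ ξ : Fin n → ℂ,
    ‖∑ j, wderiv j (fun y => (κ y : ℂ)) x * ξ j‖ ^ 2 ≤ leviForm κ x ξ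
  levi' : ∀ x ∈ Ω, ∀ ξ : Fin n → ℂ, 0 ≤ leviForm φ x ξ
  pos : 0 < c
  lam_pos : ∀ j, 0 < lam j
  strict : ∀ x ∈ Ω, x ∈ S → ∀ ξ : Fin n → ℂ, c * ∑ j, lam j * ‖ξ j‖ ^ 2 ≤ leviForm φ x ξ

/-- The reciprocal square root of the middle weight. -/
def midW {n : ℕ} (κ φ : (Fin n → ℂ) → ℝ) (x : Fin n → ℂ) : ℝ := Real.exp ((φ x + 6 * κ x) / 2)

theorem CoreWeights.midW_contDiffOn (h : CoreWeights Ω S κ φ lam c) :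
    ContDiffOn ℝ ∞ (midW κ φ) Ω :=
  ((h.smooth'.add (contDiffOn_const.mul h.smooth)).div_const 2).exp

theorem CoreWeights.dop_midW_sq (h : CoreWeights Ω S κ φ lam c) {v w x : Fin n → ℂ} (hx : x ∈ Ω) :
    dop v w (fun y => ((midW κ φ y ^ 2 : ℝ) : ℂ)) x =
      dop v w (fun y => ((φ y + 6 * κ y : ℝ) : ℂ)) x * (midW κ φ x ^ 2 : ℝ) := by
  have hs : ContDiffOn ℝ ∞ (fun y => -(φ y + 6 * κ y)) Ω :=
    (h.smooth'.add (contDiffOn_const.mul h.smooth)).neg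
  have hd : DifferentiableAt ℝ (fun y => -(φ y + 6 * κ y)) x :=
    (hs.contDiffAt (h.isOpen.mem_nhds hx)).differentiableAt (by simp)
  have e : ∀ y, ((midW κ φ y ^ 2 : ℝ) : ℂ) = expW (fun y => -(φ y + 6 * κ y)) y := fun y => by
    rw [expW, midW, ← Real.exp_nat_mul]
    congr 2
    push_cast
    ring
  simp only [e]
  change dop v w (expW _) x = _
  rw [dop_expW hd]
  congr 1
  push_cast
  rw [dop_neg, neg_neg]

theorem IsTest.memLp_mul {θ f : (Fin n → ℂ) → ℂ} (h : IsTest Ω θ) (hf : MemLp f 2 volume) :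
    MemLp (fun x => θ x * f x) 2 volume := by
  obtain ⟨C, hC⟩ := h.compact.exists_bound_of_continuous h.continuous
  exact ((L2T.const (l := (atTop : Filter ℕ)) hf).mul_left
    h.continuous.aestronglyMeasurable hC).mem'

theorem integrable_leviForm_mul {r : (Fin n → ℂ) → ℝ} (hr : ContDiff ℝ ∞ r)
    (hrc : HasCompactSupport r) {f : Fin n → (Fin n → ℂ) → ℂ} (hf : ∀ j, MemLp (f j) 2 volume) :
    Integrable fun x => leviForm r x (fun j => f j x) * Real.exp (-r x) := by
  have hrT : IsTest univ (fun y => (r y : ℂ)) :=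
    ⟨Complex.ofRealCLM.contDiff.comp hr, hrc.comp_left Complex.ofReal_zero, subset_univ _⟩
  have hi : ∀ j l, Integrable fun x => (expW r x * wderiv j (wderivBar l fun y => (r y : ℂ)) x *
      f j x) * conj (f l x) := fun j l =>
    ((((hrT.wderivBar l).wderiv j).mul_left isOpen_univ
      (expW_contDiffOn hr.contDiffOn)).memLp_mul (hf j)).integrable_mul (hf l).star
  refine (integrable_finsetSum Finset.univ fun j _ =>
    integrable_finsetSum Finset.univ fun l _ => hi j l).re.congr (Eventually.of_forall fun x => ?_)
  simp only [RCLike.re_eq_complex_re]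
  rw [leviForm, ← Complex.re_mul_ofReal, Finset.sum_mul]
  simp only [Finset.sum_mul, expW]
  congr 1
  refine Finset.sum_congr rfl fun j _ => Finset.sum_congr rfl fun l _ => ?_
  ring

theorem core_pointwise {η k p LK : ℝ} (hη : η ∈ Icc (0 : ℝ) 1) (F d a e : Fin n → ℂ) (A : ℂ)
    (he : ‖∑ j, e j * F j‖ ^ 2 ≤ LK) :
    ‖(∑ j, (d j + η * a j) * (Real.exp ((p + 6 * k) / 2) : ℂ) * F j +
        η * (Real.exp ((p + 6 * k) / 2) : ℂ) ^ 2 * A) -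
      ∑ j, (η * (Real.exp ((p + 6 * k) / 2) : ℂ) * F j) * (a j + 2 * e j)‖ ^ 2 *
        Real.exp (-(p + 8 * k)) ≤
      η ^ 2 * Real.exp (-2 * k) * (8 * LK) + 4 * ‖∑ j, d j * F j‖ ^ 2 * Real.exp (-2 * k) +
        4 * (‖A‖ ^ 2 * Real.exp (p + 4 * k)) := by
  set s := Real.exp ((p + 6 * k) / 2) with hs
  have hs0 : 0 < s := Real.exp_pos _
  have h1 : s ^ 2 * Real.exp (-(p + 8 * k)) = Real.exp (-2 * k) := by
    rw [hs, ← Real.exp_nat_mul, ← Real.exp_add]; congr 1; push_cast; ring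
  have h2 : s ^ 4 * Real.exp (-(p + 8 * k)) = Real.exp (p + 4 * k) := by
    rw [hs, ← Real.exp_nat_mul, ← Real.exp_add]; congr 1; push_cast; ring
  have hin : (∑ j, (d j + η * a j) * (s : ℂ) * F j + η * (s : ℂ) ^ 2 * A) -
      ∑ j, (η * (s : ℂ) * F j) * (a j + 2 * e j) =
      s * (∑ j, d j * F j) + η * (s : ℂ) ^ 2 * A - 2 * η * s * ∑ j, e j * F j := by
    simp only [Finset.mul_sum]
    rw [add_sub_right_comm, ← Finset.sum_sub_distrib, add_sub_right_comm,
      ← Finset.sum_sub_distrib]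
    congr 1
    refine Finset.sum_congr rfl fun j _ => ?_
    ring
  rw [hin]
  set X := ‖∑ j, d j * F j‖
  set Y := ‖∑ j, e j * F j‖
  have hb : ‖s * (∑ j, d j * F j) + η * (s : ℂ) ^ 2 * A - 2 * η * s * ∑ j, e j * F j‖ ≤
      s * X + η * s ^ 2 * ‖A‖ + 2 * η * s * Y := by
    refine (norm_sub_le _ _).trans <| add_le_add ((norm_add_le _ _).trans ?_) ?_
    · simp only [norm_mul, Complex.norm_real, norm_pow, Real.norm_of_nonneg hs0.le,
        Real.norm_of_nonneg hη.1]
      exact le_rfl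
    · simp only [norm_mul, Complex.norm_real, Real.norm_of_nonneg hs0.le,
        Real.norm_of_nonneg hη.1, Complex.norm_ofNat]
      exact le_rfl
  have hη2 : η ^ 2 ≤ 1 := by nlinarith [hη.1, hη.2]
  have hsq : ‖s * (∑ j, d j * F j) + η * (s : ℂ) ^ 2 * A - 2 * η * s * ∑ j, e j * F j‖ ^ 2 ≤
      4 * s ^ 2 * X ^ 2 + 4 * s ^ 4 * ‖A‖ ^ 2 + 8 * η ^ 2 * s ^ 2 * LK := by
    have h3 : (s * X + η * s ^ 2 * ‖A‖ + 2 * η * s * Y) ^ 2 ≤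
        4 * s ^ 2 * X ^ 2 + 4 * η ^ 2 * (s ^ 4 * ‖A‖ ^ 2) + 8 * η ^ 2 * s ^ 2 * Y ^ 2 := by
      nlinarith [sq_nonneg (s * X + η * s ^ 2 * ‖A‖ - 2 * η * s * Y),
        sq_nonneg (s * X - η * s ^ 2 * ‖A‖)]
    have h4 : 4 * η ^ 2 * (s ^ 4 * ‖A‖ ^ 2) ≤ 4 * 1 * (s ^ 4 * ‖A‖ ^ 2) := by gcongr
    have h5 : 8 * η ^ 2 * s ^ 2 * Y ^ 2 ≤ 8 * η ^ 2 * s ^ 2 * LK := by gcongr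
    have h6 := pow_le_pow_left₀ (norm_nonneg _) hb 2
    linarith
  refine (mul_le_mul_of_nonneg_right hsq (Real.exp_pos _).le).trans (le_of_eq ?_)
  rw [← h1, ← h2]
  ring

theorem core_cutoff (h : CoreWeights Ω S κ φ lam c) {η : (Fin n → ℂ) → ℝ}
    (hη : IsTest Ω fun x => (η x : ℂ)) (hη1 : ∀ x, η x ∈ Icc (0 : ℝ) 1)
    {F : Fin n → (Fin n → ℂ) → ℂ} {A : (Fin n → ℂ) → ℂ} (hF : ∀ j, MemLp (F j) 2 volume)
    (hA : IsTest Ω A)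
    (hcl : ∀ j k θ, IsTest Ω θ → ∫ x, F j x * (midW κ φ x * wderivBar k θ x) =
      ∫ x, F k x * (midW κ φ x * wderivBar j θ x))
    (hdiv : ∀ θ, IsTest Ω θ →
      ∑ j, ∫ x, (wderiv j θ x * ((midW κ φ x)⁻¹ : ℝ)) * F j x = -∫ x, θ x * A x) :
    c * ∫ x in Ω ∩ S, η x ^ 2 * Real.exp (-2 * κ x) * ∑ j, lam j * ‖F j x‖ ^ 2 ≤
      4 * (∫ x, ‖A x‖ ^ 2 * Real.exp (φ x + 4 * κ x)) +
      ∫ x in Ω, (4 * ‖∑ j, wderiv j (fun y => (η y : ℂ)) x * F j x‖ ^ 2 +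
        2⁻¹ * ∑ j, ∑ k, ‖wderivBar j (fun y => (η y : ℂ)) x * F k x -
          wderivBar k (fun y => (η y : ℂ)) x * F j x‖ ^ 2) * Real.exp (-2 * κ x) := by
  have hΩ := h.isOpen
  set a : Fin n → (Fin n → ℂ) → ℂ := fun j => wderiv j fun y => ((φ y + 6 * κ y : ℝ) : ℂ) with ha
  set σ : (Fin n → ℂ) → ℂ := fun x => (midW κ φ x : ℂ) with hσ
  set dη : Fin n → (Fin n → ℂ) → ℂ := fun j => wderiv j fun y => (η y : ℂ) with hdη
  set bη : Fin n → (Fin n → ℂ) → ℂ := fun j => wderivBar j fun y => (η y : ℂ) with hbη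
  have hσs : ContDiffOn ℝ ∞ σ Ω := h.midW_contDiffOn.ofReal_comp
  have hσ0 : ∀ x, σ x ≠ 0 := fun x => Complex.ofReal_ne_zero.2 (Real.exp_pos _).ne'
  have has : ∀ j, ContDiffOn ℝ ∞ (a j) Ω := fun j =>
    dop_contDiffOn hΩ (h.smooth'.add (contDiffOn_const.mul h.smooth)).ofReal_comp
  have hdηt : ∀ j, IsTest Ω (dη j) := fun j => hη.wderiv j
  have hbηt : ∀ j, IsTest Ω (bη j) := fun j => hη.wderivBar j
  have hf : ∀ j, MemLp (fun x => η x * σ x * F j x) 2 volume := fun j =>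
    ((hη.mul_left hΩ hσs).memLp_mul (hF j)).ae_eq (Eventually.of_forall fun x => by ring)
  set B : (Fin n → ℂ) → ℂ := fun x => ∑ j, (dη j x + η x * a j x) * σ x * F j x +
    η x * σ x ^ 2 * A x with hBdef
  set W : Fin n → Fin n → (Fin n → ℂ) → ℂ := fun j k x =>
    σ x * (bη j x * F k x - bη k x * F j x) with hWdef
  have hB1 : ∀ j, IsTest Ω (fun x => (dη j x + η x * a j x) * σ x) := fun j => by
    have := ((hdηt j).add (hη.mul_left hΩ (has j))).mul_left hΩ hσs
    convert this using 2 with x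
    ring
  have hB2 : IsTest Ω (fun x => η x * σ x ^ 2 * A x) := by
    have := (hA.mul_left hΩ (hη.smooth.contDiffOn)).mul_left hΩ (hσs.pow 2)
    convert this using 2 with x
    ring
  have hB : MemLp B 2 volume :=
    (memLp_finsetSum _ fun j _ => (hB1 j).memLp_mul (hF j)).add (hB2.memLp 2)
  have hW : ∀ j k, MemLp (W j k) 2 volume := fun j k => by
    have h1 := (((hbηt j).mul_left hΩ hσs).memLp_mul (hF k)).sub
      (((hbηt k).mul_left hΩ hσs).memLp_mul (hF j))
    refine h1.ae_eq (Eventually.of_forall fun x => ?_)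
    simp only [hWdef, Pi.sub_apply]
    ring
  obtain ⟨χ, hχs, hχc, hχΩ, -, hχ1⟩ := exists_cutoff (K := tsupport fun x => (η x : ℂ))
    hη.compact hΩ hη.sub
  have hrs : ContDiffOn ℝ ∞ (fun y => φ y + 8 * κ y) Ω :=
    h.smooth'.add (contDiffOn_const.mul h.smooth)
  set r : (Fin n → ℂ) → ℝ := fun y => χ y * (φ y + 8 * κ y) with hr
  have hrsm : ContDiff ℝ ∞ r := by
    refine contDiff_iff_contDiffAt.2 fun z => ?_
    by_cases hz : z ∈ tsupport χ
    · exact hχs.contDiffAt.mul (hrs.contDiffAt (hΩ.mem_nhds (hχΩ hz)))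
    · have : r =ᶠ[𝓝 z] fun _ => 0 := by
        filter_upwards [(notMem_tsupport_iff_eventuallyEq.1 hz)] with y hy
        simp [hr, hy]
      exact contDiffAt_const.congr_of_eventuallyEq this
  have hrc : HasCompactSupport r := hχc.mul_right
  have hreq : ∀ x ∈ tsupport (fun x => (η x : ℂ)), r =ᶠ[𝓝 x] fun y => φ y + 8 * κ y :=
    fun x hx => (hχ1 x hx).mono fun y hy => by simp [hr, hy]
  have hK0 : ∀ x ∉ tsupport (fun x => (η x : ℂ)), η x = 0 := fun x hx => by
    simpa using image_eq_zero_of_notMem_tsupport hx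
  have hdη0 : ∀ x ∉ tsupport (fun x => (η x : ℂ)), ∀ j, dη j x = 0 := fun x hx j =>
    dop_eq_zero_of_notMem_tsupport hx
  have hbη0 : ∀ x ∉ tsupport (fun x => (η x : ℂ)), ∀ j, bη j x = 0 := fun x hx j => by
    rw [hbη]
    simp only [wderivBar_eq_dop]
    exact dop_eq_zero_of_notMem_tsupport hx
  have hdiff : ∀ {u : (Fin n → ℂ) → ℂ}, ContDiffOn ℝ ∞ u Ω → ∀ y ∈ Ω, DifferentiableAt ℝ u y :=
    fun hu y hy => (hu.contDiffAt (hΩ.mem_nhds hy)).differentiableAt (by simp)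
  have hint : ∀ {τ u : (Fin n → ℂ) → ℂ}, IsTest Ω τ → MemLp u 2 volume →
      Integrable fun x => u x * τ x := fun hτ hu =>
    (hτ.mono (subset_univ _)).integrable_mul_left (hu.locallyIntegrable one_le_two)
  have hBK := bochner_kodaira_weak (B := B) (W := W) hrsm hrc (K := tsupport fun x => (η x : ℂ))
    hη.compact hf hB hW (fun j x hx => by simp [hK0 x hx]) ?_ ?_
  · obtain ⟨M, hM⟩ := hrc.exists_bound_of_continuous hrsm.continuous
    have hE : Continuous fun x => Real.exp (-r x) := Real.continuous_exp.comp hrsm.continuous.neg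
    have hEb : ∀ x, ‖Real.exp (-r x)‖ ≤ Real.exp M := fun x => by
      rw [Real.norm_of_nonneg (Real.exp_pos _).le]
      exact Real.exp_le_exp.2 ((neg_le_abs _).trans (hM x))
    have hrT : IsTest univ (fun y => (r y : ℂ)) :=
      ⟨Complex.ofRealCLM.contDiff.comp hrsm, hrc.comp_left Complex.ofReal_zero, subset_univ _⟩
    have hsq : ∀ {u : (Fin n → ℂ) → ℂ}, MemLp u 2 volume → Integrable fun x => ‖u x‖ ^ 2 :=
      fun hu => hu.integrable_norm_pow two_ne_zero
    have hsqE : ∀ {u : (Fin n → ℂ) → ℂ}, MemLp u 2 volume →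
        Integrable fun x => ‖u x‖ ^ 2 * Real.exp (-r x) := fun hu =>
      (hsq hu).mul_bdd hE.aestronglyMeasurable (Eventually.of_forall hEb)
    have iL := integrable_leviForm_mul hrsm hrc hf
    have iX : Integrable fun x => ‖B x - ∑ j, η x * σ x * F j x *
        wderiv j (fun y => (r y : ℂ)) x‖ ^ 2 * Real.exp (-r x) := by
      refine hsqE (hB.sub (memLp_finsetSum _ fun j _ => ?_))
      refine ((hrT.wderiv j).memLp_mul (hf j)).ae_eq (Eventually.of_forall fun x => ?_)
      exact mul_comm _ _
    have iY : ∀ j k, Integrable fun x => ‖W j k x‖ ^ 2 * (2⁻¹ * Real.exp (-r x)) := fun j k =>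
      ((hsqE (hW j k)).const_mul 2⁻¹).congr (Eventually.of_forall fun x => by
        simp only []; ring)
    have hκs : ContDiffOn ℝ ∞ (expW κ) Ω := expW_contDiffOn h.smooth
    have hκn : ∀ x, ‖expW κ x‖ ^ 2 = Real.exp (-2 * κ x) := fun x => by
      rw [expW, Complex.norm_real, Real.norm_of_nonneg (Real.exp_pos _).le, ← Real.exp_nat_mul]
      congr 1
      push_cast
      ring
    have iP : Integrable fun x => η x ^ 2 * Real.exp (-2 * κ x) * ∑ j, lam j * ‖F j x‖ ^ 2 := by
      refine (integrable_finsetSum Finset.univ fun j _ =>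
        (hsq ((hη.mul_left hΩ hκs).memLp_mul (hF j))).const_mul (lam j)).congr
        (Eventually.of_forall fun x => ?_)
      simp only [norm_mul, mul_pow, hκn, Complex.norm_real, Real.norm_eq_abs, sq_abs,
        Finset.mul_sum]
      refine Finset.sum_congr rfl fun j _ => ?_
      ring
    have iA : Integrable fun x => ‖A x‖ ^ 2 * Real.exp (φ x + 4 * κ x) := by
      have hs : ContDiffOn ℝ ∞ (fun y => -((φ y + 4 * κ y) / 2)) Ω :=
        ((h.smooth'.add (contDiffOn_const.mul h.smooth)).div_const 2).neg
      refine (hsq ((hA.mul_left hΩ (expW_contDiffOn hs)).memLp 2)).congr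
        (Eventually.of_forall fun x => ?_)
      simp only [norm_mul, mul_pow, expW, Complex.norm_real,
        Real.norm_of_nonneg (Real.exp_pos _).le, ← Real.exp_nat_mul]
      rw [mul_comm]
      congr 2
      push_cast
      ring
    have iQ : Integrable fun x => (4 * ‖∑ j, dη j x * F j x‖ ^ 2 +
        2⁻¹ * ∑ j, ∑ k, ‖bη j x * F k x - bη k x * F j x‖ ^ 2) * Real.exp (-2 * κ x) := by
      have q1 := (hsq (memLp_finsetSum Finset.univ fun j _ =>
        ((hdηt j).mul_left hΩ hκs).memLp_mul (hF j))).const_mul 4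
      have q2 := (integrable_finsetSum Finset.univ fun j _ => integrable_finsetSum Finset.univ
        fun k _ => hsq ((((hbηt j).mul_left hΩ hκs).memLp_mul (hF k)).sub
          (((hbηt k).mul_left hΩ hκs).memLp_mul (hF j)))).const_mul 2⁻¹
      refine (q1.add q2).congr (Eventually.of_forall fun x => ?_)
      simp only [Pi.add_apply, Pi.sub_apply, mul_assoc, ← Finset.mul_sum, ← mul_sub, norm_mul,
        mul_pow, hκn]
      ring
    have hpt : ∀ x, c * (Ω ∩ S).indicator (fun x => η x ^ 2 * Real.exp (-2 * κ x) *
        ∑ j, lam j * ‖F j x‖ ^ 2) x + ‖B x - ∑ j, η x * σ x * F j x *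
        wderiv j (fun y => (r y : ℂ)) x‖ ^ 2 * Real.exp (-r x) +
        ∑ j, ∑ k, ‖W j k x‖ ^ 2 * (2⁻¹ * Real.exp (-r x)) ≤
        leviForm r x (fun j => η x * σ x * F j x) * Real.exp (-r x) +
        (4 * (‖A x‖ ^ 2 * Real.exp (φ x + 4 * κ x)) +
        Ω.indicator (fun x => (4 * ‖∑ j, dη j x * F j x‖ ^ 2 +
        2⁻¹ * ∑ j, ∑ k, ‖bη j x * F k x - bη k x * F j x‖ ^ 2) * Real.exp (-2 * κ x)) x) := by
      intro x
      by_cases hx : x ∈ tsupport fun x => (η x : ℂ)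
      · have hxΩ : x ∈ Ω := hη.sub hx
        have hre : r x = φ x + 8 * κ x := (hreq x hx).eq_of_nhds
        have hrd : ∀ j, wderiv j (fun y => (r y : ℂ)) x =
            a j x + 2 * wderiv j (fun y => (κ y : ℂ)) x := fun j => by
          have e1 : (fun y => (r y : ℂ)) =ᶠ[𝓝 x]
              fun y => (((φ y + 6 * κ y) + 2 * κ y : ℝ) : ℂ) :=
            (hreq x hx).mono fun y hy => by simp only [hy]; push_cast; ring
          rw [wderiv_eq_dop, dop_congr e1]
          have := wderiv_add_const_mul hΩ (h.smooth'.add (contDiffOn_const.mul h.smooth) :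
            ContDiffOn ℝ ∞ (fun y => φ y + 6 * κ y) Ω) h.smooth 2 hxΩ j
          rw [wderiv_eq_dop] at this
          exact_mod_cast this
        have hlevi : leviForm r x (fun j => η x * σ x * F j x) * Real.exp (-r x) =
            η x ^ 2 * Real.exp (-2 * κ x) * (leviForm φ x (fun j => F j x) +
              8 * leviForm κ x (fun j => F j x)) := by
          have e1 : (fun j => η x * σ x * F j x) =
              fun j => ((η x * midW κ φ x : ℝ) : ℂ) * F j x := by
            ext j; simp only [hσ]; push_cast; ring
          rw [e1, leviForm_smul, leviForm_congr (hreq x hx),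
            leviForm_add_const_mul hΩ h.smooth' h.smooth 8 hxΩ]
          have e2 : midW κ φ x ^ 2 * Real.exp (-r x) = Real.exp (-2 * κ x) := by
            rw [midW, hre, ← Real.exp_nat_mul, ← Real.exp_add]; congr 1; push_cast; ring
          rw [← e2]
          ring
        have hpw := core_pointwise (hη1 x) (k := κ x) (p := φ x) (fun j => F j x)
          (fun j => dη j x) (fun j => a j x) (fun j => wderiv j (fun y => (κ y : ℂ)) x) (A x)
          (h.levi x hxΩ fun j => F j x)
        have hXe : B x - ∑ j, η x * σ x * F j x * wderiv j (fun y => (r y : ℂ)) x =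
            (∑ j, (dη j x + η x * a j x) * (Real.exp ((φ x + 6 * κ x) / 2) : ℂ) * F j x +
            η x * (Real.exp ((φ x + 6 * κ x) / 2) : ℂ) ^ 2 * A x) -
            ∑ j, (η x * (Real.exp ((φ x + 6 * κ x) / 2) : ℂ) * F j x) *
              (a j x + 2 * wderiv j (fun y => (κ y : ℂ)) x) := by
          simp only [hrd, hBdef, hσ, midW]
        rw [hXe, hlevi, indicator_of_mem hxΩ]
        have hYe : ∑ j, ∑ k, ‖W j k x‖ ^ 2 * (2⁻¹ * Real.exp (-r x)) =
            2⁻¹ * (∑ j, ∑ k, ‖bη j x * F k x - bη k x * F j x‖ ^ 2) * Real.exp (-2 * κ x) := by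
          have e2 : ‖σ x‖ ^ 2 * Real.exp (-r x) = Real.exp (-2 * κ x) := by
            rw [hσ]
            simp only [Complex.norm_real, midW, Real.norm_of_nonneg (Real.exp_pos _).le]
            rw [hre, ← Real.exp_nat_mul, ← Real.exp_add]; congr 1; push_cast; ring
          rw [← e2]
          simp only [hWdef, norm_mul, mul_pow, Finset.mul_sum, Finset.sum_mul]
          refine Finset.sum_congr rfl fun j _ => Finset.sum_congr rfl fun k _ => ?_
          ring
        rw [hYe]
        have hP : c * (Ω ∩ S).indicator (fun x => η x ^ 2 * Real.exp (-2 * κ x) *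
            ∑ j, lam j * ‖F j x‖ ^ 2) x ≤
            η x ^ 2 * Real.exp (-2 * κ x) * leviForm φ x (fun j => F j x) := by
          have hw : 0 ≤ η x ^ 2 * Real.exp (-2 * κ x) := by positivity
          by_cases hxS : x ∈ Ω ∩ S
          · rw [indicator_of_mem hxS]
            have := mul_le_mul_of_nonneg_left (h.strict x hxΩ hxS.2 fun j => F j x) hw
            calc _ = _ := by ring
              _ ≤ _ := this
          · rw [indicator_of_notMem hxS, mul_zero]
            exact mul_nonneg hw (h.levi' x hxΩ _)
        rw [← hre] at hpw
        linarith
      · have z1 := hK0 x hx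
        have z2 := hdη0 x hx
        have z3 := hbη0 x hx
        have z4 : leviForm r x (fun j => η x * σ x * F j x) = 0 := by simp [z1, leviForm]
        rw [z4]
        simp only [hBdef, hWdef, z1, z2, z3, indicator]
        simp
        positivity
    have iLHS := ((iP.indicator (hΩ.measurableSet.inter h.measS)).const_mul c).add iX
    have hm := integral_mono (((iP.indicator (hΩ.measurableSet.inter h.measS)).const_mul c).add
      iX |>.add (integrable_finsetSum Finset.univ fun j _ =>
        integrable_finsetSum Finset.univ fun k _ => iY j k))
      (iL.add ((iA.const_mul 4).add (iQ.indicator hΩ.measurableSet))) hpt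
    rw [integral_add' (iLHS) (integrable_finsetSum Finset.univ fun j _ =>
        integrable_finsetSum Finset.univ fun k _ => iY j k), integral_add' ((iP.indicator
        (hΩ.measurableSet.inter h.measS)).const_mul c) iX, integral_add' iL
        ((iA.const_mul 4).add (iQ.indicator hΩ.measurableSet)), integral_add' (iA.const_mul 4)
        (iQ.indicator hΩ.measurableSet), integral_const_mul, integral_const_mul,
        integral_indicator (hΩ.measurableSet.inter h.measS), integral_indicator hΩ.measurableSet,
        integral_finsetSum _ fun j _ => integrable_finsetSum Finset.univ fun k _ => iY j k] at hm
    simp only [fun j => integral_finsetSum Finset.univ fun k _ => iY j k] at hm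
    linarith
  · intro θ hθ
    have hηθ : IsTest Ω fun x => (η x : ℂ) * θ x := by
      have := hη.mul_left hΩ hθ.smooth.contDiffOn
      convert this using 2 with x
      ring
    have hΘ : IsTest Ω fun x => ((midW κ φ x ^ 2 : ℝ) : ℂ) * (η x * θ x) := by
      have := hηθ.mul_left hΩ (hσs.pow 2)
      convert this using 2 with x
      simp [hσ]
    have e := hdiv _ hΘ
    have ep : ∀ j x, wderiv j (fun x => ((midW κ φ x ^ 2 : ℝ) : ℂ) * (η x * θ x)) x *
        ((midW κ φ x)⁻¹ : ℝ) * F j x =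
        F j x * (((dη j x + η x * a j x) * σ x) * θ x) + η x * σ x * F j x * wderiv j θ x :=
      fun j x => by
      by_cases hx : x ∈ Ω
      · have d1 : DifferentiableAt ℝ (fun y => ((midW κ φ y ^ 2 : ℝ) : ℂ)) x :=
          hdiff (by simpa [hσ] using hσs.pow 2) x hx
        have d2 := (hη.differentiable x)
        have d3 := (hθ.differentiable x)
        rw [wderiv_eq_dop, dop_mul d1 (hηθ.differentiable x), dop_mul d2 d3, h.dop_midW_sq hx]
        simp only [← wderiv_eq_dop]
        have := hσ0 x
        simp only [hσ] at this ⊢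
        push_cast
        field_simp
        simp only [hdη, ha]
        push_cast
        ring
      · have hx' : x ∉ tsupport fun x => (η x : ℂ) := fun hh => hx (hη.sub hh)
        rw [wderiv_eq_dop, dop_eq_zero_of_notMem_tsupport fun hh => hx (hΘ.sub hh), hdη0 x hx',
          hK0 x hx']
        simp
    simp only [ep] at e
    have i1 : ∀ j, Integrable fun x => F j x * (((dη j x + η x * a j x) * σ x) * θ x) := fun j =>
      hint (by
        have := (hB1 j).mul_left hΩ hθ.smooth.contDiffOn
        convert this using 2 with x
        ring) (hF j)
    have i2 : ∀ j, Integrable fun x => η x * σ x * F j x * wderiv j θ x := fun j =>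
      (hθ.wderiv j).integrable_mul_left ((hf j).locallyIntegrable one_le_two)
    have i3 : Integrable fun x => η x * σ x ^ 2 * A x * θ x :=
      hθ.integrable_mul_left ((hB2.memLp 2).locallyIntegrable one_le_two)
    simp only [fun j => integral_add (i1 j) (i2 j), Finset.sum_add_distrib] at e
    have e2 : ∫ x, B x * θ x = (∑ j, ∫ x, F j x * (((dη j x + η x * a j x) * σ x) * θ x)) +
        ∫ x, η x * σ x ^ 2 * A x * θ x := by
      rw [← integral_finsetSum _ fun j _ => i1 j, ← integral_add
        (integrable_finsetSum _ fun j _ => i1 j) i3]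
      congr 1
      ext x
      simp only [hBdef, add_mul, Finset.sum_mul]
      congr 1
      refine Finset.sum_congr rfl fun j _ => ?_
      ring
    have e3 : ∫ x, ((midW κ φ x ^ 2 : ℝ) : ℂ) * (η x * θ x) * A x =
        ∫ x, η x * σ x ^ 2 * A x * θ x := by
      congr 1
      ext x
      simp only [hσ]
      push_cast
      ring
    rw [e2]
    rw [e3] at e
    linear_combination e
  · intro j k θ hθ
    have hηθ : IsTest Ω fun x => (η x : ℂ) * θ x := by
      have := hη.mul_left hΩ hθ.smooth.contDiffOn
      convert this using 2 with x
      ring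
    have e := hcl j k _ hηθ
    have ep : ∀ l i x, F l x * (midW κ φ x * wderivBar i (fun x => (η x : ℂ) * θ x) x) =
        F l x * (σ x * bη i x * θ x) + η x * σ x * F l x * wderivBar i θ x := fun l i x => by
      rw [wderivBar_eq_dop, dop_mul (hη.differentiable x) (hθ.differentiable x)]
      simp only [← wderivBar_eq_dop]
      simp only [hσ, hbη]
      ring
    simp only [ep] at e
    have i1 : ∀ l i, Integrable fun x => F l x * (σ x * bη i x * θ x) := fun l i =>
      hint (by
        have := ((hbηt i).mul_left hΩ hσs).mul_left hΩ hθ.smooth.contDiffOn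
        convert this using 2 with x
        ring) (hF l)
    have i2 : ∀ l i, Integrable fun x => η x * σ x * F l x * wderivBar i θ x := fun l i =>
      (hθ.wderivBar i).integrable_mul_left ((hf l).locallyIntegrable one_le_two)
    rw [integral_add (i1 _ _) (i2 _ _), integral_add (i1 _ _) (i2 _ _)] at e
    have e2 : ∫ x, W j k x * θ x = (∫ x, F k x * (σ x * bη j x * θ x)) -
        ∫ x, F j x * (σ x * bη k x * θ x) := by
      rw [← integral_sub (i1 _ _) (i1 _ _)]
      congr 1
      ext x
      simp only [hWdef]
      ring
    rw [e2]
    linear_combination -e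

end CoreEstimate

section CoreLimit

variable {n : ℕ} {Ω S : Set (Fin n → ℂ)} {κ φ : (Fin n → ℂ) → ℝ} {lam : Fin n → ℝ} {c : ℝ}

/-- A sequence of cutoff functions whose gradients are controlled by the weight `κ`. -/
structure CutoffSeq (Ω : Set (Fin n → ℂ)) (κ : (Fin n → ℂ) → ℝ) (η : ℕ → (Fin n → ℂ) → ℝ)
    (M : ℝ) : Prop where
  isTest : ∀ ν, IsTest Ω fun x => (η ν x : ℂ)
  mem : ∀ ν x, η ν x ∈ Icc (0 : ℝ) 1
  eventually : ∀ x ∈ Ω, ∀ᶠ ν in atTop, η ν =ᶠ[𝓝 x] fun _ => 1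
  bound : ∀ ν, ∀ x ∈ Ω, ∀ j, ‖wderivBar j (fun y => (η ν y : ℂ)) x‖ * Real.exp (-κ x) ≤ M

theorem core_estimate (h : CoreWeights Ω S κ φ lam c) {η : ℕ → (Fin n → ℂ) → ℝ} {M : ℝ}
    (hη : CutoffSeq Ω κ η M)
    {F : Fin n → (Fin n → ℂ) → ℂ} {A : (Fin n → ℂ) → ℂ} (hF : ∀ j, MemLp (F j) 2 volume)
    (hA : IsTest Ω A)
    (hcl : ∀ j k θ, IsTest Ω θ → ∫ x, F j x * (midW κ φ x * wderivBar k θ x) =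
      ∫ x, F k x * (midW κ φ x * wderivBar j θ x))
    (hdiv : ∀ θ, IsTest Ω θ →
      ∑ j, ∫ x, (wderiv j θ x * ((midW κ φ x)⁻¹ : ℝ)) * F j x = -∫ x, θ x * A x) :
    IntegrableOn (fun x => Real.exp (-2 * κ x) * ∑ j, lam j * ‖F j x‖ ^ 2) (Ω ∩ S) ∧
    c * ∫ x in Ω ∩ S, Real.exp (-2 * κ x) * ∑ j, lam j * ‖F j x‖ ^ 2 ≤
      4 * (∫ x, ‖A x‖ ^ 2 * Real.exp (φ x + 4 * κ x)) := by
  have hmΩ := h.isOpen.measurableSet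
  have hmS := hmΩ.inter h.measS
  have hexpΩ : ContinuousOn (fun x => Real.exp (-2 * κ x)) Ω :=
    (continuousOn_const.mul h.smooth.continuousOn).rexp
  have hmE : AEStronglyMeasurable (fun x => Real.exp (-2 * κ x)) (volume.restrict Ω) :=
    hexpΩ.aestronglyMeasurable hmΩ
  have hle : ∀ x ∈ Ω, Real.exp (-2 * κ x) ≤ 1 := fun x hx =>
    Real.exp_le_one_iff.2 (by have := h.nonneg x hx; linarith)
  have hFi : Integrable fun x => ∑ j, lam j * ‖F j x‖ ^ 2 :=
    integrable_finsetSum Finset.univ fun j _ => ((hF j).integrable_norm_pow two_ne_zero).const_mul _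
  have hFn : ∀ x, 0 ≤ ∑ j, lam j * ‖F j x‖ ^ 2 := fun x =>
    Finset.sum_nonneg fun j _ => mul_nonneg (h.lam_pos j).le (sq_nonneg _)
  have hmES : AEStronglyMeasurable (fun x => Real.exp (-2 * κ x)) (volume.restrict (Ω ∩ S)) :=
    hmE.mono_measure (Measure.restrict_mono inter_subset_left le_rfl)
  have hmF : AEStronglyMeasurable (fun x => ∑ j, lam j * ‖F j x‖ ^ 2)
      (volume.restrict (Ω ∩ S)) := hFi.1.restrict
  refine ⟨hFi.integrableOn.mono' (hmES.mul hmF) ((ae_restrict_mem hmS).mono fun x hx => ?_), ?_⟩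
  · rw [norm_mul, Real.norm_of_nonneg (Real.exp_pos _).le, Real.norm_of_nonneg (hFn x)]
    exact mul_le_of_le_one_left (hFn x) (hle x hx.1)
  have hT : MemLp (fun x => ∑ j, ‖F j x‖) 2 volume := memLp_finsetSum _ fun j _ => (hF j).norm
  have hT0 : ∀ x, 0 ≤ ∑ j, ‖F j x‖ := fun x => Finset.sum_nonneg fun j _ => norm_nonneg _
  have hTj : ∀ x j, ‖F j x‖ ≤ ∑ j, ‖F j x‖ := fun x j =>
    Finset.single_le_sum (f := fun j => ‖F j x‖) (fun i _ => norm_nonneg _) (Finset.mem_univ j)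
  have hcut := fun ν => core_cutoff h (hη.isTest ν) (hη.mem ν) hF hA hcl hdiv
  have hd : ∀ ν x j, ‖wderiv j (fun y => (η ν y : ℂ)) x‖ =
      ‖wderivBar j (fun y => (η ν y : ℂ)) x‖ := fun ν x j => by
    have : DifferentiableAt ℝ (η ν) x := by
      have := Complex.reCLM.differentiable.comp (hη.isTest ν).differentiable x
      exact this
    rw [wderivBar_real this, Complex.norm_conj]
  have l1 : Tendsto (fun ν => c * ∫ x in Ω ∩ S, η ν x ^ 2 * Real.exp (-2 * κ x) *
      ∑ j, lam j * ‖F j x‖ ^ 2) atTop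
      (𝓝 (c * ∫ x in Ω ∩ S, Real.exp (-2 * κ x) * ∑ j, lam j * ‖F j x‖ ^ 2)) := by
    refine Tendsto.const_mul _ (tendsto_integral_of_dominated_convergence
      (fun x => ∑ j, lam j * ‖F j x‖ ^ 2) (fun ν => ?_) hFi.integrableOn (fun ν => ?_) ?_)
    · have : Continuous fun x => η ν x ^ 2 :=
        (Complex.continuous_re.comp (hη.isTest ν).continuous).pow 2
      exact (this.aestronglyMeasurable.mul hmES).mul hmF
    · refine (ae_restrict_mem hmS).mono fun x hx => ?_
      have h1 := hη.mem ν x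
      have h2 : η ν x ^ 2 ≤ 1 := by nlinarith [h1.1, h1.2]
      rw [Real.norm_of_nonneg (by have := hFn x; positivity)]
      refine mul_le_of_le_one_left (hFn x) (mul_le_one₀ h2 (Real.exp_pos _).le (hle x hx.1))
    · refine (ae_restrict_mem hmS).mono fun x hx => ?_
      refine tendsto_const_nhds.congr' ?_
      filter_upwards [hη.eventually x hx.1] with ν hν
      rw [hν.eq_of_nhds]
      simp
  have l2 : Tendsto (fun ν => ∫ x in Ω, (4 * ‖∑ j, wderiv j (fun y => (η ν y : ℂ)) x * F j x‖ ^ 2 +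
        2⁻¹ * ∑ j, ∑ k, ‖wderivBar j (fun y => (η ν y : ℂ)) x * F k x -
          wderivBar k (fun y => (η ν y : ℂ)) x * F j x‖ ^ 2) * Real.exp (-2 * κ x)) atTop
      (𝓝 (∫ x in Ω, 0)) := by
    refine tendsto_integral_of_dominated_convergence
      (fun x => (4 * M ^ 2 + 2⁻¹ * (n * (n * (4 * M ^ 2)))) * (∑ j, ‖F j x‖) ^ 2) (fun ν => ?_)
      ((hT.integrable_sq.const_mul _).integrableOn) (fun ν => ?_) ?_
    · have m1 : ∀ j, AEStronglyMeasurable (F j) (volume.restrict Ω) := fun j => (hF j).1.restrict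
      have m2 := fun j => ((hη.isTest ν).wderiv j).continuous.aestronglyMeasurable
        (μ := volume.restrict Ω)
      have m3 := fun j => ((hη.isTest ν).wderivBar j).continuous.aestronglyMeasurable
        (μ := volume.restrict Ω)
      refine AEStronglyMeasurable.mul (AEStronglyMeasurable.add
        (aestronglyMeasurable_const.mul ?_) (aestronglyMeasurable_const.mul ?_)) hmE
      · exact (Finset.aestronglyMeasurable_fun_sum _ fun j _ => (m2 j).mul (m1 j)).norm.pow 2
      · exact Finset.aestronglyMeasurable_fun_sum _ fun j _ =>
          Finset.aestronglyMeasurable_fun_sum _ fun k _ =>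
          (((m3 j).mul (m1 k)).sub ((m3 k).mul (m1 j))).norm.pow 2
    · refine (ae_restrict_mem hmΩ).mono fun x hx => ?_
      set e := Real.exp (-κ x)
      have he : 0 < e := Real.exp_pos _
      have he2 : Real.exp (-2 * κ x) = e ^ 2 := by
        rw [← Real.exp_nat_mul]; congr 1; push_cast; ring
      set T := ∑ j, ‖F j x‖
      have hM := fun j => hη.bound ν x hx j
      have hM0 : ∀ j : Fin n, 0 ≤ M := fun j => (by positivity : (0 : ℝ) ≤ _).trans (hM j)
      have b1 : ‖∑ j, wderiv j (fun y => (η ν y : ℂ)) x * F j x‖ * e ≤ M * T := by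
        refine (mul_le_mul_of_nonneg_right (norm_sum_le _ _) he.le).trans ?_
        rw [Finset.sum_mul, Finset.mul_sum]
        refine Finset.sum_le_sum fun j _ => ?_
        rw [norm_mul, hd, mul_right_comm]
        exact mul_le_mul_of_nonneg_right (hM j) (norm_nonneg _)
      have b2 : ∀ j k, ‖wderivBar j (fun y => (η ν y : ℂ)) x * F k x -
          wderivBar k (fun y => (η ν y : ℂ)) x * F j x‖ * e ≤ 2 * (M * T) := fun j k => by
        refine (mul_le_mul_of_nonneg_right (norm_sub_le _ _) he.le).trans ?_
        rw [add_mul, two_mul, norm_mul, norm_mul, mul_right_comm, mul_right_comm ‖wderivBar k _ x‖]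
        exact add_le_add (mul_le_mul (hM j) (hTj x k) (norm_nonneg _) (hM0 j))
          (mul_le_mul (hM k) (hTj x j) (norm_nonneg _) (hM0 k))
      have c1 := pow_le_pow_left₀ (by positivity) b1 2
      have c2 := fun j k => pow_le_pow_left₀ (by positivity) (b2 j k) 2
      have c3 : (∑ j, ∑ k, ‖wderivBar j (fun y => (η ν y : ℂ)) x * F k x -
          wderivBar k (fun y => (η ν y : ℂ)) x * F j x‖ ^ 2) * e ^ 2 ≤
          n * (n * (2 * (M * T)) ^ 2) := by
        simp only [Finset.sum_mul, ← mul_pow]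
        refine (Finset.sum_le_sum fun j _ => Finset.sum_le_sum fun k _ => c2 j k).trans ?_
        simp
      rw [he2, Real.norm_of_nonneg (by positivity), add_mul, mul_assoc, ← mul_pow, mul_assoc]
      linarith
    · refine (ae_restrict_mem hmΩ).mono fun x hx => ?_
      refine tendsto_const_nhds.congr' ?_
      filter_upwards [hη.eventually x hx] with ν hν
      have hc : (fun y => (η ν y : ℂ)) =ᶠ[𝓝 x] fun _ => 1 := hν.mono fun y hy => by simp [hy]
      have h1 : ∀ j, wderiv j (fun y => (η ν y : ℂ)) x = 0 := fun j => by
        rw [wderiv_eq_dop, dop_congr hc, dop_const]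
      have h2 : ∀ j, wderivBar j (fun y => (η ν y : ℂ)) x = 0 := fun j => by
        rw [wderivBar_eq_dop, dop_congr hc, dop_const]
      simp [h1, h2]
  have := le_of_tendsto_of_tendsto' l1 (tendsto_const_nhds.add l2) hcut
  simpa using this

end CoreLimit

section HormanderCore

variable {n : ℕ} {Ω S : Set (Fin n → ℂ)} {κ φ : (Fin n → ℂ) → ℝ} {lam : Fin n → ℝ} {c : ℝ}

theorem sq_le_mul_of_forall_amgm {x a b : ℝ} (hx : 0 ≤ x)
    (h : ∀ t : ℝ, 0 < t → x ≤ 2⁻¹ * (t * a + t⁻¹ * b)) (ha : 0 ≤ a) (hb : 0 ≤ b) :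
    x ^ 2 ≤ a * b := by
  have key : ∀ t : ℝ, 0 ≤ a * (t * t) + (-2 * x) * t + b := fun t => by
    rcases lt_or_ge 0 t with ht | ht
    · have h1 := mul_le_mul_of_nonneg_left (h t ht) (by positivity : 0 ≤ 2 * t)
      have h2 : 2 * t * (2⁻¹ * (t * a + t⁻¹ * b)) = a * (t * t) + b := by field_simp
      linarith
    · have h1 : 0 ≤ x * -t := mul_nonneg hx (by linarith)
      have h2 : 0 ≤ a * (t * t) := mul_nonneg ha (mul_self_nonneg t)
      linarith
  have := discrim_le_zero key
  rw [discrim] at this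
  linarith

theorem integral_wderivBar_symm (hΩ : IsOpen Ω) {a b : (Fin n → ℂ) → ℂ} (j k : Fin n)
    (ha : ContDiffOn ℝ ∞ a Ω) (hb : ContDiffOn ℝ ∞ b Ω)
    (hab : ∀ x ∈ Ω, wderivBar k a x = wderivBar j b x) {θ : (Fin n → ℂ) → ℂ} (hθ : IsTest Ω θ) :
    ∫ x, a x * wderivBar k θ x = ∫ x, b x * wderivBar j θ x := by
  rw [integral_mul_wderivBar hΩ ha hθ, integral_mul_wderivBar hΩ hb hθ]
  congr 2
  ext x
  by_cases hx : x ∈ Ω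
  · rw [hab x hx]
  · rw [hθ.eq_zero hx, mul_zero, mul_zero]

/-- The a priori estimate dual to the solvability of the Cauchy–Riemann equations. -/
theorem dual_estimate (h : CoreWeights Ω S κ φ lam c) {η : ℕ → (Fin n → ℂ) → ℝ} {M : ℝ}
    (hη : CutoffSeq Ω κ η M) {α : Fin n → (Fin n → ℂ) → ℂ}
    (hα : ∀ j, ContDiffOn ℝ ∞ (α j) Ω) (hαS : ∀ j, ∀ x ∈ Ω, x ∉ S → α j x = 0)
    (hαcl : ∀ j k, ∀ x ∈ Ω, wderivBar k (α j) x = wderivBar j (α k) x)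
    (hαL : ∀ j, MemLp (α j) 2 (volume.restrict Ω)) {a : ℝ}
    (ha : ∫ x in Ω, ∑ j, (lam j)⁻¹ * ‖α j x‖ ^ 2 ≤ a)
    {p : Fin n → (Fin n → ℂ) → ℂ} (hp : ∀ j, IsTest Ω (p j)) :
    ‖∑ j, ∫ x in Ω, α j x * conj (p j x)‖ ^ 2 ≤
      (4 * a / c) * ∫ x, ‖∑ j, wderiv j (p j) x‖ ^ 2 * Real.exp (φ x + 4 * κ x) := by
  have hΩ := h.isOpen
  have hσpos : ∀ x, 0 < midW κ φ x := fun x => Real.exp_pos _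
  have hσ0 : ∀ x, (midW κ φ x : ℂ) ≠ 0 := fun x => Complex.ofReal_ne_zero.2 (hσpos x).ne'
  obtain ⟨F, hF, hcl, hii⟩ := exists_closed_part hΩ h.midW_contDiffOn hp
  have hσi : ContDiffOn ℝ ∞ (fun x => (((midW κ φ x)⁻¹ : ℝ) : ℂ)) Ω :=
    (h.midW_contDiffOn.inv fun x _ => (hσpos x).ne').ofReal_comp
  have hA : IsTest Ω fun x => ∑ j, wderiv j (p j) x := IsTest.sum _ fun j _ => (hp j).wderiv j
  have hdiv : ∀ θ, IsTest Ω θ →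
      ∑ j, ∫ x, (wderiv j θ x * ((midW κ φ x)⁻¹ : ℝ)) * F j x =
        -∫ x, θ x * ∑ j, wderiv j (p j) x := fun θ hθ => by
    have hω := hθ.conj
    have hb : ∀ j, MemLp (fun x => (((midW κ φ x)⁻¹ : ℝ) : ℂ) *
        wderivBar j (fun x => conj (θ x)) x) 2 volume := fun j =>
      ((hω.wderivBar j).mul_left hΩ hσi).memLp 2
    have e := hii _ hb fun j k θ' hθ' => by
      have h1 : ∀ i l x, (((midW κ φ x)⁻¹ : ℝ) : ℂ) * wderivBar i (fun x => conj (θ x)) x *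
          (midW κ φ x * wderivBar l θ' x) =
          wderivBar i (fun x => conj (θ x)) x * wderivBar l θ' x := fun i l x => by
        have := hσ0 x
        push_cast
        field_simp
      simp only [h1]
      refine integral_wderivBar_symm hΩ j k (hω.wderivBar j).smooth.contDiffOn
        (hω.wderivBar k).smooth.contDiffOn (fun x _ => ?_) hθ'
      have := dop_comm (n := n) (v := Pi.single k 1) (w := -Pi.single k Complex.I)
        (v' := Pi.single j 1) (w' := -Pi.single j Complex.I) (z := x)
        (hω.smooth.contDiffAt.of_le (WithTop.coe_le_coe.2 le_top))
      simpa only [wderivBar_eq_dop, wderivBar_eq_dop] using this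
    have e1 : ∀ j, ∫ x, (wderiv j θ x * ((midW κ φ x)⁻¹ : ℝ)) * F j x =
        conj (∫ x, (((midW κ φ x)⁻¹ : ℝ) : ℂ) * wderivBar j (fun x => conj (θ x)) x *
          conj (F j x)) := fun j => by
      rw [← integral_conj]
      congr 1
      ext x
      rw [wderivBar_conj j (hθ.differentiable x)]
      simp only [map_mul, Complex.conj_conj, Complex.conj_ofReal]
      ring
    have e2 : ∀ j, ∫ x, (((midW κ φ x)⁻¹ : ℝ) : ℂ) * wderivBar j (fun x => conj (θ x)) x *
          conj (midW κ φ x * p j x) = -conj (∫ x, θ x * wderiv j (p j) x) := fun j => by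
      have := integral_mul_wderivBar isOpen_univ (hp j).conj.smooth.contDiffOn
        (hω.mono (subset_univ _)) j
      rw [← integral_conj]
      refine Eq.trans ?_ (this.trans ?_)
      · congr 1
        ext x
        have := hσ0 x
        simp only [map_mul, Complex.conj_ofReal]
        push_cast
        field_simp
      · congr 2
        ext x
        rw [wderivBar_conj j ((hp j).differentiable x), map_mul, mul_comm]
    simp only [e2, Finset.sum_neg_distrib] at e
    simp only [e1, ← map_sum]
    rw [e, map_neg, ← map_sum, Complex.conj_conj, ← integral_finsetSum _ fun j _ =>
      (((hp j).wderiv j).integrable_mul hΩ hθ.smooth.contDiffOn)]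
    simp only [Finset.mul_sum]
  obtain ⟨hI, hest⟩ := core_estimate h hη hF hA hcl hdiv
  have hmΩ := hΩ.measurableSet
  have hσ1 : ∀ x ∈ Ω, (midW κ φ x)⁻¹ ≤ Real.exp (-κ x) := fun x hx => by
    rw [midW, ← Real.exp_neg]
    exact Real.exp_le_exp.2 (by linarith [h.nonneg x hx, h.nonneg' x hx])
  have hb : ∀ j, MemLp (Ω.indicator fun x => (((midW κ φ x)⁻¹ : ℝ) : ℂ) * α j x) 2 volume :=
    fun j => by
    rw [memLp_indicator_iff_restrict hmΩ]
    refine (hαL j).of_le (hσi.continuousOn.aestronglyMeasurable hmΩ |>.mul (hαL j).1)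
      ((ae_restrict_mem hmΩ).mono fun x hx => ?_)
    rw [norm_mul, Complex.norm_real, Real.norm_of_nonneg (inv_pos.2 (hσpos x)).le]
    exact mul_le_of_le_one_left (norm_nonneg _)
      ((hσ1 x hx).trans (Real.exp_le_one_iff.2 (by linarith [h.nonneg x hx])))
  have e := hii _ hb fun j k θ hθ => by
    have h1 : ∀ i l x, Ω.indicator (fun x => (((midW κ φ x)⁻¹ : ℝ) : ℂ) * α i x) x *
        (midW κ φ x * wderivBar l θ x) = α i x * wderivBar l θ x := fun i l x => by
      by_cases hx : x ∈ Ω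
      · rw [indicator_of_mem hx]
        have := hσ0 x
        push_cast
        field_simp
      · rw [(hθ.wderivBar l).eq_zero hx, mul_zero, mul_zero, mul_zero]
    simp only [h1]
    exact integral_wderivBar_symm hΩ j k (hα j) (hα k) (hαcl j k) hθ
  have e1 : ∀ j, ∫ x, Ω.indicator (fun x => (((midW κ φ x)⁻¹ : ℝ) : ℂ) * α j x) x *
      conj (midW κ φ x * p j x) = ∫ x in Ω, α j x * conj (p j x) := fun j => by
    rw [← integral_indicator hmΩ]
    congr 1
    ext x
    by_cases hx : x ∈ Ω
    · rw [indicator_of_mem hx, indicator_of_mem hx]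
      have := hσ0 x
      simp only [map_mul, Complex.conj_ofReal]
      push_cast
      field_simp
    · rw [indicator_of_notMem hx, indicator_of_notMem hx, zero_mul]
  simp only [e1] at e
  rw [← e]
  set I := ∫ x in Ω ∩ S, Real.exp (-2 * κ x) * ∑ j, lam j * ‖F j x‖ ^ 2 with hIdef
  set N := ∫ x, ‖∑ j, wderiv j (p j) x‖ ^ 2 * Real.exp (φ x + 4 * κ x)
  have hmS := hmΩ.inter h.measS
  have hsq : ∀ j, IntegrableOn (fun x => ‖α j x‖ ^ 2) Ω := fun j =>
    (hαL j).integrable_norm_pow two_ne_zero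
  have ha0 : 0 ≤ a := le_trans (integral_nonneg fun x => Finset.sum_nonneg fun j _ =>
    mul_nonneg (inv_pos.2 (h.lam_pos j)).le (sq_nonneg _)) ha
  have hI0 : 0 ≤ I := integral_nonneg fun x => mul_nonneg (Real.exp_pos _).le
    (Finset.sum_nonneg fun j _ => mul_nonneg (h.lam_pos j).le (sq_nonneg _))
  have hαI0 : IntegrableOn (fun x => ∑ j, (lam j)⁻¹ * ‖α j x‖ ^ 2) Ω :=
    integrable_finsetSum Finset.univ fun j _ => (hsq j).const_mul _
  have hαI := hαI0.mono_set (inter_subset_left (t := S))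
  have haS : ∫ x in Ω ∩ S, ∑ j, (lam j)⁻¹ * ‖α j x‖ ^ 2 ≤ a :=
    (setIntegral_mono_set (integrable_finsetSum Finset.univ fun j _ => (hsq j).const_mul _)
      (Eventually.of_forall fun x => Finset.sum_nonneg fun j _ =>
        mul_nonneg (inv_pos.2 (h.lam_pos j)).le (sq_nonneg _))
      (Eventually.of_forall fun x hx => hx.1)).trans ha
  have key := sq_le_mul_of_forall_amgm (norm_nonneg (∑ j, ∫ x,
    Ω.indicator (fun x => (((midW κ φ x)⁻¹ : ℝ) : ℂ) * α j x) x * conj (F j x)))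
    (a := a) (b := I) (fun t ht => ?_) ha0 hI0
  · refine key.trans ?_
    have : I ≤ 4 / c * N := by
      rw [div_mul_eq_mul_div, le_div_iff₀ h.pos]
      linarith
    calc a * I ≤ a * (4 / c * N) := mul_le_mul_of_nonneg_left this ha0
      _ = _ := by ring
  · have hi : ∀ j, Integrable fun x =>
        Ω.indicator (fun x => (((midW κ φ x)⁻¹ : ℝ) : ℂ) * α j x) x * conj (F j x) := fun j =>
      (hb j).integrable_mul (hF j).star
    rw [← integral_finsetSum _ fun j _ => hi j]
    have hdom : Integrable ((Ω ∩ S).indicator fun x => 2⁻¹ *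
        (t * (∑ j, (lam j)⁻¹ * ‖α j x‖ ^ 2) +
          t⁻¹ * (Real.exp (-2 * κ x) * ∑ j, lam j * ‖F j x‖ ^ 2))) :=
      (integrable_indicator_iff hmS).2
        (((hαI.const_mul t).add (hI.const_mul t⁻¹)).const_mul 2⁻¹)
    refine (norm_integral_le_of_norm_le hdom (Eventually.of_forall fun x => ?_)).trans ?_
    · by_cases hx : x ∈ Ω ∩ S
      · rw [indicator_of_mem hx]
        simp only [indicator_of_mem hx.1]
        refine (norm_sum_le _ _).trans ?_
        rw [Finset.mul_sum, Finset.mul_sum, Finset.mul_sum, ← Finset.sum_add_distrib,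
          Finset.mul_sum]
        refine Finset.sum_le_sum fun j _ => ?_
        rw [norm_mul, norm_mul, Complex.norm_real, Real.norm_of_nonneg (inv_pos.2 (hσpos x)).le,
          Complex.norm_conj]
        have he2 : Real.exp (-2 * κ x) = Real.exp (-κ x) ^ 2 := by
          rw [← Real.exp_nat_mul]; congr 1; push_cast; ring
        have hl := h.lam_pos j
        calc (midW κ φ x)⁻¹ * ‖α j x‖ * ‖F j x‖ ≤ Real.exp (-κ x) * ‖α j x‖ * ‖F j x‖ := by
              gcongr; exact hσ1 x hx.1
          _ ≤ _ := by
            rw [he2]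
            set E := Real.exp (-κ x)
            set X := ‖α j x‖
            set Y := ‖F j x‖
            have h3 : 0 ≤ 2⁻¹ * ((t * lam j)⁻¹ * (t * X - lam j * (E * Y)) ^ 2) := by positivity
            have h4 : 2⁻¹ * (t * ((lam j)⁻¹ * X ^ 2) + t⁻¹ * (E ^ 2 * (lam j * Y ^ 2))) -
                E * X * Y = 2⁻¹ * ((t * lam j)⁻¹ * (t * X - lam j * (E * Y)) ^ 2) := by
              field_simp
              ring
            linarith
      · rw [indicator_of_notMem hx]
        have hz : ∀ j, Ω.indicator (fun x => (((midW κ φ x)⁻¹ : ℝ) : ℂ) * α j x) x = 0 :=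
          fun j => by
          by_cases hxΩ : x ∈ Ω
          · rw [indicator_of_mem hxΩ, hαS j x hxΩ fun hS => hx ⟨hxΩ, hS⟩, mul_zero]
          · rw [indicator_of_notMem hxΩ]
        simp only [hz, zero_mul, Finset.sum_const_zero, norm_zero, le_refl]
    · rw [integral_indicator hmS, integral_const_mul, integral_add (hαI.const_mul t)
        (hI.const_mul t⁻¹), integral_const_mul, integral_const_mul]
      gcongr

end HormanderCore

section HormanderSolve

variable {n : ℕ} {Ω S : Set (Fin n → ℂ)} {κ φ : (Fin n → ℂ) → ℝ} {lam : Fin n → ℝ} {c : ℝ}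

theorem norm_toLp_sq {α : Type*} [MeasurableSpace α] {μ : Measure α} {b : α → ℂ}
    (hb : MemLp b 2 μ) : ‖hb.toLp b‖ ^ 2 = ∫ x, ‖b x‖ ^ 2 ∂μ := by
  have h := integral_mul_conj_eq_inner hb hb
  rw [inner_self_eq_norm_sq_to_K] at h
  have h2 : ∀ x, b x * conj (b x) = ((‖b x‖ ^ 2 : ℝ) : ℂ) := fun x => by
    rw [Complex.mul_conj, Complex.normSq_eq_norm_sq]
  simp only [h2] at h
  rw [integral_complex_ofReal] at h
  exact Complex.ofReal_injective (by rw [h, Complex.ofReal_pow]; rfl)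

/-- Tuples of test functions. -/
def testTuples {n : ℕ} (Ω : Set (Fin n → ℂ)) : Submodule ℂ (Fin n → (Fin n → ℂ) → ℂ) where
  carrier := {p | ∀ j, IsTest Ω (p j)}
  add_mem' := fun ha hb j => (ha j).add (hb j)
  zero_mem' := fun _ => IsTest.zero
  smul_mem' := fun c _ ha j => (ha j).const_mul c

/-- Weighted `L²` solvability of `∂̄u = α`, with `u = v e^{(φ + 4κ)/2}`. -/
theorem hormander_solve (h : CoreWeights Ω S κ φ lam c) {η : ℕ → (Fin n → ℂ) → ℝ} {M : ℝ}
    (hη : CutoffSeq Ω κ η M) {α : Fin n → (Fin n → ℂ) → ℂ}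
    (hα : ∀ j, ContDiffOn ℝ ∞ (α j) Ω) (hαS : ∀ j, ∀ x ∈ Ω, x ∉ S → α j x = 0)
    (hαcl : ∀ j k, ∀ x ∈ Ω, wderivBar k (α j) x = wderivBar j (α k) x)
    (hαL : ∀ j, MemLp (α j) 2 (volume.restrict Ω)) {a : ℝ}
    (ha : ∫ x in Ω, ∑ j, (lam j)⁻¹ * ‖α j x‖ ^ 2 ≤ a) :
    ∃ v : (Fin n → ℂ) → ℂ, MemLp v 2 volume ∧
      eLpNorm v 2 volume ≤ ENNReal.ofReal (Real.sqrt (4 * a / c)) ∧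
      ∀ j θ, IsTest Ω θ →
        ∫ x, v x * (Real.exp ((φ x + 4 * κ x) / 2) * wderivBar j θ x) = -∫ x, α j x * θ x := by
  have hΩ := h.isOpen
  set W : (Fin n → ℂ) → ℂ := fun x => ((Real.exp ((φ x + 4 * κ x) / 2) : ℝ) : ℂ) with hW
  have hWs : ContDiffOn ℝ ∞ W Ω :=
    ((h.smooth'.add (contDiffOn_const.mul h.smooth)).div_const 2).exp.ofReal_comp
  have hA : ∀ p : testTuples Ω, IsTest Ω fun x => W x * ∑ j, wderiv j (p.1 j) x := fun p =>
    (IsTest.sum _ fun j _ => (p.2 j).wderiv j).mul_left hΩ hWs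
  let T : testTuples Ω →ₗ[ℂ] Lp ℂ 2 (volume : Measure (Fin n → ℂ)) :=
    { toFun := fun p => ((hA p).memLp 2).toLp _
      map_add' := fun p q => by
        rw [← MemLp.toLp_add]
        congr 1
        ext x
        have : ∀ j, wderiv j ((p + q).1 j) x = wderiv j (p.1 j) x + wderiv j (q.1 j) x := fun j => by
          rw [wderiv_eq_dop]
          exact dop_add ((p.2 j).differentiable x) ((q.2 j).differentiable x)
        simp only [this, Finset.sum_add_distrib, Pi.add_apply]
        ring
      map_smul' := fun t p => by
        rw [RingHom.id_apply, ← MemLp.toLp_const_smul]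
        congr 1
        ext x
        have : ∀ j, wderiv j ((t • p).1 j) x = t * wderiv j (p.1 j) x := fun j => by
          rw [wderiv_eq_dop]
          exact dop_const_mul ((p.2 j).differentiable x) t
        simp only [this, ← Finset.mul_sum, Pi.smul_apply, smul_eq_mul]
        ring }
  have hLi : ∀ (p : testTuples Ω) j, IntegrableOn (fun x => conj (α j x) * p.1 j x) Ω :=
    fun p j => ((p.2 j).integrable_mul hΩ
      ((Complex.conjCLE : ℂ →L[ℝ] ℂ).contDiff.comp_contDiffOn (hα j))).integrableOn
  let L : testTuples Ω →ₗ[ℂ] ℂ :=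
    { toFun := fun p => ∑ j, ∫ x in Ω, conj (α j x) * p.1 j x
      map_add' := fun p q => by
        rw [← Finset.sum_add_distrib]
        refine Finset.sum_congr rfl fun j _ => ?_
        rw [← integral_add (hLi p j) (hLi q j)]
        congr 1
        ext x
        exact mul_add _ _ _
      map_smul' := fun t p => by
        rw [RingHom.id_apply, smul_eq_mul, Finset.mul_sum]
        refine Finset.sum_congr rfl fun j _ => ?_
        rw [← integral_const_mul]
        congr 1
        ext x
        exact mul_left_comm _ _ _ }
  have ha0 : 0 ≤ a := le_trans (integral_nonneg fun x => Finset.sum_nonneg fun j _ =>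
    mul_nonneg (inv_pos.2 (h.lam_pos j)).le (sq_nonneg _)) ha
  have hC0 : 0 ≤ 4 * a / c := div_nonneg (by linarith) h.pos.le
  obtain ⟨v, hv, hvL⟩ := exists_inner_eq_of_norm_le T L (Real.sqrt_nonneg (4 * a / c)) fun p => by
    refine (sq_le_sq₀ (norm_nonneg _) (by positivity)).1 ?_
    rw [mul_pow, Real.sq_sqrt hC0]
    have e := dual_estimate h hη hα hαS hαcl hαL ha p.2
    have e1 : ‖L p‖ = ‖∑ j, ∫ x in Ω, α j x * conj (p.1 j x)‖ := by
      rw [← Complex.norm_conj]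
      change ‖conj (∑ j, ∫ x in Ω, conj (α j x) * p.1 j x)‖ = _
      rw [map_sum]
      congr 1
      refine Finset.sum_congr rfl fun j _ => ?_
      rw [← integral_conj]
      simp
    have e2 : ‖T p‖ ^ 2 = ∫ x, ‖∑ j, wderiv j (p.1 j) x‖ ^ 2 * Real.exp (φ x + 4 * κ x) := by
      refine (norm_toLp_sq ((hA p).memLp 2)).trans ?_
      congr 1
      ext x
      rw [norm_mul, mul_pow, hW, Complex.norm_real, Real.norm_of_nonneg (Real.exp_pos _).le,
        ← Real.exp_nat_mul, mul_comm]
      congr 2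
      push_cast
      ring
    rw [e1, e2]
    exact e
  refine ⟨fun x => -v x, (Lp.memLp v).neg, ?_, fun j θ hθ => ?_⟩
  · have : eLpNorm (fun x => -v x) 2 volume = eLpNorm v 2 volume := eLpNorm_neg _ _ _
    rw [this, ← ENNReal.ofReal_toReal (Lp.memLp v).2.ne]
    exact ENNReal.ofReal_le_ofReal (by rwa [← Lp.norm_def])
  · classical
    have hp : ∀ i, IsTest Ω ((fun i x => if i = j then conj (θ x) else 0) i) := fun i => by
      by_cases hi : i = j
      · simpa [hi] using hθ.conj
      · simpa [hi] using IsTest.zero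
    have e := hvL ⟨_, hp⟩
    have e1 : L ⟨_, hp⟩ = conj (∫ x, α j x * θ x) := by
      change ∑ i, ∫ x in Ω, conj (α i x) * (if i = j then conj (θ x) else 0) = _
      rw [Finset.sum_eq_single j (fun i _ hi => by simp [hi]) (by simp), ← integral_conj]
      rw [setIntegral_eq_integral_of_forall_compl_eq_zero fun x hx => by simp [hθ.eq_zero hx]]
      simp
    have e2 : inner ℂ v (T ⟨_, hp⟩) = conj (∫ x, v x * (W x * wderivBar j θ x)) := by
      have := integral_mul_conj_eq_inner ((hA ⟨_, hp⟩).memLp 2) (Lp.memLp v)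
      rw [Lp.toLp_coeFn] at this
      refine this.symm.trans ?_
      rw [← integral_conj]
      congr 1
      ext x
      have : ∑ i, wderiv i (fun x => if i = j then conj (θ x) else 0) x = conj (wderivBar j θ x) := by
        rw [Finset.sum_eq_single j (fun i _ hi => by
          simp only [hi, if_false]
          rw [wderiv_eq_dop]; exact dop_const _) (by simp)]
        simp only [if_true]
        exact wderiv_conj j (hθ.differentiable x)
      rw [this]
      simp only [map_mul, hW, Complex.conj_ofReal]
      ring
    rw [e1, e2] at e
    have := (starRingEnd ℂ).injective e
    rw [this, ← integral_neg]
    congr 1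
    ext x
    ring

end HormanderSolve

section RegionSolve

variable {n : ℕ} {Ω S K : Set (Fin n → ℂ)} {r φ R : (Fin n → ℂ) → ℝ} {lam : Fin n → ℝ} {c : ℝ}
  {x z v w : Fin n → ℂ}

theorem dop_comp_real {g : ℝ → ℝ} {g' : ℝ} (hg : HasDerivAt g g' (r z))
    (hr : DifferentiableAt ℝ r z) :
    dop v w (fun y => (g (r y) : ℂ)) z = g' * dop v w (fun y => (r y : ℂ)) z := by
  have h1 : HasFDerivAt (fun x => (r x : ℂ)) (Complex.ofRealCLM.comp (fderiv ℝ r z)) z :=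
    Complex.ofRealCLM.hasFDerivAt.comp z hr.hasFDerivAt
  have h2 : HasFDerivAt (fun y => (g (r y) : ℂ))
      (Complex.ofRealCLM.comp (g' • fderiv ℝ r z)) z :=
    Complex.ofRealCLM.hasFDerivAt.comp z (hg.comp_hasFDerivAt z hr.hasFDerivAt)
  simp only [dop, h1.fderiv, h2.fderiv]
  simp
  ring

theorem leviForm_comp (hΩ : IsOpen Ω) (hr : ContDiffOn ℝ ∞ r Ω) (hx : x ∈ Ω) {g g₁ : ℝ → ℝ}
    {g₂ : ℝ} (hg : ∀ y ∈ Ω, HasDerivAt g (g₁ (r y)) (r y)) (hg₁ : HasDerivAt g₁ g₂ (r x))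
    (ξ : Fin n → ℂ) :
    leviForm (fun y => g (r y)) x ξ =
      g₁ (r x) * leviForm r x ξ + g₂ * ‖∑ j, wderiv j (fun y => (r y : ℂ)) x * ξ j‖ ^ 2 := by
  have hd : ∀ y ∈ Ω, DifferentiableAt ℝ r y :=
    fun y hy => (hr.contDiffAt (hΩ.mem_nhds hy)).differentiableAt (by simp)
  have h : ∀ μ ν, wderiv μ (wderivBar ν fun y => ((g (r y) : ℝ) : ℂ)) x =
      g₂ * wderiv μ (fun y => (r y : ℂ)) x * conj (wderiv ν (fun y => (r y : ℂ)) x) +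
        g₁ (r x) * wderiv μ (wderivBar ν fun y => (r y : ℂ)) x := fun μ ν => by
    rw [← wderivBar_real (hd x hx)]
    simp only [wderivBar_eq_dop, wderiv_eq_dop]
    have hr' := dop_contDiffOn (v := Pi.single ν 1) (w := -Pi.single ν Complex.I) hΩ hr.ofReal_comp
    rw [dop_congr (g := fun y => (g₁ (r y) : ℂ) *
        dop (Pi.single ν 1) (-Pi.single ν Complex.I) (fun y => (r y : ℂ)) y)
      (by
        filter_upwards [hΩ.mem_nhds hx] with y hy
        exact dop_comp_real (hg y hy) (hd y hy)),
      dop_mul (u := fun y => (g₁ (r y) : ℂ)) (Complex.ofRealCLM.differentiableAt.comp x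
        (hg₁.differentiableAt.comp x (hd x hx)))
        ((hr'.contDiffAt (hΩ.mem_nhds hx)).differentiableAt (by simp)),
      dop_comp_real hg₁ (hd x hx)]
  simp only [leviForm]
  have h2 : ((‖∑ j, wderiv j (fun y => (r y : ℂ)) x * ξ j‖ ^ 2 : ℝ) : ℂ) =
      ∑ μ, ∑ ν, wderiv μ (fun y => (r y : ℂ)) x * conj (wderiv ν (fun y => (r y : ℂ)) x) *
        ξ μ * conj (ξ ν) := by
    rw [← Complex.normSq_eq_norm_sq, ← Complex.mul_conj, map_sum, Finset.sum_mul_sum]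
    refine Finset.sum_congr rfl fun μ _ => Finset.sum_congr rfl fun ν _ => ?_
    rw [map_mul]
    ring
  rw [← Complex.re_ofReal_mul, ← Complex.ofReal_re (g₂ * _), ← Complex.add_re]
  congr 1
  rw [Complex.ofReal_mul, h2, Finset.mul_sum, Finset.mul_sum, ← Finset.sum_add_distrib]
  refine Finset.sum_congr rfl fun μ _ => ?_
  rw [Finset.mul_sum, Finset.mul_sum, ← Finset.sum_add_distrib]
  refine Finset.sum_congr rfl fun ν _ => ?_
  have h3 := h μ ν
  beta_reduce at h3 ⊢
  rw [h3]
  ring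

theorem exists_smoothTransition_deriv_bound :
    ∃ M : ℝ, 0 ≤ M ∧ (∀ y, |deriv Real.smoothTransition y| ≤ M) ∧
      ∀ y, 1 < y → deriv Real.smoothTransition y = 0 := by
  have hc : Continuous (deriv Real.smoothTransition) :=
    (Real.smoothTransition.contDiff (n := 1)).continuous_deriv le_rfl
  have h1 : ∀ y, 1 < y → deriv Real.smoothTransition y = 0 := fun y hy => by
    have : Real.smoothTransition =ᶠ[𝓝 y] fun _ => 1 := by
      filter_upwards [lt_mem_nhds hy] with t ht
      exact Real.smoothTransition.one_of_one_le ht.le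
    rw [this.deriv_eq, deriv_const]
  have h0 : ∀ y, y < 0 → deriv Real.smoothTransition y = 0 := fun y hy => by
    have : Real.smoothTransition =ᶠ[𝓝 y] fun _ => 0 := by
      filter_upwards [gt_mem_nhds hy] with t ht
      exact Real.smoothTransition.zero_of_nonpos ht.le
    rw [this.deriv_eq, deriv_const]
  obtain ⟨M, hM⟩ := isCompact_Icc.exists_bound_of_continuousOn (s := Icc (0 : ℝ) 1) hc.continuousOn
  refine ⟨max M 0, le_max_right _ _, fun y => ?_, h1⟩
  by_cases hy : y ∈ Icc (0 : ℝ) 1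
  · exact (hM y hy).trans (le_max_left _ _)
  · rw [mem_Icc, not_and_or, not_le, not_le] at hy
    rcases hy with hy | hy
    · rw [h0 y hy, abs_zero]; exact le_max_right _ _
    · rw [h1 y hy, abs_zero]; exact le_max_right _ _

/-- A region `{R > 0}` with a smooth plurisuperharmonic function `R` vanishing at the boundary. -/
structure SuperRegion (Ω : Set (Fin n → ℂ)) (R : (Fin n → ℂ) → ℝ) (B : ℝ) : Prop where
  isOpen : IsOpen Ω
  smooth : ContDiffOn ℝ ∞ R Ω
  pos : ∀ x ∈ Ω, 0 < R x
  compact : ∀ e : ℝ, 0 < e → IsCompact {x ∈ Ω | e ≤ R x}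
  levi : ∀ x ∈ Ω, ∀ ξ : Fin n → ℂ, leviForm R x ξ ≤ 0
  bound : ∀ x ∈ Ω, ∀ j, ‖wderivBar j (fun y => (R y : ℂ)) x‖ ≤ B

/-- The exhausting weight `log (1 + t / R)`. -/
def barrier {n : ℕ} (R : (Fin n → ℂ) → ℝ) (t : ℝ) (x : Fin n → ℂ) : ℝ :=
  Real.log (R x + t) - Real.log (R x)

variable {B t : ℝ}

theorem SuperRegion.exp_barrier (h : SuperRegion Ω R B) (ht : 0 < t) (hx : x ∈ Ω) :
    Real.exp (barrier R t x) = (R x + t) / R x := by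
  have := h.pos x hx
  rw [barrier, Real.exp_sub, Real.exp_log this, Real.exp_log (by linarith)]

theorem SuperRegion.barrier_smooth (h : SuperRegion Ω R B) (ht : 0 < t) :
    ContDiffOn ℝ ∞ (barrier R t) Ω :=
  ((h.smooth.add contDiffOn_const).log fun x hx => by have := h.pos x hx; positivity).sub
    (h.smooth.log fun x hx => (h.pos x hx).ne')

theorem SuperRegion.barrier_nonneg (h : SuperRegion Ω R B) (ht : 0 < t) (hx : x ∈ Ω) :
    0 ≤ barrier R t x :=
  sub_nonneg.2 (Real.log_le_log (h.pos x hx) (by linarith))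

theorem SuperRegion.levi_barrier (h : SuperRegion Ω R B) (ht : 0 < t) (hx : x ∈ Ω)
    (ξ : Fin n → ℂ) :
    ‖∑ j, wderiv j (fun y => (barrier R t y : ℂ)) x * ξ j‖ ^ 2 ≤ leviForm (barrier R t) x ξ := by
  set g : ℝ → ℝ := fun s => Real.log (s + t) - Real.log s with hg
  set g₁ : ℝ → ℝ := fun s => (s + t)⁻¹ - s⁻¹ with hg₁
  have hd : ∀ s : ℝ, 0 < s → HasDerivAt g (g₁ s) s := fun s hs => by
    have h1 : HasDerivAt (fun s => Real.log (s + t)) ((s + t)⁻¹) s := by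
      simpa using ((hasDerivAt_id s).add_const t).log (by simp; linarith)
    exact h1.sub (Real.hasDerivAt_log hs.ne')
  have hd₁ : ∀ s : ℝ, 0 < s → HasDerivAt g₁ (-1 / (s + t) ^ 2 - -1 / s ^ 2) s := fun s hs => by
    have h1 : HasDerivAt (fun s => (s + t)⁻¹) (-1 / (s + t) ^ 2) s :=
      ((hasDerivAt_id s).add_const t).fun_inv (by simp; linarith)
    exact h1.sub ((hasDerivAt_id s).fun_inv hs.ne')
  have hp := h.pos x hx
  have e := leviForm_comp h.isOpen h.smooth hx (g := g) (g₁ := g₁)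
    (fun y hy => hd _ (h.pos y hy)) (hd₁ _ hp) ξ
  have hrd : DifferentiableAt ℝ R x :=
    (h.smooth.contDiffAt (h.isOpen.mem_nhds hx)).differentiableAt (by simp)
  have e2 : ∀ j, wderiv j (fun y => (barrier R t y : ℂ)) x =
      g₁ (R x) * wderiv j (fun y => (R y : ℂ)) x := fun j => by
    rw [wderiv_eq_dop]
    exact dop_comp_real (hd _ hp) hrd
  change _ ≤ leviForm (fun y => g (R y)) x ξ
  rw [e]
  simp only [e2, mul_assoc, ← Finset.mul_sum]
  rw [norm_mul, mul_pow, Complex.norm_real, Real.norm_eq_abs, sq_abs]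
  have h1 : 0 ≤ g₁ (R x) * leviForm R x ξ := by
    refine mul_nonneg_of_nonpos_of_nonpos ?_ (h.levi x hx ξ)
    rw [hg₁]
    simp only [sub_nonpos]
    gcongr
    linarith
  have h2 : g₁ (R x) ^ 2 ≤ -1 / (R x + t) ^ 2 - -1 / R x ^ 2 := by
    have : -1 / (R x + t) ^ 2 - -1 / R x ^ 2 - g₁ (R x) ^ 2 = 2 * t / (R x * (R x + t) ^ 2) := by
      rw [hg₁]
      have : R x + t ≠ 0 := by positivity
      field_simp
      ring
    have h3 : 0 ≤ 2 * t / (R x * (R x + t) ^ 2) := by positivity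
    linarith
  nlinarith [sq_nonneg ‖∑ j, wderiv j (fun y => (R y : ℂ)) x * ξ j‖]

/-- The cutoff functions associated with a plurisuperharmonic exhaustion. -/
def regionCutoff {n : ℕ} (Ω : Set (Fin n → ℂ)) (R : (Fin n → ℂ) → ℝ) (ν : ℕ) :
    (Fin n → ℂ) → ℝ :=
  Ω.indicator fun x => Real.smoothTransition ((ν + 1) * R x - 1)

theorem SuperRegion.cutoffSeq (h : SuperRegion Ω R B) (ht : 0 < t) :
    ∃ M, CutoffSeq Ω (barrier R t) (regionCutoff Ω R) M := by
  obtain ⟨M, hM0, hM, hM1⟩ := exists_smoothTransition_deriv_bound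
  have hloc : ∀ ν, ∀ x ∈ Ω, regionCutoff Ω R ν =ᶠ[𝓝 x]
      fun y => Real.smoothTransition ((ν + 1) * R y - 1) := fun ν x hx => by
    filter_upwards [h.isOpen.mem_nhds hx] with y hy
    rw [regionCutoff, indicator_of_mem hy]
  have hrd : ∀ x ∈ Ω, DifferentiableAt ℝ R x := fun x hx =>
    (h.smooth.contDiffAt (h.isOpen.mem_nhds hx)).differentiableAt (by simp)
  have hts : ∀ ν : ℕ, tsupport (fun x => (regionCutoff Ω R ν x : ℂ)) ⊆
      {x ∈ Ω | ((ν : ℝ) + 1)⁻¹ ≤ R x} := fun ν => by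
    refine closure_minimal (fun x hx => ?_) (h.compact _ (by positivity)).isClosed
    have hxΩ : x ∈ Ω := by
      by_contra hxΩ
      exact hx (by simp [regionCutoff, hxΩ])
    refine ⟨hxΩ, ?_⟩
    by_contra hlt
    refine hx ?_
    simp only [regionCutoff, indicator_of_mem hxΩ]
    rw [Real.smoothTransition.zero_of_nonpos, Complex.ofReal_zero]
    rw [not_le, lt_inv_comm₀ (h.pos x hxΩ) (by positivity)] at hlt
    have : (ν + 1) * R x ≤ 1 := by
      rw [← le_div_iff₀ (h.pos x hxΩ), one_div]
      exact hlt.le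
    linarith
  refine ⟨M * 2 * |B| / t, fun ν => ⟨?_, ?_, ?_⟩, fun ν x => ?_, fun x hx => ?_,
    fun ν x hx j => ?_⟩
  · refine contDiff_iff_contDiffAt.2 fun x => ?_
    by_cases hx : x ∈ Ω
    · have h1 : ContDiffAt ℝ ∞ (fun y => Real.smoothTransition ((ν + 1) * R y - 1)) x :=
        Real.smoothTransition.contDiffAt.comp x
          ((contDiffAt_const.mul (h.smooth.contDiffAt (h.isOpen.mem_nhds hx))).sub
            contDiffAt_const)
      exact Complex.ofRealCLM.contDiff.contDiffAt.comp x (h1.congr_of_eventuallyEq (hloc ν x hx))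
    · have hz' : x ∉ tsupport (fun x => (regionCutoff Ω R ν x : ℂ)) := fun h' => hx (hts ν h').1
      exact contDiffAt_const.congr_of_eventuallyEq (notMem_tsupport_iff_eventuallyEq.1 hz')
  · exact (h.compact _ (by positivity)).of_isClosed_subset (isClosed_tsupport _) (hts ν)
  · exact (hts ν).trans (sep_subset _ _)
  · rw [regionCutoff]
    by_cases hx : x ∈ Ω
    · rw [indicator_of_mem hx]
      exact ⟨Real.smoothTransition.nonneg _, Real.smoothTransition.le_one _⟩
    · rw [indicator_of_notMem hx]
      simp
  · have hpx := h.pos x hx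
    obtain ⟨N, hN⟩ := exists_nat_gt (3 / R x)
    filter_upwards [eventually_ge_atTop N] with ν hν
    have hc : ∀ᶠ y in 𝓝 x, R x * (2 / 3) < R y :=
      (h.smooth.continuousOn.continuousAt (h.isOpen.mem_nhds hx)).eventually
        (lt_mem_nhds (by linarith))
    filter_upwards [hloc ν x hx, hc] with y hy hy2
    rw [hy]
    refine Real.smoothTransition.one_of_one_le ?_
    have h1 : 3 / R x < ν + 1 := hN.trans_le (by
      have : (N : ℝ) ≤ ν := by exact_mod_cast hν
      linarith)
    rw [div_lt_iff₀ hpx] at h1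
    have h2 : (ν + 1 : ℝ) * (R x * (2 / 3)) ≤ (ν + 1) * R y := by gcongr
    linarith
  · have hpx := h.pos x hx
    have hder : HasDerivAt (fun s : ℝ => Real.smoothTransition ((ν + 1) * s - 1))
        (deriv Real.smoothTransition ((ν + 1) * R x - 1) * (ν + 1)) (R x) := by
      have h1 : HasDerivAt Real.smoothTransition
          (deriv Real.smoothTransition ((ν + 1) * R x - 1)) ((ν + 1) * R x - 1) :=
        ((Real.smoothTransition.contDiff (n := 1)).differentiable (by simp) _).hasDerivAt
      have h2 : HasDerivAt (fun s : ℝ => ((ν : ℝ) + 1) * s - 1) (ν + 1) (R x) := by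
        simpa using ((hasDerivAt_id (R x)).const_mul ((ν : ℝ) + 1)).sub_const 1
      exact h1.comp (R x) h2
    have e : wderivBar j (fun y => (regionCutoff Ω R ν y : ℂ)) x =
        ((deriv Real.smoothTransition ((ν + 1) * R x - 1) * (ν + 1) : ℝ) : ℂ) *
          wderivBar j (fun y => (R y : ℂ)) x := by
      simp only [wderivBar_eq_dop]
      rw [dop_congr ((hloc ν x hx).mono fun y hy => congrArg (fun s : ℝ => (s : ℂ)) hy)]
      exact dop_comp_real hder (hrd x hx)
    rw [e, norm_mul, Complex.norm_real, Real.norm_eq_abs, abs_mul, Real.exp_neg,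
      h.exp_barrier ht hx, inv_div, abs_of_nonneg (by positivity : (0 : ℝ) ≤ ν + 1)]
    have hB : ‖wderivBar j (fun y => (R y : ℂ)) x‖ ≤ |B| := (h.bound x hx j).trans (le_abs_self B)
    by_cases hlarge : 1 < (ν + 1) * R x - 1
    · rw [hM1 _ hlarge, abs_zero, zero_mul, zero_mul, zero_mul]
      positivity
    · have h3 : (ν + 1) * (R x / (R x + t)) ≤ 2 / t := by
        rw [← mul_div_assoc]
        exact div_le_div₀ (by norm_num) (by linarith) ht (by linarith)
      calc |deriv Real.smoothTransition ((ν + 1) * R x - 1)| * (ν + 1) *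
            ‖wderivBar j (fun y => (R y : ℂ)) x‖ * (R x / (R x + t))
          = |deriv Real.smoothTransition ((ν + 1) * R x - 1)| *
            ‖wderivBar j (fun y => (R y : ℂ)) x‖ * ((ν + 1) * (R x / (R x + t))) := by ring
        _ ≤ M * |B| * (2 / t) := by
          gcongr
          exact hM _
        _ = _ := by ring

/-- Solvability of `∂̄u = α` on a region, with an estimate on a given compact set which does not
depend on the region. -/
theorem SuperRegion.exists_solution (h : SuperRegion Ω R B) (hS : MeasurableSet S)
    (hφ : ContDiffOn ℝ ∞ φ Ω) (hφ01 : ∀ x ∈ Ω, φ x ∈ Icc (0 : ℝ) 1)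
    (hφl : ∀ x ∈ Ω, ∀ ξ : Fin n → ℂ, 0 ≤ leviForm φ x ξ) (hc : 0 < c) (hlam : ∀ j, 0 < lam j)
    (hφs : ∀ x ∈ Ω, x ∈ S → ∀ ξ : Fin n → ℂ, c * ∑ j, lam j * ‖ξ j‖ ^ 2 ≤ leviForm φ x ξ)
    {α : Fin n → (Fin n → ℂ) → ℂ}
    (hα : ∀ j, ContDiffOn ℝ ∞ (α j) Ω) (hαS : ∀ j, ∀ x ∈ Ω, x ∉ S → α j x = 0)
    (hαcl : ∀ j k, ∀ x ∈ Ω, wderivBar k (α j) x = wderivBar j (α k) x)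
    (hαL : ∀ j, MemLp (α j) 2 (volume.restrict Ω)) {a : ℝ}
    (ha : ∫ x in Ω, ∑ j, (lam j)⁻¹ * ‖α j x‖ ^ 2 ≤ a) (hK : IsCompact K) (hKΩ : K ⊆ Ω) :
    ∃ u : (Fin n → ℂ) → ℂ, MemLp u 2 (volume.restrict K) ∧
      eLpNorm u 2 (volume.restrict K) ≤ ENNReal.ofReal (16 * Real.sqrt (a / c)) ∧
      ∀ j θ, IsTest Ω θ → ∫ x, u x * wderivBar j θ x = -∫ x, α j x * θ x := by
  obtain ⟨t, ht, htK⟩ : ∃ t : ℝ, 0 < t ∧ ∀ x ∈ K, t ≤ R x := by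
    rcases K.eq_empty_or_nonempty with rfl | hne
    · exact ⟨1, one_pos, by simp⟩
    · obtain ⟨x, hx, hmin⟩ := hK.exists_isMinOn hne (h.smooth.continuousOn.mono hKΩ)
      exact ⟨R x, h.pos x (hKΩ hx), fun y hy => hmin hy⟩
  obtain ⟨M, hM⟩ := h.cutoffSeq ht
  have hcore : CoreWeights Ω S (barrier R t) φ lam c :=
    { isOpen := h.isOpen
      measS := hS
      smooth := h.barrier_smooth ht
      smooth' := hφ
      nonneg := fun x hx => h.barrier_nonneg ht hx
      nonneg' := fun x hx => (hφ01 x hx).1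
      levi := fun x hx ξ => h.levi_barrier ht hx ξ
      levi' := hφl
      pos := hc
      lam_pos := hlam
      strict := hφs }
  obtain ⟨v, hv, hvn, hvs⟩ := hormander_solve hcore hM hα hαS hαcl hαL ha
  set W : (Fin n → ℂ) → ℝ := fun x => Real.exp ((φ x + 4 * barrier R t x) / 2) with hW
  have hWs : ContDiffOn ℝ ∞ W Ω :=
    ((hφ.add (contDiffOn_const.mul (h.barrier_smooth ht))).div_const 2).exp
  have hWK : ∀ x ∈ K, W x ≤ 8 := fun x hx => by
    have h1 : W x = Real.exp (φ x / 2) * Real.exp (barrier R t x) ^ 2 := by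
      simp only [hW]
      rw [← Real.exp_nat_mul, ← Real.exp_add]
      congr 1
      push_cast
      ring
    have hp := h.pos x (hKΩ hx)
    rw [h1, h.exp_barrier ht (hKΩ hx)]
    have h2 : (R x + t) / R x ≤ 2 := by
      rw [div_le_iff₀ hp]
      linarith [htK x hx]
    have h3 : Real.exp (φ x / 2) ≤ 2 := by
      have h4 : Real.exp (φ x / 2) ≤ Real.exp (Real.log 2) :=
        Real.exp_le_exp.2 (by linarith [(hφ01 x (hKΩ hx)).2, Real.log_two_gt_d9])
      rwa [Real.exp_log two_pos] at h4
    calc _ ≤ 2 * (2 : ℝ) ^ 2 := by gcongr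
      _ = 8 := by norm_num
  have hle : ∀ᵐ x ∂volume.restrict K, ‖v x * W x‖ ≤ 8 * ‖v x‖ :=
    (ae_restrict_mem hK.measurableSet).mono fun x hx => by
      rw [norm_mul, Complex.norm_real, Real.norm_of_nonneg (Real.exp_pos _).le, mul_comm]
      gcongr
      exact hWK x hx
  have hvK : MemLp v 2 (volume.restrict K) := hv.restrict K
  have hWm : AEStronglyMeasurable (fun x => (W x : ℂ)) (volume.restrict K) :=
    (hWs.ofReal_comp.continuousOn.mono hKΩ).aestronglyMeasurable hK.measurableSet
  refine ⟨fun x => v x * W x, hvK.of_le_mul (hvK.1.mul hWm) hle, ?_, fun j θ hθ => ?_⟩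
  · refine (eLpNorm_le_mul_eLpNorm_of_ae_le_mul hle 2).trans ?_
    calc ENNReal.ofReal 8 * eLpNorm v 2 (volume.restrict K)
        ≤ ENNReal.ofReal 8 * ENNReal.ofReal (Real.sqrt (4 * a / c)) := by
          gcongr
          exact (eLpNorm_mono_measure v Measure.restrict_le_self).trans hvn
      _ = _ := by
          have h4 : Real.sqrt 4 = 2 := by
            rw [(by norm_num : (4 : ℝ) = 2 ^ 2), Real.sqrt_sq (by norm_num)]
          rw [← ENNReal.ofReal_mul (by norm_num), mul_div_assoc, Real.sqrt_mul (by norm_num), h4,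
            ← mul_assoc]
          norm_num
  · rw [← hvs j θ hθ]
    congr 1
    ext x
    exact mul_assoc _ _ _

end RegionSolve

section Submean

open Laplacian InnerProductSpace Real

theorem exists_entire_re_near {h : ℂ → ℝ} (hh : ContinuousOn h (sphere 0 1)) {ε : ℝ} (hε : 0 < ε) :
    ∃ G : ℂ → ℂ, Differentiable ℂ G ∧ ∀ w ∈ sphere (0 : ℂ) 1, |h w - (G w).re| < ε := by
  have : Fact (0 < 2 * π) := ⟨two_pi_pos⟩
  have hc : Continuous fun θ : AddCircle (2 * π) => ((h (AddCircle.toCircle θ : ℂ) : ℝ) : ℂ) := by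
    refine Complex.continuous_ofReal.comp (hh.comp_continuous ?_ ?_)
    · exact continuous_subtype_val.comp AddCircle.continuous_toCircle
    · intro θ; rw [mem_sphere_zero_iff_norm]; exact Circle.norm_coe _
  let f : C(AddCircle (2 * π), ℂ) := ⟨_, hc⟩
  have hf : f ∈ (Submodule.span ℂ (range <| @fourier (2 * π))).topologicalClosure := by
    rw [span_fourier_closure_eq_top]; trivial
  obtain ⟨p, hp, hpf⟩ := Metric.mem_closure_iff.1 hf ε hε
  have key : ∀ p ∈ Submodule.span ℂ (range <| @fourier (2 * π)), ∃ A B : ℂ → ℂ,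
      Differentiable ℂ A ∧ Differentiable ℂ B ∧
      ∀ θ, p θ = A (AddCircle.toCircle θ) + conj (B (AddCircle.toCircle θ)) := by
    intro p hp
    induction hp using Submodule.span_induction with
    | mem x hx =>
      obtain ⟨k, rfl⟩ := hx
      obtain ⟨k, rfl | rfl⟩ := k.eq_nat_or_neg
      · refine ⟨fun w => w ^ k, 0, by fun_prop, differentiable_const _, fun θ => ?_⟩
        simp [fourier_apply, AddCircle.toCircle_nsmul]
      · refine ⟨0, fun w => w ^ k, differentiable_const _, by fun_prop, fun θ => ?_⟩
        rw [fourier_neg]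
        simp [fourier_apply, AddCircle.toCircle_nsmul]
    | zero => exact ⟨0, 0, differentiable_const _, differentiable_const _, fun θ => by simp⟩
    | add x y _ _ hx hy =>
      obtain ⟨A, B, hA, hB, h1⟩ := hx
      obtain ⟨A', B', hA', hB', h2⟩ := hy
      refine ⟨fun w => A w + A' w, fun w => B w + B' w, hA.add hA', hB.add hB', fun θ => ?_⟩
      rw [ContinuousMap.add_apply, h1, h2, map_add]; ring
    | smul c x _ hx =>
      obtain ⟨A, B, hA, hB, h1⟩ := hx
      refine ⟨fun w => c * A w, fun w => conj c * B w, hA.const_mul _, hB.const_mul _, fun θ => ?_⟩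
      rw [ContinuousMap.smul_apply, h1]; simp [mul_add]
  obtain ⟨A, B, hA, hB, hAB⟩ := key p hp
  refine ⟨fun w => A w + B w, hA.add hB, fun w hw => ?_⟩
  have hw1 : ‖w‖ = 1 := by simpa using hw
  obtain ⟨θ, hθ⟩ : ∃ θ : AddCircle (2 * π), (AddCircle.toCircle θ : ℂ) = w := by
    refine ⟨((Complex.arg w : ℝ) : AddCircle (2 * π)), ?_⟩
    rw [AddCircle.toCircle_apply_mk, div_self two_pi_pos.ne', one_mul, Circle.coe_exp]
    have := Complex.norm_mul_exp_arg_mul_I w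
    rwa [hw1, Complex.ofReal_one, one_mul] at this
  have := (ContinuousMap.dist_lt_iff hε).1 hpf θ
  rw [hAB θ, hθ] at this
  have h2 := (Complex.abs_re_le_norm (f θ - (A w + conj (B w)))).trans_lt (by
    rw [← dist_eq_norm]; exact this)
  have h3 : f θ = ((h w : ℝ) : ℂ) := by
    show ((h (AddCircle.toCircle θ : ℂ) : ℝ) : ℂ) = _
    rw [hθ]
  rw [h3] at h2
  simpa using h2

theorem laplacian_nonpos_of_isLocalMax {f : ℂ → ℝ} {w : ℂ} (hf : ContDiffAt ℝ 2 f w)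
    (hm : IsLocalMax f w) : Δ f w ≤ 0 := by
  have key : ∀ v : ℂ, fderiv ℝ (fderiv ℝ f) w v v ≤ 0 := by
    intro v
    let g : ℝ → ℝ := fun t => f (w + t • v)
    have hl : ∀ t : ℝ, HasDerivAt (fun t : ℝ => w + t • v) v t := fun t => by
      simpa using ((hasDerivAt_id t).smul_const v).const_add w
    have hl0 : Tendsto (fun t : ℝ => w + t • v) (𝓝 0) (𝓝 w) := by
      have := (hl 0).continuousAt.tendsto; simpa using this
    have hev : ∀ᶠ y in 𝓝 w, DifferentiableAt ℝ f y :=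
      (hf.eventually (by simp)).mono fun y hy => hy.differentiableAt (by simp)
    have hg1 : ∀ᶠ t in 𝓝 (0:ℝ), deriv g t = fderiv ℝ f (w + t • v) v :=
      (hl0.eventually hev).mono fun t ht => (ht.hasFDerivAt.comp_hasDerivAt t (hl t)).deriv
    have hd2 : HasFDerivAt (fderiv ℝ f) (fderiv ℝ (fderiv ℝ f) w) (w + (0:ℝ) • v) := by
      have h1 : ContDiffAt ℝ 1 (fderiv ℝ f) w := hf.fderiv_right (m := 1) (by norm_num)
      simpa using (h1.differentiableAt (by simp)).hasFDerivAt
    have hg2 : deriv (deriv g) 0 = fderiv ℝ (fderiv ℝ f) w v v := by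
      rw [EventuallyEq.deriv_eq hg1]
      have h5 : HasDerivAt (fun t : ℝ => fderiv ℝ f (w + t • v)) (fderiv ℝ (fderiv ℝ f) w v) 0 :=
        HasFDerivAt.comp_hasDerivAt (f := fun t : ℝ => w + t • v) (0 : ℝ) hd2 (hl 0)
      have h6 := h5.clm_apply (hasDerivAt_const (0:ℝ) v)
      rw [map_zero, add_zero] at h6
      exact h6.deriv
    have hgm : IsLocalMax g 0 := by
      have := hl0.eventually hm
      filter_upwards [this] with t ht; simpa [g] using ht
    by_contra! hpos
    have hcont : ContinuousAt g 0 := by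
      have : ContinuousAt f (w + (0:ℝ) • v) := by simpa using hf.continuousAt
      exact ContinuousAt.comp (f := fun t : ℝ => w + t • v) this (hl 0).continuousAt
    have hmin := isLocalMin_of_deriv_deriv_pos (f := g) (x₀ := 0) (by rw [hg2]; exact hpos)
      hgm.deriv_eq_zero hcont
    have hconst : g =ᶠ[𝓝 0] fun _ => g 0 := by
      filter_upwards [hgm, hmin] with t h1 h2 using le_antisymm h1 h2
    have : deriv (deriv g) 0 = 0 := by
      have h1 : deriv g =ᶠ[𝓝 0] fun _ => 0 := by
        filter_upwards [hconst.eventuallyEq_nhds] with t ht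
        rw [ht.deriv_eq]; simp
      rw [h1.deriv_eq]; simp
    rw [hg2] at this; linarith
  rw [laplacian_eq_iteratedFDeriv_complexPlane]
  have h1 := key 1
  have h2 := key Complex.I
  simp only [iteratedFDeriv_two_apply]
  simp
  linarith

theorem le_re_of_laplacian_pos {h : ℂ → ℝ} (hc : ContinuousOn h (closedBall 0 1)) {w₀ : ℂ}
    (hw₀ : w₀ ∈ closedBall (0 : ℂ) 1)
    (hd : ∀ w ∈ ball (0 : ℂ) 1, w ≠ w₀ → ContDiffAt ℝ 2 h w ∧ 0 < Δ h w)
    {G : ℂ → ℂ} (hG : Differentiable ℂ G) (hhG : ∀ w ∈ sphere (0 : ℂ) 1, h w ≤ (G w).re) :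
    ∀ w ∈ ball (0 : ℂ) 1, h w ≤ (G w).re := by
  have hGc : Continuous fun w => (G w).re := Complex.continuous_re.comp hG.continuous
  have main : ∀ w ∈ ball (0 : ℂ) 1, w ≠ w₀ → h w ≤ (G w).re := by
    intro w₁ hw₁ hne
    have hη : ∀ η : ℝ, 0 < η → h w₁ - (G w₁).re + η * (Real.log ‖w₁ - w₀‖ - Real.log 2) ≤ 0 := by
      intro η hη
      by_contra! hpos
      obtain ⟨C, hC⟩ : ∃ C, ∀ w ∈ closedBall (0 : ℂ) 1, h w - (G w).re ≤ C := by
        obtain ⟨C, hC⟩ := (isCompact_closedBall (0 : ℂ) 1).bddAbove_image (hc.sub hGc.continuousOn)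
        exact ⟨C, fun w hw => hC ⟨w, hw, rfl⟩⟩
      obtain ⟨r, hr0, hr1, hr2⟩ : ∃ r, 0 < r ∧ r ≤ ‖w₁ - w₀‖ ∧
          C + η * (Real.log r - Real.log 2) < 0 := by
        have h1 : Tendsto (fun r => C + η * (Real.log r - Real.log 2)) (𝓝[>] 0) atBot := by
          refine tendsto_atBot_add_const_left _ _ (Tendsto.const_mul_atBot hη ?_)
          exact tendsto_atBot_add_const_right _ _ tendsto_log_nhdsGT_zero
        have h2 := h1.eventually (eventually_lt_atBot 0)
        have h3 : ∀ᶠ r in 𝓝[>] (0:ℝ), r ≤ ‖w₁ - w₀‖ := by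
          filter_upwards [Ioo_mem_nhdsGT (norm_pos_iff.2 (sub_ne_zero.2 hne))] with r hr
          exact hr.2.le
        obtain ⟨r, hr⟩ := (h2.and (h3.and self_mem_nhdsWithin)).exists
        exact ⟨r, hr.2.2, hr.2.1, hr.1⟩
      let f : ℂ → ℝ := fun w => h w - (G w).re + η * (Real.log ‖w - w₀‖ - Real.log 2)
      let K := closedBall (0 : ℂ) 1 \ ball w₀ r
      have hK : IsCompact K := (isCompact_closedBall _ _).diff isOpen_ball
      have hw₁K : w₁ ∈ K := ⟨ball_subset_closedBall hw₁, by
        simp only [mem_ball, dist_eq_norm, not_lt]; exact hr1⟩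
      have hrK : ∀ w ∈ K, r ≤ ‖w - w₀‖ := fun w hw => by
        simpa [dist_eq_norm] using hw.2
      have hfc : ContinuousOn f K := by
        refine ((hc.mono sdiff_subset).sub hGc.continuousOn).add (continuousOn_const.mul
          (ContinuousOn.sub (ContinuousOn.log (by fun_prop) fun w hw => ?_) continuousOn_const))
        exact (hr0.trans_le (hrK w hw)).ne'
      obtain ⟨w₂, hw₂, hmax⟩ := hK.exists_isMaxOn ⟨w₁, hw₁K⟩ hfc
      have hf2 : 0 < f w₂ := hpos.trans_le (hmax hw₁K)
      have hlog : ∀ w ∈ K, Real.log ‖w - w₀‖ ≤ Real.log 2 := fun w hw => by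
        refine Real.log_le_log (hr0.trans_le (hrK w hw)) ?_
        refine (norm_sub_le _ _).trans ?_
        have := mem_closedBall_zero_iff.1 hw.1
        have := mem_closedBall_zero_iff.1 hw₀
        linarith
      have hin : w₂ ∈ ball (0 : ℂ) 1 := by
        by_contra hnot
        have hs : w₂ ∈ sphere (0 : ℂ) 1 := by
          simp only [mem_sphere, dist_zero_right]
          have := mem_closedBall_zero_iff.1 hw₂.1
          simp only [mem_ball, dist_zero_right, not_lt] at hnot
          exact le_antisymm this hnot
        have h1 := hhG w₂ hs
        have h2 := mul_nonneg hη.le (sub_nonneg.2 (hlog w₂ hw₂))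
        simp only [f] at hf2
        nlinarith
      have hr' : r < ‖w₂ - w₀‖ := by
        refine lt_of_le_of_ne (hrK w₂ hw₂) fun he => ?_
        have := hC w₂ hw₂.1
        simp only [f] at hf2
        rw [← he] at hf2
        linarith
      have hne2 : w₂ ≠ w₀ := by rintro rfl; simp at hr'; linarith
      have hloc : IsLocalMax f w₂ := by
        refine hmax.isLocalMax ?_
        have h1 : ball (0:ℂ) 1 ∩ {w | r < ‖w - w₀‖} ∈ 𝓝 w₂ :=
          (isOpen_ball.inter (isOpen_lt (by fun_prop) (by fun_prop))).mem_nhds ⟨hin, hr'⟩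
        refine mem_of_superset h1 fun w hw => ⟨ball_subset_closedBall hw.1, ?_⟩
        simpa [dist_eq_norm] using hw.2.le
      obtain ⟨hd1, hd2⟩ := hd w₂ hin hne2
      have hG2 : HarmonicAt (fun w => (G w).re) w₂ := by
        exact (hG.analyticAt w₂).harmonicAt_re
      have hL : HarmonicAt (fun w => η • Real.log ‖w - w₀‖) w₂ := by
        have : HarmonicAt (fun w => Real.log ‖w - w₀‖) w₂ :=
          AnalyticAt.harmonicAt_log_norm (f := fun w => w - w₀) (by fun_prop) (sub_ne_zero.2 hne2)
        exact this.const_smul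
      have hL2 : HarmonicAt (fun _ : ℂ => η * Real.log 2) w₂ := harmonicAt_const _
      have hH := (hG2.sub hL).add hL2
      have hfe : f = fun w => h w - (((fun w => (G w).re) - fun w => η • Real.log ‖w - w₀‖) +
          fun _ : ℂ => η * Real.log 2) w := by
        funext w; simp [f]; ring
      have h0 := laplacian_nonpos_of_isLocalMax (f := f) (w := w₂) (by
        rw [hfe]; exact hd1.sub hH.1) hloc
      have h1 : Δ f w₂ = Δ h w₂ := by
        rw [hfe]
        have := hd1.laplacian_sub hH.1
        rw [hH.2.self_of_nhds, Pi.zero_apply, sub_zero] at this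
        exact this
      linarith
    by_contra! hpos
    set l := Real.log ‖w₁ - w₀‖ - Real.log 2
    have h1 : Tendsto (fun η : ℝ => h w₁ - (G w₁).re + η * l) (𝓝[>] 0)
        (𝓝 (h w₁ - (G w₁).re + 0 * l)) := by
      refine Tendsto.mono_left (Continuous.tendsto ?_ 0) nhdsWithin_le_nhds
      fun_prop
    have h2 := le_of_tendsto h1 (by filter_upwards [self_mem_nhdsWithin] with η h using hη η h)
    linarith
  intro w hw
  by_cases hne : w = w₀
  · subst hne
    have hcw : ContinuousAt (fun y => h y - (G y).re) w :=
      (hc.continuousAt (closedBall_mem_nhds_of_mem hw)).sub hGc.continuousAt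
    have h1 : ∀ᶠ y in 𝓝[≠] w, h y - (G y).re ≤ 0 := by
      filter_upwards [self_mem_nhdsWithin, nhdsWithin_le_nhds (isOpen_ball.mem_nhds hw)] with y h1 h2
      linarith [main y h2 h1]
    have := le_of_tendsto (hcw.tendsto.mono_left nhdsWithin_le_nhds) h1
    linarith
  · exact main w hw hne

theorem le_circleAverage_of_laplacian_pos {h : ℂ → ℝ} (hc : ContinuousOn h (closedBall 0 1)) {w₀ : ℂ}
    (hw₀ : w₀ ∈ closedBall (0 : ℂ) 1)
    (hd : ∀ w ∈ ball (0 : ℂ) 1, w ≠ w₀ → ContDiffAt ℝ 2 h w ∧ 0 < Δ h w) :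
    h 0 ≤ circleAverage h 0 1 := by
  refine le_of_forall_pos_le_add fun ε hε => ?_
  obtain ⟨G, hG, hGh⟩ := exists_entire_re_near (hc.mono sphere_subset_closedBall) (half_pos hε)
  have h1 := le_re_of_laplacian_pos hc hw₀ hd (hG.add_const ((ε / 2 : ℝ) : ℂ)) (fun w hw => by
    have := abs_lt.1 (hGh w hw)
    simp only [Complex.add_re, Complex.ofReal_re]
    linarith) 0 (by simp)
  have hGi : CircleIntegrable (fun w => (G w).re) 0 1 :=
    (Complex.continuous_re.comp hG.continuous).continuousOn.circleIntegrable'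
  have h2 : circleAverage (fun w => (G w).re) 0 1 = (G 0).re := by
    refine InnerProductSpace.HarmonicOnNhd.circleAverage_eq fun w _ => ?_
    exact (hG.analyticAt w).harmonicAt_re
  have h3 : circleAverage (fun w => (G w).re - ε / 2) 0 1 ≤ circleAverage h 0 1 := by
    refine circleAverage_mono ?_ ?_ fun w hw => ?_
    · exact ((Complex.continuous_re.comp hG.continuous).sub continuous_const).continuousOn.circleIntegrable'
    · refine ContinuousOn.circleIntegrable' (hc.mono ?_)
      simpa using sphere_subset_closedBall
    · have := abs_lt.1 (hGh w (by simpa using hw)); linarith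
  rw [circleAverage_fun_sub hGi (by exact continuousOn_const.circleIntegrable'), h2,
    circleAverage_const] at h3
  simp only [Complex.add_re, Complex.ofReal_re] at h1
  linarith
end Submean

section LeviHessian

open Laplacian InnerProductSpace Real

variable {n : ℕ} {s : (Fin n → ℂ) → ℝ} {x : Fin n → ℂ}

theorem leviForm_eq_hessian (hs : ContDiffAt ℝ 2 s x) (ξ : Fin n → ℂ) :
    leviForm s x ξ = (fderiv ℝ (fderiv ℝ s) x ξ ξ +
      fderiv ℝ (fderiv ℝ s) x (Complex.I • ξ) (Complex.I • ξ)) / 4 := by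
  set D := fderiv ℝ (fderiv ℝ s) x with hD
  have hev : ∀ᶠ y in 𝓝 x, DifferentiableAt ℝ s y :=
    (hs.eventually (by simp)).mono fun y hy => hy.differentiableAt (by simp)
  have hd2 : HasFDerivAt (fderiv ℝ s) D x :=
    ((hs.fderiv_right (m := 1) (by norm_num)).differentiableAt (by simp)).hasFDerivAt
  have hbar : ∀ ν, (fun w => wderivBar ν (fun u => (s u : ℂ)) w) =ᶠ[𝓝 x] fun w =>
      ((fderiv ℝ s w (Pi.single ν 1) : ℂ) + Complex.I * fderiv ℝ s w (Pi.single ν Complex.I)) / 2 := by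
    intro ν
    filter_upwards [hev] with w hw
    have h1 : fderiv ℝ (fun u => (s u : ℂ)) w = Complex.ofRealCLM.comp (fderiv ℝ s w) :=
      (Complex.ofRealCLM.hasFDerivAt.comp w hw.hasFDerivAt).fderiv
    simp [wderivBar, h1]
  have hw : ∀ μ ν, wderiv μ (fun w => wderivBar ν (fun u => (s u : ℂ)) w) x =
      (((D (Pi.single μ 1) (Pi.single ν 1) + D (Pi.single μ Complex.I) (Pi.single ν Complex.I) : ℝ) : ℂ)
        + Complex.I * ((D (Pi.single μ 1) (Pi.single ν Complex.I)
          - D (Pi.single μ Complex.I) (Pi.single ν 1) : ℝ) : ℂ)) / 4 := by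
    intro μ ν
    have h1 : ∀ v : Fin n → ℂ, HasFDerivAt (fun w => ((fderiv ℝ s w v : ℝ) : ℂ))
        (Complex.ofRealCLM.comp (D.flip v)) x := fun v => by
      have h2 : HasFDerivAt (fun w => fderiv ℝ s w v) (D.flip v) x := by
        have := hd2.clm_apply (hasFDerivAt_const v x)
        exact this.congr_fderiv (by ext y; simp)
      exact Complex.ofRealCLM.hasFDerivAt.comp x h2
    have h3 := ((h1 (Pi.single ν 1)).add ((h1 (Pi.single ν Complex.I)).const_mul Complex.I)).mul_const
      (2⁻¹ : ℂ)
    have h4 : fderiv ℝ (fun w => wderivBar ν (fun u => (s u : ℂ)) w) x = _ :=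
      ((hbar ν).fderiv_eq.trans (by simpa [div_eq_mul_inv] using h3.fderiv))
    rw [wderiv, h4]
    simp
    ring_nf
    simp
    ring
  have hξ := pi_eq_sum_single_re_im ξ
  have hIξ : Complex.I • ξ = ∑ j, ((ξ j).re • (Pi.single j Complex.I : Fin n → ℂ)
      - (ξ j).im • (Pi.single j 1 : Fin n → ℂ)) := by
    ext k
    simp only [Pi.smul_apply, smul_eq_mul, Finset.sum_apply, Pi.sub_apply, Finset.sum_sub_distrib]
    simp only [Pi.single_apply, smul_ite, smul_zero, Finset.sum_ite_eq, Finset.mem_univ, if_true]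
    apply Complex.ext <;> simp
  have h1 : D ξ ξ = ∑ μ, ∑ ν, ((ξ μ).re * ((ξ ν).re * D (Pi.single μ 1) (Pi.single ν 1)) +
      (ξ μ).re * ((ξ ν).im * D (Pi.single μ 1) (Pi.single ν Complex.I)) +
      (ξ μ).im * ((ξ ν).re * D (Pi.single μ Complex.I) (Pi.single ν 1)) +
      (ξ μ).im * ((ξ ν).im * D (Pi.single μ Complex.I) (Pi.single ν Complex.I))) := by
    conv_lhs => rw [hξ]
    simp only [map_sum, sum_apply, map_add, map_smul,
      add_apply, smul_apply, smul_eq_mul]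
    rw [Finset.sum_comm]
    refine Finset.sum_congr rfl fun μ _ => ?_
    rw [Finset.mul_sum, Finset.mul_sum, ← Finset.sum_add_distrib]
    refine Finset.sum_congr rfl fun ν _ => ?_
    ring
  have h2 : D (Complex.I • ξ) (Complex.I • ξ) = ∑ μ, ∑ ν,
      ((ξ μ).im * ((ξ ν).im * D (Pi.single μ 1) (Pi.single ν 1)) -
      (ξ μ).im * ((ξ ν).re * D (Pi.single μ 1) (Pi.single ν Complex.I)) -
      (ξ μ).re * ((ξ ν).im * D (Pi.single μ Complex.I) (Pi.single ν 1)) +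
      (ξ μ).re * ((ξ ν).re * D (Pi.single μ Complex.I) (Pi.single ν Complex.I))) := by
    rw [hIξ]
    simp only [map_sum, sum_apply, map_sub, map_smul,
      sub_apply, smul_apply, smul_eq_mul]
    rw [Finset.sum_comm]
    refine Finset.sum_congr rfl fun μ _ => ?_
    rw [Finset.mul_sum, Finset.mul_sum, ← Finset.sum_sub_distrib]
    refine Finset.sum_congr rfl fun ν _ => ?_
    ring
  rw [h1, h2, leviForm, Complex.re_sum, ← Finset.sum_add_distrib, Finset.sum_div]
  refine Finset.sum_congr rfl fun μ _ => ?_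
  rw [Complex.re_sum, ← Finset.sum_add_distrib, Finset.sum_div]
  refine Finset.sum_congr rfl fun ν _ => ?_
  rw [hw, show (4 : ℂ) = ((4 : ℝ) : ℂ) by norm_num, div_mul_eq_mul_div, div_mul_eq_mul_div,
    Complex.div_ofReal_re]
  congr 1
  simp only [Complex.mul_re, Complex.mul_im, Complex.add_re, Complex.add_im, Complex.ofReal_re,
    Complex.ofReal_im, Complex.I_re, Complex.I_im, Complex.conj_re, Complex.conj_im]
  ring

theorem laplacian_slice {a b : Fin n → ℂ} {w : ℂ} (hs : ContDiffAt ℝ 2 s (a + w • b)) :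
    ContDiffAt ℝ 2 (fun w : ℂ => s (a + w • b)) w ∧
    Δ (fun w : ℂ => s (a + w • b)) w = 4 * leviForm s (a + w • b) b := by
  let L : ℂ →L[ℝ] (Fin n → ℂ) := (ContinuousLinearMap.id ℝ ℂ).smulRight b
  have hL : ∀ w : ℂ, HasFDerivAt (fun w : ℂ => a + w • b) L w := fun w => by
    have := (L.hasFDerivAt (x := w)).const_add a
    exact this
  have hLc : Continuous fun w : ℂ => a + w • b := by fun_prop
  have hc : ContDiffAt ℝ 2 (fun w : ℂ => s (a + w • b)) w :=
    ContDiffAt.comp (f := fun w : ℂ => a + w • b) w hs (by fun_prop)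
  refine ⟨hc, ?_⟩
  have hev : ∀ᶠ y in 𝓝 w, DifferentiableAt ℝ s (a + y • b) :=
    (hLc.tendsto w).eventually
      ((hs.eventually (by simp)).mono fun y hy => hy.differentiableAt (by simp))
  have h1 : fderiv ℝ (fun w : ℂ => s (a + w • b)) =ᶠ[𝓝 w] fun y =>
      (fderiv ℝ s (a + y • b)).comp L := by
    filter_upwards [hev] with y hy
    exact (HasFDerivAt.comp (f := fun w : ℂ => a + w • b) y hy.hasFDerivAt (hL y)).fderiv
  have hd2 : HasFDerivAt (fderiv ℝ s) (fderiv ℝ (fderiv ℝ s) (a + w • b)) (a + w • b) :=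
    ((hs.fderiv_right (m := 1) (by norm_num)).differentiableAt (by simp)).hasFDerivAt
  have h2 : ∀ v, fderiv ℝ (fderiv ℝ (fun w : ℂ => s (a + w • b))) w v v =
      fderiv ℝ (fderiv ℝ s) (a + w • b) (v • b) (v • b) := by
    intro v
    rw [h1.fderiv_eq]
    have h3 : HasFDerivAt (fun y : ℂ => fderiv ℝ s (a + y • b))
        ((fderiv ℝ (fderiv ℝ s) (a + w • b)).comp L) w :=
      HasFDerivAt.comp (f := fun w : ℂ => a + w • b) w hd2 (hL w)
    rw [(h3.clm_comp (hasFDerivAt_const L w)).fderiv]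
    simp [L]
  rw [laplacian_eq_iteratedFDeriv_complexPlane, leviForm_eq_hessian hs]
  simp only [iteratedFDeriv_two_apply]
  simp only [Matrix.cons_val_zero, Matrix.cons_val_one, h2, one_smul]
  ring

theorem le_circleAverage_of_leviForm_pos {a b : Fin n → ℂ}
    (hc : ContinuousOn (fun w : ℂ => s (a + w • b)) (closedBall 0 1)) {w₀ : ℂ}
    (hw₀ : w₀ ∈ closedBall (0 : ℂ) 1)
    (hd : ∀ w ∈ ball (0 : ℂ) 1, w ≠ w₀ →
      ContDiffAt ℝ 2 s (a + w • b) ∧ 0 < leviForm s (a + w • b) b) :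
    s a ≤ circleAverage (fun w : ℂ => s (a + w • b)) 0 1 := by
  have := le_circleAverage_of_laplacian_pos hc hw₀ fun w hw hne => by
    obtain ⟨h1, h2⟩ := hd w hw hne
    obtain ⟨h3, h4⟩ := laplacian_slice h1
    exact ⟨h3, by rw [h4]; linarith⟩
  simpa using this

theorem laplacian_norm_sq (w : ℂ) : Δ (fun w : ℂ => ‖w‖ ^ 2) w = 4 := by
  have h1 : fderiv ℝ (fun w : ℂ => ‖w‖ ^ 2) = fun w => (2 : ℝ) • innerSL ℝ w := by
    funext w; exact (hasStrictFDerivAt_norm_sq w).hasFDerivAt.fderiv.trans (by simp [two_smul])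
  rw [laplacian_eq_iteratedFDeriv_complexPlane]
  simp only [iteratedFDeriv_two_apply, h1]
  have h2 : HasFDerivAt (fun w : ℂ => (2 : ℝ) • innerSL ℝ w) ((2 : ℝ) • innerSL ℝ (E := ℂ)) w :=
    HasFDerivAt.fun_const_smul (innerSL ℝ (E := ℂ)).hasFDerivAt 2
  rw [h2.fderiv]
  have h3 : innerSL ℝ (1 : ℂ) 1 = (1 : ℝ) := by
    rw [innerSL_apply_apply]; simp
  have h4 : innerSL ℝ (Complex.I : ℂ) Complex.I = (1 : ℝ) := by
    rw [innerSL_apply_apply]; simp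
  simp [h3, h4]
  norm_num

theorem continuousAt_leviForm (hs : ContDiffAt ℝ 2 s x) (ξ : Fin n → ℂ) :
    ContinuousAt (fun y => leviForm s y ξ) x := by
  have h1 : ContinuousAt (fderiv ℝ (fderiv ℝ s)) x :=
    ((hs.fderiv_right (m := 1) (by norm_num)).fderiv_right (m := 0) (by norm_num)).continuousAt
  have h2 : (fun y => leviForm s y ξ) =ᶠ[𝓝 x] fun y => (fderiv ℝ (fderiv ℝ s) y ξ ξ +
      fderiv ℝ (fderiv ℝ s) y (Complex.I • ξ) (Complex.I • ξ)) / 4 :=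
    (hs.eventually (by simp)).mono fun y hy => leviForm_eq_hessian hy ξ
  refine ContinuousAt.congr ?_ h2.symm
  fun_prop

theorem le_leviForm_of_submean (hs : ContDiffAt ℝ 2 s x) {q : (Fin n → ℂ) → ℝ} {ξ : Fin n → ℂ}
    (hq : ∀ t : ℝ, 0 < t → q ((t : ℂ) • ξ) = t ^ 2 * q ξ)
    (h : ∀ᶠ b in 𝓝 (0 : Fin n → ℂ), s x + q b ≤ circleAverage (fun w : ℂ => s (x + w • b)) 0 1) :
    q ξ ≤ leviForm s x ξ := by
  by_contra! hlt
  obtain ⟨κ, hκ1, hκ2⟩ := exists_between hlt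
  have hev : ∀ᶠ y in 𝓝 x, ContDiffAt ℝ 2 s y ∧ leviForm s y ξ < κ :=
    (hs.eventually (by simp)).and ((continuousAt_leviForm hs ξ).eventually (gt_mem_nhds hκ1))
  obtain ⟨r, hr, hball⟩ := Metric.eventually_nhds_iff_ball.1 hev
  have ht : ∀ᶠ t : ℝ in 𝓝[>] 0, ‖(t : ℂ) • ξ‖ < r ∧
      s x + q ((t : ℂ) • ξ) ≤ circleAverage (fun w : ℂ => s (x + w • ((t : ℂ) • ξ))) 0 1 := by
    have h1 : Tendsto (fun t : ℝ => (t : ℂ) • ξ) (𝓝[>] 0) (𝓝 0) := by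
      have : Continuous fun t : ℝ => (t : ℂ) • ξ := by fun_prop
      simpa using (this.tendsto 0).mono_left nhdsWithin_le_nhds
    filter_upwards [h1.eventually (ball_mem_nhds (0 : Fin n → ℂ) hr), h1.eventually h] with t h2 h3
    exact ⟨mem_ball_zero_iff.1 h2, h3⟩
  obtain ⟨t, ⟨ht1, ht2⟩, ht0⟩ := (ht.and self_mem_nhdsWithin).exists
  replace ht0 : 0 < t := ht0
  have hin : ∀ w ∈ closedBall (0 : ℂ) 1, x + w • ((t : ℂ) • ξ) ∈ ball x r := fun w hw => by
    rw [mem_ball_iff_norm, add_sub_cancel_left, norm_smul]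
    have := mem_closedBall_zero_iff.1 hw
    nlinarith [norm_nonneg ((t : ℂ) • ξ), norm_nonneg w]
  have hcs : ContinuousOn (fun w : ℂ => s (x + w • ((t : ℂ) • ξ))) (closedBall 0 1) := fun w hw => by
    exact (laplacian_slice (hball _ (hin w hw)).1).1.continuousAt.continuousWithinAt
  have hn : ∀ w : ℂ, ContDiffAt ℝ 2 (fun w : ℂ => (κ * t ^ 2) • ‖w‖ ^ 2) w := fun w =>
    ((contDiff_norm_sq ℝ).const_smul _).contDiffAt
  have key := le_circleAverage_of_laplacian_pos
    (h := (fun w : ℂ => (κ * t ^ 2) • ‖w‖ ^ 2) - fun w : ℂ => s (x + w • ((t : ℂ) • ξ)))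
    (w₀ := 1) (by exact ContinuousOn.sub (by fun_prop) hcs) (by simp) fun w hw _ => by
      obtain ⟨h1, h2⟩ := hball _ (hin w (ball_subset_closedBall hw))
      obtain ⟨h3, h4⟩ := laplacian_slice h1
      refine ⟨(hn w).sub h3, ?_⟩
      rw [(hn w).laplacian_sub h3, h4]
      have h5 : Δ (fun w : ℂ => (κ * t ^ 2) • ‖w‖ ^ 2) w = (κ * t ^ 2) * 4 := by
        have := laplacian_smul (κ * t ^ 2) (contDiff_norm_sq ℝ (n := 2)).contDiffAt (x := w)
        rw [laplacian_norm_sq] at this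
        exact this
      have h6 : leviForm s (x + w • ((t : ℂ) • ξ)) ((t : ℂ) • ξ) = t ^ 2 *
          leviForm s (x + w • ((t : ℂ) • ξ)) ξ := leviForm_smul _ _ _
      rw [h5, h6]
      nlinarith [pow_pos ht0 2]
  have hi : CircleIntegrable (fun w : ℂ => s (x + w • ((t : ℂ) • ξ))) 0 1 :=
    ContinuousOn.circleIntegrable' (hcs.mono (by simpa using sphere_subset_closedBall))
  rw [circleAverage_sub (by exact Continuous.continuousOn (by fun_prop) |>.circleIntegrable') hi,
    circleAverage_const_on_circle (a := κ * t ^ 2) (fun w hw => by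
      have : ‖w‖ = 1 := by simpa using hw
      simp [this])] at key
  simp only [Pi.sub_apply, norm_zero, zero_smul, add_zero, zero_pow two_ne_zero, smul_zero] at key
  have := hq t ht0
  have h7 := mul_lt_mul_of_pos_right hκ2 (pow_pos ht0 2)
  nlinarith

end LeviHessian

section RealMollification

open Real

variable {n : ℕ} {ε : ℝ} {ρ : (Fin n → ℂ) → ℝ} {φ : (Fin n → ℂ) → ℝ} {x : Fin n → ℂ}

/-- Mollification of a real-valued function. -/
def smo {n : ℕ} (ρ φ : (Fin n → ℂ) → ℝ) (x : Fin n → ℂ) : ℝ := ∫ t, ρ t * φ (x - t)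

theorem mol_ofReal : mol ρ (fun y => (φ y : ℂ)) x = (smo ρ φ x : ℂ) := by
  rw [mol, smo, ← integral_complex_ofReal]
  congr 1; ext t; push_cast; ring

theorem IsMoll.contDiff_smo (h : IsMoll ε ρ) (hφ : Continuous φ) : ContDiff ℝ ∞ (smo ρ φ) := by
  have h1 := h.mol_contDiff (u := fun y => (φ y : ℂ))
    (Continuous.locallyIntegrable (by fun_prop))
  have h2 : smo ρ φ = fun x => Complex.reCLM (mol ρ (fun y => (φ y : ℂ)) x) := by
    ext x; rw [mol_ofReal]; simp
  rw [h2]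
  exact Complex.reCLM.contDiff.comp h1

theorem IsMoll.abs_smo_sub_le (h : IsMoll ε ρ) (hφ : Continuous φ) {δ : ℝ}
    (hδ : ∀ y ∈ ball x ε, |φ y - φ x| ≤ δ) : |smo ρ φ x - φ x| ≤ δ := by
  have := h.norm_mol_sub_le (u := fun y => (φ y : ℂ)) (x := x) (δ := δ)
    (Continuous.locallyIntegrable (by fun_prop)) (fun y hy => by
      rw [← Complex.ofReal_sub, Complex.norm_real]; exact hδ y hy)
  rwa [mol_ofReal, ← Complex.ofReal_sub, Complex.norm_real] at this

theorem IsMoll.integrable_smo (h : IsMoll ε ρ) (hφ : Continuous φ) (x : Fin n → ℂ) :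
    Integrable fun t => ρ t * φ (x - t) :=
  Continuous.integrable_of_hasCompactSupport (by have := h.smooth.continuous; fun_prop)
    h.hasCompactSupport.mul_right

theorem IsMoll.smo_mem_Icc (h : IsMoll ε ρ) (hφ : Continuous φ) (h01 : ∀ y, φ y ∈ Icc (0:ℝ) 1) :
    smo ρ φ x ∈ Icc (0:ℝ) 1 := by
  constructor
  · exact integral_nonneg fun t => mul_nonneg (h.nonneg t) (h01 _).1
  · rw [← h.integral_eq]
    refine integral_mono (h.integrable_smo hφ x) h.integrable fun t => ?_
    exact mul_le_of_le_one_right (h.nonneg t) (h01 _).2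

theorem IsMoll.smo_submean (h : IsMoll ε ρ) (hφ : Continuous φ) (hφc : HasCompactSupport φ)
    {b : Fin n → ℂ} {q : ℝ}
    (hx : ∀ a ∈ ball x ε, φ a + q ≤ circleAverage (fun w : ℂ => φ (a + w • b)) 0 1) :
    smo ρ φ x + q ≤ circleAverage (fun w : ℂ => smo ρ φ (x + w • b)) 0 1 := by
  obtain ⟨C, hC⟩ := hφ.bounded_above_of_compact_support hφc
  have hρc := h.smooth.continuous
  have hI : Integrable (Function.uncurry fun (θ : ℝ) (t : Fin n → ℂ) =>
      ρ t * φ (x + circleMap 0 1 θ • b - t)) ((volume.restrict (Ioc 0 (2 * π))).prod volume) := by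
    have h1 : Integrable (fun z : ℝ × (Fin n → ℂ) => C * ρ z.2)
        ((volume.restrict (Ioc 0 (2 * π))).prod volume) :=
      (integrable_const C).mul_prod h.integrable
    refine h1.mono' ?_ (Eventually.of_forall fun z => ?_)
    · refine Continuous.aestronglyMeasurable ?_
      simp only [Function.uncurry_def]
      have : Continuous (circleMap 0 1) := continuous_circleMap 0 1
      fun_prop
    · simp only [Function.uncurry_def, norm_mul, Real.norm_eq_abs, abs_of_nonneg (h.nonneg _)]
      rw [mul_comm]
      exact mul_le_mul_of_nonneg_right (hC _) (h.nonneg _)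
  have h1 : circleAverage (fun w : ℂ => smo ρ φ (x + w • b)) 0 1 =
      ∫ t, ρ t * circleAverage (fun w : ℂ => φ (x - t + w • b)) 0 1 := by
    simp only [circleAverage_def, smo]
    rw [intervalIntegral.integral_of_le two_pi_pos.le, integral_integral_swap hI, ← integral_smul]
    congr 1; ext t
    rw [intervalIntegral.integral_of_le two_pi_pos.le, integral_const_mul]
    simp only [smul_eq_mul]
    have : ∀ θ : ℝ, x + circleMap 0 1 θ • b - t = x - t + circleMap 0 1 θ • b := fun θ => by abel
    simp only [this]
    ring
  have h2 : smo ρ φ x + q = ∫ t, ρ t * (φ (x - t) + q) := by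
    simp only [mul_add]
    rw [integral_add (h.integrable_smo hφ x) (h.integrable.mul_const q), integral_mul_const,
      h.integral_eq, one_mul, smo]
  have hI2 : Integrable fun t => ρ t * circleAverage (fun w : ℂ => φ (x - t + w • b)) 0 1 := by
    refine Continuous.integrable_of_hasCompactSupport ?_ h.hasCompactSupport.mul_right
    refine hρc.mul ?_
    simp only [circleAverage_def]
    have h3 : Continuous (circleMap 0 1) := continuous_circleMap 0 1
    have h4 : Continuous fun t => ∫ θ in (0:ℝ)..2 * π, φ (x - t + circleMap 0 1 θ • b) := by
      refine intervalIntegral.continuous_parametric_intervalIntegral_of_continuous'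
        (f := fun t θ => φ (x - t + circleMap 0 1 θ • b)) (μ := volume) ?_ _ _
      simp only [Function.uncurry_def]
      fun_prop
    exact continuous_const.mul h4
  rw [h1, h2]
  refine integral_mono ?_ hI2 fun t => ?_
  · simp only [mul_add]
    exact (h.integrable_smo hφ x).add (h.integrable.mul_const q)
  · by_cases ht : ‖t‖ < ε
    · exact mul_le_mul_of_nonneg_left (hx _ (by simpa using ht)) (h.nonneg t)
    · simp [h.supp t (not_lt.1 ht)]

/-- Local strict sub-mean-value property along small complex discs. -/
def SubMeanAt {n : ℕ} (φ q : (Fin n → ℂ) → ℝ) (x : Fin n → ℂ) : Prop :=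
  ∃ δ > 0, ∀ a ∈ ball x δ, ∀ b, ‖b‖ < δ →
    φ a + q b ≤ circleAverage (fun w : ℂ => φ (a + w • b)) 0 1

theorem SubMeanAt.uniform {q : (Fin n → ℂ) → ℝ} {T : Set (Fin n → ℂ)} (hT : IsCompact T)
    (h : ∀ x ∈ T, SubMeanAt φ q x) : ∃ δ > 0, ∀ x ∈ T, ∀ a ∈ ball x δ, ∀ b, ‖b‖ < δ →
    φ a + q b ≤ circleAverage (fun w : ℂ => φ (a + w • b)) 0 1 := by
  refine hT.induction_on (p := fun T => ∃ δ > 0, ∀ x ∈ T, ∀ a ∈ ball x δ, ∀ b, ‖b‖ < δ →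
    φ a + q b ≤ circleAverage (fun w : ℂ => φ (a + w • b)) 0 1) ⟨1, one_pos, by simp⟩ ?_ ?_ ?_
  · rintro s t hst ⟨δ, hδ, h⟩
    exact ⟨δ, hδ, fun x hx => h x (hst hx)⟩
  · rintro s t ⟨δ, hδ, h⟩ ⟨δ', hδ', h'⟩
    refine ⟨min δ δ', lt_min hδ hδ', ?_⟩
    rintro x (hx | hx) a ha b hb
    · exact h x hx a (ball_subset_ball (min_le_left _ _) ha) b (hb.trans_le (min_le_left _ _))
    · exact h' x hx a (ball_subset_ball (min_le_right _ _) ha) b (hb.trans_le (min_le_right _ _))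
  · intro x hx
    obtain ⟨δ, hδ, h⟩ := h x hx
    refine ⟨ball x (δ / 2), mem_nhdsWithin_of_mem_nhds (ball_mem_nhds x (half_pos hδ)), δ / 2,
      half_pos hδ, fun y hy a ha b hb => h a ?_ b (hb.trans (half_lt_self hδ))⟩
    have := dist_triangle a y x
    simp only [mem_ball] at *
    linarith

theorem IsMoll.le_leviForm_smo (h : IsMoll ε ρ) (hφ : Continuous φ) (hφc : HasCompactSupport φ)
    {q : (Fin n → ℂ) → ℝ} {ξ : Fin n → ℂ} {δ : ℝ} (hδ : 0 < δ)
    (hq : ∀ t : ℝ, 0 < t → q ((t : ℂ) • ξ) = t ^ 2 * q ξ)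
    (hx : ∀ a ∈ ball x ε, ∀ b, ‖b‖ < δ →
      φ a + q b ≤ circleAverage (fun w : ℂ => φ (a + w • b)) 0 1) :
    q ξ ≤ leviForm (smo ρ φ) x ξ := by
  refine le_leviForm_of_submean
    ((h.contDiff_smo hφ).of_le (WithTop.coe_le_coe.2 le_top)).contDiffAt hq ?_
  filter_upwards [ball_mem_nhds (0 : Fin n → ℂ) hδ] with b hb
  exact h.smo_submean hφ hφc fun a ha => hx a ha b (mem_ball_zero_iff.1 hb)

theorem leviForm_const_sub {s : (Fin n → ℂ) → ℝ} (hs : ContDiffAt ℝ 2 s x) (c : ℝ) (ξ : Fin n → ℂ) :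
    leviForm (fun y => c - s y) x ξ = -leviForm s x ξ := by
  rw [leviForm_eq_hessian hs, leviForm_eq_hessian (contDiffAt_const.sub hs)]
  have h1 : fderiv ℝ (fun y => c - s y) = -fderiv ℝ s := by
    ext1 y; simp [fderiv_const_sub]
  rw [h1, fderiv_neg]
  simp
  ring
end RealMollification

section LocalSolve

open Real (circleAverage)

variable {n : ℕ} {D S K : Set (Fin n → ℂ)} {u φ : (Fin n → ℂ) → ℝ} {lam : Fin n → ℝ} {c A : ℝ}
  {G : (Fin n → ℂ) → ℂ}

theorem continuous_mul_of_tsupport_subset {χ : (Fin n → ℂ) → ℝ} (hD : IsOpen D)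
    (hχ : Continuous χ) (hχD : tsupport χ ⊆ D) (hu : ContinuousOn u D) :
    Continuous fun x => χ x * u x := by
  refine continuous_iff_continuousAt.2 fun x => ?_
  by_cases hx : x ∈ D
  · exact hχ.continuousAt.mul (hu.continuousAt (hD.mem_nhds hx))
  · have h0 : χ =ᶠ[𝓝 x] fun _ => 0 := notMem_tsupport_iff_eventuallyEq.1 fun h => hx (hχD h)
    have : (fun y => χ y * u y) =ᶠ[𝓝 x] fun _ => 0 := h0.mono fun y hy => by simp [hy]
    exact continuousAt_const.congr this.symm

theorem submean_transfer {L : Set (Fin n → ℂ)} {g g' : (Fin n → ℂ) → ℝ} {ε₀ δ : ℝ}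
    (hg : ∀ x ∈ cthickening ε₀ L, g x = g' x) (hδ : δ ≤ ε₀ / 2) {x a b : Fin n → ℂ} (hx : x ∈ L)
    (ha : a ∈ ball x δ) (hb : ‖b‖ < δ) {q : ℝ}
    (h : g a + q ≤ circleAverage (fun w : ℂ => g (a + w • b)) 0 1) :
    g' a + q ≤ circleAverage (fun w : ℂ => g' (a + w • b)) 0 1 := by
  have hax : dist a x < δ := ha
  have hδ0 : 0 < δ := (norm_nonneg b).trans_lt hb
  have key : ∀ y, dist y x ≤ ε₀ → g y = g' y := fun y hy => hg y (by
    exact mem_cthickening_of_dist_le y x ε₀ L hx hy)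
  rw [← key a (by linarith)]
  refine h.trans_eq (Real.circleAverage_congr_sphere fun w hw => key _ ?_)
  have hw1 : ‖w‖ = 1 := by simpa using hw
  have h1 : dist (a + w • b) a = ‖b‖ := by simp [norm_smul, hw1]
  have := dist_triangle (a + w • b) a x
  linarith

theorem exists_local_solution (hD : IsOpen D) (hu : ContinuousOn u D)
    (huc : ∀ t, IsCompact {x ∈ D | u x ≤ t}) (hus : ∀ x ∈ D, SubMeanAt u 0 x)
    (hφ : ContinuousOn φ D) (hφ01 : ∀ x ∈ D, φ x ∈ Icc (0 : ℝ) 1)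
    (hφs : ∀ x ∈ D, SubMeanAt φ 0 x) (hS : IsClosed S) (hc : 0 < c) (hlam : ∀ j, 0 < lam j)
    (hφS : ∀ x ∈ D, x ∈ S → SubMeanAt φ (fun b => c * ∑ j, lam j * ‖b j‖ ^ 2) x)
    (hG : ContDiffOn ℝ ∞ G D) (hGS : ∀ j, ∀ x ∈ D, x ∉ S → wderivBar j G x = 0)
    (hGL : ∀ j, MemLp (wderivBar j G) 2 (volume.restrict D))
    (hA : ∫ x in D, ∑ j, (lam j)⁻¹ * ‖wderivBar j G x‖ ^ 2 ≤ A)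
    (hK : IsCompact K) (hKD : K ⊆ D) :
    ∃ v : (Fin n → ℂ) → ℂ, MemLp v 2 (volume.restrict K) ∧
      eLpNorm v 2 (volume.restrict K) ≤ ENNReal.ofReal (16 * Real.sqrt (A / c)) ∧
      ∀ j θ, IsTest D θ → tsupport θ ⊆ K →
        ∫ x, v x * wderivBar j θ x = -∫ x, wderivBar j G x * θ x := by
  obtain ⟨c₀, hc₀⟩ : ∃ c₀, ∀ x ∈ K, u x ≤ c₀ := by
    obtain ⟨c₀, h⟩ := hK.bddAbove_image (hu.mono hKD)
    exact ⟨c₀, fun x hx => h (mem_image_of_mem u hx)⟩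
  set L : Set (Fin n → ℂ) := {x ∈ D | u x ≤ c₀ + 3} with hLdef
  have hL : IsCompact L := huc _
  have hLD : L ⊆ D := fun x hx => hx.1
  obtain ⟨ε₀, hε₀, hεD⟩ := hL.exists_cthickening_subset_open hD hLD
  obtain ⟨χ, hχs, hχc, hχD, hχ01, hχ1⟩ := exists_cutoff hL.cthickening hD hεD
  have hχ1' : ∀ x ∈ cthickening ε₀ L, χ x = 1 := fun x hx => (hχ1 x hx).self_of_nhds
  set u' : (Fin n → ℂ) → ℝ := fun x => χ x * u x with hu'
  set φ' : (Fin n → ℂ) → ℝ := fun x => χ x * φ x with hφ'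
  have hu'c : Continuous u' := continuous_mul_of_tsupport_subset hD hχs.continuous hχD hu
  have hφ'c : Continuous φ' := continuous_mul_of_tsupport_subset hD hχs.continuous hχD hφ
  have hu's : HasCompactSupport u' := hχc.mul_right
  have hφ's : HasCompactSupport φ' := hχc.mul_right
  have hequ : ∀ x ∈ cthickening ε₀ L, u x = u' x := fun x hx => by simp [hu', hχ1' x hx]
  have heqφ : ∀ x ∈ cthickening ε₀ L, φ x = φ' x := fun x hx => by simp [hφ', hχ1' x hx]
  have hφ'01 : ∀ x, φ' x ∈ Icc (0 : ℝ) 1 := fun x => by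
    by_cases hx : x ∈ D
    · exact ⟨mul_nonneg (hχ01 x).1 (hφ01 x hx).1, mul_le_one₀ (hχ01 x).2 (hφ01 x hx).1 (hφ01 x hx).2⟩
    · have : χ x = 0 := image_eq_zero_of_notMem_tsupport fun h => hx (hχD h)
      simp [hφ', this]
  obtain ⟨δ₁, hδ₁, h₁⟩ := SubMeanAt.uniform hL fun x hx => hus x (hLD hx)
  obtain ⟨δ₂, hδ₂, h₂⟩ := SubMeanAt.uniform hL fun x hx => hφs x (hLD hx)
  obtain ⟨δ₃, hδ₃, h₃⟩ := SubMeanAt.uniform (hL.inter_right hS)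
    fun x hx => hφS x (hLD hx.1) hx.2
  obtain ⟨δ₄, hδ₄, h₄⟩ := Metric.uniformContinuous_iff.1
    (hu's.uniformContinuous_of_continuous hu'c) 1 one_pos
  obtain ⟨δ, hδ, hd₁, hd₂, hd₃, hd₄, hd₅⟩ : ∃ δ > 0, δ ≤ δ₁ ∧ δ ≤ δ₂ ∧ δ ≤ δ₃ ∧ δ ≤ δ₄ ∧ δ ≤ ε₀ / 2 :=
    ⟨min δ₁ (min δ₂ (min δ₃ (min δ₄ (ε₀ / 2)))), by positivity, by simp, by simp, by simp, by simp,
      by simp⟩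
  obtain ⟨ρ, hρ⟩ := exists_isMoll (n := n) hδ
  have hs : ContDiff ℝ ∞ (smo ρ u') := hρ.contDiff_smo hu'c
  have hsφ : ContDiff ℝ ∞ (smo ρ φ') := hρ.contDiff_smo hφ'c
  have hclose : ∀ x ∈ L, |smo ρ u' x - u x| ≤ 1 := fun x hx => by
    rw [hequ x (self_subset_cthickening L hx)]
    exact hρ.abs_smo_sub_le hu'c fun y hy => by
      have := (h₄ (mem_ball.1 hy |>.trans_le hd₄)).le
      rwa [Real.dist_eq] at this
  set Ω : Set (Fin n → ℂ) := {x ∈ D | u x < c₀ + 3 ∧ smo ρ u' x < c₀ + 2} with hΩdef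
  have hΩD : Ω ⊆ D := fun x hx => hx.1
  have hΩL : Ω ⊆ L := fun x hx => ⟨hx.1, hx.2.1.le⟩
  have hKΩ : K ⊆ Ω := fun x hx => by
    have h := hc₀ x hx
    have h' := hclose x ⟨hKD hx, by linarith⟩
    rw [abs_le] at h'
    exact ⟨hKD hx, by linarith, by linarith⟩
  have hΩo : IsOpen Ω := by
    have h := (hu.isOpen_inter_preimage hD (isOpen_Iio (a := c₀ + 3))).inter
      (isOpen_lt hs.continuous (continuous_const (y := c₀ + 2)))
    convert h using 1
    ext x
    exact ⟨fun h => ⟨⟨h.1, h.2.1⟩, h.2.2⟩, fun h => ⟨h.1.1, h.1.2, h.2⟩⟩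
  set R : (Fin n → ℂ) → ℝ := fun x => c₀ + 2 - smo ρ u' x with hR
  have hRs : ContDiff ℝ ∞ R := contDiff_const.sub hs
  obtain ⟨B, hB⟩ : ∃ B, ∀ x ∈ L, ∀ j, ‖wderivBar j (fun y => (R y : ℂ)) x‖ ≤ B := by
    have hRc : ContDiff ℝ ∞ fun y => (R y : ℂ) := Complex.ofRealCLM.contDiff.comp hRs
    have : ∀ j, ∃ B, ∀ x ∈ L, ‖wderivBar j (fun y => (R y : ℂ)) x‖ ≤ B := fun j => by
      refine hL.exists_bound_of_continuousOn ?_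
      rw [wderivBar_eq_dop]
      exact (dop_contDiff hRc).continuous.continuousOn
    choose B hB using this
    refine ⟨∑ j, |B j|, fun x hx j => (hB j x hx).trans ((le_abs_self _).trans ?_)⟩
    exact Finset.single_le_sum (f := fun j => |B j|) (fun i _ => abs_nonneg _) (Finset.mem_univ j)
  have hreg : SuperRegion Ω R B :=
    { isOpen := hΩo
      smooth := hRs.contDiffOn
      pos := fun x hx => by have := hx.2.2; simp only [hR]; linarith
      compact := fun e he => by
        have h := hL.inter_right (isClosed_le continuous_const hRs.continuous : IsClosed {x | e ≤ R x})
        convert h using 1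
        ext x
        constructor
        · exact fun hx => ⟨hΩL hx.1, hx.2⟩
        · rintro ⟨hx, hx2⟩
          have h' := abs_le.1 (hclose x hx)
          simp only [mem_ofPred_eq, hR] at hx2
          exact ⟨⟨hx.1, by linarith, by linarith⟩, hx2⟩
      levi := fun x hx ξ => by
        rw [hR, leviForm_const_sub (hs.of_le (WithTop.coe_le_coe.2 le_top)).contDiffAt]
        have := hρ.le_leviForm_smo (x := x) (ξ := ξ) hu'c hu's (q := 0) hδ (by simp)
          fun a ha b hb => submean_transfer hequ hd₅ (hΩL hx) ha hb
            (h₁ x (hΩL hx) a (ball_subset_ball hd₁ ha) b (hb.trans_le hd₁))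
        simp at this
        linarith
      bound := fun x hx j => hB x (hΩL hx) j }
  have hGat : ∀ x ∈ Ω, ContDiffAt ℝ 2 G x := fun x hx =>
    (hG.contDiffAt (hD.mem_nhds (hΩD hx))).of_le (WithTop.coe_le_coe.2 le_top)
  obtain ⟨v, hv, hv', hv''⟩ := hreg.exists_solution (φ := smo ρ φ') (α := fun j => wderivBar j G)
    (a := A) (c := c) hS.measurableSet hsφ.contDiffOn (fun x _ => hρ.smo_mem_Icc hφ'c hφ'01)
    (fun x hx ξ => hρ.le_leviForm_smo (x := x) (ξ := ξ) hφ'c hφ's (q := 0) hδ (by simp)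
      fun a ha b hb => submean_transfer heqφ hd₅ (hΩL hx) ha hb
        (h₂ x (hΩL hx) a (ball_subset_ball hd₂ ha) b (hb.trans_le hd₂)))
    hc hlam
    (fun x hx hxS ξ => hρ.le_leviForm_smo (x := x) (ξ := ξ) hφ'c hφ's
      (q := fun b => c * ∑ j, lam j * ‖b j‖ ^ 2) hδ
      (fun t ht => by
        simp only [Pi.smul_apply, norm_smul, Complex.norm_real, Real.norm_eq_abs, mul_pow, sq_abs,
          Finset.mul_sum]
        exact Finset.sum_congr rfl fun j _ => by ring)
      fun a ha b hb => submean_transfer heqφ hd₅ (hΩL hx) ha hb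
        (h₃ x ⟨hΩL hx, hxS⟩ a (ball_subset_ball hd₃ ha) b (hb.trans_le hd₃)))
    (fun j => by rw [wderivBar_eq_dop]; exact dop_contDiffOn hΩo (hG.mono hΩD))
    (fun j x hx hxS => hGS j x (hΩD hx) hxS)
    (fun j k x hx => by simp only [wderivBar_eq_dop]; exact dop_comm (hGat x hx))
    (fun j => (hGL j).mono_measure (Measure.restrict_mono hΩD le_rfl))
    (by
      refine le_trans (setIntegral_mono_set ?_ ?_ (Eventually.of_forall hΩD)) hA
      · exact integrable_finsetSum Finset.univ fun j _ => ((hGL j).integrable_norm_pow (by simp)).const_mul _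
      · refine Eventually.of_forall fun x => Finset.sum_nonneg fun j _ => ?_
        have := (hlam j).le
        positivity)
    hK hKΩ
  exact ⟨v, hv, hv', fun j θ hθ hθK => hv'' j θ ⟨hθ.smooth, hθ.compact, hθK.trans hKΩ⟩⟩

end LocalSolve

section GlobalSolve

variable {n : ℕ} {D S : Set (Fin n → ℂ)} {u φ : (Fin n → ℂ) → ℝ} {lam : Fin n → ℝ} {c A : ℝ}
  {G : (Fin n → ℂ) → ℂ}

/-- Hörmander's theorem on a pseudoconvex open set: a smooth function whose `∂̄` lives where the
bounded weight is strictly plurisubharmonic is close in `L²` to a holomorphic function. -/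
theorem exists_differentiableOn_sub_le (hD : IsOpen D) (hu : ContinuousOn u D)
    (huc : ∀ t, IsCompact {x ∈ D | u x ≤ t}) (hus : ∀ x ∈ D, SubMeanAt u 0 x)
    (hφ : ContinuousOn φ D) (hφ01 : ∀ x ∈ D, φ x ∈ Icc (0 : ℝ) 1)
    (hφs : ∀ x ∈ D, SubMeanAt φ 0 x) (hS : IsClosed S) (hc : 0 < c) (hlam : ∀ j, 0 < lam j)
    (hφS : ∀ x ∈ D, x ∈ S → SubMeanAt φ (fun b => c * ∑ j, lam j * ‖b j‖ ^ 2) x)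
    (hG : ContDiffOn ℝ ∞ G D) (hG2 : MemLp G 2 (volume.restrict D))
    (hGS : ∀ j, ∀ x ∈ D, x ∉ S → wderivBar j G x = 0)
    (hGL : ∀ j, MemLp (wderivBar j G) 2 (volume.restrict D))
    (hA : ∫ x in D, ∑ j, (lam j)⁻¹ * ‖wderivBar j G x‖ ^ 2 ≤ A) :
    ∃ h : (Fin n → ℂ) → ℂ, DifferentiableOn ℂ h D ∧
      MemLp (fun x => h x - G x) 2 (volume.restrict D) ∧
      eLpNorm (fun x => h x - G x) 2 (volume.restrict D) ≤
        ENNReal.ofReal (16 * Real.sqrt (A / c)) := by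
  set K : ℕ → Set (Fin n → ℂ) := fun k => {x ∈ D | u x ≤ k} with hKdef
  have hK : ∀ k, IsCompact (K k) := fun k => huc k
  have hKD : ∀ k, K k ⊆ D := fun k x hx => hx.1
  have hKm : ∀ k, MeasurableSet (K k) := fun k => (hK k).measurableSet
  choose v hv hvn hvt using fun k => exists_local_solution hD hu huc hus hφ hφ01 hφs hS hc hlam hφS
    hG hGS hGL hA (hK k) (hKD k)
  obtain ⟨w, hw, hwn, hwl⟩ := exists_weak_limit (hyperfilter ℕ) (μ := volume)
    (u := fun k => (K k).indicator (v k)) (M := 16 * Real.sqrt (A / c)) (by positivity)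
    (fun k => (memLp_indicator_iff_restrict (hKm k)).2 (hv k))
    (fun k => (eLpNorm_indicator_eq_eLpNorm_restrict (hKm k)).trans_le (hvn k))
  have hweak : ∀ j θ, IsTest D θ → ∫ x, w x * wderivBar j θ x = -∫ x, wderivBar j G x * θ x := by
    intro j θ hθ
    have h1 := hwl (wderivBar j θ) ((hθ.wderivBar j).memLp 2)
    refine tendsto_nhds_unique h1 (tendsto_const_nhds.congr' ?_)
    obtain ⟨t, ht⟩ := hθ.compact.isCompact.bddAbove_image (hu.mono hθ.sub)
    obtain ⟨k₀, hk₀⟩ := exists_nat_ge t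
    have h2 : ∀ᶠ k in atTop, tsupport θ ⊆ K k := by
      filter_upwards [eventually_ge_atTop k₀] with k hk x hx
      refine ⟨hθ.sub hx, (ht (mem_image_of_mem u hx)).trans (hk₀.trans ?_)⟩
      exact_mod_cast hk
    refine Filter.Eventually.filter_mono Nat.hyperfilter_le_atTop ?_
    filter_upwards [h2] with k hk
    rw [← hvt k j θ hθ hk]
    congr 1; ext x
    by_cases hx : x ∈ K k
    · rw [indicator_of_mem hx]
    · have : wderivBar j θ x = 0 := by
        rw [wderivBar_eq_dop]
        exact dop_eq_zero_of_notMem_tsupport fun h => hx (hk h)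
      simp [this]
  have hGi : MemLp (D.indicator G) 2 volume := (memLp_indicator_iff_restrict hD.measurableSet).2 hG2
  have hWH : WeakHol D fun x => D.indicator G x - w x := by
    intro j θ hθ
    have hL := (hθ.wderivBar j).memLp 2
    have h1 : ∀ x, D.indicator G x * wderivBar j θ x = G x * wderivBar j θ x := fun x => by
      by_cases hx : x ∈ D
      · rw [indicator_of_mem hx]
      · rw [(hθ.wderivBar j).eq_zero hx]; simp
    have hi1 : Integrable fun x => D.indicator G x * wderivBar j θ x := hGi.integrable_mul hL
    have hi2 : Integrable fun x => w x * wderivBar j θ x := hw.integrable_mul hL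
    simp only [sub_mul]
    rw [integral_sub hi1 hi2, hweak j θ hθ]
    simp only [h1]
    rw [integral_mul_wderivBar hD hG hθ]
    ring
  obtain ⟨h, hh, hae⟩ := hWH.exists_differentiableOn hD (hGi.sub hw)
  have hae2 : (fun x => h x - G x) =ᵐ[volume.restrict D] fun x => -w x := by
    filter_upwards [hae, ae_restrict_mem hD.measurableSet] with x hx hxD
    rw [← hx, indicator_of_mem hxD]; ring
  have hwr : MemLp (fun x => -w x) 2 (volume.restrict D) := (hw.mono_measure Measure.restrict_le_self).neg
  refine ⟨h, hh, hwr.ae_eq hae2.symm, ?_⟩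
  rw [eLpNorm_congr_ae hae2]
  refine (eLpNorm_neg w 2 _).trans_le ?_
  exact (eLpNorm_mono_measure _ Measure.restrict_le_self).trans hwn

end GlobalSolve

section Exhaustion

open Real (circleAverage)

variable {n : ℕ} {D : Set (Fin n → ℂ)} {u : (Fin n → ℂ) → ℝ}

theorem PlurisubharmonicOn.le_circleAverage (h : PlurisubharmonicOn u D) {a b : Fin n → ℂ}
    (hab : ∀ w : ℂ, ‖w‖ ≤ 1 → a + w • b ∈ D) :
    u a ≤ circleAverage (fun w : ℂ => u (a + w • b)) 0 1 := by
  have := h.2 a b 1 one_pos hab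
  rw [Real.circleAverage_def, smul_eq_mul]
  simpa [circleMap] using this

/-- Coordinatewise scaling. -/
def scal {n : ℕ} (s : Fin n → ℝ) (z : Fin n → ℂ) : Fin n → ℂ := fun j => (s j : ℂ) * z j

theorem continuous_scal (s : Fin n → ℝ) : Continuous (scal s) := by
  unfold scal; fun_prop

theorem scal_add_smul (s : Fin n → ℝ) (a b : Fin n → ℂ) (w : ℂ) :
    scal s (a + w • b) = scal s a + w • scal s b := by
  ext j; simp [scal]; ring

theorem scal_zero (s : Fin n → ℝ) : scal s 0 = 0 := by ext; simp [scal]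

theorem PlurisubharmonicOn.subMeanAt_scal (hD : IsOpen D) (h : PlurisubharmonicOn u D)
    (s : Fin n → ℝ) {x : Fin n → ℂ} (hx : scal s x ∈ D) :
    SubMeanAt (fun z => u (scal s z)) 0 x := by
  obtain ⟨δ, hδ, hb⟩ := Metric.isOpen_iff.1 (hD.preimage (continuous_scal s)) x hx
  refine ⟨δ / 2, half_pos hδ, fun a ha b hb' => ?_⟩
  simp only [Pi.zero_apply, add_zero, scal_add_smul]
  refine h.le_circleAverage fun w hw => ?_
  rw [← scal_add_smul]
  apply hb
  have h1 : dist (a + w • b) a ≤ ‖b‖ := by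
    simp only [dist_self_add_left, norm_smul]
    exact mul_le_of_le_one_left (norm_nonneg b) hw
  have h2 := dist_triangle (a + w • b) a x
  have h3 : dist a x < δ / 2 := ha
  rw [mem_ball]
  linarith

/-- A scaled copy of a bounded pseudoconvex open set has a continuous plurisubharmonic
exhaustion. -/
theorem IsPseudoconvex.exists_exhaustion [Nonempty (Fin n)] (hD : IsOpen D)
    (hb : Bornology.IsBounded D)
    (hp : IsPseudoconvex D) {s : Fin n → ℝ} (hs : ∀ j, 0 < s j) :
    ∃ u : (Fin n → ℂ) → ℝ, ContinuousOn u (scal s ⁻¹' D) ∧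
      (∀ t, IsCompact {x ∈ scal s ⁻¹' D | u x ≤ t}) ∧ ∀ x ∈ scal s ⁻¹' D, SubMeanAt u 0 x := by
  have hne : Dᶜ.Nonempty := by
    rw [nonempty_compl]
    rintro rfl
    exact NormedSpace.unbounded_univ ℂ (Fin n → ℂ) hb
  have hpos : ∀ z, z ∈ D ↔ 0 < infDist z Dᶜ := fun z => by
    rw [← hD.isClosed_compl.notMem_iff_infDist_pos hne]; simp
  have hcd : Continuous fun z => infDist (scal s z) Dᶜ :=
    (continuous_infDist_pt _).comp (continuous_scal s)
  refine ⟨fun z => -Real.log (infDist (scal s z) Dᶜ), ?_, fun t => ?_, fun x hx =>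
    PlurisubharmonicOn.subMeanAt_scal hD hp s hx⟩
  · exact (hcd.continuousOn.log fun z hz => ((hpos (scal s z)).1 hz).ne').neg
  · have heq : {x ∈ scal s ⁻¹' D | -Real.log (infDist (scal s x) Dᶜ) ≤ t} =
        {x | Real.exp (-t) ≤ infDist (scal s x) Dᶜ} := by
      ext x
      constructor
      · rintro ⟨hx, hx'⟩
        exact (Real.le_log_iff_exp_le ((hpos _).1 hx)).1 (by linarith)
      · intro hx
        have hx0 : 0 < infDist (scal s x) Dᶜ := (Real.exp_pos _).trans_le hx
        have := (Real.le_log_iff_exp_le hx0).2 hx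
        exact ⟨(hpos _).2 hx0, by linarith⟩
    obtain ⟨M, hM⟩ := hb.exists_norm_le
    refine Metric.isCompact_of_isClosed_isBounded ?_ ?_
    · rw [heq]; exact isClosed_le continuous_const hcd
    · refine isBounded_iff_forall_norm_le.2 ⟨∑ j, M / s j, fun x hx => ?_⟩
      have h1 : ∀ j, ‖x j‖ ≤ M / s j := fun j => by
        rw [le_div_iff₀' (hs j)]
        refine le_trans ?_ ((norm_le_pi_norm (scal s x) j).trans (hM _ hx.1))
        simp [scal, abs_of_pos (hs j)]
      refine (pi_norm_le_iff_of_nonneg ?_).2 fun j => (h1 j).trans ?_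
      · exact Finset.sum_nonneg fun j _ => (norm_nonneg _).trans (h1 j)
      · exact Finset.single_le_sum (f := fun j => M / s j)
          (fun j _ => (norm_nonneg _).trans (h1 j)) (Finset.mem_univ j)

end Exhaustion

section Bergman

variable {n : ℕ} {Ω : Set (Fin n → ℂ)} {f : (Fin n → ℂ) → ℂ} {K : (Fin n → ℂ) → (Fin n → ℂ) → ℂ}
  {w : Fin n → ℂ}

theorem contDiffOn_of_differentiableOn_complex (hΩ : IsOpen Ω) (hf : DifferentiableOn ℂ f Ω) :
    ContDiffOn ℝ ∞ f Ω := by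
  intro x hx
  obtain ⟨r, hr, hrΩ⟩ := Metric.isOpen_iff.1 hΩ x hx
  obtain ⟨ρ, hρ⟩ := exists_isMoll (n := n) (ε := r / 4) (by positivity)
  have hsub : closedBall x (r / 2) ⊆ Ω := (closedBall_subset_ball (by linarith)).trans hrΩ
  have hint : Integrable ((closedBall x (r / 2)).indicator f) :=
    ((hf.continuousOn.mono hsub).integrableOn_compact (isCompact_closedBall _ _)).integrable_indicator
      measurableSet_closedBall
  refine ContDiffAt.contDiffWithinAt ?_
  refine (hρ.mol_contDiff hint.locallyIntegrable).contDiffAt.congr_of_eventuallyEq ?_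
  filter_upwards [ball_mem_nhds x (show 0 < r / 4 by positivity)] with y hy
  have hy' : closedBall y (r / 4) ⊆ closedBall x (r / 2) :=
    closedBall_subset_closedBall' (by rw [mem_ball] at hy; linarith)
  rw [← hρ.mol_eq_self (by positivity) hf (hy'.trans hsub)]
  exact hρ.mol_congr fun z hz => by rw [indicator_of_mem (hy' (ball_subset_closedBall hz))]

theorem MemA2.weakHol (hΩ : IsOpen Ω) (hf : MemA2 Ω f) {j : Fin n} {θ : (Fin n → ℂ) → ℂ}
    (hθ : IsTest Ω θ) : ∫ y, f y * wderivBar j θ y = 0 := by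
  rw [integral_mul_wderivBar hΩ (contDiffOn_of_differentiableOn_complex hΩ hf.1) hθ, neg_eq_zero]
  refine integral_eq_zero_of_ae (Eventually.of_forall fun x => ?_)
  by_cases hx : x ∈ Ω
  · simp [wderivBar_eq_zero_of_differentiableAt (hf.1.differentiableAt (hΩ.mem_nhds hx)) j]
  · simp [hθ.eq_zero hx]

theorem IsBergmanKernel.diag_eq (h : IsBergmanKernel Ω K) (hw : w ∈ Ω) :
    K w w = ((∫ z in Ω, ‖K z w‖ ^ 2 : ℝ) : ℂ) := by
  rw [h.2 _ (h.1 w hw) w hw, ← integral_complex_ofReal]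
  congr 1; ext z
  rw [Complex.mul_conj, Complex.normSq_eq_norm_sq]

theorem IsBergmanKernel.re_diag_eq (h : IsBergmanKernel Ω K) (hw : w ∈ Ω) :
    (K w w).re = ∫ z in Ω, ‖K z w‖ ^ 2 := by
  rw [h.diag_eq hw, Complex.ofReal_re]

theorem IsBergmanKernel.ofReal_re_diag (h : IsBergmanKernel Ω K) (hw : w ∈ Ω) :
    (((K w w).re : ℝ) : ℂ) = K w w := by
  rw [h.re_diag_eq hw, h.diag_eq hw]

theorem IsBergmanKernel.re_diag_nonneg (h : IsBergmanKernel Ω K) (hw : w ∈ Ω) :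
    0 ≤ (K w w).re := by
  rw [h.re_diag_eq hw]; exact integral_nonneg fun z => by positivity

theorem ofReal_integral_norm_sq {μ : Measure (Fin n → ℂ)} (hf : MemLp f 2 μ) :
    ENNReal.ofReal (∫ z, ‖f z‖ ^ 2 ∂μ) = eLpNorm f 2 μ ^ 2 := by
  rw [eLpNorm_two_sq, ofReal_integral_eq_lintegral_ofReal (hf.integrable_norm_pow (by simp))
    (Eventually.of_forall fun z => by positivity)]
  congr 1; ext z
  rw [ENNReal.ofReal_pow (norm_nonneg _), ofReal_norm]

theorem norm_integral_mul_conj_sq_le {μ : Measure (Fin n → ℂ)} {g : (Fin n → ℂ) → ℂ}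
    (hf : MemLp f 2 μ) (hg : MemLp g 2 μ) :
    ‖∫ z, f z * conj (g z) ∂μ‖ ^ 2 ≤ (∫ z, ‖g z‖ ^ 2 ∂μ) * ∫ z, ‖f z‖ ^ 2 ∂μ := by
  rw [integral_mul_conj_eq_inner hf hg, ← norm_toLp_sq hf, ← norm_toLp_sq hg, ← mul_pow]
  exact pow_le_pow_left₀ (norm_nonneg _) (norm_inner_le_norm _ _) 2

theorem IsBergmanKernel.norm_sq_le (h : IsBergmanKernel Ω K) (hw : w ∈ Ω) (hf : MemA2 Ω f) :
    ‖f w‖ ^ 2 ≤ (K w w).re * ∫ z in Ω, ‖f z‖ ^ 2 := by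
  rw [h.re_diag_eq hw, h.2 f hf w hw]
  exact norm_integral_mul_conj_sq_le hf.2 (h.1 w hw).2

end Bergman

section BergmanUpper

variable {n : ℕ} {Ω : Set (Fin n → ℂ)} {K : (Fin n → ℂ) → (Fin n → ℂ) → ℂ} {z : Fin n → ℂ}

theorem IsBergmanKernel.exists_unit_extremal (hΩ : IsOpen Ω) (h : IsBergmanKernel Ω K)
    (z : Fin n → ℂ) :
    ∃ f : (Fin n → ℂ) → ℂ, MemLp f 2 volume ∧ eLpNorm f 2 volume ≤ ENNReal.ofReal 1 ∧
      (z ∈ Ω → (∀ j θ, IsTest Ω θ → ∫ y, f y * wderivBar j θ y = 0) ∧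
        ∀ r ρ, 0 < r → IsMoll r ρ → closedBall z r ⊆ Ω →
          mol ρ f z = (Real.sqrt (K z z).re : ℂ)) := by
  by_cases hz : z ∈ Ω
  swap
  · exact ⟨0, MemLp.zero, by simp, fun h => absurd h hz⟩
  set k := (K z z).re with hk
  have hk0 : 0 ≤ k := h.re_diag_nonneg hz
  set c : ℂ := (((Real.sqrt k)⁻¹ : ℝ) : ℂ) with hc
  have hA : MemA2 Ω fun y => c * K y z :=
    ⟨(h.1 z hz).1.const_mul c, (h.1 z hz).2.const_mul c⟩
  refine ⟨Ω.indicator fun y => c * K y z, (memLp_indicator_iff_restrict hΩ.measurableSet).2 hA.2,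
    ?_, fun _ => ⟨fun j θ hθ => ?_, fun r ρ hr hρ hb => ?_⟩⟩
  · rw [eLpNorm_indicator_eq_eLpNorm_restrict hΩ.measurableSet]
    have h1 : eLpNorm (fun y => c * K y z) 2 (volume.restrict Ω) ^ 2 ≤ 1 ^ 2 := by
      rw [← ofReal_integral_norm_sq hA.2, one_pow, ENNReal.ofReal_le_one]
      simp only [norm_mul, mul_pow]
      rw [integral_const_mul, ← h.re_diag_eq hz, ← hk, hc, Complex.norm_real, Real.norm_eq_abs,
        sq_abs, inv_pow, Real.sq_sqrt hk0]
      exact inv_mul_le_one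
    rw [ENNReal.ofReal_one]
    exact (ENNReal.pow_le_pow_left_iff two_ne_zero).1 h1
  · rw [← MemA2.weakHol hΩ hA (j := j) hθ]
    congr 1; ext y
    by_cases hy : y ∈ Ω
    · rw [indicator_of_mem hy]
    · rw [(hθ.wderivBar j).eq_zero hy]; simp
  · rw [hρ.mol_congr (g := fun y => c * K y z) fun y hy => by
      rw [indicator_of_mem (hb (ball_subset_closedBall hy))], hρ.mol_eq_self hr hA.1 hb,
      ← h.ofReal_re_diag hz, ← hk, hc, ← Complex.ofReal_mul]
    congr 1
    by_cases h0 : Real.sqrt k = 0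
    · have : k = 0 := by rwa [Real.sqrt_eq_zero hk0] at h0
      simp [this]
    · field_simp
      rw [Real.sq_sqrt hk0]

/-- Upper semicontinuity of diagonal Bergman kernels when the limit domain is exhausted. -/
theorem bergman_diag_upper {Ωs : ℕ → Set (Fin n → ℂ)}
    {Ks : ℕ → (Fin n → ℂ) → (Fin n → ℂ) → ℂ} (hΩs : ∀ j, IsOpen (Ωs j)) (hΩ : IsOpen Ω)
    (hex : ∀ L, IsCompact L → L ⊆ Ω → ∀ᶠ j in atTop, L ⊆ Ωs j)
    (hKs : ∀ j, IsBergmanKernel (Ωs j) (Ks j)) (hK : IsBergmanKernel Ω K) (hz : z ∈ Ω)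
    {ε : ℝ} (hε : 0 < ε) : ∀ᶠ j in atTop, (Ks j z z).re < (K z z).re + ε := by
  by_contra hcon
  have hfr : ∃ᶠ j in atTop, (K z z).re + ε ≤ (Ks j z z).re := by
    simpa only [not_eventually, not_lt] using hcon
  set F : Filter ℕ := atTop ⊓ 𝓟 {j | (K z z).re + ε ≤ (Ks j z z).re} with hF
  have : F.NeBot := frequently_iff_neBot.1 hfr
  set 𝒰 := Ultrafilter.of F with h𝒰
  have hU : (𝒰 : Filter ℕ) ≤ F := Ultrafilter.of_le F
  choose f hf hf1 hfz using fun j => (hKs j).exists_unit_extremal (hΩs j) z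
  obtain ⟨g, hg, hg1, hgl⟩ := exists_weak_limit 𝒰 (M := 1) zero_le_one hf hf1
  have hzs : ∀ᶠ j in (𝒰 : Filter ℕ), z ∈ Ωs j := by
    have := (hex {z} isCompact_singleton (singleton_subset_iff.2 hz)).filter_mono
      (hU.trans inf_le_left)
    simpa using this
  have hwh : WeakHol Ω g := fun j θ hθ => by
    refine tendsto_nhds_unique (hgl _ ((hθ.wderivBar j).memLp 2)) (tendsto_const_nhds.congr' ?_)
    filter_upwards [hzs, (hex _ hθ.compact.isCompact hθ.sub).filter_mono (hU.trans inf_le_left)]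
      with k hk hk2
    exact ((hfz k hk).1 j θ ⟨hθ.smooth, hθ.compact, hk2⟩).symm
  obtain ⟨h, hh, hae⟩ := hwh.exists_differentiableOn hΩ hg
  obtain ⟨r, hr, hrΩ⟩ := Metric.isOpen_iff.1 hΩ z hz
  have hr2 : closedBall z (r / 2) ⊆ Ω := (closedBall_subset_ball (by linarith)).trans hrΩ
  obtain ⟨ρ, hρ⟩ := exists_isMoll (n := n) (half_pos hr)
  have hhz : h z = mol ρ g z := by
    rw [← hρ.mol_eq_self (half_pos hr) hh hr2, mol_eq_swap, mol_eq_swap]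
    refine integral_congr_ae ?_
    filter_upwards [(ae_restrict_iff' hΩ.measurableSet).1 hae] with y hy
    by_cases hyΩ : y ∈ Ω
    · rw [hy hyΩ]
    · rw [(hρ.isTest z hr2).eq_zero hyΩ]; simp
  have hlim : Tendsto (fun j => ((Real.sqrt (Ks j z z).re : ℝ) : ℂ)) 𝒰 (𝓝 (h z)) := by
    rw [hhz, mol_eq_swap]
    refine (hgl _ ((hρ.isTest z hr2).memLp 2)).congr' ?_
    filter_upwards [hzs, (hex _ (isCompact_closedBall z (r / 2)) hr2).filter_mono
      (hU.trans inf_le_left)] with k hk hk2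
    rw [← (hfz k hk).2 _ ρ (half_pos hr) hρ hk2, mol_eq_swap]
  have hlim2 : Tendsto (fun j => (Ks j z z).re) 𝒰 (𝓝 (‖h z‖ ^ 2)) := by
    refine (hlim.norm.pow 2).congr' ?_
    filter_upwards [hzs] with j hj
    rw [Complex.norm_real, Real.norm_eq_abs, sq_abs, Real.sq_sqrt ((hKs j).re_diag_nonneg hj)]
  have h1 : (K z z).re + ε ≤ ‖h z‖ ^ 2 := by
    refine ge_of_tendsto hlim2 ?_
    have h2 : F ≤ 𝓟 {j | (K z z).re + ε ≤ (Ks j z z).re} := inf_le_right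
    exact (hU.trans h2) (mem_principal_self _)
  have hhL : MemLp h 2 (volume.restrict Ω) := (hg.mono_measure Measure.restrict_le_self).ae_eq hae
  have h2 : ∫ x in Ω, ‖h x‖ ^ 2 ≤ 1 := by
    rw [← ENNReal.ofReal_le_one, ofReal_integral_norm_sq hhL, ← eLpNorm_congr_ae hae]
    refine pow_le_one₀ bot_le ?_
    exact (eLpNorm_mono_measure _ Measure.restrict_le_self).trans (by simpa using hg1)
  have h3 := hK.norm_sq_le hz ⟨hh, hhL⟩
  have h4 := mul_le_of_le_one_right (hK.re_diag_nonneg hz) h2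
  linarith

end BergmanUpper

section Model

variable {n : ℕ} {o : Fin n} {m : Fin n → ℕ} {P a H : (Fin n → ℂ) → ℝ} {z y : Fin n → ℂ} {t s : ℝ}

/-- The nonisotropic dilation with weights `1 / m j`. -/
def dil {n : ℕ} (m : Fin n → ℕ) (t : ℝ) : (Fin n → ℂ) → (Fin n → ℂ) :=
  scal fun j => t ^ ((m j : ℝ))⁻¹

theorem dil_apply (m : Fin n → ℕ) (t : ℝ) (z : Fin n → ℂ) (j : Fin n) :
    dil m t z j = ((t ^ ((m j : ℝ))⁻¹ : ℝ) : ℂ) * z j := rfl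

theorem dil_dil (hs : 0 ≤ s) (ht : 0 ≤ t) : dil m s (dil m t z) = dil m (s * t) z := by
  ext j
  simp only [dil_apply, Real.mul_rpow hs ht, Complex.ofReal_mul, mul_assoc]

theorem dil_zero_right : dil m t 0 = 0 := scal_zero _

theorem continuous_dil (m : Fin n → ℕ) (t : ℝ) : Continuous (dil m t) := continuous_scal _

theorem norm_dil_apply (ht : 0 ≤ t) (j : Fin n) :
    ‖dil m t z j‖ = t ^ ((m j : ℝ))⁻¹ * ‖z j‖ := by
  rw [dil_apply, norm_mul, Complex.norm_real, Real.norm_eq_abs,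
    abs_of_nonneg (Real.rpow_nonneg ht _)]

theorem norm_dil_apply_pow (hm : 1 ≤ m j) (ht : 0 ≤ t) :
    ‖dil m t z j‖ ^ m j = t * ‖z j‖ ^ m j := by
  rw [norm_dil_apply ht, mul_pow, Real.rpow_inv_natCast_pow ht (by omega)]

/-- A weighted homogeneous function of the variables `z j`, `j ≠ o`. -/
structure IsHomTail {n : ℕ} (o : Fin n) (m : Fin n → ℕ) (H : (Fin n → ℂ) → ℝ) : Prop where
  tail : ∀ z z' : Fin n → ℂ, (∀ j, j ≠ o → z j = z' j) → H z = H z'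
  hom : ∀ t : ℝ, 0 < t → ∀ z, H (dil m t z) = t * H z

/-- The weighted gauge in the variables `z j`, `j ≠ o`. -/
def sig {n : ℕ} (o : Fin n) (m : Fin n → ℕ) (z : Fin n → ℂ) : ℝ :=
  ∑ j ∈ Finset.univ.erase o, ‖z j‖ ^ m j

theorem continuous_sig : Continuous (sig o m) := by unfold sig; fun_prop

theorem sig_nonneg : 0 ≤ sig o m z := Finset.sum_nonneg fun j _ => by positivity

theorem isHomTail_sig (hm : ∀ j, 1 ≤ m j) : IsHomTail o m (sig o m) where
  tail z z' h := Finset.sum_congr rfl fun j hj => by rw [h j (Finset.ne_of_mem_erase hj)]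
  hom t ht z := by
    simp only [sig, Finset.mul_sum]
    exact Finset.sum_congr rfl fun j _ => norm_dil_apply_pow (hm j) ht.le

theorem norm_pow_le_sig {j : Fin n} (hj : j ≠ o) : ‖z j‖ ^ m j ≤ sig o m z :=
  Finset.single_le_sum (f := fun j => ‖z j‖ ^ m j) (fun j _ => by positivity)
    (Finset.mem_erase.2 ⟨hj, Finset.mem_univ j⟩)

theorem sig_pos (h : ∃ j, j ≠ o ∧ z j ≠ 0) : 0 < sig o m z := by
  obtain ⟨j, hj, hz⟩ := h
  exact lt_of_lt_of_le (by have := norm_pos_iff.2 hz; positivity) (norm_pow_le_sig hj)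

theorem IsHomTail.eq_zero (h : IsHomTail o m H) (hz : ∀ j, j ≠ o → z j = 0) : H z = 0 := by
  rw [h.tail z 0 hz]
  have := h.hom 2 two_pos 0
  rw [dil_zero_right] at this
  linarith

/-- The unit sphere of the gauge. -/
def gsph {n : ℕ} (o : Fin n) (m : Fin n → ℕ) : Set (Fin n → ℂ) := {z | z o = 0 ∧ sig o m z = 1}

theorem isCompact_gsph (hm : ∀ j, 1 ≤ m j) : IsCompact (gsph o m) := by
  refine Metric.isCompact_of_isClosed_isBounded ?_ ?_
  · exact (isClosed_eq (continuous_apply o) continuous_const).inter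
      (isClosed_eq continuous_sig continuous_const)
  · refine isBounded_iff_forall_norm_le.2 ⟨1, fun z hz => ?_⟩
    refine (pi_norm_le_iff_of_nonneg zero_le_one).2 fun j => ?_
    by_cases hj : j = o
    · rw [hj, hz.1]; simp
    · have h := norm_pow_le_sig (m := m) (z := z) hj
      rw [hz.2] at h
      exact (pow_le_one_iff_of_nonneg (norm_nonneg _) (by have := hm j; omega)).1 h

theorem ne_of_mem_gsph (hz : z ∈ gsph o m) (hm : ∀ j, 1 ≤ m j) : ∃ j, j ≠ o ∧ z j ≠ 0 := by
  by_contra! h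
  have := (isHomTail_sig hm).eq_zero h
  rw [hz.2] at this
  exact one_ne_zero this

theorem exists_gsph (hm : ∀ j, 1 ≤ m j) (h : ∃ j, j ≠ o ∧ z j ≠ 0) :
    ∃ y ∈ gsph o m, ∀ H, IsHomTail o m H → H z = sig o m z * H y := by
  have ht := sig_pos (m := m) h
  set t := sig o m z
  have key : ∀ H, IsHomTail o m H → H (dil m t⁻¹ (Function.update z o 0)) = t⁻¹ * H z := by
    intro H hH
    rw [hH.hom _ (inv_pos.2 ht), hH.tail (Function.update z o 0) z]
    intro j hj
    simp [hj]
  refine ⟨dil m t⁻¹ (Function.update z o 0), ⟨by simp [dil_apply], ?_⟩, fun H hH => ?_⟩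
  · rw [key _ (isHomTail_sig hm)]
    exact inv_mul_cancel₀ ht.ne'
  · rw [key H hH]; field_simp

theorem IsHomTail.exists_abs_le (h : IsHomTail o m H) (hm : ∀ j, 1 ≤ m j)
    (hc : ContinuousOn H {z | ∃ j, j ≠ o ∧ z j ≠ 0}) : ∃ C > 0, ∀ z, |H z| ≤ C * sig o m z := by
  obtain ⟨C, hC⟩ := (isCompact_gsph (o := o) hm).exists_bound_of_continuousOn
    (hc.mono fun z hz => ne_of_mem_gsph hz hm)
  refine ⟨|C| + 1, by positivity, fun z => ?_⟩
  by_cases hz : ∃ j, j ≠ o ∧ z j ≠ 0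
  · obtain ⟨y, hy, hyH⟩ := exists_gsph hm hz
    rw [hyH H h, abs_mul, abs_of_nonneg sig_nonneg, mul_comm]
    refine mul_le_mul_of_nonneg_right ?_ sig_nonneg
    have := hC y hy
    rw [Real.norm_eq_abs] at this
    linarith [le_abs_self C]
  · push Not at hz
    rw [h.eq_zero hz, abs_zero]
    exact mul_nonneg (by positivity) sig_nonneg

theorem IsHomTail.exists_le (h : IsHomTail o m H) (hm : ∀ j, 1 ≤ m j)
    (hc : ContinuousOn H {z | ∃ j, j ≠ o ∧ z j ≠ 0}) (hpos : ∀ z, (∃ j, j ≠ o ∧ z j ≠ 0) → 0 < H z) :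
    ∃ c > 0, ∀ z, c * sig o m z ≤ H z := by
  obtain ⟨c, hc0, hcH⟩ : ∃ c > 0, ∀ y ∈ gsph o m, c ≤ H y := by
    rcases (gsph o m).eq_empty_or_nonempty with he | hne
    · exact ⟨1, one_pos, by simp [he]⟩
    · obtain ⟨x, hx, hmin⟩ := (isCompact_gsph (o := o) hm).exists_isMinOn hne
        (hc.mono fun z hz => ne_of_mem_gsph hz hm)
      exact ⟨H x, hpos x (ne_of_mem_gsph hx hm), fun y hy => hmin hy⟩
  refine ⟨c, hc0, fun z => ?_⟩
  by_cases hz : ∃ j, j ≠ o ∧ z j ≠ 0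
  · obtain ⟨y, hy, hyH⟩ := exists_gsph hm hz
    rw [hyH H h, mul_comm]
    exact mul_le_mul_of_nonneg_left (hcH y hy) sig_nonneg
  · push Not at hz
    rw [h.eq_zero hz, (isHomTail_sig hm).eq_zero hz, mul_zero]

theorem isOpen_tail_ne (o : Fin n) : IsOpen {z : Fin n → ℂ | ∃ j, j ≠ o ∧ z j ≠ 0} := by
  have : {z : Fin n → ℂ | ∃ j, j ≠ o ∧ z j ≠ 0} = ⋃ j, {z | j ≠ o ∧ z j ≠ 0} := by ext; simp
  rw [this]
  refine isOpen_iUnion fun j => ?_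
  by_cases hj : j = o
  · simp [hj]
  · simpa [hj] using isOpen_ne_fun (continuous_apply j) continuous_const

theorem IsHomTail.continuous (h : IsHomTail o m H) (hm : ∀ j, 1 ≤ m j)
    (hc : ContinuousOn H {z | ∃ j, j ≠ o ∧ z j ≠ 0}) : Continuous H := by
  refine continuous_iff_continuousAt.2 fun z => ?_
  by_cases hz : ∃ j, j ≠ o ∧ z j ≠ 0
  · exact hc.continuousAt ((isOpen_tail_ne o).mem_nhds hz)
  · push Not at hz
    obtain ⟨C, -, hC⟩ := h.exists_abs_le hm hc
    rw [ContinuousAt, h.eq_zero hz]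
    have h1 : Tendsto (fun y => C * sig o m y) (𝓝 z) (𝓝 0) := by
      have := (continuous_sig (o := o) (m := m)).tendsto z
      rw [(isHomTail_sig hm).eq_zero hz] at this
      simpa using this.const_mul C
    exact squeeze_zero_norm (fun y => hC y) h1

end Model

section ModelPsh

open Real (circleAverage)

variable {n : ℕ} {o : Fin n} {m : Fin n → ℕ} {F : (Fin n → ℂ) → ℝ}

/-- A continuous function of the variables `z j`, `j ≠ o`, with positive Levi form off the
`o`-axis satisfies the mean value inequality on every complex line. -/
theorem le_circleAverage_of_tail
    (htail : ∀ z z' : Fin n → ℂ, (∀ j, j ≠ o → z j = z' j) → F z = F z') (hc : Continuous F)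
    (hF : ∀ z : Fin n → ℂ, (∃ j, j ≠ o ∧ z j ≠ 0) → ContDiffAt ℝ 2 F z ∧
      ∀ ξ : Fin n → ℂ, ξ o = 0 → ξ ≠ 0 → 0 < leviForm F z ξ) (a b : Fin n → ℂ) :
    F a ≤ circleAverage (fun w : ℂ => F (a + w • b)) 0 1 := by
  have hcm : ∀ b : Fin n → ℂ, Continuous fun w : ℂ => F (a + w • b) := fun b =>
    hc.comp (by fun_prop)
  set b' := Function.update b o 0 with hb'
  have hbj : ∀ j, j ≠ o → b' j = b j := fun j hj => by simp [hb', hj]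
  have hsame : (fun w : ℂ => F (a + w • b)) = fun w : ℂ => F (a + w • b') := by
    funext w
    refine htail _ _ fun j hj => ?_
    simp [hbj j hj]
  rw [hsame]
  by_cases hb : b' = 0
  · simp [hb, Real.circleAverage_const]
  have hbo : b' o = 0 := by simp [hb']
  obtain ⟨k, hk⟩ : ∃ k, b' k ≠ 0 := by
    by_contra! h
    exact hb (funext h)
  have hko : k ≠ o := fun h => hk (h ▸ hbo)
  have main : ∀ w : ℂ, a k + w * b' k ≠ 0 → ContDiffAt ℝ 2 F (a + w • b') ∧
      0 < leviForm F (a + w • b') b' := fun w hw => by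
    obtain ⟨h1, h2⟩ := hF (a + w • b') ⟨k, hko, by simpa using hw⟩
    exact ⟨h1, h2 b' hbo hb⟩
  have key : ∀ w, w ≠ -a k / b' k → a k + w * b' k ≠ 0 := by
    intro w hw h
    apply hw
    rw [eq_div_iff hk]
    linear_combination h
  by_cases hw₀ : -a k / b' k ∈ closedBall (0 : ℂ) 1
  · exact le_circleAverage_of_leviForm_pos (hcm b').continuousOn hw₀ fun w _ hw =>
      main w (key w hw)
  · refine le_circleAverage_of_leviForm_pos (w₀ := 1) (hcm b').continuousOn (by simp) fun w h _ =>
      main w (key w ?_)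
    rintro rfl
    exact hw₀ (ball_subset_closedBall h)

theorem circleAverage_re_of_differentiable {g : ℂ → ℂ} (hg : Differentiable ℂ g) :
    circleAverage (fun w => (g w).re) 0 1 = (g 0).re := by
  have h1 : circleAverage g 0 1 = g 0 :=
    DiffContOnCl.circleAverage (f := g) (c := 0) (R := 1) hg.diffContOnCl
  rw [← h1, Real.circleAverage_def, Real.circleAverage_def, Complex.smul_re, smul_eq_mul, smul_eq_mul]
  congr 1
  have hint : IntervalIntegrable (fun θ => g (circleMap 0 1 θ)) volume 0 (2 * Real.pi) :=
    (hg.continuous.comp (continuous_circleMap 0 1)).intervalIntegrable _ _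
  exact (Complex.reCLM.intervalIntegral_comp_comm hint)

theorem sqN_add_smul (a b : Fin n → ℂ) (w : ℂ) (hw : ‖w‖ = 1) :
    sqN (a + w • b) = sqN a + sqN b + ((2 * ∑ k, conj (a k) * b k) * w).re := by
  simp only [sqN, Finset.mul_sum, Finset.sum_mul, Complex.re_sum, ← Finset.sum_add_distrib]
  refine Finset.sum_congr rfl fun k _ => ?_
  have hw2 : Complex.normSq w = 1 := by rw [Complex.normSq_eq_norm_sq, hw]; norm_num
  rw [← Complex.normSq_eq_norm_sq, ← Complex.normSq_eq_norm_sq, ← Complex.normSq_eq_norm_sq,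
    Pi.add_apply, Pi.smul_apply, smul_eq_mul, Complex.normSq_add, Complex.normSq_mul, hw2]
  simp only [Complex.mul_re, Complex.mul_im, map_mul, Complex.conj_re, Complex.conj_im,
    Complex.re_ofNat, Complex.im_ofNat]
  ring

/-- The local barrier function. -/
def barr {n : ℕ} (o : Fin n) (F : (Fin n → ℂ) → ℝ) (μ η : ℝ) (z : Fin n → ℂ) : ℝ :=
  (z o + μ * z o ^ 2).re + F z + η * sqN z

theorem continuous_sqN : Continuous (sqN : (Fin n → ℂ) → ℝ) := sqN_contDiff.continuous

theorem continuous_barr (hc : Continuous F) (μ η : ℝ) : Continuous (barr o F μ η) := by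
  unfold barr
  have := continuous_sqN (n := n)
  fun_prop

theorem barr_add_le_circleAverage (hc : Continuous F)
    (hF : ∀ a b : Fin n → ℂ, F a ≤ circleAverage (fun w : ℂ => F (a + w • b)) 0 1)
    (μ η : ℝ) (a b : Fin n → ℂ) :
    barr o F μ η a + η * sqN b ≤ circleAverage (fun w : ℂ => barr o F μ η (a + w • b)) 0 1 := by
  set g : ℂ → ℂ := fun w => (a o + w * b o) + μ * (a o + w * b o) ^ 2 + (η * (sqN a + sqN b) : ℝ)
    + η * ((2 * ∑ k, conj (a k) * b k) * w) with hg
  have hgd : Differentiable ℂ g := by fun_prop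
  have heq : circleAverage (fun w : ℂ => barr o F μ η (a + w • b)) 0 1 =
      circleAverage ((fun w => (g w).re) + fun w : ℂ => F (a + w • b)) 0 1 := by
    refine Real.circleAverage_congr_sphere fun w hw => ?_
    have hw1 : ‖w‖ = 1 := by simpa using hw
    simp only [barr, sqN_add_smul a b w hw1, hg, Pi.add_apply, Pi.smul_apply, smul_eq_mul,
      Complex.add_re, Complex.re_ofReal_mul, Complex.ofReal_re]
    ring
  have hi1 : CircleIntegrable (fun w => (g w).re) 0 1 :=
    (Complex.continuous_re.comp hgd.continuous).continuousOn.circleIntegrable zero_le_one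
  have hi2 : CircleIntegrable (fun w : ℂ => F (a + w • b)) 0 1 :=
    (hc.comp (f := fun w : ℂ => a + w • b) (by fun_prop)).continuousOn.circleIntegrable zero_le_one
  rw [heq, Real.circleAverage_add hi1 hi2, circleAverage_re_of_differentiable hgd]
  have := hF a b
  simp only [barr, hg, Complex.add_re, Complex.re_ofReal_mul, Complex.ofReal_re, zero_mul, add_zero,
    mul_zero] at this ⊢
  linarith

end ModelPsh

section Barrier

open Real (circleAverage)

variable {n : ℕ} {o : Fin n} {m : Fin n → ℕ} {P a F φ φ' q q' : (Fin n → ℂ) → ℝ} {x : Fin n → ℂ}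

theorem SubMeanAt.congr (h : SubMeanAt φ' q x) (he : φ =ᶠ[𝓝 x] φ') : SubMeanAt φ q x := by
  obtain ⟨δ, hδ, h⟩ := h
  obtain ⟨ε, hε, he⟩ := Metric.eventually_nhds_iff_ball.1 he
  refine ⟨min δ (ε / 2), lt_min hδ (half_pos hε), fun a ha b hb => ?_⟩
  have ha' := mem_ball.1 ha
  have h1 := h a (mem_ball.2 (ha'.trans_le (min_le_left _ _))) b (hb.trans_le (min_le_left _ _))
  have h2 := ha'.trans_le (min_le_right δ (ε / 2))
  have h3 := hb.trans_le (min_le_right δ (ε / 2))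
  rw [he a (mem_ball.2 (by linarith))]
  refine h1.trans (le_of_eq (Real.circleAverage_congr_sphere fun w hw => ?_))
  have hw1 : ‖w‖ = 1 := by simpa using hw
  refine (he _ (mem_ball.2 ?_)).symm
  calc dist (a + w • b) x ≤ dist (a + w • b) a + dist a x := dist_triangle _ _ _
    _ = ‖b‖ + dist a x := by rw [dist_eq_norm, add_sub_cancel_left, norm_smul, hw1, one_mul]
    _ < ε := by linarith

theorem SubMeanAt.comp_scal {s : Fin n → ℝ} (h : SubMeanAt φ q (scal s x)) :
    SubMeanAt (fun z => φ (scal s z)) (fun b => q (scal s b)) x := by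
  obtain ⟨δ, hδ, h⟩ := h
  obtain ⟨ε, hε, he⟩ := Metric.continuousAt_iff.1 (continuous_scal s).continuousAt δ hδ
  obtain ⟨ε', hε', he'⟩ := Metric.continuousAt_iff.1 (continuous_scal s).continuousAt δ hδ
  refine ⟨min ε ε', lt_min hε hε', fun a ha b hb => ?_⟩
  have h1 := h (scal s a) (he ((mem_ball.1 ha).trans_le (min_le_left _ _))) (scal s b) (by
    have := he' (x := b) (by rw [dist_zero_right]; exact hb.trans_le (min_le_right _ _))
    rwa [scal_zero, dist_zero_right] at this)
  simpa only [scal_add_smul] using h1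

theorem barr_zero_neg (hm : ∀ j, 1 ≤ m j) (hP : ∀ z, (∀ j, j ≠ o → z j = 0) → P z = 0) {C c : ℝ}
    (hC : 0 < C) (hc : 0 < c)
    (hPC : ∀ z, |P z| ≤ C * sig o m z) (hac : ∀ z, c * sig o m z ≤ a z) :
    ∃ μ > 0, ∀ z, ‖z‖ ≤ 1 → (z o).re + P z ≤ 0 → z ≠ 0 → barr o (fun z => P z - a z) μ 0 z < 0 := by
  set N : ℝ := (n : ℝ) with hN
  have hN0 : 0 ≤ N := by positivity
  obtain ⟨μ, hμ, hμ1, hμ2⟩ : ∃ μ > 0, μ * (2 * C ^ 2 * N) ≤ c / 2 ∧ μ * (2 * (1 + C * N)) ≤ 1 / 2 := by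
    set X := 2 * C ^ 2 * N
    set Y := 2 * (1 + C * N)
    have hX : 0 ≤ X := by positivity
    have hY : 0 ≤ Y := by positivity
    refine ⟨min (c / (2 * (X + 1))) (1 / (2 * (Y + 1))), by positivity, ?_, ?_⟩
    · refine (mul_le_mul_of_nonneg_right (min_le_left _ _) hX).trans ?_
      rw [div_mul_eq_mul_div, div_le_div_iff₀ (by positivity) (by positivity)]
      nlinarith
    · refine (mul_le_mul_of_nonneg_right (min_le_right _ _) hY).trans ?_
      rw [div_mul_eq_mul_div, div_le_div_iff₀ (by positivity) (by positivity)]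
      nlinarith
  refine ⟨μ, hμ, fun z hz hxP hz0 => ?_⟩
  have hzj : ∀ j, ‖z j‖ ≤ 1 := fun j => (norm_le_pi_norm z j).trans hz
  have hsN : sig o m z ≤ N := by
    calc sig o m z ≤ ∑ j ∈ Finset.univ.erase o, (1 : ℝ) :=
          Finset.sum_le_sum fun j _ => pow_le_one₀ (norm_nonneg _) (hzj j)
      _ ≤ ∑ j : Fin n, (1 : ℝ) := Finset.sum_le_sum_of_subset_of_nonneg (Finset.subset_univ _)
          fun _ _ _ => zero_le_one
      _ = N := by simp [hN]
  have hs0 : 0 ≤ sig o m z := sig_nonneg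
  have hPz := hPC z
  have haz := hac z
  set σ := sig o m z with hσ
  set X := (z o).re
  set Y := (z o).im
  set s := -(X + P z) with hs
  have hs1 : 0 ≤ s := by linarith
  have hX1 : |X| ≤ 1 := (Complex.abs_re_le_norm _).trans (hzj o)
  have hs2 : s ≤ 1 + C * N := by
    have h1 := abs_le.1 hPz
    have h2 := abs_le.1 hX1
    have h3 : C * σ ≤ C * N := mul_le_mul_of_nonneg_left hsN hC.le
    linarith [h1.1, h2.1]
  have hP2 : P z ^ 2 ≤ C ^ 2 * N * σ := by
    have h1 : P z ^ 2 ≤ (C * σ) ^ 2 := sq_le_sq' (abs_le.1 hPz).1 (abs_le.1 hPz).2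
    have h2 : C ^ 2 * σ * σ ≤ C ^ 2 * σ * N := mul_le_mul_of_nonneg_left hsN (by positivity)
    nlinarith
  have hs3 : s ^ 2 ≤ (1 + C * N) * s := by nlinarith
  have hX2 : X ^ 2 ≤ 2 * C ^ 2 * N * σ + 2 * (1 + C * N) * s := by
    have : X = -P z - s := by rw [hs]; ring
    rw [this]
    nlinarith [sq_nonneg (P z - s)]
  have hv : barr o (fun z => P z - a z) μ 0 z = -s - a z + μ * X ^ 2 - μ * Y ^ 2 := by
    simp only [barr, hs, X, Y, Complex.add_re, Complex.ofReal_re, Complex.ofReal_im, pow_two, Complex.mul_re]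
    ring
  have hkey : barr o (fun z => P z - a z) μ 0 z ≤ -(s / 2) - c / 2 * σ - μ * Y ^ 2 := by
    rw [hv]
    have h1 := mul_le_mul_of_nonneg_left hX2 hμ.le
    have h2 := mul_le_mul_of_nonneg_right hμ1 hs0
    have h3 := mul_le_mul_of_nonneg_right hμ2 hs1
    nlinarith
  by_contra! hcon
  have hY2 : 0 ≤ μ * Y ^ 2 := by positivity
  have hcσ : 0 ≤ c / 2 * σ := by positivity
  have hs4 : s = 0 := by linarith
  have hσ0 : σ = 0 := by
    have : c / 2 * σ = 0 := by linarith
    simpa [hc.ne'] using this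
  have hY0 : Y = 0 := by
    have : μ * Y ^ 2 = 0 := by linarith
    simpa [hμ.ne'] using this
  have htail : ∀ j, j ≠ o → z j = 0 := fun j hj => by
    have h1 := norm_pow_le_sig (m := m) (z := z) hj
    rw [← hσ, hσ0] at h1
    have h2 := le_antisymm h1 (by positivity)
    simpa using pow_eq_zero_iff (by have := hm j; omega) |>.1 h2
  have hX0 : X = 0 := by have := hP z htail; linarith
  apply hz0
  ext j
  by_cases hj : j = o
  · rw [hj]; exact Complex.ext hX0 hY0
  · exact htail j hj

theorem sqN_le (hz : ‖x‖ ≤ 1) : sqN x ≤ n := by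
  calc sqN x ≤ ∑ j : Fin n, (1 : ℝ) := Finset.sum_le_sum fun j _ =>
        pow_le_one₀ (norm_nonneg _) ((norm_le_pi_norm x j).trans hz)
    _ = n := by simp

theorem sqN_nonneg (x : Fin n → ℂ) : 0 ≤ sqN x := Finset.sum_nonneg fun _ _ => by positivity

/-- A plurisubharmonic cut-off: bounded, strictly plurisubharmonic near `0`, and zero outside the
unit ball, on every open set which is close to the model domain. -/
theorem exists_barrier (hm : ∀ j, 1 ≤ m j) (hPc : Continuous P) (hac : Continuous a)
    (hP : ∀ z, (∀ j, j ≠ o → z j = 0) → P z = 0) (ha : a 0 = 0) {C c : ℝ}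
    (hC : 0 < C) (hc : 0 < c) (hPC : ∀ z, |P z| ≤ C * sig o m z) (hac' : ∀ z, c * sig o m z ≤ a z)
    (hF : ∀ x b : Fin n → ℂ, (P x - a x) ≤
      circleAverage (fun w : ℂ => P (x + w • b) - a (x + w • b)) 0 1) :
    ∃ (ψ : (Fin n → ℂ) → ℝ) (r κ τ : ℝ), 0 < r ∧ 0 < κ ∧ 0 < τ ∧ (∀ z, ψ z ∈ Icc 0 1) ∧
      ∀ W : Set (Fin n → ℂ), IsOpen W → (∀ z ∈ W, ‖z‖ ≤ 1 → (z o).re + P z < τ) →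
        ContinuousOn ψ W ∧ ∀ z ∈ W, SubMeanAt ψ 0 z ∧
          (z ∈ closedBall 0 r → SubMeanAt ψ (fun b => κ * sqN b) z) := by
  set F : (Fin n → ℂ) → ℝ := fun z => P z - a z with hFdef
  have hFc : Continuous F := hPc.sub hac
  obtain ⟨μ, hμ, hneg⟩ := barr_zero_neg hm hP hC hc hPC hac'
  have hann : IsCompact {z : Fin n → ℂ | 1 / 2 ≤ ‖z‖ ∧ ‖z‖ ≤ 1} := by
    have : {z : Fin n → ℂ | 1 / 2 ≤ ‖z‖ ∧ ‖z‖ ≤ 1} = closedBall 0 1 ∩ {z | 1 / 2 ≤ ‖z‖} := by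
      ext z; simp [and_comm]
    rw [this]
    exact (isCompact_closedBall _ _).inter_right (isClosed_le continuous_const continuous_norm)
  have hxPc : Continuous fun z : Fin n → ℂ => (z o).re + P z := by fun_prop
  obtain ⟨c₁, hc₁, hc₁v⟩ : ∃ c₁ > 0, ∀ z : Fin n → ℂ, 1 / 2 ≤ ‖z‖ → ‖z‖ ≤ 1 → (z o).re + P z ≤ 0 →
      barr o F μ 0 z ≤ -c₁ := by
    have hK : IsCompact ({z : Fin n → ℂ | 1 / 2 ≤ ‖z‖ ∧ ‖z‖ ≤ 1} ∩ {z | (z o).re + P z ≤ 0}) :=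
      hann.inter_right (isClosed_le hxPc continuous_const)
    rcases Set.eq_empty_or_nonempty ({z : Fin n → ℂ | 1 / 2 ≤ ‖z‖ ∧ ‖z‖ ≤ 1} ∩
      {z | (z o).re + P z ≤ 0}) with he | hne
    · refine ⟨1, one_pos, fun z h1 h2 h3 => ?_⟩
      have : z ∈ (∅ : Set (Fin n → ℂ)) := he ▸ ⟨⟨h1, h2⟩, h3⟩
      exact this.elim
    · obtain ⟨y, hy, hmax⟩ := hK.exists_isMaxOn hne (continuous_barr hFc μ 0).continuousOn
      refine ⟨-barr o F μ 0 y, ?_, fun z h1 h2 h3 => ?_⟩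
      · have := hneg y hy.1.2 hy.2 (by rintro rfl; have := hy.1.1; norm_num at this)
        exact neg_pos.2 this
      · rw [neg_neg]; exact hmax ⟨⟨h1, h2⟩, h3⟩
  set η := c₁ / (2 * (n + 1)) with hη
  have hη0 : 0 < η := by positivity
  set v := barr o F μ η with hv
  have hvc : Continuous v := continuous_barr hFc μ η
  set e := c₁ / 8 with he
  have he0 : 0 < e := by positivity
  have hv1 : ∀ z : Fin n → ℂ, 1 / 2 ≤ ‖z‖ → ‖z‖ ≤ 1 → (z o).re + P z ≤ 0 → v z < -(2 * e) := by
    intro z h1 h2 h3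
    have h4 := hc₁v z h1 h2 h3
    have h5 : η * sqN z ≤ c₁ / 2 := by
      calc η * sqN z ≤ η * (n + 1) := mul_le_mul_of_nonneg_left (by linarith [sqN_le h2]) hη0.le
        _ = c₁ / 2 := by rw [hη]; field_simp
    have h6 : v z = barr o F μ 0 z + η * sqN z := by simp [hv, barr]
    rw [h6, he]; linarith
  obtain ⟨τ, hτ, hτv⟩ : ∃ τ > 0, ∀ z : Fin n → ℂ, 1 / 2 ≤ ‖z‖ → ‖z‖ ≤ 1 → (z o).re + P z < τ →
      v z < -(2 * e) := by
    have hK : IsCompact ({z : Fin n → ℂ | 1 / 2 ≤ ‖z‖ ∧ ‖z‖ ≤ 1} ∩ {z | -(2 * e) ≤ v z}) :=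
      hann.inter_right (isClosed_le continuous_const hvc)
    rcases Set.eq_empty_or_nonempty ({z : Fin n → ℂ | 1 / 2 ≤ ‖z‖ ∧ ‖z‖ ≤ 1} ∩
      {z | -(2 * e) ≤ v z}) with he | hne
    · refine ⟨1, one_pos, fun z h1 h2 h3 => ?_⟩
      by_contra! hcon
      have : z ∈ (∅ : Set (Fin n → ℂ)) := he ▸ ⟨⟨h1, h2⟩, hcon⟩
      exact this.elim
    · obtain ⟨y, hy, hmin⟩ := hK.exists_isMinOn hne hxPc.continuousOn
      refine ⟨(y o).re + P y, ?_, fun z h1 h2 h3 => ?_⟩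
      · by_contra! hcon
        exact absurd (hv1 y hy.1.1 hy.1.2 hcon) (not_lt.2 hy.2)
      · by_contra! hcon
        exact absurd (hmin ⟨⟨h1, h2⟩, hcon⟩) (not_le.2 h3)
  have hv0 : v 0 = 0 := by simp [hv, barr, hFdef, hP 0 (by simp), ha, sqN]
  obtain ⟨r', hr', hr'v⟩ : ∃ r' > 0, ∀ z ∈ ball (0 : Fin n → ℂ) r', -e < v z :=
    Metric.eventually_nhds_iff_ball.1 (hvc.continuousAt.eventually (lt_mem_nhds (by rw [hv0]; linarith)))
  obtain ⟨B, hB⟩ := (isCompact_closedBall (0 : Fin n → ℂ) 1).exists_bound_of_continuousOn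
    (hvc.add continuous_const (f := v) (g := fun _ => 2 * e)).continuousOn
  set M := |B| + 1 with hM
  have hM0 : 0 < M := by positivity
  set g : (Fin n → ℂ) → ℝ := fun z => M⁻¹ * max (v z + 2 * e) 0 with hg
  have hgc : Continuous g := by fun_prop
  have hvline : ∀ x b : Fin n → ℂ, M⁻¹ * (v x + 2 * e) + M⁻¹ * η * sqN b ≤
      circleAverage (fun w : ℂ => M⁻¹ * (v (x + w • b) + 2 * e)) 0 1 := by
    intro x b
    have h1 := barr_add_le_circleAverage (o := o) hFc hF μ η x b
    have hi : CircleIntegrable (fun w : ℂ => v (x + w • b)) 0 1 :=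
      (hvc.comp (f := fun w : ℂ => x + w • b) (by fun_prop)).continuousOn.circleIntegrable zero_le_one
    have h2 : circleAverage (fun w : ℂ => M⁻¹ * (v (x + w • b) + 2 * e)) 0 1 =
        M⁻¹ * (circleAverage (fun w : ℂ => v (x + w • b)) 0 1 + 2 * e) := by
      have h3 := Real.circleAverage_fun_add hi (circleIntegrable_const (2 * e) 0 1)
      rw [Real.circleAverage_const] at h3
      rw [← h3]
      exact Real.circleAverage_fun_smul (a := M⁻¹) (f := fun w : ℂ => v (x + w • b) + 2 * e)
    rw [h2]
    have := mul_le_mul_of_nonneg_left h1 (inv_pos.2 hM0).le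
    rw [← hv] at this
    linarith
  have hci : ∀ (G : (Fin n → ℂ) → ℝ), Continuous G → ∀ x b : Fin n → ℂ,
      CircleIntegrable (fun w : ℂ => G (x + w • b)) 0 1 := fun G hG x b =>
    (hG.comp (f := fun w : ℂ => x + w • b) (by fun_prop)).continuousOn.circleIntegrable zero_le_one
  have hgsub : ∀ x : Fin n → ℂ, SubMeanAt g 0 x := by
    refine fun x => ⟨1, one_pos, fun y _ b _ => ?_⟩
    simp only [Pi.zero_apply, add_zero]
    have hgi := hci g hgc y b
    rcases le_total (v y + 2 * e) 0 with h | h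
    · have h1 : g y = 0 := by simp [hg, max_eq_right h]
      rw [h1]
      exact Real.circleAverage_nonneg_of_nonneg fun w _ =>
        mul_nonneg (inv_pos.2 hM0).le (le_max_right _ _)
    · have h1 : g y = M⁻¹ * (v y + 2 * e) := by simp [hg, max_eq_left h]
      rw [h1]
      have h2 : 0 ≤ M⁻¹ * η * sqN b := mul_nonneg (by positivity) (sqN_nonneg b)
      have h3 := hvline y b
      refine (by linarith : _ ≤ _).trans (Real.circleAverage_mono
        (hci (fun z => M⁻¹ * (v z + 2 * e)) (by fun_prop) y b) hgi fun w _ => ?_)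
      exact mul_le_mul_of_nonneg_left (le_max_left _ _) (inv_pos.2 hM0).le
  set ψ : (Fin n → ℂ) → ℝ := fun z => if ‖z‖ < 1 then g z else 0 with hψ
  have hψin : ∀ z : Fin n → ℂ, ‖z‖ < 1 → ψ =ᶠ[𝓝 z] g := by
    intro z hz
    filter_upwards [(isOpen_lt continuous_norm continuous_const).mem_nhds hz] with y hy
    exact if_pos hy
  refine ⟨ψ, min (r' / 2) (1 / 2), M⁻¹ * η, τ, by positivity, by positivity, hτ, ?_, ?_⟩
  · intro z
    simp only [hψ]
    split_ifs with h
    · refine ⟨mul_nonneg (inv_pos.2 hM0).le (le_max_right _ _), ?_⟩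
      simp only [hg]
      rw [inv_mul_le_iff₀ hM0, mul_one]
      refine max_le ?_ hM0.le
      have := hB z (by simpa using h.le)
      simp only [Pi.add_apply, Real.norm_eq_abs] at this
      linarith [le_abs_self (v z + 2 * e), le_abs_self B]
    · simp
  intro W hW hWτ
  have hψout : ∀ z ∈ W, ¬ ‖z‖ < 1 → ψ =ᶠ[𝓝 z] fun _ => 0 := by
    intro z hz hz1
    have : {y : Fin n → ℂ | 1 / 2 < ‖y‖} ∈ 𝓝 z :=
      (isOpen_lt continuous_const continuous_norm).mem_nhds (by
        simp only [Set.mem_ofPred_eq]; linarith)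
    filter_upwards [this, hW.mem_nhds hz] with y hy hyW
    simp only [hψ]
    split_ifs with h
    · have := hτv y (le_of_lt hy) h.le (hWτ y hyW h.le)
      simp [hg, max_eq_right (by linarith : v y + 2 * e ≤ 0)]
    · rfl
  refine ⟨fun z hz => ContinuousAt.continuousWithinAt ?_, fun z hz => ⟨?_, fun hzr => ?_⟩⟩
  · by_cases h : ‖z‖ < 1
    · exact hgc.continuousAt.congr (hψin z h).symm
    · exact continuousAt_const.congr (hψout z hz h).symm
  · by_cases h : ‖z‖ < 1
    · exact (hgsub z).congr (hψin z h)
    · refine SubMeanAt.congr ⟨1, one_pos, fun y _ b _ => ?_⟩ (hψout z hz h)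
      simp [Real.circleAverage_const]
  · have hzr' : ‖z‖ ≤ min (r' / 2) (1 / 2) := by simpa using hzr
    have h1 : ‖z‖ < 1 := by have := hzr'.trans (min_le_right _ _); linarith
    have h2 : ‖z‖ < r' := by have := hzr'.trans (min_le_left _ _); linarith
    refine SubMeanAt.congr (φ' := fun z => M⁻¹ * (v z + 2 * e))
      ⟨1, one_pos, fun y _ b _ => hvline y b⟩ ((hψin z h1).trans ?_)
    filter_upwards [isOpen_ball.mem_nhds (show z ∈ ball (0 : Fin n → ℂ) r' by simpa using h2)] with y hy
    have := hr'v y hy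
    simp only [hg]
    rw [max_eq_left (by linarith)]

end Barrier

section ScaledDomains

variable {n : ℕ} {o : Fin n} {m : Fin n → ℕ} {P ρ R : (Fin n → ℂ) → ℝ} {D : Set (Fin n → ℂ)}

theorem eventually_norm_dil_lt (hm : ∀ j, 1 ≤ m j) (r : ℝ) {δ : ℝ} (hδ : 0 < δ) :
    ∀ᶠ s in 𝓝[>] (0 : ℝ), ∀ z : Fin n → ℂ, ‖z‖ ≤ r → ‖dil m s z‖ < δ := by
  have h : ∀ j, ∀ᶠ s in 𝓝[>] (0 : ℝ), s ^ ((m j : ℝ))⁻¹ * r < δ := by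
    intro j
    have hmj : (0 : ℝ) < (m j : ℝ)⁻¹ := by
      have := hm j
      positivity
    have h1 : Tendsto (fun s : ℝ => s ^ ((m j : ℝ))⁻¹ * r) (𝓝 0) (𝓝 (0 ^ ((m j : ℝ))⁻¹ * r)) :=
      ((Real.continuousAt_rpow_const 0 _ (Or.inr hmj.le)).tendsto).mul_const r
    rw [Real.zero_rpow hmj.ne', zero_mul] at h1
    exact (h1.mono_left nhdsWithin_le_nhds).eventually (gt_mem_nhds hδ)
  filter_upwards [eventually_all.2 h, self_mem_nhdsWithin] with s hs hs0 z hz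
  refine (pi_norm_lt_iff hδ).2 fun j => ?_
  rw [norm_dil_apply (le_of_lt hs0)]
  refine lt_of_le_of_lt ?_ (hs j)
  exact mul_le_mul_of_nonneg_left ((norm_le_pi_norm z j).trans hz) (Real.rpow_nonneg (le_of_lt hs0) _)

/-- The scaled domains approach the model domain. -/
theorem eventually_scaled_close (hm : ∀ j, 1 ≤ m j) (hmo : m o = 1) (hP : IsHomTail o m P)
    (hρ : ∀ z, ρ z = (z o).re + P z + R z) (hρ0 : ρ 0 = 0)
    (hR : Tendsto (fun z => R z / (‖z o‖ + sig o m z)) (𝓝[≠] 0) (𝓝 0))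
    (hD : ∀ᶠ z in 𝓝 (0 : Fin n → ℂ), z ∈ D ↔ ρ z < 0) (r : ℝ) {τ : ℝ} (hτ : 0 < τ) :
    ∀ᶠ s in 𝓝[>] (0 : ℝ), ∀ z : Fin n → ℂ, ‖z‖ ≤ r →
      (dil m s z ∈ D → (z o).re + P z < τ) ∧ ((z o).re + P z ≤ -τ → dil m s z ∈ D) := by
  have hgc : Continuous fun z : Fin n → ℂ => ‖z o‖ + sig o m z :=
    (by fun_prop : Continuous fun z : Fin n → ℂ => ‖z o‖).add continuous_sig
  obtain ⟨B, hB⟩ := (isCompact_closedBall (0 : Fin n → ℂ) r).exists_bound_of_continuousOn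
    hgc.continuousOn
  have hg0 : ∀ z : Fin n → ℂ, 0 ≤ ‖z o‖ + sig o m z := fun z => add_nonneg (norm_nonneg _) sig_nonneg
  set ε := τ / (|B| + 1) with hε
  have hε0 : 0 < ε := by positivity
  have hR' : ∀ᶠ z in 𝓝 (0 : Fin n → ℂ), |R z| ≤ ε * (‖z o‖ + sig o m z) := by
    have h1 : ∀ᶠ z in 𝓝[≠] (0 : Fin n → ℂ), |R z| ≤ ε * (‖z o‖ + sig o m z) := by
      have h2 := (Metric.tendsto_nhds.1 hR) ε hε0
      filter_upwards [h2, self_mem_nhdsWithin] with z hz hz0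
      have hpos : 0 < ‖z o‖ + sig o m z := by
        by_cases ho : z o = 0
        · refine add_pos_of_nonneg_of_pos (norm_nonneg _) (sig_pos ?_)
          by_contra! h
          refine hz0 (funext fun j => ?_)
          by_cases hj : j = o
          · rw [hj]; exact ho
          · exact h j hj
        · exact add_pos_of_pos_of_nonneg (norm_pos_iff.2 ho) sig_nonneg
      rw [Real.dist_eq, sub_zero, abs_div, abs_of_pos hpos, div_lt_iff₀ hpos] at hz
      exact hz.le
    rw [eventually_nhdsWithin_iff] at h1
    filter_upwards [h1] with z hz
    by_cases h : z = 0
    · have hR0 : R z = 0 := by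
        have := hρ 0
        rw [hρ0, hP.eq_zero (by simp)] at this
        rw [h]; simpa using this.symm
      rw [hR0, abs_zero]
      exact mul_nonneg hε0.le (hg0 z)
    · exact hz h
  obtain ⟨δ, hδ, hδ'⟩ := Metric.eventually_nhds_iff_ball.1 (hR'.and hD)
  filter_upwards [eventually_norm_dil_lt hm r hδ, self_mem_nhdsWithin] with s hs hs0 z hz
  obtain ⟨h1, h2⟩ := hδ' (dil m s z) (by simpa using hs z hz)
  have hs0 : 0 < s := hs0
  have hN : ‖dil m s z o‖ + sig o m (dil m s z) = s * (‖z o‖ + sig o m z) := by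
    rw [(isHomTail_sig hm).hom s hs0, norm_dil_apply hs0.le, hmo]
    simp [mul_add]
  have hre : (dil m s z o).re = s * (z o).re := by
    rw [dil_apply, hmo, Complex.re_ofReal_mul]; simp
  have hρs : ρ (dil m s z) = s * ((z o).re + P z) + R (dil m s z) := by
    rw [hρ, hre, hP.hom s hs0]; ring
  have hBz : ‖z o‖ + sig o m z < |B| + 1 := by
    have := hB z (by simpa using hz)
    rw [Real.norm_eq_abs, abs_of_nonneg (hg0 z)] at this
    linarith [le_abs_self B]
  have hRs : |R (dil m s z)| < s * τ := by
    rw [hN] at h1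
    refine h1.trans_lt ?_
    calc ε * (s * (‖z o‖ + sig o m z)) = s * (ε * (‖z o‖ + sig o m z)) := by ring
      _ < s * (ε * (|B| + 1)) := by gcongr
      _ = s * τ := by rw [hε]; field_simp
  have h3 := abs_lt.1 hRs
  rw [h2, hρs]
  constructor
  · intro h
    have : s * ((z o).re + P z) < s * τ := by linarith [h3.1]
    exact lt_of_mul_lt_mul_left this hs0.le
  · intro h
    have : s * ((z o).re + P z) ≤ s * (-τ) := mul_le_mul_of_nonneg_left h hs0.le
    linarith [h3.2]

theorem eventually_subset_scaled (hPc : Continuous P)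
    (hclose : ∀ r τ : ℝ, 0 < τ → ∀ᶠ s in 𝓝[>] (0 : ℝ), ∀ z : Fin n → ℂ, ‖z‖ ≤ r →
      (dil m s z ∈ D → (z o).re + P z < τ) ∧ ((z o).re + P z ≤ -τ → dil m s z ∈ D))
    {L : Set (Fin n → ℂ)} (hL : IsCompact L) (hLs : L ⊆ {z | (z o).re + P z < 0}) :
    ∀ᶠ s in 𝓝[>] (0 : ℝ), L ⊆ dil m s ⁻¹' D := by
  rcases L.eq_empty_or_nonempty with rfl | hne
  · simp
  obtain ⟨y, hy, hmax⟩ := hL.exists_isMaxOn hne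
    (by fun_prop : Continuous fun z : Fin n → ℂ => (z o).re + P z).continuousOn
  obtain ⟨r, hr⟩ := hL.isBounded.exists_norm_le
  filter_upwards [hclose r (-((y o).re + P y)) (neg_pos.2 (hLs hy))] with s hs z hz
  exact (hs z (hr z hz)).2 (by rw [neg_neg]; exact hmax hz)

end ScaledDomains

section CutoffCorrection

variable {n : ℕ} {D U : Set (Fin n → ℂ)} {u φ χ : (Fin n → ℂ) → ℝ} {q : Fin n → ℝ}
  {F X : (Fin n → ℂ) → ℂ} {z : Fin n → ℂ}

theorem contDiff_scal (q : Fin n → ℝ) : ContDiff ℝ ∞ (scal q) := by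
  refine contDiff_pi.2 fun j => ?_
  exact contDiff_const.mul (contDiff_apply ℝ ℂ j)

theorem fderiv_scal_single (q : Fin n → ℝ) (z : Fin n → ℂ) (j : Fin n) (c : ℂ) :
    fderiv ℝ (scal q) z (Pi.single j c) = q j • Pi.single j c := by
  let L : (Fin n → ℂ) →L[ℝ] (Fin n → ℂ) :=
    (ContinuousLinearMap.pi fun i => (q i : ℂ) • ContinuousLinearMap.proj (R := ℂ)
      (φ := fun _ : Fin n => ℂ) i).restrictScalars ℝ
  have hL : scal q = ⇑L := rfl
  rw [hL, L.fderiv, ← hL]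
  ext i
  rw [scal]
  by_cases hij : i = j
  · subst hij; simp
  · simp [hij]

theorem wderivBar_comp_scal (hX : DifferentiableAt ℝ X (scal q z)) (j : Fin n) :
    wderivBar j (fun y => X (scal q y)) z = q j * wderivBar j X (scal q z) := by
  have h : fderiv ℝ (fun y => X (scal q y)) z = (fderiv ℝ X (scal q z)).comp (fderiv ℝ (scal q) z) :=
    fderiv_comp z hX ((contDiff_scal q).differentiable (by simp) z)
  simp only [wderivBar, h, ContinuousLinearMap.comp_apply, fderiv_scal_single, map_smul,
    Complex.real_smul]
  ring

theorem wderivBar_cutoff_mul (hU : IsOpen U) (hF : DifferentiableOn ℂ F U) (hX : ContDiff ℝ ∞ X)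
    (hz : scal q z ∈ tsupport X → z ∈ U) (j : Fin n) :
    wderivBar j (fun y => X (scal q y) * F y) z = q j * wderivBar j X (scal q z) * F z := by
  by_cases h : scal q z ∈ tsupport X
  · have hFz := hF.differentiableAt (hU.mem_nhds (hz h))
    have hXz : DifferentiableAt ℝ X (scal q z) := hX.differentiable (by simp) _
    have hXq : DifferentiableAt ℝ (fun y => X (scal q y)) z :=
      hXz.comp z ((contDiff_scal q).differentiable (by simp) z)
    have h0 := wderivBar_eq_zero_of_differentiableAt hFz j
    rw [wderivBar_eq_dop] at h0
    rw [wderivBar_eq_dop, dop_mul hXq (hFz.restrictScalars ℝ), h0, ← wderivBar_eq_dop,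
      wderivBar_comp_scal hXz]
    ring
  · have h1 : wderivBar j X (scal q z) = 0 := by
      rw [wderivBar_eq_dop]; exact dop_eq_zero_of_notMem_tsupport h
    have h2 : (fun y => X (scal q y) * F y) =ᶠ[𝓝 z] fun _ => 0 := by
      filter_upwards [((isClosed_tsupport X).isOpen_compl.preimage (continuous_scal q)).mem_nhds h]
        with y hy
      rw [image_eq_zero_of_notMem_tsupport hy, zero_mul]
    rw [h1, wderivBar_eq_dop, dop_congr h2, dop_const]
    ring

theorem contDiffOn_cutoff_mul (hU : IsOpen U) (hF : DifferentiableOn ℂ F U) (hX : ContDiff ℝ ∞ X)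
    (hz : ∀ z ∈ D, scal q z ∈ tsupport X → z ∈ U) :
    ContDiffOn ℝ ∞ (fun y => X (scal q y) * F y) D := by
  refine fun z hzD => ContDiffAt.contDiffWithinAt ?_
  by_cases h : scal q z ∈ tsupport X
  · have hFz := (contDiffOn_of_differentiableOn_complex hU hF).contDiffAt (hU.mem_nhds (hz z hzD h))
    exact (hX.comp (contDiff_scal q)).contDiffAt.mul hFz
  · have h2 : (fun y => X (scal q y) * F y) =ᶠ[𝓝 z] fun _ => 0 := by
      filter_upwards [((isClosed_tsupport X).isOpen_compl.preimage (continuous_scal q)).mem_nhds h]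
        with y hy
      rw [image_eq_zero_of_notMem_tsupport hy, zero_mul]
    exact contDiffAt_const.congr_of_eventuallyEq h2

theorem exists_cutoff_correction {r r₁ κ B T : ℝ} (hD : IsOpen D) (hu : ContinuousOn u D)
    (huc : ∀ t, IsCompact {x ∈ D | u x ≤ t}) (hus : ∀ x ∈ D, SubMeanAt u 0 x)
    (hφ : ContinuousOn φ D) (hφ01 : ∀ x ∈ D, φ x ∈ Icc (0 : ℝ) 1)
    (hφs : ∀ x ∈ D, SubMeanAt φ 0 x) (hκ : 0 < κ) (hq : ∀ j, 0 < q j)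
    (hφS : ∀ x ∈ D, scal q x ∈ closedBall 0 r → SubMeanAt φ (fun b => κ * sqN (scal q b)) x)
    (hX : ContDiff ℝ ∞ X) (hXs : tsupport X ⊆ ball 0 r) (hX1 : ∀ z, ‖X z‖ ≤ 1)
    (hXr : ∀ z ∈ closedBall 0 r₁, X =ᶠ[𝓝 z] fun _ => 1) (hXB : ∀ j z, ‖wderivBar j X z‖ ≤ B)
    (hU : IsOpen U) (hF : DifferentiableOn ℂ F U) (hFL : MemLp F 2 volume)
    (hDU : ∀ z ∈ D, scal q z ∈ ball 0 r → z ∈ U)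
    (hT : ∫ z in {z | r₁ ≤ ‖scal q z‖}, ‖F z‖ ^ 2 ≤ T) :
    ∃ h : (Fin n → ℂ) → ℂ, DifferentiableOn ℂ h D ∧ MemLp h 2 (volume.restrict D) ∧
      eLpNorm h 2 (volume.restrict D) ≤
        ENNReal.ofReal (16 * √(n * B ^ 2 * T / κ)) + eLpNorm F 2 volume ∧
      ∀ V ⊆ D, MeasurableSet V → (∀ z ∈ V, scal q z ∈ closedBall 0 r₁) →
        MemLp (fun z => h z - F z) 2 (volume.restrict V) ∧
        eLpNorm (fun z => h z - F z) 2 (volume.restrict V) ≤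
          ENNReal.ofReal (16 * √(n * B ^ 2 * T / κ)) := by
  set G : (Fin n → ℂ) → ℂ := fun y => X (scal q y) * F y with hG
  have hsup : ∀ z ∈ D, scal q z ∈ tsupport X → z ∈ U := fun z hz h => hDU z hz (hXs h)
  have hGc : ContDiffOn ℝ ∞ G D := contDiffOn_cutoff_mul hU hF hX hsup
  have hGd : ∀ j, ∀ z ∈ D, wderivBar j G z = q j * wderivBar j X (scal q z) * F z := fun j z hz =>
    wderivBar_cutoff_mul hU hF hX (hsup z hz) j
  have hFLD : MemLp F 2 (volume.restrict D) := hFL.restrict D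
  have hGF : ∀ z, ‖G z‖ ≤ ‖F z‖ := fun z => by
    rw [hG]
    simp only [norm_mul]
    exact mul_le_of_le_one_left (norm_nonneg _) (hX1 _)
  have hGL : MemLp G 2 (volume.restrict D) :=
    hFLD.mono (hGc.continuousOn.aestronglyMeasurable hD.measurableSet) (Eventually.of_forall hGF)
  have hGdL : ∀ j, MemLp (wderivBar j G) 2 (volume.restrict D) := by
    intro j
    refine (hFLD.const_mul ((q j * B : ℝ) : ℂ)).mono ?_ ?_
    · have : ContDiffOn ℝ ∞ (wderivBar j G) D := by
        rw [wderivBar_eq_dop]; exact dop_contDiffOn hD hGc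
      exact this.continuousOn.aestronglyMeasurable hD.measurableSet
    · filter_upwards [ae_restrict_mem hD.measurableSet] with z hz
      rw [hGd j z hz, norm_mul, norm_mul, norm_mul, Complex.norm_real, Complex.norm_real,
        Real.norm_of_nonneg (hq j).le]
      gcongr
      rw [norm_mul, Real.norm_of_nonneg (hq j).le]
      exact mul_le_mul_of_nonneg_left ((hXB j _).trans (le_abs_self B)) (hq j).le
  have hG1 : ∀ z, scal q z ∈ closedBall 0 r₁ → G z = F z := fun z hz => by
    simp only [hG, (hXr _ hz).self_of_nhds, one_mul]
  have hFi : Integrable (fun z => ‖F z‖ ^ 2) volume := (memLp_two_iff_integrable_sq_norm hFL.1).1 hFL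
  have hEm : MeasurableSet {z : Fin n → ℂ | r₁ ≤ ‖scal q z‖} :=
    (isClosed_le continuous_const (continuous_scal q).norm).measurableSet
  have hA : ∫ x in D, ∑ j, (q j ^ 2)⁻¹ * ‖wderivBar j G x‖ ^ 2 ≤ n * B ^ 2 * T := by
    have hIi : Integrable (fun z => n * B ^ 2 *
        {z : Fin n → ℂ | r₁ ≤ ‖scal q z‖}.indicator (fun z => ‖F z‖ ^ 2) z) volume :=
      (hFi.indicator hEm).const_mul _
    have hnn : ∀ z, 0 ≤ n * B ^ 2 *
        {z : Fin n → ℂ | r₁ ≤ ‖scal q z‖}.indicator (fun z => ‖F z‖ ^ 2) z := fun z =>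
      mul_nonneg (by positivity) (indicator_nonneg (fun _ _ => by positivity) _)
    calc ∫ x in D, ∑ j, (q j ^ 2)⁻¹ * ‖wderivBar j G x‖ ^ 2
        ≤ ∫ z in D, n * B ^ 2 *
          {z : Fin n → ℂ | r₁ ≤ ‖scal q z‖}.indicator (fun z => ‖F z‖ ^ 2) z := by
          refine integral_mono_of_nonneg (Eventually.of_forall fun z =>
            Finset.sum_nonneg fun j _ => by positivity) hIi.integrableOn ?_
          filter_upwards [ae_restrict_mem hD.measurableSet] with z hz
          by_cases hE : r₁ ≤ ‖scal q z‖
          · rw [indicator_of_mem (show z ∈ {z : Fin n → ℂ | r₁ ≤ ‖scal q z‖} from hE)]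
            calc ∑ j, (q j ^ 2)⁻¹ * ‖wderivBar j G z‖ ^ 2
                ≤ ∑ j : Fin n, B ^ 2 * ‖F z‖ ^ 2 := by
                  refine Finset.sum_le_sum fun j _ => ?_
                  rw [hGd j z hz, norm_mul, norm_mul, Complex.norm_real,
                    Real.norm_of_nonneg (hq j).le, mul_pow, mul_pow, mul_assoc,
                    inv_mul_cancel_left₀ (pow_ne_zero 2 (hq j).ne')]
                  gcongr
                  exact hXB j _
              _ = n * B ^ 2 * ‖F z‖ ^ 2 := by simp; ring
          · refine le_trans (le_of_eq (Finset.sum_eq_zero fun j _ => ?_)) (hnn z)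
            have : wderivBar j X (scal q z) = 0 := by
              rw [wderivBar_eq_dop, dop_congr (hXr _ (by simpa using (not_le.1 hE).le)), dop_const]
            rw [hGd j z hz, this]
            simp
      _ ≤ ∫ z, n * B ^ 2 *
          {z : Fin n → ℂ | r₁ ≤ ‖scal q z‖}.indicator (fun z => ‖F z‖ ^ 2) z :=
          setIntegral_le_integral hIi (Eventually.of_forall hnn)
      _ = n * B ^ 2 * ∫ z in {z | r₁ ≤ ‖scal q z‖}, ‖F z‖ ^ 2 := by
          rw [integral_const_mul, integral_indicator hEm]
      _ ≤ n * B ^ 2 * T := mul_le_mul_of_nonneg_left hT (by positivity)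
  obtain ⟨h, hh, hhL, hhe⟩ := exists_differentiableOn_sub_le hD hu huc hus hφ hφ01 hφs
    (S := scal q ⁻¹' closedBall 0 r) (isClosed_closedBall.preimage (continuous_scal q)) hκ
    (lam := fun j => q j ^ 2) (fun j => pow_pos (hq j) 2)
    (fun x hx hxS => by
      have := hφS x hx hxS
      convert this using 5 with b j
      refine Finset.sum_congr rfl fun j _ => ?_
      rw [scal, norm_mul, mul_pow, Complex.norm_real, Real.norm_of_nonneg (hq j).le]) hGc hGL
    (fun j x hx hxS => by
      have : wderivBar j X (scal q x) = 0 := by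
        rw [wderivBar_eq_dop]
        exact dop_eq_zero_of_notMem_tsupport fun hh => hxS (ball_subset_closedBall (hXs hh))
      rw [hGd j x hx, this]
      simp) hGdL hA
  have hheq : h = fun z => (h z - G z) + G z := by funext z; simp
  refine ⟨h, hh, ?_, ?_, fun V hV hVm hVr => ?_⟩
  · rw [hheq]; exact hhL.add hGL
  · calc eLpNorm h 2 (volume.restrict D)
        = eLpNorm ((fun z => h z - G z) + G) 2 (volume.restrict D) := by
          congr 1
      _ ≤ eLpNorm (fun z => h z - G z) 2 (volume.restrict D) + eLpNorm G 2 (volume.restrict D) :=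
          eLpNorm_add_le hhL.1 hGL.1 (by norm_num)
      _ ≤ _ := by
          refine add_le_add hhe ((eLpNorm_mono hGF).trans ?_)
          exact eLpNorm_mono_measure _ Measure.restrict_le_self
  · have hae : (fun z => h z - F z) =ᵐ[volume.restrict V] fun z => h z - G z := by
      filter_upwards [ae_restrict_mem hVm] with z hz
      rw [hG1 z (hVr z hz)]
    refine ⟨(hhL.mono_measure (Measure.restrict_mono hV le_rfl)).ae_eq hae.symm, ?_⟩
    rw [eLpNorm_congr_ae hae]
    exact (eLpNorm_mono_measure _ (Measure.restrict_mono hV le_rfl)).trans hhe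

end CutoffCorrection

section LowerBound

variable {n : ℕ} {o : Fin n} {m : Fin n → ℕ} {P ψ : (Fin n → ℂ) → ℝ} {D Ω : Set (Fin n → ℂ)}
  {f : (Fin n → ℂ) → ℂ} {z₀ : Fin n → ℂ}

theorem exists_setIntegral_tail_le {g : (Fin n → ℂ) → ℝ} (hg : Integrable g) {T : ℝ} (hT : 0 < T) :
    ∃ N : ℕ, ∫ z in {z : Fin n → ℂ | (N : ℝ) ≤ ‖z‖}, g z ≤ T := by
  have h := Antitone.tendsto_setIntegral (μ := volume) (f := g)
    (s := fun N : ℕ => {z : Fin n → ℂ | (N : ℝ) ≤ ‖z‖})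
    (fun N => (isClosed_le continuous_const continuous_norm).measurableSet)
    (fun a b hab z (hz : (b : ℝ) ≤ ‖z‖) => show (a : ℝ) ≤ ‖z‖ from le_trans (Nat.cast_le.2 hab) hz) hg.integrableOn
  have he : (⋂ N : ℕ, {z : Fin n → ℂ | (N : ℝ) ≤ ‖z‖}) = ∅ := by
    refine eq_empty_iff_forall_notMem.2 fun z hz => ?_
    obtain ⟨N, hN⟩ := exists_nat_gt ‖z‖
    exact absurd (mem_iInter.1 hz N) (not_le.2 hN)
  rw [he, setIntegral_empty] at h
  obtain ⟨N, hN⟩ := (h.eventually (gt_mem_nhds hT)).exists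
  exact ⟨N, hN.le⟩

theorem exists_smooth_cutoff_bound {r : ℝ} (hr : 0 < r) :
    ∃ (X : (Fin n → ℂ) → ℂ) (B : ℝ), ContDiff ℝ ∞ X ∧ tsupport X ⊆ ball 0 r ∧ (∀ z, ‖X z‖ ≤ 1) ∧
      (∀ z ∈ closedBall (0 : Fin n → ℂ) (r / 2), X =ᶠ[𝓝 z] fun _ => 1) ∧
      ∀ j z, ‖wderivBar j X z‖ ≤ B := by
  obtain ⟨χ, hχ, hχc, hχs, hχ01, hχ1⟩ := exists_cutoff
    (isCompact_closedBall (0 : Fin n → ℂ) (r / 2)) (isOpen_ball (x := 0) (ε := r))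
    (closedBall_subset_ball (by linarith))
  set X : (Fin n → ℂ) → ℂ := fun z => (χ z : ℂ) with hX
  have hsupp : tsupport X = tsupport χ := by
    unfold tsupport; congr 1; ext z; simp [hX]
  have hXt : IsTest (ball (0 : Fin n → ℂ) r) X :=
    ⟨Complex.ofRealCLM.contDiff.comp hχ, by rw [HasCompactSupport, hsupp]; exact hχc,
      hsupp ▸ hχs⟩
  choose B hB using fun j => (hXt.wderivBar j).compact.exists_bound_of_continuous
    (hXt.wderivBar j).continuous
  refine ⟨X, ∑ j, |B j|, hXt.smooth, hXt.sub, fun z => ?_, fun z hz => ?_, fun j z => ?_⟩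
  · rw [hX]
    simp only [Complex.norm_real, Real.norm_eq_abs]
    exact abs_le.2 ⟨by linarith [(hχ01 z).1], (hχ01 z).2⟩
  · filter_upwards [hχ1 z hz] with y hy
    simp [hX, hy]
  · exact ((hB j z).trans (le_abs_self _)).trans
      (Finset.single_le_sum (f := fun j => |B j|) (fun _ _ => abs_nonneg _) (Finset.mem_univ j))

theorem tendsto_div_right_zero {s₁ : ℝ} (hs₁ : 0 < s₁) :
    Tendsto (fun s : ℝ => s / s₁) (𝓝[>] 0) (𝓝[>] 0) := by
  refine tendsto_nhdsWithin_iff.2 ⟨?_, ?_⟩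
  · have : Tendsto (fun s : ℝ => s / s₁) (𝓝 0) (𝓝 (0 / s₁)) := tendsto_id.div_const s₁
    rw [zero_div] at this
    exact this.mono_left nhdsWithin_le_nhds
  · filter_upwards [self_mem_nhdsWithin] with s hs
    exact div_pos hs hs₁

theorem memLp_and_eLpNorm_comp_sub_right {g : (Fin n → ℂ) → ℂ} (hg : MemLp g 2 volume) (v : Fin n → ℂ) :
    MemLp (fun z => g (z - v)) 2 volume ∧
      eLpNorm (fun z => g (z - v)) 2 volume = eLpNorm g 2 volume ∧
      ∀ S : Set (Fin n → ℂ), MeasurableSet S → ∀ S' ⊆ (fun z => z - v) ⁻¹' S,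
        ∫ z in S', ‖g (z - v)‖ ^ 2 ≤ ∫ z in S, ‖g z‖ ^ 2 := by
  have hmp : MeasurePreserving (fun z : Fin n → ℂ => z - v) volume volume :=
    measurePreserving_sub_right volume v
  have h1 : MemLp (fun z => g (z - v)) 2 volume := hg.comp_measurePreserving hmp
  refine ⟨h1, eLpNorm_comp_measurePreserving hg.1 hmp, fun S _ S' hS' => ?_⟩
  have hi := (memLp_two_iff_integrable_sq_norm h1.1).1 h1
  refine (setIntegral_mono_set hi.integrableOn (Eventually.of_forall fun z => ?_)
    hS'.eventuallyLE).trans (le_of_eq ?_)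
  · exact sq_nonneg _
  · exact hmp.setIntegral_preimage_emb (MeasurableEquiv.subRight v).measurableEmbedding
      (fun z => ‖g z‖ ^ 2) S

set_option maxHeartbeats 2000000 in
/-- Functions in the Bergman space of the model domain are approximated by functions in the
Bergman spaces of the scaled domains, without increasing norms. -/
theorem eventually_exists_approx (hm : ∀ j, 1 ≤ m j) (hmo : m o = 1) (hP : IsHomTail o m P)
    (hPc : Continuous P) (hD : IsOpen D) (hDb : Bornology.IsBounded D) (hDp : IsPseudoconvex D)
    (hclose : ∀ r τ : ℝ, 0 < τ → ∀ᶠ s in 𝓝[>] (0 : ℝ), ∀ z : Fin n → ℂ, ‖z‖ ≤ r →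
      (dil m s z ∈ D → (z o).re + P z < τ) ∧ ((z o).re + P z ≤ -τ → dil m s z ∈ D))
    {r κ τ : ℝ} (hr : 0 < r) (hκ : 0 < κ) (hτ : 0 < τ) (hψ : ∀ z, ψ z ∈ Icc (0 : ℝ) 1)
    (hψW : ∀ W : Set (Fin n → ℂ), IsOpen W → (∀ z ∈ W, ‖z‖ ≤ 1 → (z o).re + P z < τ) →
        ContinuousOn ψ W ∧ ∀ z ∈ W, SubMeanAt ψ 0 z ∧
          (z ∈ closedBall 0 r → SubMeanAt ψ (fun b => κ * sqN b) z))
    (hΩ : Ω = {z | (z o).re + P z < 0}) (hf : MemA2 Ω f) (hz₀ : z₀ ∈ Ω) {e : ℝ} (he : 0 < e) :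
    ∀ᶠ s in 𝓝[>] (0 : ℝ), ∃ h, MemA2 (dil m s ⁻¹' D) h ∧
      eLpNorm h 2 (volume.restrict (dil m s ⁻¹' D)) ≤
        ENNReal.ofReal e + eLpNorm f 2 (volume.restrict Ω) ∧ ‖h z₀ - f z₀‖ ≤ e := by
  have : Nonempty (Fin n) := ⟨o⟩
  have hlc : Continuous fun z : Fin n → ℂ => (z o).re + P z := by fun_prop
  have hΩo : IsOpen Ω := hΩ ▸ isOpen_lt hlc continuous_const
  obtain ⟨X, B, hX, hXs, hX1, hXr, hXB⟩ := exists_smooth_cutoff_bound (n := n) hr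
  obtain ⟨ε, hε, hεΩ⟩ := Metric.nhds_basis_closedBall.mem_iff.1 (hΩo.mem_nhds hz₀)
  obtain ⟨M, hM, hMh⟩ := exists_norm_sq_le_of_differentiableOn n hε
  obtain ⟨e', he', he'e, hMe'⟩ : ∃ e' > 0, e' ≤ e ∧ M * e' ^ 2 ≤ (e / 2) ^ 2 := by
    refine ⟨min e (e / (2 * (M + 1))), by positivity, min_le_left _ _, ?_⟩
    have h1 : (min e (e / (2 * (M + 1)))) ^ 2 ≤ (e / (2 * (M + 1))) ^ 2 :=
      pow_le_pow_left₀ (by positivity) (min_le_right _ _) 2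
    refine (mul_le_mul_of_nonneg_left h1 hM.le).trans ?_
    rw [div_pow, div_pow, mul_div_assoc', div_le_div_iff₀ (by positivity) (by positivity)]
    have : M ≤ (M + 1) ^ 2 := by nlinarith
    nlinarith [mul_le_mul_of_nonneg_left this (by positivity : 0 ≤ e ^ 2 * 2 ^ 2)]
  set T := κ * (e' / 16) ^ 2 / (n * B ^ 2 + 1) with hT
  have hT0 : 0 < T := by positivity
  have hTe : 16 * √(n * B ^ 2 * T / κ) ≤ e' := by
    have h1 : n * B ^ 2 * T / κ ≤ (e' / 16) ^ 2 := by
      rw [hT]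
      have : n * B ^ 2 * (κ * (e' / 16) ^ 2 / (n * B ^ 2 + 1)) / κ =
        (n * B ^ 2) * (e' / 16) ^ 2 / (n * B ^ 2 + 1) := by field_simp
      rw [this, div_le_iff₀ (by positivity)]
      nlinarith [sq_nonneg (e' / 16)]
    have h2 := Real.sqrt_le_sqrt h1
    rw [Real.sqrt_sq (by positivity)] at h2
    linarith
  set f₀ := Ω.indicator f with hf₀
  have hf₀L : MemLp f₀ 2 volume := (memLp_indicator_iff_restrict hΩo.measurableSet).2 hf.2
  have hf₀i : Integrable (fun z => ‖f₀ z‖ ^ 2) volume :=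
    (memLp_two_iff_integrable_sq_norm hf₀L.1).1 hf₀L
  obtain ⟨N, hN⟩ := exists_setIntegral_tail_le hf₀i hT0
  obtain ⟨s₁, hs₁r, hs₁⟩ := ((eventually_norm_dil_lt hm (max ((N : ℝ) + 1) (‖z₀‖ + ε))
    (half_pos hr)).and self_mem_nhdsWithin).exists
  have hs₁ : 0 < s₁ := hs₁
  set E : Fin n → ℂ := Pi.single o 1 with hE
  obtain ⟨t, ⟨htf, ht1⟩, ht0⟩ : ∃ t : ℝ, (‖f (z₀ - (t : ℂ) • E) - f z₀‖ < e / 2 ∧ t < 1) ∧ 0 < t := by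
    have h1 : ContinuousAt f (z₀ - ((0 : ℝ) : ℂ) • E) := by
      have := (hf.1.differentiableAt (hΩo.mem_nhds hz₀)).continuousAt
      simpa using this
    have h2 : ContinuousAt (fun t : ℝ => f (z₀ - (t : ℂ) • E)) 0 :=
      ContinuousAt.comp (f := fun t : ℝ => z₀ - (t : ℂ) • E) h1 (by fun_prop)
    have h3 := Metric.tendsto_nhds.1 h2.tendsto (e / 2) (half_pos he)
    simp only [Complex.ofReal_zero, zero_smul, sub_zero, dist_eq_norm] at h3
    have h4 : ∀ᶠ t in 𝓝[>] (0 : ℝ), 0 < t := self_mem_nhdsWithin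
    exact (((h3.and (gt_mem_nhds one_pos)).filter_mono nhdsWithin_le_nhds).and h4).exists
  have htE : ∀ z : Fin n → ℂ, ((z - (t : ℂ) • E) o).re + P (z - (t : ℂ) • E) =
      (z o).re + P z - t := by
    intro z
    rw [hP.tail (z - (t : ℂ) • E) z fun j hj => by simp [hE, hj]]
    simp [hE]; ring
  set F : (Fin n → ℂ) → ℂ := fun z => f₀ (z - (t : ℂ) • E) with hF
  set U : Set (Fin n → ℂ) := {z | (z o).re + P z < t} with hU
  have hUo : IsOpen U := isOpen_lt hlc continuous_const
  have hUΩ : ∀ z ∈ U, z - (t : ℂ) • E ∈ Ω := fun z hz => by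
    have hz' : (z o).re + P z < t := hz
    rw [hΩ]
    show ((z - (t : ℂ) • E) o).re + P (z - (t : ℂ) • E) < 0
    rw [htE]; linarith
  have hFU : DifferentiableOn ℂ F U := by
    have h1 : DifferentiableOn ℂ (fun z => f (z - (t : ℂ) • E)) U :=
      hf.1.comp (f := fun z => z - (t : ℂ) • E)
        (differentiableOn_id.sub (differentiableOn_const _)) hUΩ
    exact h1.congr fun z hz => indicator_of_mem (hUΩ z hz) f
  obtain ⟨hFL, hFn', hFt⟩ := memLp_and_eLpNorm_comp_sub_right hf₀L ((t : ℂ) • E)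
  have hFn : eLpNorm F 2 volume = eLpNorm f 2 (volume.restrict Ω) :=
    hFn'.trans (eLpNorm_indicator_eq_eLpNorm_restrict hΩo.measurableSet)
  have hEn : ‖(t : ℂ) • E‖ ≤ 1 := by
    rw [norm_smul, Complex.norm_real, Real.norm_of_nonneg ht0.le, hE, Pi.norm_single, norm_one,
      mul_one]
    exact ht1.le
  have htail : ∫ z in {z | r / 2 ≤ ‖dil m s₁ z‖}, ‖F z‖ ^ 2 ≤ T := by
    refine le_trans ?_ hN
    have hm1 : MeasurableSet {z : Fin n → ℂ | (N : ℝ) ≤ ‖z‖} :=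
      (isClosed_le continuous_const continuous_norm).measurableSet
    have hsub : {z | r / 2 ≤ ‖dil m s₁ z‖} ⊆
        (fun z : Fin n → ℂ => z - (t : ℂ) • E) ⁻¹' {z : Fin n → ℂ | (N : ℝ) ≤ ‖z‖} := by
      intro z hz
      by_contra hcon
      have h1 : ‖z - (t : ℂ) • E‖ < N := not_le.1 hcon
      have h2 : ‖z‖ ≤ N + 1 := by
        calc ‖z‖ = ‖(z - (t : ℂ) • E) + (t : ℂ) • E‖ := by rw [sub_add_cancel]
          _ ≤ ‖z - (t : ℂ) • E‖ + ‖(t : ℂ) • E‖ := norm_add_le _ _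
          _ ≤ N + 1 := add_le_add h1.le hEn
      exact absurd (hs₁r z (h2.trans (le_max_left _ _))) (not_lt.2 hz)
    exact hFt _ hm1 _ hsub
  have hτ' : 0 < min τ (s₁ * t) := lt_min hτ (mul_pos hs₁ ht0)
  filter_upwards [(tendsto_div_right_zero hs₁).eventually (hclose (max 1 r) _ hτ'),
    eventually_subset_scaled hPc hclose (isCompact_closedBall z₀ ε) (hΩ ▸ hεΩ),
    self_mem_nhdsWithin] with s hs hsub hs0
  have hs0 : 0 < s := hs0
  set Ds := dil m s ⁻¹' D with hDs
  have hDso : IsOpen Ds := hD.preimage (continuous_dil m s)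
  set W := dil m (s / s₁) ⁻¹' D with hW
  have hWo : IsOpen W := hD.preimage (continuous_dil m _)
  have hDW : ∀ z ∈ Ds, dil m s₁ z ∈ W := fun z hz => by
    show dil m (s / s₁) (dil m s₁ z) ∈ D
    rw [dil_dil (div_pos hs0 hs₁).le hs₁.le, div_mul_cancel₀ _ hs₁.ne']
    exact hz
  obtain ⟨hψc, hψs⟩ := hψW W hWo fun z hz hz1 =>
    ((hs z (hz1.trans (le_max_left _ _))).1 hz).trans_le (min_le_left _ _)
  obtain ⟨u, hu, huc, hus⟩ := hDp.exists_exhaustion hD hDb (s := fun j => s ^ ((m j : ℝ))⁻¹)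
    fun j => Real.rpow_pos_of_pos hs0 _
  have hDU : ∀ z ∈ Ds, dil m s₁ z ∈ ball 0 r → z ∈ U := by
    intro z hz hzr
    have h1 : ‖dil m s₁ z‖ ≤ max 1 r := by
      rw [mem_ball_zero_iff] at hzr
      exact hzr.le.trans (le_max_right _ _)
    have h2 := ((hs _ h1).1 (hDW z hz)).trans_le (min_le_right _ _)
    have h3 : (dil m s₁ z o).re = s₁ * (z o).re := by
      rw [dil_apply, hmo, Complex.re_ofReal_mul]; simp
    rw [h3, hP.hom s₁ hs₁, ← mul_add] at h2
    exact lt_of_mul_lt_mul_left h2 hs₁.le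
  obtain ⟨h, hh, hhL, hhn, hhV⟩ := exists_cutoff_correction (D := Ds) (U := U) (u := u)
    (φ := fun z => ψ (dil m s₁ z)) (q := fun j => s₁ ^ ((m j : ℝ))⁻¹) (F := F) (X := X) (r := r)
    (r₁ := r / 2) (κ := κ) (B := B) (T := T) hDso hu huc hus
    (hψc.comp (continuous_dil m s₁).continuousOn hDW) (fun _ _ => hψ _)
    (fun x hx => (hψs _ (hDW x hx)).1.comp_scal) hκ (fun j => Real.rpow_pos_of_pos hs₁ _)
    (fun x hx hxr => ((hψs _ (hDW x hx)).2 hxr).comp_scal) hX hXs hX1 hXr hXB hUo hFU hFL hDU htail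
  refine ⟨h, ⟨hh, hhL⟩, hhn.trans ?_, ?_⟩
  · rw [hFn]
    exact add_le_add (ENNReal.ofReal_le_ofReal (hTe.trans he'e)) le_rfl
  · set V := Ds ∩ dil m s₁ ⁻¹' ball 0 (r / 2) with hV
    have hVo : IsOpen V := hDso.inter (isOpen_ball.preimage (continuous_dil m s₁))
    have hVU : V ⊆ U := fun z hz => hDU z hz.1 (ball_subset_ball (by linarith) hz.2)
    obtain ⟨h1, h2⟩ := hhV V inter_subset_left hVo.measurableSet fun z hz =>
      ball_subset_closedBall hz.2
    have hzV : closedBall z₀ ε ⊆ V := fun z hz => ⟨hsub hz, by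
      refine mem_ball_zero_iff.2 (hs₁r z (le_trans ?_ (le_max_right _ _)))
      have := mem_closedBall_iff_norm.1 hz
      calc ‖z‖ = ‖z₀ + (z - z₀)‖ := by rw [add_sub_cancel]
        _ ≤ ‖z₀‖ + ‖z - z₀‖ := norm_add_le _ _
        _ ≤ ‖z₀‖ + ε := by linarith⟩
    have h3 := hMh z₀ V (fun z => h z - F z) hVo
      ((hh.mono inter_subset_left).sub (hFU.mono hVU)) hzV h1
    have h4 : ‖h z₀ - F z₀‖ₑ ^ 2 ≤ ENNReal.ofReal ((e / 2) ^ 2) := by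
      refine h3.trans ?_
      calc ENNReal.ofReal M * eLpNorm (fun z => h z - F z) 2 (volume.restrict V) ^ 2
          ≤ ENNReal.ofReal M * ENNReal.ofReal e' ^ 2 := by
            gcongr
            exact h2.trans (ENNReal.ofReal_le_ofReal hTe)
        _ = ENNReal.ofReal (M * e' ^ 2) := by
            rw [ENNReal.ofReal_mul hM.le, ENNReal.ofReal_pow he'.le]
        _ ≤ _ := ENNReal.ofReal_le_ofReal hMe'
    have h5 : ‖h z₀ - F z₀‖ ≤ e / 2 := by
      rw [← ofReal_norm, ← ENNReal.ofReal_pow (norm_nonneg _),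
        ENNReal.ofReal_le_ofReal_iff (by positivity)] at h4
      exact le_of_sq_le_sq h4 (by positivity)
    have h6 : F z₀ = f (z₀ - (t : ℂ) • E) :=
      indicator_of_mem (hUΩ z₀ (hVU (hzV (mem_closedBall_self hε.le)))) f
    calc ‖h z₀ - f z₀‖ = ‖(h z₀ - F z₀) + (F z₀ - f z₀)‖ := by rw [sub_add_sub_cancel]
      _ ≤ ‖h z₀ - F z₀‖ + ‖F z₀ - f z₀‖ := norm_add_le _ _
      _ ≤ e := by rw [h6] at h5 ⊢; linarith

end LowerBound

section Conclusion

variable {n : ℕ} {o : Fin n} {m : Fin n → ℕ} {P a : (Fin n → ℂ) → ℝ} {D Ω : Set (Fin n → ℂ)}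
  {K : (Fin n → ℂ) → (Fin n → ℂ) → ℂ} {z₀ : Fin n → ℂ}

/-- Lower semicontinuity of the diagonal Bergman kernel along domains on which the extremal
function can be approximated. -/
theorem bergman_diag_lower {Ωs : ℝ → Set (Fin n → ℂ)} {l : Filter ℝ} (hK : IsBergmanKernel Ω K)
    (hz₀ : z₀ ∈ Ω) (hmem : ∀ᶠ s in l, z₀ ∈ Ωs s)
    (happ : ∀ f, MemA2 Ω f → ∀ e : ℝ, 0 < e → ∀ᶠ s in l, ∃ h, MemA2 (Ωs s) h ∧
      eLpNorm h 2 (volume.restrict (Ωs s)) ≤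
        ENNReal.ofReal e + eLpNorm f 2 (volume.restrict Ω) ∧ ‖h z₀ - f z₀‖ ≤ e)
    {ε : ℝ} (hε : 0 < ε) :
    ∀ᶠ s in l, ∀ K', IsBergmanKernel (Ωs s) K' → (K z₀ z₀).re < (K' z₀ z₀).re + ε := by
  set k := (K z₀ z₀).re with hk
  rcases (hK.re_diag_nonneg hz₀).eq_or_lt with h0 | h0
  · filter_upwards [hmem] with s hs K' hK'
    have := hK'.re_diag_nonneg hs
    rw [hk, ← h0]; linarith
  replace h0 : 0 < k := h0
  have hfn : eLpNorm (fun z => K z z₀) 2 (volume.restrict Ω) = ENNReal.ofReal √k := by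
    have h1 := ofReal_integral_norm_sq (hK.1 z₀ hz₀).2
    rw [← hK.re_diag_eq hz₀, ← Real.sq_sqrt (hK.re_diag_nonneg hz₀),
      ENNReal.ofReal_pow (Real.sqrt_nonneg _)] at h1
    exact ((ENNReal.pow_right_strictMono two_ne_zero).injective h1).symm
  obtain ⟨e, ⟨he, hek⟩, he0⟩ : ∃ e : ℝ, ((k - ε) * (√k + e) ^ 2 < (k - e) ^ 2 ∧ e < k) ∧ 0 < e := by
    have h1 : Tendsto (fun e : ℝ => (k - e) ^ 2 - (k - ε) * (√k + e) ^ 2) (𝓝 0)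
        (𝓝 ((k - 0) ^ 2 - (k - ε) * (√k + 0) ^ 2)) :=
      (by fun_prop : Continuous fun e : ℝ => (k - e) ^ 2 - (k - ε) * (√k + e) ^ 2).tendsto 0
    have h2 : 0 < (k - 0) ^ 2 - (k - ε) * (√k + 0) ^ 2 := by
      rw [add_zero, Real.sq_sqrt h0.le]; nlinarith
    have h3 : ∀ᶠ t in 𝓝[>] (0 : ℝ), 0 < t := self_mem_nhdsWithin
    obtain ⟨e, h, h'⟩ := ((((h1.eventually (lt_mem_nhds h2)).and
      (gt_mem_nhds h0)).filter_mono nhdsWithin_le_nhds).and h3).exists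
    exact ⟨e, ⟨by linarith [h.1], h.2⟩, h'⟩
  filter_upwards [hmem, happ _ (hK.1 z₀ hz₀) e he0] with s hs ⟨h, hh, hhn, hhv⟩ K' hK'
  have h1 : k - e ≤ ‖h z₀‖ := by
    have h2 : ‖K z₀ z₀‖ = k := by
      rw [← hK.ofReal_re_diag hz₀, Complex.norm_real, Real.norm_of_nonneg h0.le]
    have := norm_sub_norm_le (K z₀ z₀) (h z₀)
    rw [norm_sub_rev] at this
    linarith
  have h2 : ∫ z in Ωs s, ‖h z‖ ^ 2 ≤ (√k + e) ^ 2 := by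
    rw [← ENNReal.ofReal_le_ofReal_iff (by positivity), ofReal_integral_norm_sq hh.2,
      ENNReal.ofReal_pow (by positivity)]
    gcongr
    rwa [hfn, ← ENNReal.ofReal_add he0.le (Real.sqrt_nonneg _), add_comm] at hhn
  have h3 := hK'.norm_sq_le hs hh
  by_contra hcon
  have h4 : (K' z₀ z₀).re ≤ k - ε := by linarith
  have h5 : (k - e) ^ 2 ≤ ‖h z₀‖ ^ 2 := pow_le_pow_left₀ (by linarith) h1 2
  have h6 := mul_le_mul h4 h2 (integral_nonneg fun z => by positivity)
    ((hK'.re_diag_nonneg hs).trans h4)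
  linarith

theorem IsPolyNoPluriharm.contDiff (h : IsPolyNoPluriharm P) : ContDiff ℝ ∞ P := by
  obtain ⟨d, c, -, -, hc⟩ := h
  have h1 : ContDiff ℝ ∞ fun z => (P z : ℂ) := by
    simp only [hc]
    have hz : ∀ j : Fin n, ContDiff ℝ ∞ fun z : Fin n → ℂ => z j := fun j => contDiff_apply ℝ ℂ j
    have hz' : ∀ j : Fin n, ContDiff ℝ ∞ fun z : Fin n → ℂ => conj (z j) := fun j =>
      Complex.conjCLE.contDiff.comp (hz j)
    refine ContDiff.sum fun α _ => ContDiff.sum fun β _ => ContDiff.mul (ContDiff.mul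
      contDiff_const (contDiff_prod fun j _ => (hz j).pow _)) (contDiff_prod fun j _ => (hz' j).pow _)
  exact Complex.reCLM.contDiff.comp h1

/-- Approximation of Bergman functions of the model by Bergman functions of the scaled domains,
for a model admitting a bumping function. -/
theorem eventually_exists_approx_of_bump (hm : ∀ j, 1 ≤ m j) (hmo : m o = 1)
    (hP : IsHomTail o m P) (hPs : ContDiff ℝ ∞ P) (ha : IsHomTail o m a)
    (has : ContDiffOn ℝ ∞ a {z | ∃ j, j ≠ o ∧ z j ≠ 0})
    (hapos : ∀ z, (∃ j, j ≠ o ∧ z j ≠ 0) → 0 < a z)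
    (hlevi : ∀ z : Fin n → ℂ, (∃ j, j ≠ o ∧ z j ≠ 0) → ∀ ξ : Fin n → ℂ, ξ o = 0 → ξ ≠ 0 →
      0 < leviForm (fun w => P w - a w) z ξ)
    (hD : IsOpen D) (hDb : Bornology.IsBounded D) (hDp : IsPseudoconvex D)
    (hclose : ∀ r τ : ℝ, 0 < τ → ∀ᶠ s in 𝓝[>] (0 : ℝ), ∀ z : Fin n → ℂ, ‖z‖ ≤ r →
      (dil m s z ∈ D → (z o).re + P z < τ) ∧ ((z o).re + P z ≤ -τ → dil m s z ∈ D))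
    (hΩ : Ω = {z | (z o).re + P z < 0}) (hz₀ : z₀ ∈ Ω) {f : (Fin n → ℂ) → ℂ} (hf : MemA2 Ω f)
    {e : ℝ} (he : 0 < e) :
    ∀ᶠ s in 𝓝[>] (0 : ℝ), ∃ h, MemA2 (dil m s ⁻¹' D) h ∧
      eLpNorm h 2 (volume.restrict (dil m s ⁻¹' D)) ≤
        ENNReal.ofReal e + eLpNorm f 2 (volume.restrict Ω) ∧ ‖h z₀ - f z₀‖ ≤ e := by
  have hac := ha.continuous hm has.continuousOn
  obtain ⟨C, hC, hPC⟩ := hP.exists_abs_le hm hPs.continuous.continuousOn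
  obtain ⟨c, hc, hca⟩ := ha.exists_le hm has.continuousOn hapos
  have h2 : (2 : WithTop ℕ∞) ≤ ((⊤ : ℕ∞) : WithTop ℕ∞) := WithTop.coe_le_coe.2 le_top
  obtain ⟨ψ, r, κ, τ, hr, hκ, hτ, hψ, hψW⟩ := exists_barrier hm hPs.continuous hac
    (fun z hz => hP.eq_zero hz) (ha.eq_zero fun _ _ => rfl) hC hc hPC hca
    (le_circleAverage_of_tail (o := o) (F := fun z => P z - a z)
      (fun z z' h => by simp only [hP.tail z z' h, ha.tail z z' h]) (hPs.continuous.sub hac)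
      fun z hz => ⟨(hPs.contDiffAt.of_le h2).sub
        ((has.contDiffAt ((isOpen_tail_ne o).mem_nhds hz)).of_le h2), hlevi z hz⟩)
  exact eventually_exists_approx hm hmo hP hPs.continuous hD hDb hDp hclose hr hκ hτ hψ hψW hΩ hf
    hz₀ he

end Conclusion

end

/-- stability of the Bergman kernels on the diagonal under nonisotropic
scaling of an h-extendible domain along a nontangentially converging sequence. -/
theorem bergman_kernel_stability_h_extendible {n : ℕ} (hn : 2 ≤ n)
    (D : Set (Fin n → ℂ)) (hopen : IsOpen D) (hconn : IsConnected D)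
    (hbdd : Bornology.IsBounded D) (hpsc : IsPseudoconvex D)
    (h0 : (0 : Fin n → ℂ) ∈ frontier D)
    (m : Fin n → ℕ) (hm0 : m ⟨0, by omega⟩ = 1) (hm : ∀ j, 1 ≤ m j)
    (ρ : (Fin n → ℂ) → ℝ) (hρsm : ContDiff ℝ (⊤ : ℕ∞) ρ)
    (hρdef : ∃ V ∈ nhds (0 : Fin n → ℂ), ∀ z ∈ V, z ∈ D ↔ ρ z < 0)
    (P : (Fin n → ℂ) → ℝ)
    (hPtail : ∀ z z' : Fin n → ℂ, (∀ j : Fin n, 0 < (j : ℕ) → z j = z' j) → P z = P z')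
    (hPhom : ∀ t : ℝ, 0 < t → ∀ z : Fin n → ℂ,
      P (fun j => ((t ^ ((m j : ℝ))⁻¹ : ℝ) : ℂ) * z j) = t * P z)
    (hPpsh : PlurisubharmonicOn P Set.univ)
    (hPpoly : IsPolyNoPluriharm P)
    (R : (Fin n → ℂ) → ℝ)
    (hρeq : ∀ z, ρ z = (z ⟨0, by omega⟩).re + P z + R z)
    (hRo : Filter.Tendsto
      (fun z : Fin n → ℂ => R z / (‖z ⟨0, by omega⟩‖ +
        ∑ j ∈ Finset.univ.filter (fun j : Fin n => 0 < (j : ℕ)),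
          ‖z j‖ ^ (m j)))
      (nhdsWithin 0 {0}ᶜ) (nhds 0))
    -- h-extendibility: a smooth weighted homogeneous bumping function exists
    (hbump : ∃ a : (Fin n → ℂ) → ℝ,
      (∀ z z' : Fin n → ℂ, (∀ j : Fin n, 0 < (j : ℕ) → z j = z' j) → a z = a z') ∧
      (∀ z : Fin n → ℂ, (∃ j : Fin n, 0 < (j : ℕ) ∧ z j ≠ 0) → 0 < a z) ∧
      ContDiffOn ℝ (⊤ : ℕ∞) a { z : Fin n → ℂ | ∃ j : Fin n, 0 < (j : ℕ) ∧ z j ≠ 0 } ∧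
      (∀ t : ℝ, 0 < t → ∀ z : Fin n → ℂ,
        a (fun j => ((t ^ ((m j : ℝ))⁻¹ : ℝ) : ℂ) * z j) = t * a z) ∧
      ∀ ε : ℝ, 0 < ε → ε ≤ 1 → ∀ z : Fin n → ℂ, (∃ j : Fin n, 0 < (j : ℕ) ∧ z j ≠ 0) →
        ∀ ξ : Fin n → ℂ, ξ ⟨0, by omega⟩ = 0 → ξ ≠ 0 →
          0 < leviForm (fun w => P w - ε * a w) z ξ)
    (p : ℕ → (Fin n → ℂ)) (hp : ∀ j, p j ∈ D)
    (hplim : Filter.Tendsto p Filter.atTop (nhds 0))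
    (hcone : ∃ C : ℝ, 0 < C ∧ ∀ j, ‖p j‖ ≤ C * Metric.infDist (p j) Dᶜ)
    (Dinf : Set (Fin n → ℂ))
    (hDinf : Dinf = { z : Fin n → ℂ | (z ⟨0, by omega⟩).re + P z < 0 })
    (Dseq : ℕ → Set (Fin n → ℂ))
    (hDseq : ∀ j, Dseq j = (fun z : Fin n → ℂ => (fun μ =>
      z μ / ((|ρ (p j)| ^ ((m μ : ℝ))⁻¹ : ℝ) : ℂ) : Fin n → ℂ)) '' D)
    (Kj : ℕ → (Fin n → ℂ) → (Fin n → ℂ) → ℂ)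
    (hKj : ∀ j, IsBergmanKernel (Dseq j) (Kj j))
    (Kinf : (Fin n → ℂ) → (Fin n → ℂ) → ℂ) (hKinf : IsBergmanKernel Dinf Kinf) :
    ∀ z ∈ Dinf, Filter.Tendsto (fun j => Kj j z z) Filter.atTop (nhds (Kinf z z)) := by
  intro z₀ hz₀
  set o : Fin n := ⟨0, by omega⟩ with ho
  have hoj : ∀ j : Fin n, 0 < (j : ℕ) ↔ j ≠ o := fun j => by
    rw [ne_eq, Fin.ext_iff, Nat.pos_iff_ne_zero]
  have hfil : Finset.univ.filter (fun j : Fin n => 0 < (j : ℕ)) = Finset.univ.erase o := by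
    ext j; simp [hoj]
  simp only [hoj] at hPtail hbump
  obtain ⟨a, hatail, hapos, has, hahom, hlevi⟩ := hbump
  have hP : IsHomTail o m P := ⟨hPtail, hPhom⟩
  have ha : IsHomTail o m a := ⟨hatail, hahom⟩
  have hPs := hPpoly.contDiff
  have hDe : ∀ᶠ z in 𝓝 (0 : Fin n → ℂ), z ∈ D ↔ ρ z < 0 := by
    obtain ⟨V, hV, hVD⟩ := hρdef
    filter_upwards [hV] with z hz using hVD z hz
  have hρ0 : ρ 0 = 0 := by
    refine le_antisymm ?_ ?_
    · refine le_of_not_gt fun hlt => ?_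
      have h2 : ∃ᶠ z in 𝓝 (0 : Fin n → ℂ), z ∈ D := mem_closure_iff_frequently.1 h0.1
      obtain ⟨z, hz, hzD, hz0⟩ :=
        (h2.and_eventually (hDe.and (hρsm.continuous.continuousAt.eventually (lt_mem_nhds hlt)))).exists
      exact absurd (hzD.1 hz) (not_lt.2 hz0.le)
    · refine le_of_not_gt fun hlt => ?_
      exact h0.2 (hopen.interior_eq.symm ▸ hDe.self_of_nhds.2 hlt)
  have hclose : ∀ r τ : ℝ, 0 < τ → ∀ᶠ s in 𝓝[>] (0 : ℝ), ∀ z : Fin n → ℂ, ‖z‖ ≤ r →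
      (dil m s z ∈ D → (z o).re + P z < τ) ∧ ((z o).re + P z ≤ -τ → dil m s z ∈ D) := by
    intro r τ hτ
    rw [hfil] at hRo
    exact eventually_scaled_close hm hm0 hP hρeq hρ0 hRo hDe r hτ
  have hex := fun L (hL : IsCompact L) (hLs : L ⊆ Dinf) =>
    eventually_subset_scaled hPs.continuous hclose hL (hDinf ▸ hLs)
  have hDo : IsOpen Dinf := by
    have := hPs.continuous
    rw [hDinf]
    exact isOpen_lt (by fun_prop) continuous_const
  have hmem : ∀ᶠ s in 𝓝[>] (0 : ℝ), z₀ ∈ dil m s ⁻¹' D :=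
    (hex {z₀} isCompact_singleton (singleton_subset_iff.2 hz₀)).mono fun s hs => hs rfl
  have hs : Tendsto (fun j => |ρ (p j)|) atTop (𝓝[>] 0) := by
    refine tendsto_nhdsWithin_iff.2 ⟨?_, ?_⟩
    · have := ((hρsm.continuous.tendsto 0).comp hplim).abs
      rwa [hρ0, abs_zero] at this
    · filter_upwards [hplim.eventually hDe] with j hj
      exact abs_pos.2 (hj.1 (hp j)).ne
  have hseq : ∀ j, 0 < |ρ (p j)| → Dseq j = dil m |ρ (p j)| ⁻¹' D := by
    intro j hj
    have hne : ∀ μ, ((|ρ (p j)| ^ ((m μ : ℝ))⁻¹ : ℝ) : ℂ) ≠ 0 := fun μ =>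
      Complex.ofReal_ne_zero.2 (Real.rpow_pos_of_pos hj _).ne'
    rw [hDseq]
    ext z
    constructor
    · rintro ⟨y, hy, rfl⟩
      show dil m _ _ ∈ D
      convert hy using 1
      ext μ
      rw [dil_apply, mul_div_cancel₀ _ (hne μ)]
    · intro hz
      refine ⟨_, hz, ?_⟩
      ext μ
      simp only [dil_apply]
      rw [mul_div_cancel_left₀ _ (hne μ)]
  obtain ⟨N, hN⟩ := eventually_atTop.1 (hs.eventually self_mem_nhdsWithin)
  have hup : ∀ ε : ℝ, 0 < ε → ∀ᶠ j in atTop, (Kj j z₀ z₀).re < (Kinf z₀ z₀).re + ε := by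
    intro ε hε
    have h1 := bergman_diag_upper (Ωs := fun j => Dseq (j + N)) (Ks := fun j => Kj (j + N))
      (fun j => by
        rw [hseq _ (hN _ (Nat.le_add_left N j))]
        exact hopen.preimage (continuous_dil m _)) hDo
      (fun L hL hLs => by
        filter_upwards [((tendsto_add_atTop_iff_nat N).2 hs).eventually (hex L hL hLs)] with j hj
        rwa [hseq _ (hN _ (Nat.le_add_left N j))])
      (fun j => hKj _) hKinf hz₀ hε
    exact (eventually_atTop.1 h1).elim fun M hM => eventually_atTop.2 ⟨M + N, fun j hj => by
      have := hM (j - N) (by omega)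
      rwa [Nat.sub_add_cancel (by omega)] at this⟩
  have hlow : ∀ ε : ℝ, 0 < ε → ∀ᶠ j in atTop, (Kinf z₀ z₀).re < (Kj j z₀ z₀).re + ε := by
    intro ε hε
    have h1 := bergman_diag_lower hKinf hz₀ hmem (fun f hf e he =>
      eventually_exists_approx_of_bump hm hm0 hP hPs ha has hapos
        (fun z hz ξ hξ hξ0 => by simpa only [one_mul] using hlevi 1 one_pos le_rfl z hz ξ hξ hξ0)
        hopen hbdd hpsc hclose hDinf hz₀ hf he) hε
    filter_upwards [hs.eventually h1, eventually_ge_atTop N] with j hj hjN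
    exact hj _ (hseq j (hN j hjN) ▸ hKj j)
  have hre : Tendsto (fun j => (Kj j z₀ z₀).re) atTop (𝓝 (Kinf z₀ z₀).re) := by
    refine Metric.tendsto_nhds.2 fun ε hε => ?_
    filter_upwards [hup ε hε, hlow ε hε] with j h1 h2
    rw [Real.dist_eq, abs_lt]
    constructor <;> linarith
  rw [← hKinf.ofReal_re_diag hz₀]
  refine ((Complex.continuous_ofReal.tendsto _).comp hre).congr' ?_
  filter_upwards [hs.eventually hmem, eventually_ge_atTop N] with j hj hjN
  exact (hKj j).ofReal_re_diag (hseq j (hN j hjN) ▸ hj)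

end
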